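/- Suppose d_i ≥ 3 for all 1 ≤ i ≤ r, let k be the largest degree and μ = μ_t the smallest multiplicity, and for 1 ≤ h < t set s̃_1(𝐤_h) = max{k̃_h(k̃_h − 1), (k/2)(1+ϖ_h)}, where k̃_h = max{k_{l,n} : 1 ≤ l ≤ h, 1 ≤ n ≤ ν(l)}. Suppose s ≥ 2μ k(k−1) + 2·Σ_{h=1}^{t−1} (μ_h − μ_{h+1}) s̃_1(𝐤_h) + 1. Then for every highly non-singular system Σ_{j=1}^s c_{ij} x_j^{d_i} = 0 (1 ≤ i ≤ r) with nonzero integer coefficients which possesses a non-singular real solution with all coordinates positive and, for every prime p, a non-singular solution in ℚ_p^s, there exists C > 0 such that the number N(P) of integer solutions x with 1 ≤ x_j ≤ P satisfies N(P) = (C + o(1)) P^{s − K} as P → ∞. -/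

import Mathlib

open MeasureTheory Filter Finset
open scoped Classical

noncomputable section

/-- `e(θ) = exp(2πiθ)`. -/
def eC (θ : ℝ) : ℂ := Complex.exp (2 * Real.pi * Complex.I * θ)

/-- Index pairs `(l, n)` for the distinct exponents `k_{l,n}`. -/
abbrev KIdx (t : ℕ) (ν : Fin t → ℕ) := Σ l : Fin t, Fin (ν l)

/-- Equation indices `(l, n, m)`: the `μ_l` equations of exponent `k_{l,n}`
(the interval `𝓘_{l,n}`). -/
abbrev EqIdx (t : ℕ) (ν μ : Fin t → ℕ) := Σ l : Fin t, Fin (ν l) × Fin (μ l)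

variable (t : ℕ) (ν μ : Fin t → ℕ) (k : (l : Fin t) → Fin (ν l) → ℕ)

/-- The degree `d_i` of equation `i`. -/
def deg (i : EqIdx t ν μ) : ℕ := k i.1 i.2.1

/-- `μ_h` for `1 ≤ h ≤ t` (`1`-based), with the convention `μ_{t+1} = 0`. -/
def mu1 (h : ℕ) : ℕ := if hh : 1 ≤ h ∧ h ≤ t then μ ⟨h - 1, by omega⟩ else 0

/-- `ϖ_h = ν(1) + ⋯ + ν(h)`. -/
def varpi (h : ℕ) : ℕ := ∑ l : Fin t, if (l : ℕ) < h then ν l else 0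

/-- `K_1 + ⋯ + K_h`. -/
def Ksum (h : ℕ) : ℕ := ∑ p : KIdx t ν, if (p.1 : ℕ) < h then k p.1 p.2 else 0

/-- The largest degree `k`. -/
def kmax : ℕ := Finset.univ.sup fun p : KIdx t ν => k p.1 p.2

/-- The total degree `K = d_1 + ⋯ + d_r`. -/
def Ktot : ℕ := ∑ i : EqIdx t ν μ, deg t ν μ k i

/-- The grouping hypotheses: `t ≥ 1`, all `ν l ≥ 1`, the multiplicities are
positive and strictly decreasing `μ_1 > ⋯ > μ_t`, and the exponents `k_{l,n}`
are positive and pairwise distinct. -/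
def GroupedDegrees : Prop :=
  0 < t ∧ (∀ l, 0 < ν l) ∧ (∀ l, 0 < μ l) ∧ StrictAnti μ ∧
    (∀ l n, 0 < k l n) ∧ Function.Injective fun p : KIdx t ν => k p.1 p.2

/-- `ℤ ∩ [1, P]` as a finite set. -/
def completeFS (P : ℝ) : Finset ℕ := Finset.Icc 1 ⌊P⌋₊

/-- `𝒜(P,R)`: the `R`-smooth numbers up to `P`. -/
def smoothFS (P R : ℝ) : Finset ℕ :=
  (Finset.Icc 1 ⌊P⌋₊).filter fun n => ∀ p : ℕ, p.Prime → p ∣ n → (p : ℝ) ≤ R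

/-- The exponential sum `f_{𝐤_h}(γ; 𝒜) = Σ_{x ∈ 𝒜} e(Σ_{l ≤ h, n} γ_{l,n} x^{k_{l,n}})`. -/
def fA (A : Finset ℕ) (h : ℕ) (γ : KIdx t ν → ℝ) : ℂ :=
  ∑ x ∈ A, eC (∑ p : KIdx t ν, if (p.1 : ℕ) < h then γ p * (x : ℝ) ^ (k p.1 p.2) else 0)

/-- The mean value `J_{u,𝐤_h}(𝒜)` (the coordinates `γ_{l,n}` with `l > h` are
dummy variables over the probability box, so this agrees with the
`ϖ_h`-dimensional integral). -/
def JA (A : Finset ℕ) (u h : ℕ) : ℝ :=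
  ∫ γ in Set.univ.pi fun _ : KIdx t ν => Set.Ico (0 : ℝ) 1, ‖fA t ν k A h γ‖ ^ (2 * u)

variable (s : ℕ) (c : EqIdx t ν μ → Fin s → ℤ)

/-- The system `Σ_j c_{ij} x_j^{d_i} = 0` is highly non-singular: all coefficients
are nonzero and every `μ_l × μ_l` minor taken from the rows `𝓘_{l,n}` is nonzero. -/
def HighlyNonSingular : Prop :=
  (∀ i j, c i j ≠ 0) ∧
  ∀ (l : Fin t) (n : Fin (ν l)) (J : Fin (μ l) → Fin s), Function.Injective J →
    (Matrix.of fun m m' : Fin (μ l) => c ⟨l, (n, m)⟩ (J m')).det ≠ 0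

/-- `x` is a solution of the system, with coordinates in a commutative ring. -/
def IsSol {A : Type*} [CommRing A] (x : Fin s → A) : Prop :=
  ∀ i, ∑ j, (c i j : A) * x j ^ deg t ν μ k i = 0

/-- The Jacobian `(d_i c_{ij} x_j^{d_i - 1})` has full rank `r` at `x`. -/
def JacFullRank {A : Type*} [CommRing A] (x : Fin s → A) : Prop :=
  (Matrix.of fun (i : EqIdx t ν μ) (j : Fin s) =>
      (deg t ν μ k i : A) * (c i j : A) * x j ^ (deg t ν μ k i - 1)).rank
    = Fintype.card (EqIdx t ν μ)

/-- The generalized exponential sum `f_j(α; 𝒜) = Σ_{x ∈ 𝒜} e(Σ_{l,n} γ_{j,l,n} x^{k_{l,n}})`,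
where `γ_{j,l,n} = Σ_{i ∈ 𝓘_{l,n}} c_{ij} α_i`. -/
def fj (A : Finset ℕ) (α : EqIdx t ν μ → ℝ) (j : Fin s) : ℂ :=
  ∑ x ∈ A, eC (∑ i : EqIdx t ν μ, (c i j : ℝ) * α i * (x : ℝ) ^ deg t ν μ k i)

end

noncomputable section

/-- `k̃_h`: the largest exponent among the `k_{l,n}` with `l ≤ h`. -/
def ktil (t : ℕ) (ν : Fin t → ℕ) (k : (l : Fin t) → Fin (ν l) → ℕ) (h : ℕ) : ℕ :=
  (Finset.univ.filter fun p : KIdx t ν => (p.1 : ℕ) < h).sup fun p => k p.1 p.2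

/-- The number of solutions `x ∈ [1,P]^s` of the system. -/
def Ncount (t : ℕ) (ν μ : Fin t → ℕ) (k : (l : Fin t) → Fin (ν l) → ℕ) (s : ℕ)
    (c : EqIdx t ν μ → Fin s → ℤ) (P : ℕ) : ℕ :=
  Nat.card {x : Fin s → ℕ // (∀ j, 1 ≤ x j ∧ x j ≤ P) ∧
    IsSol t ν μ k s c fun j => (x j : ℤ)}

namespace Decoupling

/-! ### Minkowski's inequality for finite sums -/

lemma rpow_sum_rpow_le {ι κ : Type*} (s : Finset ι) (t : Finset κ) (φ : κ → ι → ℝ)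
    (hφ : ∀ j i, 0 ≤ φ j i) {r : ℝ} (hr : 1 ≤ r) :
    (∑ i ∈ s, (∑ j ∈ t, φ j i) ^ r) ^ (1 / r) ≤ ∑ j ∈ t, (∑ i ∈ s, φ j i ^ r) ^ (1 / r) := by
  induction t using Finset.induction_on with
  | empty =>
    have : r ≠ 0 := by linarith
    simp [Real.zero_rpow this, Real.zero_rpow (inv_ne_zero this)]
  | insert j t hj ih =>
    simp only [Finset.sum_insert hj]
    refine (Real.Lp_add_le_of_nonneg s hr (fun i _ => hφ j i)
      (fun i _ => Finset.sum_nonneg fun j _ => hφ j i)).trans ?_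
    gcongr

/-- The unnormalised `ℓ^q` norm of a function on a finite type. -/
def nrm {G : Type*} [Fintype G] (q : ℕ) (f : G → ℂ) : ℝ := (∑ α, ‖f α‖ ^ q) ^ (1 / (q : ℝ))

section nrm

variable {G : Type*} [Fintype G]

lemma nrm_nonneg (q : ℕ) (f : G → ℂ) : 0 ≤ nrm q f :=
  Real.rpow_nonneg (Finset.sum_nonneg fun _ _ => by positivity) _

lemma nrm_pow {q : ℕ} (hq : q ≠ 0) (f : G → ℂ) : nrm q f ^ q = ∑ α, ‖f α‖ ^ q := by
  unfold nrm
  rw [one_div, Real.rpow_inv_natCast_pow _ hq]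
  exact Finset.sum_nonneg fun _ _ => by positivity

lemma nrm_congr {q : ℕ} {f g : G → ℂ} (h : ∀ α, ‖f α‖ = ‖g α‖) : nrm q f = nrm q g := by
  simp [nrm, h]

lemma nrm_sum_le {κ : Type*} {q : ℕ} (hq : q ≠ 0) (t : Finset κ) (f : κ → G → ℂ) :
    nrm q (fun α => ∑ j ∈ t, f j α) ≤ ∑ j ∈ t, nrm q (f j) := by
  have h1 : (1 : ℝ) ≤ q := by exact_mod_cast Nat.one_le_iff_ne_zero.2 hq
  have := rpow_sum_rpow_le (Finset.univ : Finset G) t (fun j α => ‖f j α‖)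
    (fun _ _ => norm_nonneg _) h1
  simp only [Real.rpow_natCast] at this
  refine le_trans ?_ this
  unfold nrm
  gcongr
  exact norm_sum_le _ _

lemma nrm_sq {q : ℕ} (hq : q ≠ 0) (f : G → ℂ) : nrm (2 * q) f ^ 2 = nrm q (fun α => f α * f α) := by
  unfold nrm
  have h0 : 0 ≤ ∑ α, ‖f α‖ ^ (2 * q) := Finset.sum_nonneg fun _ _ => by positivity
  rw [← Real.rpow_natCast, ← Real.rpow_mul h0]
  have : (1 / ((2 * q : ℕ) : ℝ) * ((2 : ℕ) : ℝ)) = 1 / (q : ℝ) := by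
    push_cast
    field_simp
  rw [this]
  congr 2
  ext α
  rw [norm_mul, ← pow_two, ← pow_mul]

end nrm

/-! ### Residue classes of finite sets of `p`-adic integers -/

variable {p : ℕ} [Fact p.Prime]

/-- The partition of `Ω` into residue classes modulo `p ^ N`. -/
def classes (N : ℕ) (Ω : Finset ℤ_[p]) : Finset (Finset ℤ_[p]) :=
  Ω.image fun x => Ω.filter fun y => (p : ℤ_[p]) ^ N ∣ y - x

lemma mem_classes {N : ℕ} {Ω T : Finset ℤ_[p]} :
    T ∈ classes N Ω ↔ ∃ x ∈ Ω, (Ω.filter fun y => (p : ℤ_[p]) ^ N ∣ y - x) = T := by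
  simp [classes]

lemma dvd_sub_symm {d x y : ℤ_[p]} (h : d ∣ x - y) : d ∣ y - x := by
  rw [← neg_sub]; exact h.neg_right

lemma classes_subset {N : ℕ} {Ω T : Finset ℤ_[p]} (h : T ∈ classes N Ω) : T ⊆ Ω := by
  obtain ⟨x, _, rfl⟩ := mem_classes.1 h
  exact Finset.filter_subset _ _

lemma classes_dvd {N : ℕ} {Ω T : Finset ℤ_[p]} (h : T ∈ classes N Ω) {x y : ℤ_[p]} (hx : x ∈ T)
    (hy : y ∈ T) : (p : ℤ_[p]) ^ N ∣ x - y := by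
  obtain ⟨z, _, rfl⟩ := mem_classes.1 h
  have h1 := (Finset.mem_filter.1 hx).2
  have h2 := (Finset.mem_filter.1 hy).2
  simpa using dvd_sub h1 h2

lemma classes_nonempty {N : ℕ} {Ω T : Finset ℤ_[p]} (h : T ∈ classes N Ω) : T.Nonempty := by
  obtain ⟨z, hz, rfl⟩ := mem_classes.1 h
  exact ⟨z, by simp [hz]⟩

lemma classes_eq_filter {N : ℕ} {Ω T : Finset ℤ_[p]} (h : T ∈ classes N Ω) {x : ℤ_[p]}
    (hx : x ∈ T) : T = Ω.filter fun y => (p : ℤ_[p]) ^ N ∣ y - x := by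
  obtain ⟨z, hz, rfl⟩ := mem_classes.1 h
  have h1 := (Finset.mem_filter.1 hx).2
  ext y
  simp only [Finset.mem_filter]
  refine and_congr_right fun _ => ⟨fun h2 => ?_, fun h2 => ?_⟩
  · simpa using dvd_sub h2 h1
  · simpa using dvd_add h2 h1

lemma classes_eq_of_mem {N : ℕ} {Ω T T' : Finset ℤ_[p]} (h : T ∈ classes N Ω)
    (h' : T' ∈ classes N Ω) {x y : ℤ_[p]} (hx : x ∈ T) (hy : y ∈ T')
    (hxy : (p : ℤ_[p]) ^ N ∣ y - x) : T = T' := by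
  rw [classes_eq_filter h hx, classes_eq_filter h' hy]
  ext z
  simp only [Finset.mem_filter]
  refine and_congr_right fun _ => ⟨fun h2 => ?_, fun h2 => ?_⟩
  · simpa using dvd_sub h2 hxy
  · simpa using dvd_add h2 hxy

lemma classes_pairwiseDisjoint (N : ℕ) (Ω : Finset ℤ_[p]) :
    ((classes N Ω : Finset (Finset ℤ_[p])) : Set (Finset ℤ_[p])).PairwiseDisjoint id := by
  intro T hT T' hT' hne
  refine Finset.disjoint_left.2 fun x hx hx' => hne ?_
  exact classes_eq_of_mem hT hT' hx hx' (by simp)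

lemma biUnion_classes (N : ℕ) (Ω : Finset ℤ_[p]) : (classes N Ω).biUnion id = Ω := by
  ext x
  simp only [Finset.mem_biUnion, id]
  constructor
  · rintro ⟨T, hT, hx⟩
    exact classes_subset hT hx
  · intro hx
    exact ⟨_, mem_classes.2 ⟨x, hx, rfl⟩, by simp [hx]⟩

lemma sum_classes {M : Type*} [AddCommMonoid M] (N : ℕ) (Ω : Finset ℤ_[p]) (φ : ℤ_[p] → M) :
    ∑ x ∈ Ω, φ x = ∑ T ∈ classes N Ω, ∑ x ∈ T, φ x := by
  conv_lhs => rw [← biUnion_classes N Ω]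
  rw [Finset.sum_biUnion (classes_pairwiseDisjoint N Ω)]
  rfl

lemma mem_classes_of_refine {N a : ℕ} (ha : a ≤ N) {Ω J T : Finset ℤ_[p]}
    (hJ : J ∈ classes a Ω) : T ∈ classes N J ↔ T ∈ classes N Ω ∧ T ⊆ J := by
  have key : ∀ x ∈ J, (J.filter fun y => (p : ℤ_[p]) ^ N ∣ y - x)
      = Ω.filter fun y => (p : ℤ_[p]) ^ N ∣ y - x := by
    intro x hx
    ext y
    simp only [Finset.mem_filter]
    refine and_congr_left fun hy => ⟨fun h => classes_subset hJ h, fun h => ?_⟩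
    rw [classes_eq_filter hJ hx, Finset.mem_filter]
    exact ⟨h, (pow_dvd_pow _ ha).trans hy⟩
  constructor
  · intro hT
    obtain ⟨x, hx, rfl⟩ := mem_classes.1 hT
    exact ⟨mem_classes.2 ⟨x, classes_subset hJ hx, (key x hx).symm⟩, Finset.filter_subset _ _⟩
  · rintro ⟨hT, hTJ⟩
    obtain ⟨x, hx⟩ := classes_nonempty hT
    rw [classes_eq_filter hT hx, ← key x (hTJ hx)]
    exact mem_classes.2 ⟨x, hTJ hx, rfl⟩

lemma sum_classes_refine {M : Type*} [AddCommMonoid M] {N a : ℕ} (ha : a ≤ N) (Ω : Finset ℤ_[p])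
    (φ : Finset ℤ_[p] → M) :
    ∑ T ∈ classes N Ω, φ T = ∑ J ∈ classes a Ω, ∑ T ∈ classes N J, φ T := by
  rw [← Finset.sum_biUnion]
  · congr 1
    ext T
    simp only [Finset.mem_biUnion]
    constructor
    · intro hT
      obtain ⟨x, hx⟩ := classes_nonempty hT
      have hJ : (Ω.filter fun y => (p : ℤ_[p]) ^ a ∣ y - x) ∈ classes a Ω :=
        mem_classes.2 ⟨x, classes_subset hT hx, rfl⟩
      refine ⟨_, hJ, (mem_classes_of_refine ha hJ).2 ⟨hT, fun y hy => ?_⟩⟩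
      exact Finset.mem_filter.2 ⟨classes_subset hT hy,
        (pow_dvd_pow _ ha).trans (classes_dvd hT hy hx)⟩
    · rintro ⟨J, hJ, hT⟩
      exact ((mem_classes_of_refine ha hJ).1 hT).1
  · intro J hJ J' hJ' hne
    refine Finset.disjoint_left.2 fun T hT hT' => hne ?_
    obtain ⟨x, hx⟩ := classes_nonempty hT
    exact classes_eq_of_mem hJ hJ' (classes_subset hT hx) (classes_subset hT' hx) (by simp)

lemma card_classes_le (N : ℕ) (Ω : Finset ℤ_[p]) : (classes N Ω).card ≤ p ^ N := by
  have hp : NeZero (p ^ N) := ⟨pow_ne_zero _ (Fact.out : p.Prime).ne_zero⟩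
  have : (classes N Ω).card ≤ (Finset.univ : Finset (ZMod (p ^ N))).card := by
    refine Finset.card_le_card_of_injOn
      (fun T => if h : T.Nonempty then PadicInt.toZModPow N h.choose else 0)
      (fun _ _ => Finset.mem_coe.2 (Finset.mem_univ _)) ?_
    intro T hT T' hT' heq
    have h := classes_nonempty hT
    have h' := classes_nonempty hT'
    simp only [dif_pos h, dif_pos h'] at heq
    refine classes_eq_of_mem hT hT' h.choose_spec h'.choose_spec ?_
    have : h'.choose - h.choose ∈ RingHom.ker (PadicInt.toZModPow (p := p) N) := by
      rw [RingHom.mem_ker, map_sub, heq, sub_self]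
    rwa [PadicInt.ker_toZModPow, Ideal.mem_span_singleton] at this
  simpa [ZMod.card] using this

lemma classes_image {N b : ℕ} (u : ℤ_[p]) (Ω : Finset ℤ_[p]) :
    classes (N + b) (Ω.image fun y => u + (p : ℤ_[p]) ^ b * y)
      = (classes N Ω).image fun T => T.image fun y => u + (p : ℤ_[p]) ^ b * y := by
  have hp : (p : ℤ_[p]) ^ b ≠ 0 := pow_ne_zero _ (by exact_mod_cast (Fact.out : p.Prime).ne_zero)
  unfold classes
  rw [Finset.image_image, Finset.image_image]
  refine Finset.image_congr fun x _ => ?_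
  simp only [Function.comp]
  rw [Finset.filter_image]
  congr 1
  refine Finset.filter_congr fun y _ => ?_
  rw [show u + (p : ℤ_[p]) ^ b * y - (u + (p : ℤ_[p]) ^ b * x) = (y - x) * (p : ℤ_[p]) ^ b by ring,
    pow_add, mul_dvd_mul_iff_right hp]

lemma affine_injective (u : ℤ_[p]) (b : ℕ) :
    Function.Injective fun y : ℤ_[p] => u + (p : ℤ_[p]) ^ b * y := by
  have hp : (p : ℤ_[p]) ^ b ≠ 0 := pow_ne_zero _ (by exact_mod_cast (Fact.out : p.Prime).ne_zero)
  intro y y' h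
  simpa [hp] using h

lemma exists_affine_image {u : ℤ_[p]} {b : ℕ} {Ω : Finset ℤ_[p]}
    (h : ∀ x ∈ Ω, (p : ℤ_[p]) ^ b ∣ x - u) :
    ∃ Ω' : Finset ℤ_[p], Ω'.image (fun y => u + (p : ℤ_[p]) ^ b * y) = Ω := by
  have : ∀ x : ℤ_[p], ∃ y, (p : ℤ_[p]) ^ b ∣ x - u → u + (p : ℤ_[p]) ^ b * y = x := by
    intro x
    by_cases hx : (p : ℤ_[p]) ^ b ∣ x - u
    · obtain ⟨y, hy⟩ := hx
      exact ⟨y, fun _ => by rw [← hy]; ring⟩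
    · exact ⟨0, fun h => absurd h hx⟩
  choose e he using this
  refine ⟨Ω.image e, ?_⟩
  rw [Finset.image_image]
  ext z
  simp only [Finset.mem_image, Function.comp]
  constructor
  · rintro ⟨x, hx, rfl⟩
    rwa [he x (h x hx)]
  · intro hz
    exact ⟨z, hz, he z (h z hz)⟩

/-! ### Exponential sums along a curve -/

/-- The exponential sum over `Ω` along `γ`, with weights `w`. -/
def expSum {G : Type*} [AddCommGroup G] {k : ℕ} (Ψ : (Fin k → ℤ_[p]) →+ AddChar G ℂ)
    (γ : ℤ_[p] → Fin k → ℤ_[p]) (w : ℤ_[p] → ℂ) (Ω : Finset ℤ_[p]) (α : G) : ℂ :=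
  ∑ x ∈ Ω, w x * Ψ (γ x) α

/-- The square function of the pieces of the exponential sum modulo `p ^ N`. -/
def sqf {G : Type*} [AddCommGroup G] [Fintype G] {k : ℕ} (q N : ℕ)
    (Ψ : (Fin k → ℤ_[p]) →+ AddChar G ℂ)
    (γ : ℤ_[p] → Fin k → ℤ_[p]) (w : ℤ_[p] → ℂ) (Ω : Finset ℤ_[p]) : ℝ :=
  Real.sqrt (∑ T ∈ classes N Ω, nrm q (expSum Ψ γ w T) ^ 2)

/-- A small perturbation of the moment curve. -/
def IsCurve {k : ℕ} (g : Fin k → Polynomial ℤ_[p]) : Prop :=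
  ∀ i : Fin k, ∃ h : Polynomial ℤ_[p],
    g i = Polynomial.X ^ ((i : ℕ) + 1) + Polynomial.C (p : ℤ_[p]) * Polynomial.X ^ (k + 1) * h

/-- The map defined by a tuple of polynomials. -/
def evalCurve {k : ℕ} (g : Fin k → Polynomial ℤ_[p]) (x : ℤ_[p]) : Fin k → ℤ_[p] :=
  fun i => (g i).eval x

/-- The characters are separated modulo `p ^ m`. -/
def Sep {G : Type*} [AddCommGroup G] {k : ℕ} (m : ℕ) (Ψ : (Fin k → ℤ_[p]) →+ AddChar G ℂ) : Prop :=
  ∀ ξ, Ψ ξ = 0 → ∀ i, (p : ℤ_[p]) ^ m ∣ ξ i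

variable (p) in
/-- The `ℓ²` decoupling inequality at scale `p ^ (-N)` with constant `D`. -/
def Dec (k N : ℕ) (D : ℝ) : Prop :=
  ∀ (G : Type) [AddCommGroup G] [Fintype G] (Ψ : (Fin k → ℤ_[p]) →+ AddChar G ℂ),
    Sep (k * N) Ψ → ∀ g : Fin k → Polynomial ℤ_[p], IsCurve g →
    ∀ (w : ℤ_[p] → ℂ) (Ω : Finset ℤ_[p]),
      nrm (k * (k + 1)) (expSum Ψ (evalCurve g) w Ω)
        ≤ D * sqf (k * (k + 1)) N Ψ (evalCurve g) w Ω

variable (p) in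
/-- The asymmetric bilinear decoupling inequality with constant `B`. -/
def Bil (k N l a b : ℕ) (B : ℝ) : Prop :=
  ∀ (G : Type) [AddCommGroup G] [Fintype G] (Ψ : (Fin k → ℤ_[p]) →+ AddChar G ℂ),
    Sep (k * N) Ψ → ∀ g : Fin k → Polynomial ℤ_[p], IsCurve g →
    ∀ (w : ℤ_[p] → ℂ) (Ω₁ Ω₂ : Finset ℤ_[p]) (u v : ℤ_[p]), IsUnit (u - v) →
      (∀ x ∈ Ω₁, (p : ℤ_[p]) ^ a ∣ x - u) → (∀ x ∈ Ω₂, (p : ℤ_[p]) ^ b ∣ x - v) →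
      ∑ α, ‖expSum Ψ (evalCurve g) w Ω₁ α‖ ^ (l * (l + 1))
          * ‖expSum Ψ (evalCurve g) w Ω₂ α‖ ^ (k * (k + 1) - l * (l + 1))
        ≤ B ^ (k * (k + 1)) * (sqf (k * (k + 1)) N Ψ (evalCurve g) w Ω₁ ^ (l * (l + 1))
          * sqf (k * (k + 1)) N Ψ (evalCurve g) w Ω₂ ^ (k * (k + 1) - l * (l + 1)))

section expSum

variable {G : Type*} [AddCommGroup G] {k : ℕ} (Ψ : (Fin k → ℤ_[p]) →+ AddChar G ℂ)
    (γ : ℤ_[p] → Fin k → ℤ_[p]) (w : ℤ_[p] → ℂ)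

lemma expSum_classes (N : ℕ) (Ω : Finset ℤ_[p]) (α : G) :
    expSum Ψ γ w Ω α = ∑ T ∈ classes N Ω, expSum Ψ γ w T α :=
  sum_classes N Ω _

variable [Fintype G]

lemma sqf_nonneg (q N : ℕ) (Ω : Finset ℤ_[p]) : 0 ≤ sqf q N Ψ γ w Ω := Real.sqrt_nonneg _

lemma sqf_sq (q N : ℕ) (Ω : Finset ℤ_[p]) :
    sqf q N Ψ γ w Ω ^ 2 = ∑ T ∈ classes N Ω, nrm q (expSum Ψ γ w T) ^ 2 :=
  Real.sq_sqrt (Finset.sum_nonneg fun _ _ => by positivity)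

lemma sqf_sq_refine (q : ℕ) {N a : ℕ} (ha : a ≤ N) (Ω : Finset ℤ_[p]) :
    sqf q N Ψ γ w Ω ^ 2 = ∑ J ∈ classes a Ω, sqf q N Ψ γ w J ^ 2 := by
  simp only [sqf_sq]
  exact sum_classes_refine ha Ω _

lemma nrm_expSum_le_sum {q : ℕ} (hq : q ≠ 0) (N : ℕ) (Ω : Finset ℤ_[p]) :
    nrm q (expSum Ψ γ w Ω) ≤ ∑ T ∈ classes N Ω, nrm q (expSum Ψ γ w T) := by
  have : expSum Ψ γ w Ω = fun α => ∑ T ∈ classes N Ω, expSum Ψ γ w T α := by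
    ext α; exact expSum_classes Ψ γ w N Ω α
  rw [this]
  exact nrm_sum_le hq _ _

/-- The trivial decoupling inequality. -/
lemma nrm_expSum_le_sqf {q : ℕ} (hq : q ≠ 0) (N : ℕ) (Ω : Finset ℤ_[p]) :
    nrm q (expSum Ψ γ w Ω) ≤ (p : ℝ) ^ N * sqf q N Ψ γ w Ω := by
  have hp1 : (1 : ℝ) ≤ (p : ℝ) ^ N := one_le_pow₀ (by exact_mod_cast (Fact.out : p.Prime).one_le)
  refine (nrm_expSum_le_sum Ψ γ w hq N Ω).trans ?_
  refine (sq_le_sq₀ (Finset.sum_nonneg fun _ _ => nrm_nonneg _ _)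
    (mul_nonneg (by positivity) (sqf_nonneg _ _ _ _ _ _))).1 ?_
  refine (sq_sum_le_card_mul_sum_sq).trans ?_
  rw [mul_pow, sqf_sq]
  gcongr
  have : ((classes N Ω).card : ℝ) ≤ (p : ℝ) ^ N := by exact_mod_cast card_classes_le N Ω
  nlinarith

end expSum

end Decoupling

namespace Decoupling

open Polynomial in
/-- The matrix of low-degree Taylor coefficients at a point of consecutive powers is
invertible. -/
lemma det_taylor_coeff_ne_zero {p : ℕ} [Fact p.Prime] {l n : ℕ} (hp : n + l < p) {z : ZMod p}
    (hz : n = 0 ∨ z ≠ 0) :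
    (Matrix.of fun i j : Fin l =>
      (taylor z (X ^ (n + (i : ℕ) + 1) : (ZMod p)[X])).coeff ((j : ℕ) + 1)).det ≠ 0 := by
  intro hdet
  obtain ⟨v, hv0, hv⟩ := Matrix.exists_vecMul_eq_zero_iff.2 hdet
  apply hv0
  set Q : (ZMod p)[X] := ∑ i : Fin l, C (v i) * X ^ (n + (i : ℕ) + 1) with hQ
  set R : (ZMod p)[X] := ∑ i : Fin l, C (v i * ((n + (i : ℕ) + 1 : ℕ) : ZMod p)) * X ^ (i : ℕ) with hR
  have hder : derivative Q = X ^ n * R := by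
    rw [hQ, hR, derivative_sum, Finset.mul_sum]
    refine Finset.sum_congr rfl fun i _ => ?_
    rw [derivative_C_mul_X_pow]
    rw [show n + (i : ℕ) + 1 - 1 = n + i by omega, pow_add]
    ring
  have hcoef : ∀ j : Fin l, (taylor z Q).coeff ((j : ℕ) + 1) = 0 := by
    intro j
    have := congrFun hv j
    simp only [Matrix.vecMul, dotProduct, Matrix.of_apply, Pi.zero_apply] at this
    rw [← this, hQ, map_sum, finsetSum_coeff]
    refine Finset.sum_congr rfl fun i _ => ?_
    rw [← smul_eq_C_mul, map_smul, coeff_smul, smul_eq_mul]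
  have hdvd : X ^ l ∣ taylor z (derivative Q) := by
    rw [X_pow_dvd_iff]
    intro d hd
    have h1 : taylor z (derivative Q) = derivative (taylor z Q) := by
      rw [taylor_apply, taylor_apply, derivative_comp]
      simp
    rw [h1, coeff_derivative, hcoef ⟨d, hd⟩, zero_mul]
  have hdvd' : (X - C z) ^ l ∣ X ^ n * R := by
    rw [← hder]
    obtain ⟨q, hq⟩ := hdvd
    refine ⟨taylor (-z) q, ?_⟩
    have h2 := congrArg (taylor (-z)) hq
    rw [taylor_taylor, neg_add_cancel, taylor_zero, taylor_mul, taylor_pow, taylor_X] at h2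
    rw [h2]; simp [sub_eq_add_neg]
  have hcop : IsCoprime ((X - C z) ^ l) ((X : (ZMod p)[X]) ^ n) := by
    rcases hz with h | h
    · rw [h, pow_zero]; exact isCoprime_one_right
    · apply IsCoprime.pow
      have := isCoprime_X_sub_C_of_isUnit_sub (R := ZMod p) (a := z) (b := 0) (by simpa using h)
      simpa using this
  have hR0 : R = 0 := by
    refine eq_zero_of_dvd_of_degree_lt (hcop.dvd_of_dvd_mul_left hdvd') ?_
    rw [degree_pow, degree_X_sub_C, nsmul_one]
    refine (degree_sum_le _ _).trans_lt ?_
    refine (Finset.sup_lt_iff (by exact_mod_cast WithBot.bot_lt_coe l)).2 fun i _ => ?_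
    refine (degree_C_mul_X_pow_le _ _).trans_lt ?_
    exact_mod_cast i.2
  ext i
  have hc : R.coeff (i : ℕ) = v i * ((n + (i : ℕ) + 1 : ℕ) : ZMod p) := by
    rw [hR, finsetSum_coeff, Finset.sum_eq_single i]
    · rw [coeff_C_mul, coeff_X_pow, if_pos rfl, mul_one]
    · intro b _ hb
      rw [coeff_C_mul, coeff_X_pow, if_neg, mul_zero]
      exact fun h => hb (Fin.ext h.symm)
    · simp
  rw [hR0, coeff_zero] at hc
  rcases mul_eq_zero.1 hc.symm with h | h
  · exact h
  · exfalso
    rw [ZMod.natCast_eq_zero_iff] at h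
    have := Nat.le_of_dvd (by omega) h
    have := i.2
    omega

variable {p : ℕ} [Fact p.Prime]

lemma isUnit_of_toZMod_ne_zero {x : ℤ_[p]} (h : PadicInt.toZMod x ≠ 0) : IsUnit x := by
  by_contra hx
  apply h
  rw [← RingHom.mem_ker, PadicInt.ker_toZMod]
  exact (IsLocalRing.mem_maximalIdeal x).2 hx

lemma toZMod_ne_zero_of_isUnit {x : ℤ_[p]} (h : IsUnit x) : PadicInt.toZMod x ≠ 0 := by
  intro hx
  rw [← RingHom.mem_ker, PadicInt.ker_toZMod] at hx
  exact (IsLocalRing.mem_maximalIdeal x).1 hx h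

lemma dvd_of_dvd_mulVec {l : ℕ} {W : Matrix (Fin l) (Fin l) ℤ_[p]} (hW : IsUnit W.det)
    {d : ℤ_[p]} {ξ : Fin l → ℤ_[p]} (h : ∀ i, d ∣ W.mulVec ξ i) (i : Fin l) : d ∣ ξ i := by
  have : ξ = W⁻¹.mulVec (W.mulVec ξ) := by
    rw [Matrix.mulVec_mulVec, Matrix.nonsing_inv_mul _ hW, Matrix.one_mulVec]
  rw [this]
  simp only [Matrix.mulVec, dotProduct] at h ⊢
  exact Finset.dvd_sum fun j _ => (h j).mul_left _

/-- The matrix of Taylor coefficients of degrees `1, …, l` at `u`. -/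
def tayMat {l : ℕ} (f : Fin l → Polynomial ℤ_[p]) (u : ℤ_[p]) : Matrix (Fin l) (Fin l) ℤ_[p] :=
  Matrix.of fun i j => (Polynomial.taylor u (f i)).coeff ((j : ℕ) + 1)

open Polynomial in
lemma isUnit_det_tayMat {l n : ℕ} (hp : n + l < p) {f : Fin l → Polynomial ℤ_[p]}
    (hf : ∀ i : Fin l, ∃ h, f i = X ^ (n + (i : ℕ) + 1) + C (p : ℤ_[p]) * h) {u : ℤ_[p]}
    (hu : n = 0 ∨ IsUnit u) : IsUnit (tayMat f u).det := by
  apply isUnit_of_toZMod_ne_zero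
  rw [RingHom.map_det]
  have : (PadicInt.toZMod (p := p)).mapMatrix (tayMat f u) = Matrix.of fun i j : Fin l =>
      (taylor (PadicInt.toZMod u) (X ^ (n + (i : ℕ) + 1) : (ZMod p)[X])).coeff ((j : ℕ) + 1) := by
    ext i j
    obtain ⟨h, hh⟩ := hf i
    simp only [tayMat, RingHom.mapMatrix_apply, Matrix.map_apply, Matrix.of_apply]
    rw [hh, map_add, coeff_add, map_add, taylor_mul, taylor_C, coeff_C_mul, map_mul, map_natCast,
      CharP.cast_eq_zero, zero_mul, add_zero, taylor_X_pow, taylor_X_pow, coeff_X_add_C_pow,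
      coeff_X_add_C_pow]
    simp
  rw [this]
  exact det_taylor_coeff_ne_zero hp (hu.imp id toZMod_ne_zero_of_isUnit)

open Polynomial in
/-- Taylor expansion of a tuple of polynomials, normalised by the linear change of variables
given by its low-degree coefficients. -/
lemma exists_taylor_remainder {l : ℕ} (f : Fin l → Polynomial ℤ_[p]) (u : ℤ_[p])
    (hW : IsUnit (tayMat f u).det) :
    ∃ r : Fin l → Polynomial ℤ_[p],
      (∀ i, taylor u (f i) = C ((f i).eval u)
        + ∑ j, C (tayMat f u i j) * (X ^ ((j : ℕ) + 1) + X ^ (l + 1) * r j)) ∧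
      ((∀ i, ∀ n, l < n → (p : ℤ_[p]) ∣ (taylor u (f i)).coeff n) →
        ∀ j, C (p : ℤ_[p]) ∣ r j) := by
  set W := tayMat f u with hWd
  have hR : ∀ i, ∃ R : Polynomial ℤ_[p], taylor u (f i) = C ((f i).eval u)
      + ∑ j : Fin l, C (W i j) * X ^ ((j : ℕ) + 1) + X ^ (l + 1) * R := by
    intro i
    have : X ^ (l + 1) ∣ taylor u (f i) - (C ((f i).eval u)
      + ∑ j : Fin l, C (W i j) * X ^ ((j : ℕ) + 1)) := by
      rw [X_pow_dvd_iff]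
      intro d hd
      rw [coeff_sub, coeff_add, finsetSum_coeff]
      rcases d with _ | d
      · rw [taylor_coeff_zero, coeff_C_zero]
        simp
      · have hd' : d < l := by omega
        rw [Finset.sum_eq_single (⟨d, hd'⟩ : Fin l)]
        · simp [hWd, tayMat]
        · intro b _ hb
          rw [coeff_C_mul, coeff_X_pow, if_neg, mul_zero]
          intro h
          exact hb (Fin.ext (by simp at h ⊢; omega))
        · simp
    obtain ⟨R, hR⟩ := this
    exact ⟨R, by rw [← hR]; ring⟩
  choose R hR using hR
  refine ⟨fun j => ∑ i, C (W⁻¹ j i) * R i, fun i => ?_, fun h j => ?_⟩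
  · rw [hR i, add_assoc]
    congr 1
    simp only [mul_add, Finset.sum_add_distrib]
    congr 1
    have : ∀ j, C (W i j) * (X ^ (l + 1) * ∑ i', C (W⁻¹ j i') * R i')
        = ∑ i', X ^ (l + 1) * (C (W i j * W⁻¹ j i') * R i') := by
      intro j
      rw [Finset.mul_sum, Finset.mul_sum]
      refine Finset.sum_congr rfl fun i' _ => ?_
      rw [C_mul]; ring
    simp only [this]
    rw [Finset.sum_comm]
    have h2 : ∀ i', ∑ j, X ^ (l + 1) * (C (W i j * W⁻¹ j i') * R i')
        = X ^ (l + 1) * (C ((W * W⁻¹) i i') * R i') := by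
      intro i'
      rw [← Finset.mul_sum, ← Finset.sum_mul, Matrix.mul_apply, map_sum]
    simp only [h2]
    rw [Matrix.mul_nonsing_inv _ hW, Finset.sum_eq_single i]
    · simp
    · intro b _ hb
      simp [hb.symm]
    · simp
  · refine Finset.dvd_sum fun i _ => Dvd.dvd.mul_left ?_ _
    rw [C_dvd_iff_dvd_coeff]
    intro n
    have h1 := h i (n + (l + 1)) (by omega)
    rw [hR i, coeff_add, coeff_add, coeff_X_pow_mul, finsetSum_coeff, coeff_C,
      if_neg (by omega), zero_add, Finset.sum_eq_zero, zero_add] at h1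
    · exact h1
    · intro j _
      rw [coeff_C_mul, coeff_X_pow, if_neg, mul_zero]
      have := j.2; omega

open Polynomial in
/-- Local rescaling of a nondegenerate tuple of polynomials to the moment curve. -/
lemma exists_curve_rescale {l : ℕ} (f : Fin l → Polynomial ℤ_[p]) (u : ℤ_[p])
    (hW : IsUnit (tayMat f u).det) {b : ℕ} (hb : 1 ≤ b) :
    ∃ g' : Fin l → Polynomial ℤ_[p], IsCurve g' ∧ ∀ y, evalCurve f (u + (p : ℤ_[p]) ^ b * y)
      = evalCurve f u + (tayMat f u).mulVec
        fun j => (p : ℤ_[p]) ^ (((j : ℕ) + 1) * b) * (g' j).eval y := by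
  obtain ⟨r, hr, -⟩ := exists_taylor_remainder f u hW
  refine ⟨fun j => X ^ ((j : ℕ) + 1) + C (p : ℤ_[p]) * X ^ (l + 1) *
    (C ((p : ℤ_[p]) ^ ((l - (j : ℕ)) * b - 1)) * (r j).comp (C ((p : ℤ_[p]) ^ b) * X)),
    fun j => ⟨_, rfl⟩, fun y => ?_⟩
  ext i
  simp only [evalCurve, Pi.add_apply, Matrix.mulVec, dotProduct]
  have := congrArg (Polynomial.eval ((p : ℤ_[p]) ^ b * y)) (hr i)
  rw [taylor_eval, add_comm] at this
  rw [this, eval_add, eval_C, eval_finsetSum]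
  congr 1
  refine Finset.sum_congr rfl fun j _ => ?_
  simp only [eval_mul, eval_C, eval_add, eval_pow, eval_X, eval_comp]
  have hj := j.2
  have e1 : (p : ℤ_[p]) ^ (((j : ℕ) + 1) * b) * ((p : ℤ_[p]) *
      (p : ℤ_[p]) ^ ((l - (j : ℕ)) * b - 1)) = ((p : ℤ_[p]) ^ b) ^ (l + 1) := by
    rw [← pow_succ', ← pow_add, ← pow_mul]
    congr 1
    have h1 : 1 ≤ (l - (j : ℕ)) * b := Nat.mul_pos (by omega) hb
    rw [Nat.sub_add_cancel h1, ← add_mul, mul_comm]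
    congr 1; omega
  rw [mul_pow, mul_pow, ← e1]
  ring

open Polynomial in
/-- Recentring of a perturbed moment curve. -/
lemma exists_curve_recentre {k : ℕ} (hk : k < p) {g : Fin k → Polynomial ℤ_[p]} (hg : IsCurve g)
    (u : ℤ_[p]) : ∃ (W : Matrix (Fin k) (Fin k) ℤ_[p]) (g' : Fin k → Polynomial ℤ_[p]),
      IsUnit W.det ∧ IsCurve g' ∧
        ∀ y, evalCurve g (u + y) = evalCurve g u + W.mulVec (evalCurve g' y) := by
  have hW : IsUnit (tayMat g u).det := by
    refine isUnit_det_tayMat (n := 0) (by omega) (fun i => ?_) (Or.inl rfl)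
    obtain ⟨h, hh⟩ := hg i
    exact ⟨X ^ (k + 1) * h, by rw [hh, zero_add, mul_assoc]⟩
  obtain ⟨r, hr, hr'⟩ := exists_taylor_remainder g u hW
  have hdvd := hr' (fun i n hn => by
    obtain ⟨h, hh⟩ := hg i
    rw [hh, mul_assoc, map_add, coeff_add, taylor_mul, taylor_C, coeff_C_mul, taylor_X_pow,
      coeff_X_add_C_pow, Nat.choose_eq_zero_of_lt (by have := i.2; omega)]
    simp)
  choose q hq using hdvd
  refine ⟨tayMat g u, fun j => X ^ ((j : ℕ) + 1) + C (p : ℤ_[p]) * X ^ (k + 1) * q j, hW,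
    fun j => ⟨_, rfl⟩, fun y => ?_⟩
  ext i
  simp only [evalCurve, Pi.add_apply, Matrix.mulVec, dotProduct]
  have := congrArg (Polynomial.eval y) (hr i)
  rw [taylor_eval, add_comm] at this
  rw [this, eval_add, eval_C, eval_finsetSum]
  congr 1
  refine Finset.sum_congr rfl fun j _ => ?_
  rw [hq j]
  simp only [eval_mul, eval_C, eval_add, eval_pow, eval_X]
  ring

end Decoupling

namespace Decoupling

variable {p : ℕ} [Fact p.Prime]

section rescale

variable {G : Type} [AddCommGroup G] [Fintype G]

/-- Composition with an anisotropic linear change of variables. -/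
def rescaleHom {k l : ℕ} (Ψ : (Fin k → ℤ_[p]) →+ AddChar G ℂ) (W : Matrix (Fin k) (Fin l) ℤ_[p])
    (e : Fin l → ℤ_[p]) : (Fin l → ℤ_[p]) →+ AddChar G ℂ :=
  Ψ.comp
    { toFun := fun ξ => W.mulVec fun j => e j * ξ j
      map_zero' := by
        ext i; simp [Matrix.mulVec, dotProduct]
      map_add' := fun x y => by
        rw [← Matrix.mulVec_add]
        congr 1
        ext j
        simp [mul_add] }

lemma rescaleHom_apply {k l : ℕ} (Ψ : (Fin k → ℤ_[p]) →+ AddChar G ℂ)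
    (W : Matrix (Fin k) (Fin l) ℤ_[p]) (e : Fin l → ℤ_[p]) (ξ : Fin l → ℤ_[p]) :
    rescaleHom Ψ W e ξ = Ψ (W.mulVec fun j => e j * ξ j) := rfl

lemma sep_rescaleHom {l m b n : ℕ} {Ψ : (Fin l → ℤ_[p]) →+ AddChar G ℂ} (h : Sep m Ψ)
    {W : Matrix (Fin l) (Fin l) ℤ_[p]} (hW : IsUnit W.det) (hm : l * (n + b) ≤ m) :
    Sep (l * n) (rescaleHom Ψ W fun j => (p : ℤ_[p]) ^ (((j : ℕ) + 1) * b)) := by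
  intro ξ hξ i
  have h1 := dvd_of_dvd_mulVec hW (h _ hξ) i
  have hp : (p : ℤ_[p]) ^ (((i : ℕ) + 1) * b) ≠ 0 :=
    pow_ne_zero _ (by exact_mod_cast (Fact.out : p.Prime).ne_zero)
  have h2 : ((i : ℕ) + 1) * b + l * n ≤ m := by
    have : ((i : ℕ) + 1) * b ≤ l * b := Nat.mul_le_mul_right _ i.2
    linarith [mul_add l n b]
  have h3 := (pow_dvd_pow (p : ℤ_[p]) h2).trans h1
  rw [pow_add] at h3
  exact (mul_dvd_mul_iff_left hp).1 h3

lemma expSum_image_affine {k l : ℕ} (Ψ : (Fin k → ℤ_[p]) →+ AddChar G ℂ)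
    (γ : ℤ_[p] → Fin k → ℤ_[p]) (u : ℤ_[p]) (b : ℕ) (W : Matrix (Fin k) (Fin l) ℤ_[p])
    (e : Fin l → ℤ_[p]) (δ : ℤ_[p] → Fin l → ℤ_[p])
    (hγ : ∀ y, γ (u + (p : ℤ_[p]) ^ b * y) = γ u + W.mulVec fun j => e j * δ y j)
    (w : ℤ_[p] → ℂ) (Ω : Finset ℤ_[p]) (α : G) :
    expSum Ψ γ w (Ω.image fun y => u + (p : ℤ_[p]) ^ b * y) α
      = Ψ (γ u) α * expSum (rescaleHom Ψ W e) δ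
        (fun y => w (u + (p : ℤ_[p]) ^ b * y)) Ω α := by
  unfold expSum
  rw [Finset.sum_image fun x _ y _ h => affine_injective u b h, Finset.mul_sum]
  refine Finset.sum_congr rfl fun y _ => ?_
  rw [hγ, map_add, AddChar.add_apply, rescaleHom_apply]
  ring

lemma norm_expSum_image_affine {k l : ℕ} (Ψ : (Fin k → ℤ_[p]) →+ AddChar G ℂ)
    (γ : ℤ_[p] → Fin k → ℤ_[p]) (u : ℤ_[p]) (b : ℕ) (W : Matrix (Fin k) (Fin l) ℤ_[p])
    (e : Fin l → ℤ_[p]) (δ : ℤ_[p] → Fin l → ℤ_[p])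
    (hγ : ∀ y, γ (u + (p : ℤ_[p]) ^ b * y) = γ u + W.mulVec fun j => e j * δ y j)
    (w : ℤ_[p] → ℂ) (Ω : Finset ℤ_[p]) (α : G) :
    ‖expSum Ψ γ w (Ω.image fun y => u + (p : ℤ_[p]) ^ b * y) α‖
      = ‖expSum (rescaleHom Ψ W e) δ
        (fun y => w (u + (p : ℤ_[p]) ^ b * y)) Ω α‖ := by
  rw [expSum_image_affine Ψ γ u b W e δ hγ, norm_mul, AddChar.norm_apply, one_mul]

/-- The decoupling inequality applied on a small ball of a general nondegenerate curve. -/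
lemma Dec.apply {l n b m : ℕ} {D : ℝ} (hD : Dec p l n D)
    {Ψ : (Fin l → ℤ_[p]) →+ AddChar G ℂ} (hΨ : Sep m Ψ) (hm : l * (n + b) ≤ m)
    {γ : ℤ_[p] → Fin l → ℤ_[p]} {u : ℤ_[p]} {g' : Fin l → Polynomial ℤ_[p]} (hg' : IsCurve g')
    {W : Matrix (Fin l) (Fin l) ℤ_[p]} (hW : IsUnit W.det)
    (hγ : ∀ y, γ (u + (p : ℤ_[p]) ^ b * y)
      = γ u + W.mulVec fun j => (p : ℤ_[p]) ^ (((j : ℕ) + 1) * b) * (g' j).eval y)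
    (w : ℤ_[p] → ℂ) {Ω : Finset ℤ_[p]} (hΩ : ∀ x ∈ Ω, (p : ℤ_[p]) ^ b ∣ x - u) :
    nrm (l * (l + 1)) (expSum Ψ γ w Ω) ≤ D * sqf (l * (l + 1)) (n + b) Ψ γ w Ω := by
  obtain ⟨Ω', rfl⟩ := exists_affine_image hΩ
  have key := norm_expSum_image_affine Ψ γ u b W
    (fun j => (p : ℤ_[p]) ^ (((j : ℕ) + 1) * b)) (evalCurve g') hγ w
  rw [nrm_congr (key Ω')]
  refine (hD G _ (sep_rescaleHom hΨ hW hm) g' hg' _ Ω').trans_eq ?_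
  congr 1
  unfold sqf
  congr 1
  rw [classes_image, Finset.sum_image]
  · refine Finset.sum_congr rfl fun T _ => ?_
    rw [nrm_congr (key T)]
  · intro T _ T' _ h
    exact Finset.image_injective (affine_injective u b) h

end rescale

lemma isUnit_det_tayMat_curve {k : ℕ} (hk : k < p) {g : Fin k → Polynomial ℤ_[p]} (hg : IsCurve g)
    (u : ℤ_[p]) : IsUnit (tayMat g u).det := by
  refine isUnit_det_tayMat (n := 0) (by omega) (fun i => ?_) (Or.inl rfl)
  obtain ⟨h, hh⟩ := hg i
  exact ⟨Polynomial.X ^ (k + 1) * h, by rw [hh, zero_add, mul_assoc]⟩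

/-- Parabolic rescaling. -/
lemma Dec.rescale {k n b : ℕ} {D : ℝ} (hk : k < p) (hD : Dec p k n D) {G : Type} [AddCommGroup G]
    [Fintype G] {Ψ : (Fin k → ℤ_[p]) →+ AddChar G ℂ} (hΨ : Sep (k * (n + b)) Ψ)
    {g : Fin k → Polynomial ℤ_[p]} (hg : IsCurve g) (w : ℤ_[p] → ℂ) {Ω : Finset ℤ_[p]} {u : ℤ_[p]}
    (hΩ : ∀ x ∈ Ω, (p : ℤ_[p]) ^ b ∣ x - u) :
    nrm (k * (k + 1)) (expSum Ψ (evalCurve g) w Ω)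
      ≤ D * sqf (k * (k + 1)) (n + b) Ψ (evalCurve g) w Ω := by
  rcases Nat.eq_zero_or_pos b with rfl | hb
  · exact hD G Ψ hΨ g hg w Ω
  · have hW := isUnit_det_tayMat_curve hk hg u
    obtain ⟨g', hg', he⟩ := exists_curve_rescale g u hW hb
    exact hD.apply hΨ le_rfl hg' hW he w hΩ

lemma dec_zero_scale {k : ℕ} (hk : k ≠ 0) : Dec p k 0 1 := by
  intro G _ _ Ψ _ g _ w Ω
  simpa using nrm_expSum_le_sqf Ψ (evalCurve g) w (mul_ne_zero hk k.succ_ne_zero) 0 Ω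

lemma isUnit_of_not_dvd {x : ℤ_[p]} (h : ¬ (p : ℤ_[p]) ∣ x) : IsUnit x := by
  by_contra hx
  apply h
  rw [← Ideal.mem_span_singleton, ← PadicInt.maximalIdeal_eq_span_p]
  exact (IsLocalRing.mem_maximalIdeal x).2 hx

lemma not_dvd_of_isUnit {x : ℤ_[p]} (h : IsUnit x) : ¬ (p : ℤ_[p]) ∣ x := fun hx =>
  PadicInt.prime_p.not_isUnit (isUnit_of_dvd_unit hx h)

section bilinear

variable {G : Type} [AddCommGroup G] [Fintype G]

lemma sqf_le_of_mem_classes {k : ℕ} (Ψ : (Fin k → ℤ_[p]) →+ AddChar G ℂ)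
    (γ : ℤ_[p] → Fin k → ℤ_[p]) (w : ℤ_[p] → ℂ) (q : ℕ) {N a : ℕ} (ha : a ≤ N)
    {Ω T : Finset ℤ_[p]} (hT : T ∈ classes a Ω) : sqf q N Ψ γ w T ≤ sqf q N Ψ γ w Ω := by
  refine (sq_le_sq₀ (sqf_nonneg _ _ _ _ _ _) (sqf_nonneg _ _ _ _ _ _)).1 ?_
  rw [sqf_sq_refine Ψ γ w q ha Ω]
  exact Finset.single_le_sum (f := fun J => sqf q N Ψ γ w J ^ 2) (fun _ _ => by positivity) hT

/-- Symmetrisation of a bilinear estimate by the Cauchy–Schwarz inequality. -/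
lemma nrm_mul_le {m q : ℕ} (hm : m ≠ 0) (hq : q ≤ 2 * m) {f₁ f₂ : G → ℂ} {B S₁ S₂ : ℝ}
    (hB : 0 ≤ B) (hS₁ : 0 ≤ S₁) (hS₂ : 0 ≤ S₂)
    (h₁ : ∑ α, ‖f₁ α‖ ^ q * ‖f₂ α‖ ^ (2 * m - q) ≤ B ^ (2 * m) * (S₁ ^ q * S₂ ^ (2 * m - q)))
    (h₂ : ∑ α, ‖f₂ α‖ ^ q * ‖f₁ α‖ ^ (2 * m - q) ≤ B ^ (2 * m) * (S₂ ^ q * S₁ ^ (2 * m - q))) :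
    nrm m (fun α => f₁ α * f₂ α) ≤ B ^ 2 * (S₁ * S₂) := by
  refine (pow_le_pow_iff_left₀ (nrm_nonneg _ _) (by positivity) hm).1 ?_
  rw [nrm_pow hm]
  refine (sq_le_sq₀ (Finset.sum_nonneg fun _ _ => by positivity) (by positivity)).1 ?_
  have hsplit : ∀ x y : ℝ, ((x * y) ^ m) ^ 2
      = (x ^ q * y ^ (2 * m - q)) * (y ^ q * x ^ (2 * m - q)) := by
    intro x y
    calc ((x * y) ^ m) ^ 2 = x ^ (2 * m) * y ^ (2 * m) := by
          rw [← pow_mul, mul_pow, mul_comm m 2]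
      _ = (x ^ q * x ^ (2 * m - q)) * (y ^ q * y ^ (2 * m - q)) := by
          rw [← pow_add, ← pow_add, Nat.add_sub_cancel' hq]
      _ = _ := by ring
  refine (Finset.sum_sq_le_sum_mul_sum_of_sq_le_mul Finset.univ
    (f := fun α => ‖f₁ α‖ ^ q * ‖f₂ α‖ ^ (2 * m - q))
    (g := fun α => ‖f₂ α‖ ^ q * ‖f₁ α‖ ^ (2 * m - q))
    (fun _ _ => by positivity) (fun _ _ => by positivity)
    (fun α _ => by rw [norm_mul, hsplit])).trans ?_
  refine (mul_le_mul h₁ h₂ (Finset.sum_nonneg fun _ _ => by positivity)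
    (by positivity)).trans_eq ?_
  rw [mul_pow, mul_pow, hsplit, ← pow_mul, ← pow_mul, mul_mul_mul_comm, ← pow_add]
  congr 2
  ring

end bilinear

/-- Whitney decomposition: linear decoupling from bilinear decoupling. -/
lemma Dec.whitney {k N l : ℕ} {D B : ℝ} (hk0 : k ≠ 0) (hk : k < p) (hl : l ≤ k)
    (hB0 : 0 ≤ B) (hD : Dec p k N D) (hB : Bil p k (N + 1) l 1 1 B) :
    Dec p k (N + 1) (Real.sqrt (D ^ 2 + p * B ^ 2)) := by
  intro G _ _ Ψ hΨ g hg w Ω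
  obtain ⟨m, hm⟩ : ∃ m, k * (k + 1) = 2 * m := (Nat.even_mul_succ_self k).two_dvd
  have hm0 : m ≠ 0 := by
    rintro rfl
    have : k * (k + 1) ≠ 0 := mul_ne_zero hk0 k.succ_ne_zero
    omega
  have hq : l * (l + 1) ≤ 2 * m := by
    rw [← hm]; exact Nat.mul_le_mul hl (by omega)
  set F := expSum Ψ (evalCurve g) w with hF
  set S := sqf (k * (k + 1)) (N + 1) Ψ (evalCurve g) w with hS
  have hS0 : ∀ T, 0 ≤ S T := fun T => sqf_nonneg _ _ _ _ _ _
  have hdiag : ∀ J ∈ classes 1 Ω, nrm m (fun α => F J α * F J α) ≤ D ^ 2 * S J ^ 2 := by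
    intro J hJ
    obtain ⟨x, hx⟩ := classes_nonempty hJ
    rw [← nrm_sq hm0, ← mul_pow, ← hm]
    refine pow_le_pow_left₀ (nrm_nonneg _ _) ?_ 2
    exact hD.rescale hk hΨ hg w (u := x) fun y hy => classes_dvd hJ hy hx
  have hoff : ∀ J ∈ classes 1 Ω, ∀ J' ∈ classes 1 Ω, J ≠ J' →
      nrm m (fun α => F J α * F J' α) ≤ B ^ 2 * (S J * S J') := by
    intro J hJ J' hJ' hne
    obtain ⟨x, hx⟩ := classes_nonempty hJ
    obtain ⟨x', hx'⟩ := classes_nonempty hJ'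
    have hunit : IsUnit (x' - x) := isUnit_of_not_dvd fun h =>
      hne (classes_eq_of_mem hJ hJ' hx hx' (by simpa using h))
    have hunit' : IsUnit (x - x') := by rw [← neg_sub]; exact hunit.neg
    refine nrm_mul_le hm0 hq hB0 (hS0 _) (hS0 _) ?_ ?_
    · rw [← hm]
      exact hB G Ψ hΨ g hg w J J' x x' hunit' (fun y hy => classes_dvd hJ hy hx)
        (fun y hy => classes_dvd hJ' hy hx')
    · rw [← hm]
      exact hB G Ψ hΨ g hg w J' J x' x hunit (fun y hy => classes_dvd hJ' hy hx')
        (fun y hy => classes_dvd hJ hy hx)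
  have hpair : ∀ J ∈ classes 1 Ω, ∀ J' ∈ classes 1 Ω, nrm m (fun α => F J α * F J' α)
      ≤ (if J = J' then D ^ 2 * S J ^ 2 else 0) + B ^ 2 * (S J * S J') := by
    intro J hJ J' hJ'
    by_cases h : J = J'
    · subst h
      rw [if_pos rfl]
      refine (hdiag J hJ).trans (le_add_of_nonneg_right ?_)
      have := hS0 J
      positivity
    · rw [if_neg h, zero_add]
      exact hoff J hJ J' hJ' h
  have hsq : nrm (k * (k + 1)) (F Ω) ^ 2 ≤ (D ^ 2 + p * B ^ 2) * S Ω ^ 2 := by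
    have hFF : (fun α => F Ω α * F Ω α) = fun α =>
        ∑ x ∈ classes 1 Ω ×ˢ classes 1 Ω, F x.1 α * F x.2 α := by
      ext α
      rw [hF, expSum_classes Ψ _ w 1 Ω α, Finset.sum_mul_sum, Finset.sum_product]
    rw [hm, nrm_sq hm0, hFF]
    have hle := nrm_sum_le hm0 (classes 1 Ω ×ˢ classes 1 Ω)
      (fun (x : Finset ℤ_[p] × Finset ℤ_[p]) (α : G) => F x.1 α * F x.2 α)
    refine hle.trans ?_
    rw [Finset.sum_product]
    refine (Finset.sum_le_sum fun J hJ => Finset.sum_le_sum fun J' hJ' =>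
      hpair J hJ J' hJ').trans ?_
    have h1 : S Ω ^ 2 = ∑ J ∈ classes 1 Ω, S J ^ 2 :=
      sqf_sq_refine Ψ _ w _ (by omega) Ω
    have h2 : (∑ J ∈ classes 1 Ω, S J) ^ 2 ≤ p * ∑ J ∈ classes 1 Ω, S J ^ 2 := by
      refine sq_sum_le_card_mul_sum_sq.trans ?_
      refine mul_le_mul_of_nonneg_right ?_ (Finset.sum_nonneg fun _ _ => by positivity)
      have := card_classes_le 1 Ω
      rw [pow_one] at this
      exact_mod_cast this
    simp only [Finset.sum_add_distrib]
    have h3 : ∑ J ∈ classes 1 Ω, ∑ J' ∈ classes 1 Ω, (if J = J' then D ^ 2 * S J ^ 2 else 0)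
        = D ^ 2 * S Ω ^ 2 := by
      rw [h1, Finset.mul_sum]
      refine Finset.sum_congr rfl fun J hJ => ?_
      rw [Finset.sum_ite_eq, if_pos hJ]
    have h4 : ∑ J ∈ classes 1 Ω, ∑ J' ∈ classes 1 Ω, B ^ 2 * (S J * S J')
        = B ^ 2 * (∑ J ∈ classes 1 Ω, S J) ^ 2 := by
      rw [sq (∑ J ∈ classes 1 Ω, S J), Finset.sum_mul_sum, Finset.mul_sum]
      refine Finset.sum_congr rfl fun J hJ => ?_
      rw [Finset.mul_sum]
    rw [h3, h4, h1]
    have := mul_le_mul_of_nonneg_left h2 (sq_nonneg B)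
    linarith
  refine (sq_le_sq₀ (nrm_nonneg _ _) (mul_nonneg (Real.sqrt_nonneg _) (hS0 _))).1 ?_
  rw [mul_pow, Real.sq_sqrt (by positivity)]
  exact hsq

/-! ### Interpolation of bilinear estimates -/

lemma sum_rpow_mul_rpow_le {ι : Type*} (s : Finset ι) {U V : ι → ℝ} (hU : ∀ i, 0 ≤ U i)
    (hV : ∀ i, 0 ≤ V i) {θ : ℝ} (h0 : 0 < θ) (h1 : θ < 1) :
    ∑ i ∈ s, U i ^ θ * V i ^ (1 - θ) ≤ (∑ i ∈ s, U i) ^ θ * (∑ i ∈ s, V i) ^ (1 - θ) := by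
  have hpq : (1 / θ).HolderConjugate (1 / (1 - θ)) := by
    have h1' : 0 < 1 - θ := by linarith
    refine Real.holderConjugate_iff.2 ⟨?_, ?_⟩
    · rw [lt_div_iff₀ h0]; linarith
    · rw [one_div, one_div, inv_inv, inv_inv]; ring
  have h1' : 0 < 1 - θ := by linarith
  have := Real.inner_le_Lp_mul_Lq_of_nonneg s hpq (f := fun i => U i ^ θ)
    (g := fun i => V i ^ (1 - θ)) (fun i _ => Real.rpow_nonneg (hU i) _)
    (fun i _ => Real.rpow_nonneg (hV i) _)
  refine this.trans_eq ?_
  congr 1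
  · rw [one_div, one_div, inv_inv]
    congr 1
    exact Finset.sum_congr rfl fun i _ => Real.rpow_rpow_inv (hU i) h0.ne'
  · rw [one_div, one_div, inv_inv]
    congr 1
    exact Finset.sum_congr rfl fun i _ => Real.rpow_rpow_inv (hV i) h1'.ne'

lemma interp_exponents {x y : ℝ} (hx : 0 ≤ x) (hy : 0 ≤ y) {a b c d e f : ℕ} {θ : ℝ} (h0 : 0 ≤ θ)
    (h1 : θ ≤ 1) (he : (e : ℝ) = a * θ + c * (1 - θ)) (hf : (f : ℝ) = b * θ + d * (1 - θ)) :
    x ^ e * y ^ f = (x ^ a * y ^ b) ^ θ * (x ^ c * y ^ d) ^ (1 - θ) := by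
  have h1' : 0 ≤ 1 - θ := by linarith
  rw [Real.mul_rpow (by positivity) (by positivity), Real.mul_rpow (by positivity) (by positivity)]
  simp only [← Real.rpow_natCast]
  rw [← Real.rpow_mul hx, ← Real.rpow_mul hy, ← Real.rpow_mul hx, ← Real.rpow_mul hy, he, hf,
    Real.rpow_add_of_nonneg hx (by positivity) (by positivity),
    Real.rpow_add_of_nonneg hy (by positivity) (by positivity)]
  ring

lemma interp_constants {B₁ B₂ A C : ℝ} (hB₁ : 0 ≤ B₁) (hB₂ : 0 ≤ B₂) (hA : 0 ≤ A) (hC : 0 ≤ C)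
    (n : ℕ) (θ : ℝ) : (B₁ ^ n * A) ^ θ * (B₂ ^ n * C) ^ (1 - θ)
      = (B₁ ^ θ * B₂ ^ (1 - θ)) ^ n * (A ^ θ * C ^ (1 - θ)) := by
  have h : ∀ {B : ℝ}, 0 ≤ B → ∀ τ : ℝ, (B ^ n) ^ τ = (B ^ τ) ^ n := by
    intro B hB τ
    rw [← Real.rpow_natCast, ← Real.rpow_natCast, ← Real.rpow_mul hB, ← Real.rpow_mul hB, mul_comm]
  rw [Real.mul_rpow (by positivity) hA, Real.mul_rpow (by positivity) hC, h hB₁, h hB₂, mul_pow]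
  ring

lemma Bil.holder {k N l j a b : ℕ} {B₁ B₂ : ℝ} (hk : k = l + 1 + j) (hj : 1 ≤ j) (hB₁ : 0 ≤ B₁)
    (hB₂ : 0 ≤ B₂) (h₁ : Bil p k N j b a B₁) (h₂ : Bil p k N l a b B₂) :
    Bil p k N (l + 1) a b (B₁ ^ (1 / ((j : ℝ) + 1)) * B₂ ^ (1 - 1 / ((j : ℝ) + 1))) := by
  intro G _ _ Ψ hΨ g hg w Ω₁ Ω₂ u v huv hΩ₁ hΩ₂
  have hvu : IsUnit (v - u) := by rw [← neg_sub]; exact huv.neg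
  have e₁ := h₁ G Ψ hΨ g hg w Ω₂ Ω₁ v u hvu hΩ₂ hΩ₁
  have e₂ := h₂ G Ψ hΨ g hg w Ω₁ Ω₂ u v huv hΩ₁ hΩ₂
  set θ : ℝ := 1 / ((j : ℝ) + 1) with hθ
  have hj' : (1 : ℝ) ≤ j := by exact_mod_cast hj
  have hθ0 : 0 < θ := by positivity
  have hθ1 : θ < 1 := by rw [hθ, div_lt_one (by positivity)]; linarith
  have hP1 : j * (j + 1) ≤ k * (k + 1) := Nat.mul_le_mul (by omega) (by omega)
  have hP2 : l * (l + 1) ≤ k * (k + 1) := Nat.mul_le_mul (by omega) (by omega)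
  have hP3 : (l + 1) * (l + 1 + 1) ≤ k * (k + 1) := Nat.mul_le_mul (by omega) (by omega)
  have hkr : (k : ℝ) = l + 1 + j := by rw [hk]; push_cast; ring
  have E1 : (((l + 1) * (l + 1 + 1) : ℕ) : ℝ)
      = ((k * (k + 1) - j * (j + 1) : ℕ) : ℝ) * θ + ((l * (l + 1) : ℕ) : ℝ) * (1 - θ) := by
    rw [Nat.cast_sub hP1, hθ]
    push_cast
    rw [hkr]
    field_simp
    ring
  have E2 : ((k * (k + 1) - (l + 1) * (l + 1 + 1) : ℕ) : ℝ)
      = ((j * (j + 1) : ℕ) : ℝ) * θ + ((k * (k + 1) - l * (l + 1) : ℕ) : ℝ) * (1 - θ) := by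
    rw [Nat.cast_sub hP3, Nat.cast_sub hP2, hθ]
    push_cast
    rw [hkr]
    field_simp
    ring
  have hS0 : ∀ T, 0 ≤ sqf (k * (k + 1)) N Ψ (evalCurve g) w T := fun T => sqf_nonneg _ _ _ _ _ _
  rw [interp_exponents (hS0 Ω₁) (hS0 Ω₂) hθ0.le hθ1.le E1 E2]
  simp_rw [interp_exponents (norm_nonneg _) (norm_nonneg _) hθ0.le hθ1.le E1 E2]
  refine (sum_rpow_mul_rpow_le _ (fun _ => by positivity) (fun _ => by positivity) hθ0 hθ1).trans ?_
  have h1' : 0 ≤ 1 - θ := by linarith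
  have hsum0 : ∀ (f₁ f₂ : G → ℝ), (∀ α, 0 ≤ f₁ α) → (∀ α, 0 ≤ f₂ α) → 0 ≤ ∑ α, f₁ α * f₂ α :=
    fun f₁ f₂ h h' => Finset.sum_nonneg fun α _ => mul_nonneg (h α) (h' α)
  have hA := hS0 Ω₁
  have hB := hS0 Ω₂
  have e₁' : ∑ α, ‖expSum Ψ (evalCurve g) w Ω₁ α‖ ^ (k * (k + 1) - j * (j + 1))
        * ‖expSum Ψ (evalCurve g) w Ω₂ α‖ ^ (j * (j + 1))
      ≤ B₁ ^ (k * (k + 1)) *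
        (sqf (k * (k + 1)) N Ψ (evalCurve g) w Ω₁ ^ (k * (k + 1) - j * (j + 1))
          * sqf (k * (k + 1)) N Ψ (evalCurve g) w Ω₂ ^ (j * (j + 1))) := by
    rw [mul_comm (sqf _ _ _ _ _ Ω₁ ^ _)]
    refine le_trans (le_of_eq ?_) e₁
    exact Finset.sum_congr rfl fun α _ => mul_comm _ _
  refine (mul_le_mul (Real.rpow_le_rpow (hsum0 _ _ (fun _ => by positivity) (fun _ => by positivity))
    e₁' hθ0.le) (Real.rpow_le_rpow (hsum0 _ _ (fun _ => by positivity) (fun _ => by positivity))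
    e₂ h1') (Real.rpow_nonneg (hsum0 _ _ (fun _ => by positivity) (fun _ => by positivity)) _)
    (by positivity)).trans_eq ?_
  exact interp_constants hB₁ hB₂ (by positivity) (by positivity) _ _

end Decoupling

namespace Decoupling

variable {p : ℕ} [Fact p.Prime]

/-! ### The dual of a subgroup of a finite abelian group -/

section dual

variable {G : Type} [AddCommGroup G] [Fintype G]

/-- The common kernel of a group of characters. -/
def annih (Λ : AddSubgroup (AddChar G ℂ)) : AddSubgroup G where
  carrier := {α | ∀ χ ∈ Λ, χ α = 1}
  zero_mem' := fun χ _ => AddChar.map_zero_eq_one χ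
  add_mem' := fun {a b} ha hb χ hχ => by
    rw [AddChar.map_add_eq_mul, ha χ hχ, hb χ hχ, one_mul]
  neg_mem' := fun {a} ha χ hχ => by
    rw [AddChar.map_neg_eq_inv, ha χ hχ, inv_one]

lemma mem_of_annih {Λ : AddSubgroup (AddChar G ℂ)} {χ : AddChar G ℂ}
    (h : ∀ α ∈ annih Λ, χ α = 1) : χ ∈ Λ := by
  by_contra hχ
  have hne : (QuotientAddGroup.mk χ : AddChar G ℂ ⧸ Λ) ≠ 0 := by
    rwa [Ne, QuotientAddGroup.eq_zero_iff]
  obtain ⟨ψ, hψ⟩ := AddChar.exists_apply_ne_zero.2 hne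
  obtain ⟨α, hα⟩ := AddChar.doubleDualEmb_bijective.2
    (ψ.compAddMonoidHom (QuotientAddGroup.mk' Λ))
  have hev : ∀ χ' : AddChar G ℂ, χ' α = ψ (QuotientAddGroup.mk χ') := by
    intro χ'
    have := DFunLike.congr_fun hα χ'
    simpa using this
  apply hψ
  rw [← hev]
  refine h α fun χ' hχ' => ?_
  rw [hev, (QuotientAddGroup.eq_zero_iff χ').2 hχ', AddChar.map_zero_eq_one]

lemma sum_subgroup_translate (H : AddSubgroup G) {ω f : G → ℝ}
    (hω : ∀ α, ∀ η ∈ H, ω (α + η) = ω α) :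
    ∑ α, ω α * ∑ η : H, f (α + η) = Fintype.card H * ∑ α, ω α * f α := by
  simp_rw [Finset.mul_sum]
  rw [Finset.sum_comm]
  have : ∀ η : H, ∑ α, ω α * f (α + η) = ∑ α, ω α * f α := by
    intro η
    rw [← Equiv.sum_comp (Equiv.addRight (η : G)) fun α => ω α * f α]
    refine Finset.sum_congr rfl fun α _ => ?_
    rw [Equiv.coe_addRight, hω α η η.2]
  simp [this, Finset.mul_sum]

/-- An `ℓ²` inequality valid on all cosets of a subgroup can be integrated against a weight
invariant under that subgroup. -/
lemma sum_pow_mul_le_of_subgroup {ι : Type*} (H : AddSubgroup G) {r : ℕ} (hr : r ≠ 0) {ω : G → ℝ}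
    (hω0 : ∀ α, 0 ≤ ω α) (hω : ∀ α, ∀ η ∈ H, ω (α + η) = ω α) (F : G → ℂ) (t : Finset ι)
    (Fp : ι → G → ℂ) {D E : ℝ} (hD : 0 ≤ D) (hE : 0 ≤ E)
    (hloc : ∀ α, nrm (2 * r) (fun η : H => F (α + η))
      ≤ D * Real.sqrt (∑ T ∈ t, nrm (2 * r) (fun η : H => Fp T (α + η)) ^ 2))
    {S : ι → ℝ} (hS : ∀ T, 0 ≤ S T)
    (hX : ∀ T ∈ t, ∑ α, ‖Fp T α‖ ^ (2 * r) * ω α ≤ E * S T ^ (2 * r)) :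
    ∑ α, ‖F α‖ ^ (2 * r) * ω α ≤ D ^ (2 * r) * (E * (∑ T ∈ t, S T ^ 2) ^ r) := by
  have h2r : 2 * r ≠ 0 := by omega
  have hr1 : (1 : ℝ) ≤ r := by exact_mod_cast Nat.one_le_iff_ne_zero.2 hr
  have hr0 : (r : ℝ) ≠ 0 := by positivity
  have hcard : (0 : ℝ) < Fintype.card H := by exact_mod_cast Fintype.card_pos
  set φ : ι → G → ℝ := fun T α => ω α ^ (1 / (r : ℝ)) * nrm (2 * r) (fun η : H => Fp T (α + η)) ^ 2
    with hφ
  have hφ0 : ∀ T α, 0 ≤ φ T α := fun T α =>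
    mul_nonneg (Real.rpow_nonneg (hω0 α) _) (sq_nonneg _)
  have hroot : ∀ x : ℝ, 0 ≤ x → (x ^ (1 / (r : ℝ))) ^ r = x := fun x hx => by
    rw [one_div, Real.rpow_inv_natCast_pow hx hr]
  have hφr : ∀ T α, φ T α ^ r = ω α * ∑ η : H, ‖Fp T (α + η)‖ ^ (2 * r) := by
    intro T α
    rw [hφ]
    simp only
    rw [mul_pow, hroot _ (hω0 α), ← pow_mul, nrm_pow h2r]
  have hstep : ∀ α, ω α * ∑ η : H, ‖F (α + η)‖ ^ (2 * r) ≤ D ^ (2 * r) * (∑ T ∈ t, φ T α) ^ r := by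
    intro α
    have h1 := pow_le_pow_left₀ (nrm_nonneg _ _) (hloc α) (2 * r)
    rw [nrm_pow h2r, mul_pow, pow_mul (Real.sqrt _), Real.sq_sqrt
      (Finset.sum_nonneg fun _ _ => sq_nonneg _)] at h1
    refine (mul_le_mul_of_nonneg_left h1 (hω0 α)).trans_eq ?_
    rw [hφ]
    simp only
    rw [← Finset.mul_sum, mul_pow, hroot _ (hω0 α)]
    ring
  have hmink : ∑ α, (∑ T ∈ t, φ T α) ^ r
      ≤ Fintype.card H * (E * (∑ T ∈ t, S T ^ 2) ^ r) := by
    have h1 := rpow_sum_rpow_le Finset.univ t φ hφ0 hr1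
    have h2 : ∀ T ∈ t, (∑ α, φ T α ^ (r : ℝ)) ^ (1 / (r : ℝ))
        ≤ (Fintype.card H * E) ^ (1 / (r : ℝ)) * S T ^ 2 := by
      intro T hT
      simp only [Real.rpow_natCast, hφr]
      rw [sum_subgroup_translate H (f := fun α => ‖Fp T α‖ ^ (2 * r)) hω]
      have h3 : (S T ^ 2) = ((S T ^ 2) ^ r) ^ (1 / (r : ℝ)) := by
        rw [one_div, Real.pow_rpow_inv_natCast (sq_nonneg _) hr]
      rw [h3, ← Real.mul_rpow (by positivity) (by positivity)]
      refine Real.rpow_le_rpow (mul_nonneg hcard.le (Finset.sum_nonneg fun α _ =>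
        mul_nonneg (hω0 α) (by positivity))) ?_ (by positivity)
      rw [← pow_mul, mul_assoc]
      refine mul_le_mul_of_nonneg_left ?_ hcard.le
      refine le_trans (le_of_eq ?_) (hX T hT)
      exact Finset.sum_congr rfl fun α _ => mul_comm _ _
    have h4 := h1.trans (Finset.sum_le_sum h2)
    rw [← Finset.mul_sum] at h4
    have h5 := pow_le_pow_left₀ (Real.rpow_nonneg (Finset.sum_nonneg fun α _ =>
      Real.rpow_nonneg (Finset.sum_nonneg fun T _ => hφ0 T α) _) _) h4 r
    rw [hroot _ (Finset.sum_nonneg fun α _ =>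
      Real.rpow_nonneg (Finset.sum_nonneg fun T _ => hφ0 T α) _), mul_pow,
      hroot _ (by positivity)] at h5
    simp only [Real.rpow_natCast] at h5
    rw [← mul_assoc]
    exact h5
  have htot := Finset.sum_le_sum fun α (_ : α ∈ Finset.univ) => hstep α
  rw [sum_subgroup_translate H (f := fun α => ‖F α‖ ^ (2 * r)) hω, ← Finset.mul_sum] at htot
  have h6 := htot.trans (mul_le_mul_of_nonneg_left hmink (by positivity : 0 ≤ D ^ (2 * r)))
  rw [mul_left_comm] at h6
  have h7 := le_of_mul_le_mul_left h6 hcard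
  refine le_trans (le_of_eq ?_) h7
  exact Finset.sum_congr rfl fun α _ => mul_comm _ _

end dual

open Polynomial in
/-- Lower-dimensional decoupling in the first factor of a bilinear expression. -/
lemma Bil.refine_left {n l N a a' b : ℕ} {D B : ℝ} (hk : n + l < p) (hl : l ≠ 0) (ha : 1 ≤ a)
    (haa' : a ≤ a') (ha'N : a' ≤ N) (hb : (n + 1) * b ≤ (n + l) * N)
    (hab : l * a' ≤ (n + 1) * b) (hD1 : 1 ≤ D) (hB : 0 ≤ B) (hD : Dec p l (a' - a) D)
    (h : Bil p (n + l) N l a' b B) : Bil p (n + l) N l a b (D * B) := by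
  intro G _ _ Ψ hΨ g hg w Ω₁ Ω₂ u v huv hΩ₁ hΩ₂
  obtain ⟨W, f, hW, hf, hrec⟩ := exists_curve_recentre hk hg v
  obtain ⟨r, hr⟩ : ∃ r, l * (l + 1) = 2 * r := (Nat.even_mul_succ_self l).two_dvd
  have hr0 : r ≠ 0 := by
    rintro rfl
    have : l * (l + 1) ≠ 0 := mul_ne_zero hl l.succ_ne_zero
    omega
  -- the frequencies relative to the centre of the second set
  set Φ : (Fin (n + l) → ℤ_[p]) →+ AddChar G ℂ := Ψ.comp W.mulVecLin.toAddMonoidHom with hΦ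
  have hΦa : ∀ ζ, Φ ζ = Ψ (W.mulVec ζ) := fun ζ => rfl
  have hΨΦ : ∀ x, Ψ (evalCurve g x) = Ψ (evalCurve g v) + Φ (evalCurve f (x - v)) := by
    intro x
    rw [hΦa, ← map_add, ← hrec, add_sub_cancel]
  let Z : AddSubgroup (Fin (n + l) → ℤ_[p]) :=
    { carrier := {ζ | ∀ i : Fin l, (p : ℤ_[p]) ^ ((n + 1) * b) ∣ ζ (Fin.natAdd n i)}
      zero_mem' := fun i => dvd_zero _
      add_mem' := fun hx hy i => dvd_add (hx i) (hy i)
      neg_mem' := fun hx i => (hx i).neg_right }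
  have hZ : ∀ ζ, ζ ∈ Z ↔ ∀ i : Fin l, (p : ℤ_[p]) ^ ((n + 1) * b) ∣ ζ (Fin.natAdd n i) :=
    fun ζ => Iff.rfl
  set H := annih (Z.map Φ) with hH
  have hHZ : ∀ ζ ∈ Z, ∀ η : H, Φ ζ η = 1 := fun ζ hζ η =>
    η.2 _ (AddSubgroup.mem_map_of_mem Φ hζ)
  -- the last coordinates determine the restriction to the subgroup
  let emb : (Fin l → ℤ_[p]) →+ (Fin (n + l) → ℤ_[p]) :=
    { toFun := fun ξ => Fin.append (0 : Fin n → ℤ_[p]) ξ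
      map_zero' := by
        ext i; refine Fin.addCases (fun i => ?_) (fun i => ?_) i <;> simp
      map_add' := fun x y => by
        ext i; refine Fin.addCases (fun i => ?_) (fun i => ?_) i <;> simp }
  have hemb : ∀ ξ i, emb ξ (Fin.natAdd n i) = ξ i := fun ξ i => Fin.append_right _ _ i
  let res : AddChar G ℂ →+ AddChar H ℂ :=
    { toFun := fun χ => χ.compAddMonoidHom H.subtype
      map_zero' := rfl
      map_add' := fun _ _ => rfl }
  have hres : ∀ χ (η : H), res χ η = χ η := fun _ _ => rfl
  let Θ : (Fin l → ℤ_[p]) →+ AddChar H ℂ := (res.comp Φ).comp emb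
  have hΘ : ∀ ξ (η : H), Θ ξ η = Φ (emb ξ) η := fun _ _ => rfl
  have hΘΦ : ∀ ζ (η : H), Φ ζ η = Θ (fun i => ζ (Fin.natAdd n i)) η := by
    intro ζ η
    have h1 : ζ - emb (fun i => ζ (Fin.natAdd n i)) ∈ Z := by
      rw [hZ]
      intro i
      simp [hemb]
    have h2 := hHZ _ h1 η
    rw [hΘ]
    conv_lhs => rw [← sub_add_cancel ζ (emb fun i => ζ (Fin.natAdd n i)), map_add,
      AddChar.add_apply, h2, one_mul]
  have hsep : Sep ((n + 1) * b) Θ := by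
    intro ξ hξ i
    have h1 : Φ (emb ξ) ∈ Z.map Φ := by
      apply mem_of_annih
      intro α hα
      have := DFunLike.congr_fun hξ (⟨α, hα⟩ : H)
      rw [hΘ] at this
      exact this
    obtain ⟨ζ, hζ, he⟩ := AddSubgroup.mem_map.1 h1
    have h2 : Ψ (W.mulVec (emb ξ - ζ)) = 0 := by
      rw [← hΦa, map_sub, he, sub_self]
    have h3 := dvd_of_dvd_mulVec hW (hΨ _ h2) (Fin.natAdd n i)
    have h4 := (pow_dvd_pow (p : ℤ_[p]) hb).trans h3
    rw [Pi.sub_apply, hemb] at h4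
    simpa using dvd_add h4 ((hZ ζ).1 hζ i)
  -- the projected curve
  let fl : Fin l → Polynomial ℤ_[p] := fun i => f (Fin.natAdd n i)
  have hfl : ∀ i : Fin l, ∃ q, fl i = X ^ (n + (i : ℕ) + 1) + C (p : ℤ_[p]) * q := by
    intro i
    obtain ⟨q, hq⟩ := hf (Fin.natAdd n i)
    refine ⟨X ^ (n + l + 1) * q, ?_⟩
    simp only [fl, hq, Fin.val_natAdd, mul_assoc]
  have hWl := isUnit_det_tayMat hk hfl (u := u - v) (Or.inr huv)
  obtain ⟨g', hg', hcurve⟩ := exists_curve_rescale fl (u - v) hWl ha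
  have hF₂ : ∀ α, ∀ η ∈ H, ‖expSum Ψ (evalCurve g) w Ω₂ (α + η)‖
      = ‖expSum Ψ (evalCurve g) w Ω₂ α‖ := by
    intro α η hη
    have : expSum Ψ (evalCurve g) w Ω₂ (α + η)
        = Ψ (evalCurve g v) η * expSum Ψ (evalCurve g) w Ω₂ α := by
      unfold expSum
      rw [Finset.mul_sum]
      refine Finset.sum_congr rfl fun x hx => ?_
      have h1 : Ψ (evalCurve g x) η = Ψ (evalCurve g v) η := by
        rw [hΨΦ x, AddChar.add_apply, hHZ _ ?_ ⟨η, hη⟩, mul_one]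
        rw [hZ]
        intro i
        have h2 : (p : ℤ_[p]) ^ ((n + 1) * b) ∣ (x - v) ^ (n + 1) := by
          rw [mul_comm, pow_mul]; exact pow_dvd_pow_of_dvd (hΩ₂ x hx) _
        refine h2.trans ?_
        obtain ⟨q, hq⟩ := hf (Fin.natAdd n i)
        simp only [evalCurve, hq, Fin.val_natAdd, eval_add, eval_mul, eval_pow, eval_X, eval_C]
        refine dvd_add (pow_dvd_pow _ (by omega)) ?_
        exact ((pow_dvd_pow _ (by omega)).mul_left _).mul_right _
      rw [AddChar.map_add_eq_mul, h1]
      ring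
    rw [this, norm_mul, AddChar.norm_apply, one_mul]
  have hF₁ : ∀ (α : G) (T : Finset ℤ_[p]) (η : H), ‖expSum Ψ (evalCurve g) w T (α + η)‖
      = ‖expSum Θ (fun x => evalCurve fl (x - v)) (fun x => w x * Ψ (evalCurve g x) α) T η‖ := by
    intro α T η
    have : expSum Ψ (evalCurve g) w T (α + η) = Ψ (evalCurve g v) η *
        expSum Θ (fun x => evalCurve fl (x - v)) (fun x => w x * Ψ (evalCurve g x) α) T η := by
      unfold expSum
      rw [Finset.mul_sum]
      refine Finset.sum_congr rfl fun x hx => ?_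
      have h1 : Ψ (evalCurve g x) η = Ψ (evalCurve g v) η * Θ (evalCurve fl (x - v)) η := by
        rw [hΨΦ x, AddChar.add_apply, hΘΦ]
        rfl
      rw [AddChar.map_add_eq_mul, h1]
      ring
    rw [this, norm_mul, AddChar.norm_apply, one_mul]
  have hD0 : 0 ≤ D := by linarith
  set S := sqf ((n + l) * (n + l + 1)) N Ψ (evalCurve g) w with hS
  have hS0 : ∀ T, 0 ≤ S T := fun T => sqf_nonneg _ _ _ _ _ _
  set e := (n + l) * (n + l + 1) - l * (l + 1) with he
  have hmain := sum_pow_mul_le_of_subgroup H hr0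
    (ω := fun α => ‖expSum Ψ (evalCurve g) w Ω₂ α‖ ^ e) (fun _ => by positivity)
    (fun α η hη => by simp only [hF₂ α η hη]) (expSum Ψ (evalCurve g) w Ω₁) (classes a' Ω₁)
    (expSum Ψ (evalCurve g) w) (E := B ^ ((n + l) * (n + l + 1)) * S Ω₂ ^ e) hD0
    (mul_nonneg (by positivity) (pow_nonneg (hS0 _) _))
    (fun α => by
      have h1 := hD.apply (b := a) hsep (by rw [Nat.sub_add_cancel haa']; exact hab) hg' hWl
        (γ := fun x => evalCurve fl (x - v)) (u := u)
        (fun y => by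
          have := hcurve y
          rw [← this]
          congr 1
          ring) (fun x => w x * Ψ (evalCurve g x) α) hΩ₁
      rw [Nat.sub_add_cancel haa', hr] at h1
      rw [nrm_congr (hF₁ α Ω₁)]
      refine h1.trans_eq ?_
      unfold sqf
      congr 2
      refine Finset.sum_congr rfl fun T _ => ?_
      rw [nrm_congr (hF₁ α T)])
    (S := S) hS0
    (fun T hT => by
      obtain ⟨x, hx⟩ := classes_nonempty hT
      have h1 : IsUnit (x - v) := isUnit_of_not_dvd fun hd => by
        have h2 : (p : ℤ_[p]) ∣ x - u :=
          (dvd_pow_self _ (by omega)).trans (hΩ₁ x (classes_subset hT hx))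
        refine not_dvd_of_isUnit huv ?_
        have := dvd_sub hd h2
        simpa using this
      have h3 := h G Ψ hΨ g hg w T Ω₂ x v h1 (fun y hy => classes_dvd hT hy hx) hΩ₂
      rw [← hr]
      refine h3.trans_eq ?_
      rw [← hS]
      ring)
  rw [← hr] at hmain
  refine hmain.trans ?_
  have hs : (∑ T ∈ classes a' Ω₁, S T ^ 2) ^ r = S Ω₁ ^ (l * (l + 1)) := by
    rw [← sqf_sq_refine Ψ _ w _ ha'N, hr, pow_mul]
  rw [hs]
  have hpow : D ^ (l * (l + 1)) ≤ D ^ ((n + l) * (n + l + 1)) :=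
    pow_le_pow_right₀ hD1 (Nat.mul_le_mul (by omega) (by omega))
  have hnn : 0 ≤ B ^ ((n + l) * (n + l + 1)) * S Ω₂ ^ e * S Ω₁ ^ (l * (l + 1)) :=
    mul_nonneg (mul_nonneg (by positivity) (pow_nonneg (hS0 _) _)) (pow_nonneg (hS0 _) _)
  refine (mul_le_mul_of_nonneg_right hpow hnn).trans_eq ?_
  rw [mul_pow]
  ring

end Decoupling

namespace Decoupling

variable {p : ℕ} [Fact p.Prime]

lemma Dec.mono {k N : ℕ} {D D' : ℝ} (h : Dec p k N D) (hD : D ≤ D') : Dec p k N D' := by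
  intro G _ _ Ψ hΨ g hg w Ω
  exact (h G Ψ hΨ g hg w Ω).trans (mul_le_mul_of_nonneg_right hD (sqf_nonneg _ _ _ _ _ _))

lemma Bil.mono {k N l a b : ℕ} {B B' : ℝ} (h : Bil p k N l a b B) (hB0 : 0 ≤ B) (hB : B ≤ B') :
    Bil p k N l a b B' := by
  intro G _ _ Ψ hΨ g hg w Ω₁ Ω₂ u v huv hΩ₁ hΩ₂
  refine (h G Ψ hΨ g hg w Ω₁ Ω₂ u v huv hΩ₁ hΩ₂).trans ?_
  have h1 := sqf_nonneg Ψ (evalCurve g) w (k * (k + 1)) N Ω₁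
  have h2 := sqf_nonneg Ψ (evalCurve g) w (k * (k + 1)) N Ω₂
  gcongr

lemma dec_trivial {k N : ℕ} (hk : k ≠ 0) : Dec p k N ((p : ℝ) ^ N) := by
  intro G _ _ Ψ _ g _ w Ω
  exact nrm_expSum_le_sqf Ψ (evalCurve g) w (mul_ne_zero hk k.succ_ne_zero) N Ω

/-- Hölder's inequality with integral exponents. -/
lemma sum_pow_mul_pow_le {G : Type*} [Fintype G] {q r : ℕ} (hq : q ≠ 0) (hr : r ≠ 0) (f₁ f₂ : G → ℂ) :
    ∑ α, ‖f₁ α‖ ^ q * ‖f₂ α‖ ^ r ≤ nrm (q + r) f₁ ^ q * nrm (q + r) f₂ ^ r := by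
  have hq0 : (0 : ℝ) < q := by exact_mod_cast Nat.pos_of_ne_zero hq
  have hr0 : (0 : ℝ) < r := by exact_mod_cast Nat.pos_of_ne_zero hr
  set θ : ℝ := q / (q + r) with hθ
  have h0 : 0 < θ := by positivity
  have h1 : θ < 1 := by rw [hθ, div_lt_one (by positivity)]; linarith
  have h1' : 1 - θ = r / (q + r) := by rw [hθ]; field_simp; ring
  have := sum_rpow_mul_rpow_le Finset.univ (U := fun α => ‖f₁ α‖ ^ (q + r))
    (V := fun α => ‖f₂ α‖ ^ (q + r)) (fun _ => by positivity) (fun _ => by positivity) h0 h1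
  have e : ∀ x : ℝ, 0 ≤ x → ∀ n : ℕ, (x ^ (q + r)) ^ ((n : ℝ) / (q + r)) = x ^ n := by
    intro x hx n
    rw [← Real.rpow_natCast, ← Real.rpow_natCast, ← Real.rpow_mul hx]
    congr 1
    push_cast
    field_simp
  rw [h1'] at this
  simp only [hθ, e _ (norm_nonneg _)] at this
  rw [← nrm_pow (by omega), ← nrm_pow (by omega), e _ (nrm_nonneg _ _), e _ (nrm_nonneg _ _)] at this
  exact this

lemma Dec.bil {k N l a b : ℕ} {D : ℝ} (hl : 1 ≤ l) (hlk : l < k) (h : Dec p k N D) :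
    Bil p k N l a b D := by
  intro G _ _ Ψ hΨ g hg w Ω₁ Ω₂ u v _ _ _
  have hlt : l * (l + 1) < k * (k + 1) := by nlinarith
  have hq : l * (l + 1) ≠ 0 := by positivity
  have hsum : l * (l + 1) + (k * (k + 1) - l * (l + 1)) = k * (k + 1) := by omega
  have hs := sum_pow_mul_pow_le hq (show k * (k + 1) - l * (l + 1) ≠ 0 by omega)
    (expSum Ψ (evalCurve g) w Ω₁) (expSum Ψ (evalCurve g) w Ω₂)
  rw [hsum] at hs
  refine hs.trans ?_
  have h1 := h G Ψ hΨ g hg w Ω₁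
  have h2 := h G Ψ hΨ g hg w Ω₂
  have n1 := nrm_nonneg (k * (k + 1)) (expSum Ψ (evalCurve g) w Ω₁)
  have n2 := nrm_nonneg (k * (k + 1)) (expSum Ψ (evalCurve g) w Ω₂)
  refine (mul_le_mul (pow_le_pow_left₀ n1 h1 _) (pow_le_pow_left₀ n2 h2 _) (by positivity)
    (pow_nonneg (n1.trans h1) _)).trans_eq ?_
  rw [mul_pow, mul_pow, ← hsum, pow_add, hsum]
  ring

lemma Dec.bil_zero {k N a b : ℕ} {D : ℝ} (hk0 : k ≠ 0) (hk : k < p) (hb : b ≤ N) (h : Dec p k (N - b) D) :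
    Bil p k N 0 a b D := by
  intro G _ _ Ψ hΨ g hg w Ω₁ Ω₂ u v _ _ hΩ₂
  have hP : k * (k + 1) ≠ 0 := mul_ne_zero hk0 k.succ_ne_zero
  have := h.rescale (b := b) hk (by rwa [Nat.sub_add_cancel hb]) hg w hΩ₂
  rw [Nat.sub_add_cancel hb] at this
  have h2 := pow_le_pow_left₀ (nrm_nonneg _ _) this (k * (k + 1))
  rw [nrm_pow hP, mul_pow] at h2
  simpa using h2

lemma sum_classes_pow_le {a q : ℕ} (hq : q ≠ 0) (Ω : Finset ℤ_[p]) (x : Finset ℤ_[p] → ℝ)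
    (hx : ∀ T, 0 ≤ x T) :
    (∑ T ∈ classes a Ω, x T) ^ q ≤ ((p : ℝ) ^ a) ^ (q - 1) * ∑ T ∈ classes a Ω, x T ^ q := by
  obtain ⟨n, rfl⟩ := Nat.exists_eq_succ_of_ne_zero hq
  rcases (classes a Ω).eq_empty_or_nonempty with h | h
  · simp [h]
  have hc : (0 : ℝ) < (classes a Ω).card := by exact_mod_cast h.card_pos
  have := pow_sum_div_card_le_sum_pow (s := classes a Ω) (f := x) (n := n) (fun T _ => hx T)
  rw [div_le_iff₀ (by positivity)] at this
  refine this.trans ?_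
  rw [mul_comm, Nat.succ_sub_one]
  have hc' : ((classes a Ω).card : ℝ) ≤ (p : ℝ) ^ a := by exact_mod_cast card_classes_le a Ω
  have h0 : 0 ≤ ∑ T ∈ classes a Ω, x T ^ (n + 1) :=
    Finset.sum_nonneg fun T _ => pow_nonneg (hx T) _
  gcongr

lemma Bil.coarsen {k N l a b : ℕ} {B : ℝ} (hl : 1 ≤ l) (hlk : l < k) (ha : 1 ≤ a) (hb : 1 ≤ b)
    (haN : a ≤ N) (hbN : b ≤ N) (hB : 0 ≤ B) (h : Bil p k N l a b B) :
    Bil p k N l 1 1 ((p : ℝ) ^ (a + b) * B) := by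
  intro G _ _ Ψ hΨ g hg w Ω₁ Ω₂ u v huv hΩ₁ hΩ₂
  have hlt : l * (l + 1) < k * (k + 1) := by nlinarith
  have hsum : l * (l + 1) + (k * (k + 1) - l * (l + 1)) = k * (k + 1) := by omega
  have hq : l * (l + 1) ≠ 0 := by positivity
  have hr : k * (k + 1) - l * (l + 1) ≠ 0 := by omega
  set q := l * (l + 1) with hqdef
  set r := k * (k + 1) - q with hrdef
  set F := expSum Ψ (evalCurve g) w with hF
  set S := sqf (k * (k + 1)) N Ψ (evalCurve g) w with hS
  have hS0 : ∀ Ω, 0 ≤ S Ω := fun Ω => sqf_nonneg _ _ _ _ _ _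
  have hp1 : (1 : ℝ) ≤ p := by exact_mod_cast (Fact.out : p.Prime).one_le
  have hpiece : ∀ T ∈ classes a Ω₁, ∀ T' ∈ classes b Ω₂,
      ∑ α, ‖F T α‖ ^ q * ‖F T' α‖ ^ r ≤ B ^ (k * (k + 1)) * (S Ω₁ ^ q * S Ω₂ ^ r) := by
    intro T hT T' hT'
    obtain ⟨x, hx⟩ := classes_nonempty hT
    obtain ⟨y, hy⟩ := classes_nonempty hT'
    have hxy : IsUnit (x - y) := by
      refine isUnit_of_not_dvd fun hd => not_dvd_of_isUnit huv ?_
      have h1 := hΩ₁ x (classes_subset hT hx)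
      have h2 := hΩ₂ y (classes_subset hT' hy)
      rw [pow_one] at h1 h2
      have := dvd_add (dvd_sub hd h1) h2
      rwa [show x - y - (x - u) + (y - v) = u - v by ring] at this
    refine (h G Ψ hΨ g hg w T T' x y hxy (fun z hz => classes_dvd hT hz hx)
      (fun z hz => classes_dvd hT' hz hy)).trans ?_
    have s1 := sqf_le_of_mem_classes Ψ (evalCurve g) w (k * (k + 1)) haN hT
    have s2 := sqf_le_of_mem_classes Ψ (evalCurve g) w (k * (k + 1)) hbN hT'
    exact mul_le_mul_of_nonneg_left (mul_le_mul (pow_le_pow_left₀ (hS0 _) s1 _)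
      (pow_le_pow_left₀ (hS0 _) s2 _) (pow_nonneg (hS0 _) _) (pow_nonneg (hS0 _) _)) (by positivity)
  have hpt : ∀ (c n : ℕ), n ≠ 0 → ∀ Ω α, ‖F Ω α‖ ^ n
      ≤ ((p : ℝ) ^ c) ^ (n - 1) * ∑ T ∈ classes c Ω, ‖F T α‖ ^ n := by
    intro c n hn Ω α
    refine le_trans ?_ (sum_classes_pow_le hn Ω (fun T => ‖F T α‖) fun _ => norm_nonneg _)
    refine pow_le_pow_left₀ (norm_nonneg _) ?_ _
    rw [hF, expSum_classes Ψ (evalCurve g) w c Ω α]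
    exact norm_sum_le _ _
  set Z := B ^ (k * (k + 1)) * (S Ω₁ ^ q * S Ω₂ ^ r) with hZ
  have hZ0 : 0 ≤ Z := by have := hS0 Ω₁; have := hS0 Ω₂; positivity
  calc ∑ α, ‖F Ω₁ α‖ ^ q * ‖F Ω₂ α‖ ^ r
      ≤ ∑ α, (((p : ℝ) ^ a) ^ (q - 1) * ∑ T ∈ classes a Ω₁, ‖F T α‖ ^ q)
        * (((p : ℝ) ^ b) ^ (r - 1) * ∑ T ∈ classes b Ω₂, ‖F T α‖ ^ r) := by
        refine Finset.sum_le_sum fun α _ => ?_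
        exact mul_le_mul (hpt a q hq Ω₁ α) (hpt b r hr Ω₂ α) (by positivity) (by positivity)
    _ = ((p : ℝ) ^ a) ^ (q - 1) * ((p : ℝ) ^ b) ^ (r - 1) * ∑ T ∈ classes a Ω₁,
        ∑ T' ∈ classes b Ω₂, ∑ α, ‖F T α‖ ^ q * ‖F T' α‖ ^ r := by
        simp_rw [mul_mul_mul_comm, ← Finset.mul_sum, Finset.sum_mul_sum]
        congr 1
        rw [Finset.sum_comm]
        refine Finset.sum_congr rfl fun T _ => ?_
        rw [Finset.sum_comm]
    _ ≤ ((p : ℝ) ^ a) ^ (q - 1) * ((p : ℝ) ^ b) ^ (r - 1) * ((p : ℝ) ^ a * ((p : ℝ) ^ b * Z)) := by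
        refine mul_le_mul_of_nonneg_left ?_ (by positivity)
        have hc1 : ((classes a Ω₁).card : ℝ) ≤ (p : ℝ) ^ a := by exact_mod_cast card_classes_le a Ω₁
        have hc2 : ((classes b Ω₂).card : ℝ) ≤ (p : ℝ) ^ b := by exact_mod_cast card_classes_le b Ω₂
        refine (Finset.sum_le_card_nsmul _ _ ((p : ℝ) ^ b * Z) fun T hT => ?_).trans ?_
        · refine (Finset.sum_le_card_nsmul _ _ Z fun T' hT' => hpiece T hT T' hT').trans ?_
          rw [nsmul_eq_mul]
          gcongr
        · rw [nsmul_eq_mul]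
          gcongr
    _ = ((p : ℝ) ^ a) ^ q * ((p : ℝ) ^ b) ^ r * Z := by
        rw [← pow_sub_one_mul hq ((p : ℝ) ^ a), ← pow_sub_one_mul hr ((p : ℝ) ^ b)]
        ring
    _ ≤ ((p : ℝ) ^ (a + b)) ^ q * ((p : ℝ) ^ (a + b)) ^ r * Z := by
        gcongr <;> first | exact hp1 | omega
    _ = _ := by
        rw [hZ, mul_pow, ← pow_add, hsum]
        ring

end Decoupling

namespace Decoupling

variable {p : ℕ} [Fact p.Prime]

open ComplexConjugate in
lemma sum_expSum_mul_conj_eq_zero {G : Type} [AddCommGroup G] [Fintype G] {k : ℕ}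
    (Ψ : (Fin k → ℤ_[p]) →+ AddChar G ℂ) (γ : ℤ_[p] → Fin k → ℤ_[p]) (w : ℤ_[p] → ℂ)
    {T T' : Finset ℤ_[p]} (h : ∀ x ∈ T, ∀ y ∈ T', Ψ (γ x - γ y) ≠ 0) :
    ∑ α, expSum Ψ γ w T α * conj (expSum Ψ γ w T' α) = 0 := by
  simp only [expSum, map_sum, Finset.sum_mul_sum]
  rw [Finset.sum_comm]
  refine Finset.sum_eq_zero fun x hx => ?_
  rw [Finset.sum_comm]
  refine Finset.sum_eq_zero fun y hy => ?_
  have h1 := AddChar.sum_eq_ite (Ψ (γ x - γ y))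
  rw [if_neg (h x hx y hy)] at h1
  have : ∀ α, w x * Ψ (γ x) α * conj (w y * Ψ (γ y) α)
      = w x * conj (w y) * Ψ (γ x - γ y) α := by
    intro α
    rw [map_sub, AddChar.sub_apply, map_mul, AddChar.map_neg_eq_conj]
    ring
  simp_rw [this, ← Finset.mul_sum, h1, mul_zero]

open ComplexConjugate in
/-- Decoupling for the one-dimensional curve, from orthogonality. -/
lemma dec_one (N : ℕ) : Dec p 1 N 1 := by
  intro G _ _ Ψ hΨ g hg w Ω
  simp only [one_mul, show 1 + 1 = 2 from rfl]
  refine (sq_le_sq₀ (nrm_nonneg 2 (expSum Ψ (evalCurve g) w Ω))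
    (sqf_nonneg Ψ (evalCurve g) w 2 N Ω)).1 (le_of_eq ?_)
  rw [sqf_sq]
  simp only [nrm_pow (two_ne_zero : (2 : ℕ) ≠ 0)]
  have horth : ∀ T ∈ classes N Ω, ∀ T' ∈ classes N Ω, T ≠ T' →
      ∑ α, expSum Ψ (evalCurve g) w T α * conj (expSum Ψ (evalCurve g) w T' α) = 0 := by
    intro T hT T' hT' hne
    refine sum_expSum_mul_conj_eq_zero Ψ _ w fun x hx y hy h0 => hne ?_
    refine classes_eq_of_mem hT hT' hx hy (dvd_sub_symm ?_)
    have h1 := hΨ _ h0 0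
    rw [one_mul] at h1
    obtain ⟨h, hh⟩ := hg 0
    obtain ⟨c, hc⟩ := Polynomial.sub_dvd_eval_sub x y (Polynomial.X ^ 2 * h)
    have he : (evalCurve g x - evalCurve g y) 0 = (x - y) * (1 + p * c) := by
      simp only [evalCurve, Pi.sub_apply, hh]
      simp only [Polynomial.eval_mul, Polynomial.eval_pow, Polynomial.eval_X] at hc
      simp only [Polynomial.eval_add, Polynomial.eval_mul, Polynomial.eval_pow, Polynomial.eval_X,
        Polynomial.eval_C, Fin.val_zero]
      linear_combination (p : ℤ_[p]) * hc
    rw [he] at h1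
    have hu : IsUnit (1 + (p : ℤ_[p]) * c) := by
      refine isUnit_of_not_dvd fun hd => not_dvd_of_isUnit (p := p) isUnit_one ?_
      have := dvd_sub hd (dvd_mul_right (p : ℤ_[p]) c)
      simpa using this
    exact hu.dvd_mul_right.1 h1
  have hsq : ∀ z : ℂ, ((‖z‖ ^ 2 : ℝ) : ℂ) = z * conj z := fun z => by
    rw [Complex.mul_conj, Complex.normSq_eq_norm_sq]
  apply Complex.ofReal_injective
  push_cast
  have hsq' : ∀ z : ℂ, (‖z‖ : ℂ) ^ 2 = z * conj z := fun z => by rw [← hsq]; push_cast; rfl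
  simp only [hsq']
  calc ∑ α, expSum Ψ (evalCurve g) w Ω α * conj (expSum Ψ (evalCurve g) w Ω α)
      = ∑ α, ∑ T ∈ classes N Ω, ∑ T' ∈ classes N Ω,
        expSum Ψ (evalCurve g) w T α * conj (expSum Ψ (evalCurve g) w T' α) := by
        refine Finset.sum_congr rfl fun α _ => ?_
        rw [expSum_classes Ψ (evalCurve g) w N Ω α, map_sum, Finset.sum_mul_sum]
    _ = _ := by
        rw [Finset.sum_comm]
        refine Finset.sum_congr rfl fun T hT => ?_
        rw [Finset.sum_comm]
        rw [Finset.sum_eq_single T (fun T' hT' hne => horth T hT T' hT' hne.symm)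
          (fun h => absurd hT h)]

/-! ### The iteration -/

variable (p) in
/-- Decoupling at all scales with exponent `η`, up to an arbitrarily small loss. -/
def DecExp (k : ℕ) (η : ℝ) : Prop :=
  ∀ ε : ℝ, 0 < ε → ∃ C : ℝ, 1 ≤ C ∧ ∀ N : ℕ, Dec p k N (C * (p : ℝ) ^ ((η + ε) * N))

/-- The gains in the bilinear estimates after `n` iterations. -/
def gain (k : ℕ) : ℕ → ℕ → ℝ
  | _, 0 => 1
  | 0, _ + 1 => 0
  | n + 1, l + 1 => gain k n (k - (l + 1)) / (l + 1 : ℕ)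
      + (1 - 1 / (((k - (l + 1) : ℕ) : ℝ) + 1)) * gain k n l

lemma gain_zero (k n : ℕ) : gain k n 0 = 1 := by cases n <;> simp [gain]

lemma gain_succ (k n l : ℕ) : gain k (n + 1) (l + 1) = gain k n (k - (l + 1)) / (l + 1 : ℕ)
      + (1 - 1 / (((k - (l + 1) : ℕ) : ℝ) + 1)) * gain k n l := by simp [gain]

lemma gain_sum (k n : ℕ) : ∑ l ∈ Finset.range k, gain (k + 1) (n + 1) (l + 1)
    = k / (k + 1) + ∑ l ∈ Finset.range k, gain (k + 1) n (l + 1) := by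
  simp only [gain_succ, Finset.sum_add_distrib, Nat.add_sub_add_right]
  have h1 : ∑ l ∈ Finset.range k, gain (k + 1) n (k - l) / ((l + 1 : ℕ) : ℝ)
      = ∑ l ∈ Finset.range k, gain (k + 1) n (l + 1) / ((k - l : ℕ) : ℝ) := by
    rw [← Finset.sum_range_reflect]
    refine Finset.sum_congr rfl fun l hl => ?_
    have := Finset.mem_range.1 hl
    rw [show k - (k - 1 - l) = l + 1 by omega, show k - 1 - l + 1 = k - l by omega]
  have h2 : ∑ l ∈ Finset.range k, (1 - 1 / (((k - l : ℕ) : ℝ) + 1)) * gain (k + 1) n l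
      = k / (k + 1) + ∑ l ∈ Finset.range k, (1 - 1 / ((k - l : ℕ) : ℝ)) * gain (k + 1) n (l + 1) := by
    have := Finset.sum_range_succ (fun l => (1 - 1 / (((k - l : ℕ) : ℝ) + 1)) * gain (k + 1) n l) k
    rw [Finset.sum_range_succ'] at this
    simp only [Nat.sub_self, Nat.cast_zero, zero_add, div_one, sub_self, zero_mul, add_zero,
      gain_zero, Nat.sub_zero, mul_one] at this
    rw [← this, add_comm]
    congr 1
    · field_simp
      ring
    · refine Finset.sum_congr rfl fun l hl => ?_
      have := Finset.mem_range.1 hl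
      rw [show k - l = k - (l + 1) + 1 by omega]
      push_cast
      rfl
  rw [h1, h2, add_left_comm, ← Finset.sum_add_distrib]
  congr 1
  refine Finset.sum_congr rfl fun l _ => ?_
  ring

lemma exists_gain_ge {k : ℕ} (hk : 1 ≤ k) (L : ℝ) :
    ∃ n l, 1 ≤ l ∧ l ≤ k ∧ L ≤ gain (k + 1) n l := by
  by_contra! h
  have hk0 : (0 : ℝ) < k := by exact_mod_cast hk
  have hsum : ∀ n, ∑ l ∈ Finset.range k, gain (k + 1) n (l + 1) = n * (k / (k + 1)) := by
    intro n
    induction n with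
    | zero => simp [gain]
    | succ n ih => rw [gain_sum, ih]; push_cast; ring
  obtain ⟨n, hn⟩ := exists_nat_gt (k * L / (k / (k + 1)))
  rw [div_lt_iff₀ (by positivity), ← hsum] at hn
  have : ∑ l ∈ Finset.range k, gain (k + 1) n (l + 1) ≤ ∑ l ∈ Finset.range k, L :=
    Finset.sum_le_sum fun l hl => (h n (l + 1) (by omega) (by have := Finset.mem_range.1 hl; omega)).le
  simp only [Finset.sum_const, Finset.card_range, nsmul_eq_mul] at this
  linarith

end Decoupling

namespace Decoupling

variable {p : ℕ} [Fact p.Prime]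

lemma one_le_rpow_prime {x : ℝ} (hx : 0 ≤ x) : (1 : ℝ) ≤ (p : ℝ) ^ x :=
  Real.one_le_rpow (by exact_mod_cast (Fact.out : p.Prime).one_le) hx

lemma prime_cast_pos : (0 : ℝ) < p := by exact_mod_cast (Fact.out : p.Prime).pos

variable (p) in
/-- The bilinear estimates with gain after `n` iterations. -/
def BilExp (k : ℕ) (η : ℝ) (n : ℕ) : Prop :=
  ∀ ε : ℝ, 0 < ε → ∃ C : ℝ, 1 ≤ C ∧ ∀ N b : ℕ, k.factorial ^ (n + 1) ∣ b → k ^ (n + 1) * b ≤ N →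
    0 < b → ∀ l a : ℕ, l < k → l * a = (k - l + 1) * b ∨ l = 0 →
    Bil p k N l a b (C * (p : ℝ) ^ (η * (N - gain k n l * b) + ε * N))

lemma bilExp_zero_index {k : ℕ} {η : ℝ} (hk0 : k ≠ 0) (hk : k < p) (h : DecExp p k η) {ε : ℝ} (hε : 0 < ε) :
    ∃ C : ℝ, 1 ≤ C ∧ ∀ N b a : ℕ, b ≤ N → Bil p k N 0 a b (C * (p : ℝ) ^ (η * (N - b) + ε * N)) := by
  obtain ⟨C, hC, hD⟩ := h ε hε
  refine ⟨C, hC, fun N b a hb => (((hD (N - b)).bil_zero (a := a) hk0 hk hb).mono (by positivity) ?_)⟩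
  have hp1 : (1 : ℝ) ≤ p := by exact_mod_cast (Fact.out : p.Prime).one_le
  refine mul_le_mul_of_nonneg_left (Real.rpow_le_rpow_of_exponent_le hp1 ?_) (by positivity)
  rw [Nat.cast_sub hb]
  have : (0 : ℝ) ≤ b := Nat.cast_nonneg b
  nlinarith

lemma bilExp_zero {k : ℕ} {η : ℝ} (hk0 : k ≠ 0) (hk : k < p) (h : DecExp p k η) : BilExp p k η 0 := by
  intro ε hε
  obtain ⟨C₁, hC₁, h1⟩ := bilExp_zero_index hk0 hk h hε
  obtain ⟨C₂, hC₂, h2⟩ := h ε hε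
  refine ⟨max C₁ C₂, le_max_of_le_left hC₁, fun N b _ hbN hb l a hl _ => ?_⟩
  have hbN' : b ≤ N := by
    refine le_trans ?_ hbN
    rw [zero_add, pow_one]
    exact Nat.le_mul_of_pos_left _ (by omega)
  have hp := prime_cast_pos (p := p)
  cases l with
  | zero =>
    rw [gain_zero, one_mul]
    refine (h1 N b a hbN').mono (by positivity) ?_
    gcongr
    exact le_max_left _ _
  | succ l =>
    refine ((h2 N).bil (by omega) hl).mono (by positivity) ?_
    simp only [gain, zero_mul, sub_zero, ← add_mul]
    gcongr
    exact le_max_right _ _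

lemma bilExp_succ {k : ℕ} {η : ℝ} (hk : k < p) (h : DecExp p k η)
    (hlow : ∀ l, 1 ≤ l → l < k → DecExp p l 0) {n : ℕ} (hn : BilExp p k η n) :
    BilExp p k η (n + 1) := by
  intro ε hε
  rcases Nat.eq_zero_or_pos k with rfl | hk0
  · exact ⟨1, le_rfl, fun N b _ _ _ l a hl => absurd hl (by omega)⟩
  obtain ⟨C₁, hC₁, h1⟩ := bilExp_zero_index hk0.ne' hk h (half_pos hε)
  obtain ⟨C₂, hC₂, h2⟩ := hn (ε / 2) (half_pos hε)
  obtain ⟨E, hE, hlow'⟩ : ∃ E : ℝ, 1 ≤ E ∧ ∀ l, 1 ≤ l → l < k → ∀ N : ℕ,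
      Dec p l N (E * (p : ℝ) ^ (ε / 2 * N)) := by
    have : ∀ l, ∃ E : ℝ, 1 ≤ E ∧ (1 ≤ l → l < k → ∀ N : ℕ, Dec p l N (E * (p : ℝ) ^ (ε / 2 * N))) := by
      intro l
      by_cases hl : 1 ≤ l ∧ l < k
      · obtain ⟨E, hE, hD⟩ := hlow l hl.1 hl.2 (ε / 2) (half_pos hε)
        exact ⟨E, hE, fun _ _ N => by simpa using hD N⟩
      · exact ⟨1, le_rfl, fun h1 h2 => absurd ⟨h1, h2⟩ hl⟩
    choose E hE1 hE2 using this
    refine ⟨∑ l ∈ Finset.range (k + 1), E l, ?_, fun l hl hlk N => (hE2 l hl hlk N).mono ?_⟩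
    · exact (hE1 0).trans (Finset.single_le_sum (f := E) (fun l _ => by linarith [hE1 l])
        (Finset.mem_range.2 (by omega)))
    · refine mul_le_mul_of_nonneg_right ?_ (by have := prime_cast_pos (p := p); positivity)
      exact Finset.single_le_sum (f := E) (fun l _ => by linarith [hE1 l])
        (Finset.mem_range.2 (by omega))
  have hp := prime_cast_pos (p := p)
  have hp1 : (1 : ℝ) ≤ p := by exact_mod_cast (Fact.out : p.Prime).one_le
  set C := max C₁ (E * C₂) with hC
  have hC1 : 1 ≤ C := le_max_of_le_left hC₁
  refine ⟨C, hC1, fun N b hbd hbN hb l a hl hla => ?_⟩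
  have hkb : b ≤ k * b := Nat.le_mul_of_pos_left _ hk0
  have hkb2 : k * b ≤ k * (k * b) := Nat.le_mul_of_pos_left _ hk0
  have hkn : k * (k * b) ≤ k ^ (n + 1 + 1) * b := by
    rw [← mul_assoc, ← pow_two]
    exact Nat.mul_le_mul_right _ (Nat.pow_le_pow_right hk0 (by omega))
  have hbN2 : k * (k * b) ≤ N := hkn.trans hbN
  -- lower-dimensional refinement of the estimates at the previous stage
  have step : ∀ l a a' b : ℕ, 1 ≤ l → l < k → l * a' = (k - l + 1) * b → 1 ≤ a → a ≤ a' → a' ≤ N →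
      b ≤ N → 0 < b → k.factorial ^ (n + 1) ∣ b → k ^ (n + 1) * b ≤ N →
      Bil p k N l a b (C * (p : ℝ) ^ (η * (N - gain k n l * b) + ε * N)) := by
    intro l a a' b hl1 hlk hla' ha haa' ha'N hbN' hb0 hbd hbN
    obtain ⟨m, rfl⟩ : ∃ m, k = m + l := ⟨k - l, by omega⟩
    have hm : m + l - l = m := by omega
    rw [hm] at hla'
    refine (Bil.refine_left (D := E * (p : ℝ) ^ (ε / 2 * N)) hk (by omega) ha haa' ha'N ?_
      hla'.le ?_ (by positivity) ?_ (h2 N b hbd hbN hb0 l a' hlk (Or.inl (by rw [hm, hla'])))).mono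
      (by positivity) ?_
    · calc (m + 1) * b ≤ (m + l) * b := Nat.mul_le_mul_right _ (by omega)
        _ ≤ (m + l) * N := Nat.mul_le_mul_left _ hbN'
    · have := one_le_rpow_prime (p := p) (x := ε / 2 * N) (by positivity)
      nlinarith
    · refine (hlow' l hl1 hlk (a' - a)).mono ?_
      refine mul_le_mul_of_nonneg_left (Real.rpow_le_rpow_of_exponent_le hp1 ?_) (by linarith)
      have : ((a' - a : ℕ) : ℝ) ≤ N := by exact_mod_cast (Nat.sub_le _ _).trans ha'N
      gcongr
    · rw [mul_mul_mul_comm, ← Real.rpow_add hp]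
      refine mul_le_mul (le_max_right _ _) (Real.rpow_le_rpow_of_exponent_le hp1 ?_)
        (by positivity) (by positivity)
      linarith
  cases l with
  | zero =>
    rw [gain_zero, one_mul]
    refine (h1 N b a (by omega)).mono (by positivity) ?_
    refine mul_le_mul (le_max_left _ _) (Real.rpow_le_rpow_of_exponent_le hp1 ?_)
        (by positivity) (by positivity)
    have : (0 : ℝ) ≤ N := by positivity
    nlinarith
  | succ l =>
    have hla : (l + 1) * a = (k - (l + 1) + 1) * b := by simpa using hla
    obtain ⟨j, rfl⟩ : ∃ j, k = l + 1 + j := ⟨k - (l + 1), by omega⟩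
    have hj : 1 ≤ j := by omega
    rw [show l + 1 + j - (l + 1) = j by omega] at hla
    have hfac : ∀ i x : ℕ, 1 ≤ i → i ≤ l + 1 + j → (l + 1 + j).factorial ^ (n + 1) ∣ x →
        ∃ y, i * y = x := by
      intro i x hi hik hx
      obtain ⟨y, hy⟩ := (Nat.dvd_factorial (by omega) hik).trans
        ((dvd_pow_self _ (by omega)).trans hx)
      exact ⟨y, hy.symm⟩
    have hab : a ≤ (l + 1 + j) * b :=
      calc a ≤ (l + 1) * a := Nat.le_mul_of_pos_left _ (by omega)
        _ = (j + 1) * b := hla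
        _ ≤ _ := Nat.mul_le_mul_right _ (by omega)
    have ha0 : 0 < a := by
      rcases Nat.eq_zero_or_pos a with rfl | h
      · rw [mul_zero] at hla
        have : 0 < (j + 1) * b := by positivity
        omega
      · exact h
    have had : (l + 1 + j).factorial ^ (n + 1) ∣ a := by
      obtain ⟨m, hm⟩ := Nat.dvd_factorial (show 0 < l + 1 by omega)
        (show l + 1 ≤ l + 1 + j by omega)
      obtain ⟨z, hz⟩ := hbd
      refine ⟨(j + 1) * (m * z), Nat.eq_of_mul_eq_mul_left (show 0 < l + 1 by omega) ?_⟩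
      rw [hla, hz, pow_succ]
      generalize (l + 1 + j).factorial ^ (n + 1) = Q
      rw [hm]
      ring
    have hbd' : (l + 1 + j).factorial ^ (n + 1) ∣ b := (pow_dvd_pow _ (by omega)).trans hbd
    have haN : (l + 1 + j) ^ (n + 1) * a ≤ N := by
      refine le_trans ?_ hbN
      rw [pow_succ _ (n + 1), mul_assoc]
      exact Nat.mul_le_mul_left _ hab
    have hbN' : (l + 1 + j) ^ (n + 1) * b ≤ N := by
      refine le_trans ?_ hbN
      rw [pow_succ _ (n + 1), mul_assoc]
      exact Nat.mul_le_mul_left _ hkb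
    obtain ⟨b', hb'⟩ := hfac j ((l + 1 + 1) * a) hj (by omega) (had.mul_left _)
    have hbb' : b ≤ b' := by
      refine Nat.le_of_mul_le_mul_left (?_ : j * (l + 1) * b ≤ j * (l + 1) * b') (by positivity)
      calc j * (l + 1) * b ≤ (j + 1) * (l + 1 + 1) * b := by gcongr <;> omega
        _ = (l + 1 + 1) * ((j + 1) * b) := by ring
        _ = (l + 1 + 1) * ((l + 1) * a) := by rw [hla]
        _ = (l + 1) * ((l + 1 + 1) * a) := by ring
        _ = j * (l + 1) * b' := by rw [← hb']; ring
    have hb'N : b' ≤ N := by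
      calc b' ≤ j * b' := Nat.le_mul_of_pos_left _ hj
        _ = (l + 1 + 1) * a := hb'
        _ ≤ (l + 1 + j) * ((l + 1 + j) * b) := Nat.mul_le_mul (by omega) hab
        _ ≤ N := hbN2
    have B₁ := step j b b' a hj (by omega) (by rw [hb', show l + 1 + j - j + 1 = l + 1 + 1 by omega])
      hb hbb' hb'N (by omega) ha0 had haN
    have B₂ : Bil p (l + 1 + j) N l a b (C * (p : ℝ) ^ (η * (N - gain (l + 1 + j) n l * b) + ε * N)) := by
      rcases Nat.eq_zero_or_pos l with rfl | hl0
      · rw [gain_zero, one_mul]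
        refine (h1 N b a (by omega)).mono (by positivity) ?_
        refine mul_le_mul (le_max_left _ _) (Real.rpow_le_rpow_of_exponent_le hp1 ?_)
            (by positivity) (by positivity)
        have : (0 : ℝ) ≤ N := by positivity
        nlinarith
      · obtain ⟨a', ha'⟩ := hfac l ((j + 2) * b) hl0 (by omega) (hbd'.mul_left _)
        refine step l a a' b hl0 (by omega) (by rw [ha', show l + 1 + j - l + 1 = j + 2 by omega])
          ha0 ?_ ?_ (by omega) hb hbd' hbN'
        · refine Nat.le_of_mul_le_mul_left (?_ : l * (l + 1) * a ≤ l * (l + 1) * a') (by positivity)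
          calc l * (l + 1) * a = l * ((j + 1) * b) := by rw [← hla]; ring
            _ ≤ (l + 1) * ((j + 2) * b) := by gcongr <;> omega
            _ = l * (l + 1) * a' := by rw [← ha']; ring
        · calc a' ≤ l * a' := Nat.le_mul_of_pos_left _ hl0
            _ = (j + 2) * b := ha'
            _ ≤ (l + 1 + j) * b := Nat.mul_le_mul_right _ (by omega)
            _ ≤ N := by omega
    refine (B₁.holder rfl hj (by positivity) (by positivity) B₂).mono (by positivity) (le_of_eq ?_)
    rw [Real.mul_rpow (by positivity) (by positivity), Real.mul_rpow (by positivity) (by positivity),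
      ← Real.rpow_mul hp.le, ← Real.rpow_mul hp.le, mul_mul_mul_comm, ← Real.rpow_add hp,
      ← Real.rpow_add (by linarith), add_sub_cancel, Real.rpow_one, gain_succ,
      show l + 1 + j - (l + 1) = j by omega]
    congr 2
    have hab' : (a : ℝ) / (j + 1) = b / (l + 1) := by
      rw [div_eq_div_iff (by positivity) (by positivity)]
      have : ((l + 1 : ℕ) : ℝ) * a = ((j + 1 : ℕ) : ℝ) * b := by exact_mod_cast hla
      push_cast at this
      linarith
    push_cast
    linear_combination (-η * gain (l + 1 + j) n j) * hab'

end Decoupling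

namespace Decoupling

variable {p : ℕ} [Fact p.Prime]

lemma decExp_of_bil {k l : ℕ} {τ C : ℝ} (hk0 : k ≠ 0) (hk : k < p) (hl : l ≤ k) (hτ : 0 ≤ τ)
    (hC : 0 ≤ C) (h : ∀ N : ℕ, Bil p k (N + 1) l 1 1 (C * (p : ℝ) ^ (τ * ((N + 1 : ℕ) : ℝ)))) :
    DecExp p k τ := by
  have hp := prime_cast_pos (p := p)
  have hp1 : (1 : ℝ) < p := by exact_mod_cast (Fact.out : p.Prime).one_lt
  have hrec : ∀ N : ℕ, Dec p k N (Real.sqrt (1 + p * C ^ 2 * N * ((p : ℝ) ^ (τ * (N : ℝ))) ^ 2)) := by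
    intro N
    induction N with
    | zero => simpa using dec_zero_scale hk0
    | succ N ih =>
      refine (Dec.whitney hk0 hk hl (by positivity) ih (h N)).mono (Real.sqrt_le_sqrt ?_)
      rw [Real.sq_sqrt (by positivity)]
      have : ((p : ℝ) ^ (τ * (N : ℝ))) ≤ (p : ℝ) ^ (τ * ((N + 1 : ℕ) : ℝ)) := by
        refine Real.rpow_le_rpow_of_exponent_le hp1.le ?_
        push_cast
        nlinarith
      have h2 : p * C ^ 2 * N * ((p : ℝ) ^ (τ * (N : ℝ))) ^ 2
          ≤ p * C ^ 2 * N * ((p : ℝ) ^ (τ * ((N + 1 : ℕ) : ℝ))) ^ 2 := by gcongr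
      generalize (p : ℝ) ^ (τ * ((N + 1 : ℕ) : ℝ)) = X at *
      push_cast
      linarith
  intro ε hε
  have hlog : 0 < Real.log p := Real.log_pos hp1
  refine ⟨Real.sqrt (1 + p * C ^ 2 / (2 * ε * Real.log p)), ?_, fun N => (hrec N).mono ?_⟩
  · rw [Real.one_le_sqrt]
    have : 0 ≤ p * C ^ 2 / (2 * ε * Real.log p) := by positivity
    linarith
  · rw [← Real.sqrt_sq (show 0 ≤ (p : ℝ) ^ ((τ + ε) * N) by positivity), ← Real.sqrt_mul (by positivity)]
    refine Real.sqrt_le_sqrt ?_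
    rw [add_mul τ, Real.rpow_add hp, mul_pow, add_mul]
    have h1 := one_le_rpow_prime (p := p) (x := τ * N) (by positivity)
    have h2 := one_le_rpow_prime (p := p) (x := ε * N) (by positivity)
    have h3 : 2 * ε * Real.log p * N ≤ ((p : ℝ) ^ (ε * N)) ^ 2 := by
      rw [← Real.rpow_natCast, ← Real.rpow_mul hp.le, Real.rpow_def_of_pos hp]
      refine le_trans (le_of_eq ?_) ((le_add_of_nonneg_right zero_le_one).trans
        (Real.add_one_le_exp _))
      push_cast
      ring
    generalize (p : ℝ) ^ (τ * N) = X at *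
    generalize (p : ℝ) ^ (ε * N) = Y at *
    refine add_le_add (by nlinarith [mul_self_nonneg X, mul_self_nonneg Y, one_le_pow₀ h1 (n := 2), one_le_pow₀ h2 (n := 2)]) ?_
    rw [div_mul_eq_mul_div, le_div_iff₀ (by positivity)]
    calc p * C ^ 2 * N * X ^ 2 * (2 * ε * Real.log p)
        = p * C ^ 2 * X ^ 2 * (2 * ε * Real.log p * N) := by ring
      _ ≤ p * C ^ 2 * X ^ 2 * Y ^ 2 := by gcongr
      _ = _ := by ring

lemma exists_decExp_sub {k : ℕ} (hk2 : 2 ≤ k) (hk : k < p) {η : ℝ} (hη : 0 < η) (h : DecExp p k η)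
    (hlow : ∀ l, 1 ≤ l → l < k → DecExp p l 0) :
    ∃ κ, 0 < κ ∧ κ ≤ η ∧ DecExp p k (η - κ) := by
  have hp := prime_cast_pos (p := p)
  have hp1 : (1 : ℝ) < p := by exact_mod_cast (Fact.out : p.Prime).one_lt
  have hbil : ∀ n, BilExp p k η n := by
    intro n
    induction n with
    | zero => exact bilExp_zero (by omega) hk h
    | succ n ih => exact bilExp_succ hk h hlow ih
  obtain ⟨n, l, hl1, hlk, hgain⟩ := exists_gain_ge (k := k - 1) (by omega) ((2 * k + 1) / η)
  rw [Nat.sub_add_cancel (by omega), div_le_iff₀ hη] at hgain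
  set R := k ^ (n + 1) with hR
  set Q := k.factorial ^ (n + 1) with hQ
  have hR0 : 0 < R := by positivity
  have hQ0 : 0 < Q := by have := k.factorial_pos; positivity
  have hkR : k ≤ R := Nat.le_self_pow (by omega) k
  obtain ⟨C, hC, hB⟩ := hbil n (1 / (2 * R)) (by positivity)
  refine ⟨min η (1 / (2 * R)), by positivity, min_le_left _ _, ?_⟩
  set κ := min η (1 / (2 * (R : ℝ))) with hκ
  have hτ : 0 ≤ η - κ := sub_nonneg.2 (min_le_left _ _)
  refine decExp_of_bil (C := C * (p : ℝ) ^ (R * Q : ℕ)) (l := l) (by omega) hk (by omega) hτ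
    (by positivity) fun N' => ?_
  set N := N' + 1 with hN
  have h1p := one_le_rpow_prime (p := p) (x := (η - κ) * (N : ℝ)) (by positivity)
  rcases Nat.eq_zero_or_pos (N / (R * Q)) with h0 | hpos
  · have hlt : N < R * Q := by
      rcases (Nat.div_eq_zero_iff).1 h0 with h | h
      · have := Nat.mul_pos hR0 hQ0; omega
      · exact h
    refine ((dec_trivial (show k ≠ 0 by omega)).bil hl1 (by omega)).mono (by positivity) ?_
    have : (p : ℝ) ^ N ≤ (p : ℝ) ^ (R * Q : ℕ) := pow_le_pow_right₀ hp1.le hlt.le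
    calc (p : ℝ) ^ N ≤ (p : ℝ) ^ (R * Q : ℕ) := this
      _ = 1 * (p : ℝ) ^ (R * Q : ℕ) * 1 := by ring
      _ ≤ _ := by gcongr
  · set b := Q * (N / (R * Q)) with hb
    have hb0 : 0 < b := by positivity
    have hRb : R * b ≤ N := by
      rw [hb, ← mul_assoc]; exact Nat.mul_div_le N _
    obtain ⟨a, ha⟩ : ∃ a, l * a = (k - l + 1) * b := by
      obtain ⟨y, hy⟩ := ((Nat.dvd_factorial (show 0 < l by omega) (show l ≤ k by omega)).trans
        (dvd_pow_self _ (Nat.succ_ne_zero n))).trans (Dvd.intro _ rfl : Q ∣ b)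
      exact ⟨(k - l + 1) * y, by rw [hy]; ring⟩
    have hakb : a ≤ k * b := by
      calc a ≤ l * a := Nat.le_mul_of_pos_left _ (by omega)
        _ = (k - l + 1) * b := ha
        _ ≤ _ := Nat.mul_le_mul_right _ (by omega)
    have hkb : k * b ≤ R * b := Nat.mul_le_mul_right _ hkR
    have hbb : b ≤ k * b := Nat.le_mul_of_pos_left _ (by omega)
    have ha0 : 1 ≤ a := by
      rcases Nat.eq_zero_or_pos a with rfl | h
      · rw [mul_zero] at ha
        have : 0 < (k - l + 1) * b := by positivity
        omega
      · exact h
    have key := (hB N b (Dvd.intro _ rfl) hRb hb0 l a (by omega) (Or.inl ha)).coarsen hl1 (by omega)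
      ha0 hb0 (by omega) (by omega) (by positivity)
    refine key.mono (by positivity) ?_
    have hlt : (N : ℝ) ≤ R * b + R * Q := by
      have : N ≤ R * b + R * Q := by
        have := (Nat.lt_mul_div_succ N (show 0 < R * Q by positivity)).le
        rw [hb]
        calc N ≤ _ := this
          _ = _ := by ring
      exact_mod_cast this
    have hab : ((a + b : ℕ) : ℝ) ≤ 2 * k * b := by
      have : a + b ≤ 2 * (k * b) := by omega
      calc ((a + b : ℕ) : ℝ) ≤ ((2 * (k * b) : ℕ) : ℝ) := by exact_mod_cast this
        _ = _ := by push_cast; ring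
    have hg : (2 * (k : ℝ) + 1) * b ≤ gain k n l * η * b := by gcongr
    have hb' : (N : ℝ) / R - Q ≤ b := by
      rw [sub_le_iff_le_add, div_le_iff₀ (by positivity)]
      linarith
    have hQR : (Q : ℝ) ≤ (R * Q : ℕ) := by exact_mod_cast Nat.le_mul_of_pos_left _ hR0
    have hκ' : κ * N ≤ 1 / (2 * R) * N := by
      gcongr
      exact min_le_right _ _
    have hhalf : (N : ℝ) / R = 1 / (2 * R) * N + 1 / (2 * R) * N := by field_simp; norm_num
    rw [mul_left_comm, mul_assoc C, ← Real.rpow_natCast, ← Real.rpow_natCast, ← Real.rpow_add hp,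
      ← Real.rpow_add hp]
    refine mul_le_mul_of_nonneg_left (Real.rpow_le_rpow_of_exponent_le hp1.le ?_) (by positivity)
    linarith

/-- Sharp `ℓ²` decoupling for perturbed moment curves over `ℤ_p`, up to `ε`-losses. -/
theorem decExp_zero {k : ℕ} (hk1 : 1 ≤ k) (hk : k < p) : DecExp p k 0 := by
  induction k using Nat.strong_induction_on with
  | _ k ih =>
    have hp := prime_cast_pos (p := p)
    have hp1 : (1 : ℝ) < p := by exact_mod_cast (Fact.out : p.Prime).one_lt
    rcases hk1.eq_or_lt with rfl | hk2
    · intro ε hε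
      refine ⟨1, le_rfl, fun N => (dec_one N).mono ?_⟩
      have := one_le_rpow_prime (p := p) (x := ε * N) (by positivity)
      simpa using this
    set S := {η : ℝ | 0 ≤ η ∧ DecExp p k η} with hS
    have hne : S.Nonempty := by
      refine ⟨1, zero_le_one, fun ε hε => ⟨1, le_rfl, fun N => (dec_trivial (by omega)).mono ?_⟩⟩
      rw [one_mul, ← Real.rpow_natCast]
      refine Real.rpow_le_rpow_of_exponent_le hp1.le ?_
      have : 0 ≤ ε * N := by positivity
      linarith
    have hbdd : BddBelow S := ⟨0, fun η hη => hη.1⟩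
    have hinf0 : 0 ≤ sInf S := le_csInf hne fun η hη => hη.1
    have hinf : DecExp p k (sInf S) := by
      intro ε hε
      obtain ⟨η, ⟨hη0, hη⟩, hlt⟩ := exists_lt_of_csInf_lt hne (show sInf S < sInf S + ε / 2 by linarith)
      obtain ⟨C, hC, hD⟩ := hη (ε / 2) (half_pos hε)
      refine ⟨C, hC, fun N => (hD N).mono ?_⟩
      refine mul_le_mul_of_nonneg_left (Real.rpow_le_rpow_of_exponent_le hp1.le ?_) (by linarith)
      refine mul_le_mul_of_nonneg_right ?_ (Nat.cast_nonneg N)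
      linarith
    rcases hinf0.eq_or_lt with h0 | hpos
    · rwa [← h0] at hinf
    · obtain ⟨κ, hκ0, hκ, hD⟩ := exists_decExp_sub hk2 hk hpos hinf
        fun l hl hlk => ih l hlk hl (by omega)
      have : sInf S ≤ sInf S - κ := csInf_le hbdd ⟨by linarith, hD⟩
      linarith

end Decoupling

namespace Decoupling

variable {p : ℕ} [Fact p.Prime]

instance instNeZeroPrimePow (L : ℕ) : NeZero (p ^ L) := ⟨pow_ne_zero _ (Fact.out : p.Prime).ne_zero⟩

/-- The standard pairing of `ℤ_p ^ k` with the characters of `(ℤ / p ^ L) ^ k`. -/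
def stdPairing (p : ℕ) [Fact p.Prime] (k L : ℕ) :
    (Fin k → ℤ_[p]) →+ AddChar (Fin k → ZMod (p ^ L)) ℂ where
  toFun ξ := (ZMod.stdAddChar (N := p ^ L)).compAddMonoidHom
    (∑ i, ((AddMonoidHom.mulLeft (PadicInt.toZModPow L (ξ i))).comp
      (Pi.evalAddMonoidHom (fun _ : Fin k => ZMod (p ^ L)) i)))
  map_zero' := by
    ext α
    simp
  map_add' ξ ζ := by
    ext α
    simp [add_mul, Finset.sum_add_distrib, AddChar.map_add_eq_mul]

lemma stdPairing_apply (k L : ℕ) (ξ : Fin k → ℤ_[p]) (α : Fin k → ZMod (p ^ L)) :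
    stdPairing p k L ξ α = ZMod.stdAddChar (∑ i, PadicInt.toZModPow L (ξ i) * α i) := by
  simp [stdPairing]

lemma sep_stdPairing (k L : ℕ) : Sep L (stdPairing p k L) := by
  intro ξ h i
  have h1 := DFunLike.congr_fun h (Pi.single i 1)
  rw [stdPairing_apply, AddChar.zero_apply] at h1
  have h2 : ∑ j, PadicInt.toZModPow L (ξ j) * (Pi.single i (1 : ZMod (p ^ L)) : Fin k → _) j
      = PadicInt.toZModPow L (ξ i) := by
    simp [Pi.single_apply]
  rw [h2, ← AddChar.map_zero_eq_one (ZMod.stdAddChar (N := p ^ L))] at h1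
  have h3 : ξ i ∈ RingHom.ker (PadicInt.toZModPow (p := p) L) := ZMod.injective_stdAddChar h1
  rwa [PadicInt.ker_toZModPow, Ideal.mem_span_singleton] at h3

/-- Pairs of `u`-tuples of integers in `[1, P]`. -/
def pairBox (u P : ℕ) : Finset ((Fin u → ℕ) × (Fin u → ℕ)) :=
  Fintype.piFinset (fun _ => Finset.Icc 1 P) ×ˢ Fintype.piFinset fun _ => Finset.Icc 1 P

/-- The difference of the power sums of degree `e`. -/
def powDiff {u : ℕ} (e : ℕ) (z : (Fin u → ℕ) × (Fin u → ℕ)) : ℤ :=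
  ∑ a, ((z.1 a : ℤ) ^ e - (z.2 a : ℤ) ^ e)

open ComplexConjugate in
lemma normSq_pow_expand {G : Type*} [AddCommGroup G] [Fintype G] {k : ℕ}
    (Ψ : (Fin k → ℤ_[p]) →+ AddChar G ℂ) (u P : ℕ) (α : G) :
    ((‖∑ x ∈ Finset.Icc 1 P, Ψ (fun i => (x : ℤ_[p]) ^ ((i : ℕ) + 1)) α‖ ^ (2 * u) : ℝ) : ℂ)
      = ∑ z ∈ pairBox u P, Ψ (fun i => (powDiff ((i : ℕ) + 1) z : ℤ_[p])) α := by
  have hsq : ∀ z : ℂ, ((‖z‖ ^ (2 * u) : ℝ) : ℂ) = z ^ u * conj z ^ u := fun z => by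
    rw [← mul_pow, Complex.mul_conj, Complex.normSq_eq_norm_sq, pow_mul]
    push_cast; rfl
  rw [hsq]
  have e1 : ∀ f : ℕ → ℂ, (∑ x ∈ Finset.Icc 1 P, f x) ^ u
      = ∑ x ∈ Fintype.piFinset (fun _ : Fin u => Finset.Icc 1 P), ∏ a, f (x a) := by
    intro f
    rw [← Finset.prod_univ_sum]
    simp
  rw [map_sum, e1, e1, Finset.sum_mul_sum, pairBox, Finset.sum_product]
  refine Finset.sum_congr rfl fun x _ => Finset.sum_congr rfl fun y _ => ?_
  have e2 : (fun i : Fin k => (powDiff ((i : ℕ) + 1) (x, y) : ℤ_[p]))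
      = ∑ a, ((fun i : Fin k => ((x a : ℕ) : ℤ_[p]) ^ ((i : ℕ) + 1))
        - fun i : Fin k => ((y a : ℕ) : ℤ_[p]) ^ ((i : ℕ) + 1)) := by
    ext i
    simp [powDiff, Finset.sum_apply]
  have e3 : ∀ (ξ : Fin u → Fin k → ℤ_[p]), Ψ (∑ a, ξ a) α = ∏ a, Ψ (ξ a) α := by
    intro ξ
    rw [map_sum, AddChar.sum_apply]
  rw [e2, e3, ← Finset.prod_mul_distrib]
  refine Finset.prod_congr rfl fun a _ => ?_
  rw [map_sub, AddChar.sub_apply, AddChar.map_neg_eq_conj]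

lemma card_mul_count_le {G : Type*} [AddCommGroup G] [Fintype G] {k : ℕ}
    (Ψ : (Fin k → ℤ_[p]) →+ AddChar G ℂ) (u P : ℕ) (h : Fin k → ℤ) :
    (Fintype.card G : ℝ)
        * ((pairBox u P).filter fun z => ∀ i : Fin k, powDiff ((i : ℕ) + 1) z = h i).card
      ≤ ∑ α, ‖∑ x ∈ Finset.Icc 1 P, Ψ (fun i => (x : ℤ_[p]) ^ ((i : ℕ) + 1)) α‖ ^ (2 * u) := by
  set η : Fin k → ℤ_[p] := fun i => (h i : ℤ_[p])
  set F : G → ℝ := fun α =>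
    ‖∑ x ∈ Finset.Icc 1 P, Ψ (fun i => (x : ℤ_[p]) ^ ((i : ℕ) + 1)) α‖ ^ (2 * u) with hF
  have h1 : ∑ α, Ψ (-η) α * (F α : ℂ)
      = ∑ z ∈ pairBox u P, ∑ α, Ψ ((fun i : Fin k => (powDiff ((i : ℕ) + 1) z : ℤ_[p])) - η) α := by
    rw [Finset.sum_comm]
    refine Finset.sum_congr rfl fun α _ => ?_
    rw [hF, normSq_pow_expand, Finset.mul_sum]
    refine Finset.sum_congr rfl fun z _ => ?_
    rw [sub_eq_neg_add, map_add, AddChar.add_apply]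
  have h2 : ∑ z ∈ pairBox u P, ∑ α, Ψ ((fun i : Fin k => (powDiff ((i : ℕ) + 1) z : ℤ_[p])) - η) α
      = ((∑ z ∈ pairBox u P, if Ψ ((fun i : Fin k => (powDiff ((i : ℕ) + 1) z : ℤ_[p])) - η) = 0 then
        (Fintype.card G : ℝ) else 0 : ℝ) : ℂ) := by
    push_cast
    refine Finset.sum_congr rfl fun z _ => ?_
    rw [AddChar.sum_eq_ite]
    split_ifs <;> simp
  have h3 : (Fintype.card G : ℝ)
        * ((pairBox u P).filter fun z => ∀ i : Fin k, powDiff ((i : ℕ) + 1) z = h i).card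
      ≤ ∑ z ∈ pairBox u P, if Ψ ((fun i : Fin k => (powDiff ((i : ℕ) + 1) z : ℤ_[p])) - η) = 0 then
        (Fintype.card G : ℝ) else 0 := by
    rw [mul_comm, ← nsmul_eq_mul, ← Finset.sum_const, Finset.sum_filter]
    refine Finset.sum_le_sum fun z _ => ?_
    by_cases hz : ∀ i : Fin k, powDiff ((i : ℕ) + 1) z = h i
    · have : (fun i : Fin k => (powDiff ((i : ℕ) + 1) z : ℤ_[p])) - η = 0 := by
        ext i
        simp [η, hz i]
      rw [if_pos hz, this, map_zero, if_pos rfl]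
    · rw [if_neg hz]
      split_ifs <;> positivity
  have h4 : ‖∑ α, Ψ (-η) α * (F α : ℂ)‖ ≤ ∑ α, F α := by
    refine (norm_sum_le _ _).trans (Finset.sum_le_sum fun α _ => ?_)
    rw [norm_mul, AddChar.norm_apply, one_mul, Complex.norm_real, Real.norm_of_nonneg]
    simp only [hF]
    positivity
  rw [h1, h2, Complex.norm_real] at h4
  exact h3.trans ((le_abs_self _).trans h4)

/-- Vinogradov's mean value theorem. -/
theorem vinogradov_mean_value {k : ℕ} (hk : 1 ≤ k) {u : ℕ} (hu : k * (k + 1) ≤ 2 * u) {ε : ℝ}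
    (hε : 0 < ε) : ∃ C : ℝ, 0 < C ∧ ∀ P : ℕ, 1 ≤ P → ∀ h : Fin k → ℤ,
      (((pairBox u P).filter fun z => ∀ i : Fin k, powDiff ((i : ℕ) + 1) z = h i).card : ℝ)
        ≤ C * (P : ℝ) ^ ((2 * u : ℝ) - k * (k + 1) / 2 + ε) := by
  obtain ⟨p, hkp, hpp⟩ := Nat.exists_infinite_primes (k + 1)
  have : Fact p.Prime := ⟨hpp⟩
  have hp := prime_cast_pos (p := p)
  obtain ⟨m, hm⟩ : ∃ m, k * (k + 1) = 2 * m := (Nat.even_mul_succ_self k).two_dvd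
  have hm0 : 0 < m := by
    have : 0 < k * (k + 1) := by positivity
    omega
  set ε' : ℝ := ε / (2 * m) with hε'
  obtain ⟨C, hC, hD⟩ := decExp_zero (p := p) hk hkp ε' (by positivity)
  refine ⟨C ^ (2 * m : ℕ) * (p : ℝ) ^ ε, by positivity, fun P hP h => ?_⟩
  have hP0 : (0 : ℝ) < P := by exact_mod_cast hP
  set N := Nat.clog p P with hN
  have hNle : P ≤ p ^ N := Nat.le_pow_clog hpp.one_lt P
  have hNge : ((p ^ N : ℕ) : ℝ) ≤ p * P := by
    rcases hP.eq_or_lt with h1 | h1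
    · rw [hN, ← h1, Nat.clog_one_right]
      have : (1 : ℝ) ≤ p := by exact_mod_cast hpp.one_le
      simpa using this
    · have h2 := (Nat.pow_pred_clog_lt_self hpp.one_lt h1).le
      have h3 : 0 < N := Nat.clog_pos hpp.one_lt h1
      have h4 : p ^ N ≤ p * P := by
        conv_lhs => rw [← Nat.succ_pred_eq_of_pos h3, pow_succ, mul_comm]
        exact Nat.mul_le_mul_left _ h2
      exact_mod_cast h4
  set Ψ := stdPairing p k (k * N) with hΨ
  set g : Fin k → Polynomial ℤ_[p] := fun i => Polynomial.X ^ ((i : ℕ) + 1) with hg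
  have hcurve : IsCurve g := fun i => ⟨0, by simp [hg]⟩
  set Ω : Finset ℤ_[p] := (Finset.Icc 1 P).image fun n : ℕ => (n : ℤ_[p]) with hΩ
  set F : (Fin k → ZMod (p ^ (k * N))) → ℂ := fun α =>
    ∑ x ∈ Finset.Icc 1 P, Ψ (fun i => (x : ℤ_[p]) ^ ((i : ℕ) + 1)) α with hF
  have hFe : expSum Ψ (evalCurve g) (fun _ => 1) Ω = F := by
    ext α
    rw [expSum, hΩ, Finset.sum_image fun x _ y _ hxy => Nat.cast_injective hxy]
    have hev : ∀ x : ℤ_[p], evalCurve g x = fun i : Fin k => x ^ ((i : ℕ) + 1) := fun x => by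
      ext i
      simp [evalCurve, hg]
    simp [hF, hev]
  set q := k * (k + 1) with hq
  have hq0 : q ≠ 0 := by omega
  set cG : ℝ := ((Fintype.card (Fin k → ZMod (p ^ (k * N))) : ℕ) : ℝ) with hcG
  have hcG0 : 0 < cG := by rw [hcG]; exact_mod_cast Fintype.card_pos
  have hsing : ∀ T ∈ classes N Ω, nrm q (expSum Ψ (evalCurve g) (fun _ => 1) T) ^ q = cG := by
    intro T hT
    obtain ⟨x, hx⟩ := classes_nonempty hT
    have hTx : T = {x} := by
      refine Finset.eq_singleton_iff_unique_mem.2 ⟨hx, fun y hy => ?_⟩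
      obtain ⟨a, ha, rfl⟩ := Finset.mem_image.1 (classes_subset hT hx)
      obtain ⟨b, hb, rfl⟩ := Finset.mem_image.1 (classes_subset hT hy)
      have hd := classes_dvd hT hx hy
      have hd' : (p : ℤ_[p]) ^ N ∣ (((a : ℤ) - b : ℤ) : ℤ_[p]) := by simpa using hd
      rw [PadicInt.pow_p_dvd_int_iff] at hd'
      have h1 := Finset.mem_Icc.1 ha
      have h2 := Finset.mem_Icc.1 hb
      have h3 : (a : ℤ) - b = 0 := by
        refine Int.eq_zero_of_abs_lt_dvd hd' ?_
        have : (P : ℤ) ≤ (p : ℤ) ^ N := by exact_mod_cast hNle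
        rw [abs_lt]
        constructor <;> omega
      have : b = a := by omega
      rw [this]
    rw [nrm_pow hq0, hTx, hcG]
    simp [expSum]
  have hS : sqf q N Ψ (evalCurve g) (fun _ => 1) Ω ^ q ≤ (P : ℝ) ^ m * cG := by
    set ρ : ℝ := cG ^ (1 / (q : ℝ)) with hρ
    have hρq : ρ ^ q = cG := by rw [hρ, one_div, Real.rpow_inv_natCast_pow hcG0.le hq0]
    have hT : ∀ T ∈ classes N Ω, nrm q (expSum Ψ (evalCurve g) (fun _ => 1) T) ^ 2 ≤ ρ ^ 2 := by
      intro T hT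
      refine pow_le_pow_left₀ (nrm_nonneg _ _) ?_ 2
      refine (pow_le_pow_iff_left₀ (nrm_nonneg _ _) (by positivity) hq0).1 ?_
      rw [hsing T hT, hρq]
    have hpow : ∀ y : ℝ, y ^ q = (y ^ 2) ^ m := fun y => by rw [hm, pow_mul]
    rw [hpow, sqf_sq]
    have hcard : ((classes N Ω).card : ℝ) ≤ P := by
      have : (classes N Ω).card ≤ P := by
        refine Finset.card_image_le.trans (Finset.card_image_le.trans ?_)
        simp
      exact_mod_cast this
    calc _ ≤ ((P : ℝ) * ρ ^ 2) ^ m := by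
          refine pow_le_pow_left₀ (Finset.sum_nonneg fun _ _ => by positivity) ?_ m
          refine (Finset.sum_le_card_nsmul _ _ _ hT).trans ?_
          rw [nsmul_eq_mul]
          gcongr
      _ = _ := by rw [mul_pow, ← pow_mul, ← hm, hρq]
  have hdec := hD N _ Ψ (sep_stdPairing k (k * N)) g hcurve (fun _ => 1) Ω
  rw [hFe] at hdec
  have hdec2 := pow_le_pow_left₀ (nrm_nonneg _ _) hdec q
  rw [nrm_pow hq0, mul_pow, mul_pow] at hdec2
  have hpε : ((p : ℝ) ^ ((0 + ε') * N)) ^ q ≤ (p : ℝ) ^ ε * (P : ℝ) ^ ε := by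
    rw [zero_add, mul_comm ε', Real.rpow_mul hp.le, Real.rpow_natCast, ← Real.rpow_natCast _ q,
      ← Real.rpow_mul (by positivity), ← Real.mul_rpow hp.le hP0.le, hm,
      show ε' * ((2 * m : ℕ) : ℝ) = ε by rw [hε']; push_cast; field_simp]
    refine Real.rpow_le_rpow (by positivity) ?_ hε.le
    exact_mod_cast hNge
  have hF0 : ∀ α, ‖F α‖ ≤ P := by
    intro α
    refine (norm_sum_le _ _).trans ?_
    simp [AddChar.norm_apply]
  have hcount := card_mul_count_le Ψ u P h
  rw [← hcG] at hcount
  have hfin : cG * (((pairBox u P).filter fun z => ∀ i : Fin k, powDiff ((i : ℕ) + 1) z = h i).card : ℝ)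
      ≤ cG * (C ^ (2 * m : ℕ) * (p : ℝ) ^ ε * (P : ℝ) ^ ((2 * u : ℝ) - k * (k + 1) / 2 + ε)) := by
    refine hcount.trans ?_
    calc ∑ α, ‖F α‖ ^ (2 * u) ≤ ∑ α, (P : ℝ) ^ (2 * u - q) * ‖F α‖ ^ q := by
          refine Finset.sum_le_sum fun α _ => ?_
          conv_lhs => rw [← Nat.sub_add_cancel hu, pow_add]
          gcongr
          exact hF0 α
      _ = (P : ℝ) ^ (2 * u - q) * ∑ α, ‖F α‖ ^ q := by rw [Finset.mul_sum]
      _ ≤ (P : ℝ) ^ (2 * u - q) * (C ^ q * ((p : ℝ) ^ ε * (P : ℝ) ^ ε) * ((P : ℝ) ^ m * cG)) := by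
          refine mul_le_mul_of_nonneg_left (hdec2.trans ?_) (by positivity)
          have := sqf_nonneg Ψ (evalCurve g) (fun _ => 1) q N Ω
          gcongr
      _ = cG * (C ^ (2 * m : ℕ) * (p : ℝ) ^ ε * ((P : ℝ) ^ (2 * u - q + m : ℕ) * (P : ℝ) ^ ε)) := by
          rw [pow_add (P : ℝ), show C ^ q = C ^ (2 * m : ℕ) by rw [hm]]; ring
      _ = _ := by
          rw [← Real.rpow_natCast (P : ℝ) (2 * u - q + m), ← Real.rpow_add hP0]
          congr 3
          have : (q : ℝ) = k * (k + 1) := by rw [hq]; push_cast; ring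
          have hm' : (q : ℝ) = 2 * m := by rw [hm]; push_cast; ring
          push_cast [Nat.cast_sub hu]
          linarith
  exact le_of_mul_le_mul_left hfin hcG0

end Decoupling

namespace DiagonalSystem

open Decoupling

lemma eC_zero : eC 0 = 1 := by simp [eC]

lemma eC_add (x y : ℝ) : eC (x + y) = eC x * eC y := by
  simp [eC, mul_add, Complex.exp_add]

lemma eC_sum {α : Type*} (S : Finset α) (f : α → ℝ) : eC (∑ i ∈ S, f i) = ∏ i ∈ S, eC (f i) := by
  induction S using Finset.induction_on with
  | empty => simp [eC_zero]
  | insert a S ha ih => rw [Finset.sum_insert ha, Finset.prod_insert ha, eC_add, ih]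

lemma norm_eC (x : ℝ) : ‖eC x‖ = 1 := by
  rw [eC, show (2 * Real.pi * Complex.I * x : ℂ) = ((2 * Real.pi * x : ℝ) : ℂ) * Complex.I by
    push_cast; ring, Complex.norm_exp_ofReal_mul_I]

lemma eC_int (n : ℤ) : eC n = 1 := by
  rw [eC, Complex.exp_eq_one_iff]
  exact ⟨n, by push_cast; ring⟩

lemma eC_add_int (x : ℝ) (n : ℤ) : eC (x + n) = eC x := by rw [eC_add, eC_int, mul_one]

open ComplexConjugate in
lemma conj_eC (x : ℝ) : conj (eC x) = eC (-x) := by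
  simp [eC, ← Complex.exp_conj, map_ofNat]

@[fun_prop]
lemma continuous_eC : Continuous eC := by unfold eC; fun_prop

lemma norm_eC_sub_one_le (x : ℝ) : ‖eC x - 1‖ ≤ 2 * Real.pi * |x| := by
  have h := Real.norm_exp_I_mul_ofReal_sub_one_le (x := 2 * Real.pi * x)
  have e : eC x = Complex.exp (Complex.I * ((2 * Real.pi * x : ℝ) : ℂ)) := by
    rw [eC]; congr 1; push_cast; ring
  rw [e]
  refine h.trans (le_of_eq ?_)
  rw [Real.norm_eq_abs, abs_mul, abs_of_pos (by positivity : 0 < 2 * Real.pi)]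

lemma norm_eC_sub_le (x y : ℝ) : ‖eC x - eC y‖ ≤ 2 * Real.pi * |x - y| := by
  have : eC x - eC y = eC y * (eC (x - y) - 1) := by
    rw [mul_sub, ← eC_add]; simp
  rw [this, norm_mul, norm_eC, one_mul]
  exact norm_eC_sub_one_le _

lemma integral_Ico_eC (a : ℝ) (n : ℤ) :
    ∫ x in Set.Ico a (a + 1), eC (n * x) = if n = 0 then 1 else 0 := by
  rw [integral_Ico_eq_integral_Ioc, ← intervalIntegral.integral_of_le (by linarith)]
  split_ifs with h
  · simp [h, eC_zero]
  · have hc : (2 * Real.pi * Complex.I * n : ℂ) ≠ 0 := by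
      simp [Real.pi_ne_zero, h]
    have e : (fun x : ℝ => eC (n * x)) = fun x : ℝ => Complex.exp ((2 * Real.pi * Complex.I * n : ℂ) * x) := by
      ext x; rw [eC]; congr 1; push_cast; ring
    rw [e, integral_exp_mul_complex hc]
    have : (2 * Real.pi * Complex.I * n : ℂ) * ((a + 1 : ℝ) : ℂ)
        = (2 * Real.pi * Complex.I * n : ℂ) * a + n * (2 * Real.pi * Complex.I) := by
      push_cast; ring
    rw [this, Complex.exp_add, Complex.exp_int_mul_two_pi_mul_I]
    simp

variable {ι : Type*} [Fintype ι]

/-- The unit box with lower corner `a`. -/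
def box (a : ι → ℝ) : Set (ι → ℝ) := Set.univ.pi fun i => Set.Ico (a i) (a i + 1)

lemma measurableSet_box (a : ι → ℝ) : MeasurableSet (box a) :=
  MeasurableSet.univ_pi fun _ => measurableSet_Ico

lemma integrableOn_of_continuous_pi {E : Type*} [NormedAddCommGroup E] {f : (ι → ℝ) → E}
    (hf : Continuous f) {S : Set (ι → ℝ)} (hS : Bornology.IsBounded S) : IntegrableOn f S := by
  obtain ⟨K, hK, hSK⟩ : ∃ K, IsCompact K ∧ S ⊆ K :=
    ⟨closure S, hS.isCompact_closure, subset_closure⟩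
  exact (hf.continuousOn.integrableOn_compact hK).mono_set hSK

lemma isBounded_box (a : ι → ℝ) : Bornology.IsBounded (box a) :=
  (Metric.isBounded_Icc a (a + 1)).subset fun _ hx =>
    ⟨fun i => (hx i trivial).1, fun i => (hx i trivial).2.le⟩

lemma integral_box_eC (a : ι → ℝ) (v : ι → ℤ) :
    ∫ α in box a, eC (∑ i, α i * v i) = if v = 0 then 1 else 0 := by
  have h1 : (volume.restrict (box a) : Measure (ι → ℝ))
      = Measure.pi fun i => volume.restrict (Set.Ico (a i) (a i + 1)) := by
    rw [box, volume_pi, Measure.restrict_pi_pi]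
  have h2 : (fun α : ι → ℝ => eC (∑ i, α i * v i)) = fun α => ∏ i, (fun x : ℝ => eC (v i * x)) (α i) := by
    ext α
    rw [eC_sum]
    exact Finset.prod_congr rfl fun i _ => by rw [mul_comm]
  rw [h1, h2, integral_fintype_prod_eq_prod (fun i (x : ℝ) => eC (v i * x))]
  simp_rw [integral_Ico_eC]
  split_ifs with h
  · simp [h]
  · obtain ⟨i, hi⟩ := Function.ne_iff.1 h
    exact Finset.prod_eq_zero (Finset.mem_univ i) (if_neg hi)

lemma integral_box_sum {α : Type*} (a : ι → ℝ) (Z : Finset α) (v : α → ι → ℤ) :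
    ∫ γ in box a, ∑ z ∈ Z, eC (∑ i, γ i * v z i) = ((Z.filter fun z => v z = 0).card : ℂ) := by
  rw [integral_finsetSum]
  · simp_rw [integral_box_eC]
    simp
  · exact fun z _ => integrableOn_of_continuous_pi (by fun_prop) (isBounded_box a)

variable (d : ι → ℕ) {s : ℕ} (c : ι → Fin s → ℤ)

/-- The exponential sum attached to the `j`-th variable of a diagonal system. -/
def fsum (P : ℕ) (j : Fin s) (α : ι → ℝ) : ℂ :=
  ∑ x ∈ Finset.Icc 1 P, eC (∑ i, α i * (c i j * (x : ℝ) ^ d i))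

@[fun_prop]
lemma continuous_fsum (P : ℕ) (j : Fin s) : Continuous (fsum d c P j) := by
  unfold fsum; fun_prop

lemma norm_fsum_le (P : ℕ) (j : Fin s) (α : ι → ℝ) : ‖fsum d c P j α‖ ≤ P := by
  refine (norm_sum_le _ _).trans ?_
  simp [norm_eC]

lemma prod_fsum (P : ℕ) (α : ι → ℝ) : ∏ j, fsum d c P j α
    = ∑ x ∈ Fintype.piFinset (fun _ : Fin s => Finset.Icc 1 P),
      eC (∑ i, α i * ((∑ j, c i j * (x j : ℤ) ^ d i : ℤ) : ℝ)) := by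
  simp only [fsum]
  rw [Finset.prod_univ_sum]
  refine Finset.sum_congr rfl fun x _ => ?_
  rw [← eC_sum, Finset.sum_comm]
  congr 1
  refine Finset.sum_congr rfl fun i _ => ?_
  push_cast
  rw [Finset.mul_sum]

open ComplexConjugate in
lemma norm_fsum_pow (P : ℕ) (j : Fin s) (α : ι → ℝ) (u : ℕ) :
    ((‖fsum d c P j α‖ ^ (2 * u) : ℝ) : ℂ)
      = ∑ z ∈ pairBox u P, eC (∑ i, α i * ((c i j * powDiff (d i) z : ℤ) : ℝ)) := by
  have hsq : ∀ z : ℂ, ((‖z‖ ^ (2 * u) : ℝ) : ℂ) = z ^ u * conj z ^ u := fun z => by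
    rw [← mul_pow, Complex.mul_conj, Complex.normSq_eq_norm_sq, pow_mul]
    push_cast; rfl
  rw [hsq]
  have e1 : ∀ f : ℕ → ℂ, (∑ x ∈ Finset.Icc 1 P, f x) ^ u
      = ∑ x ∈ Fintype.piFinset (fun _ : Fin u => Finset.Icc 1 P), ∏ a, f (x a) := by
    intro f
    rw [← Finset.prod_univ_sum]
    simp
  rw [fsum, map_sum, e1, e1, Finset.sum_mul_sum, pairBox, Finset.sum_product]
  refine Finset.sum_congr rfl fun x _ => Finset.sum_congr rfl fun y _ => ?_
  simp_rw [conj_eC, ← eC_sum, ← eC_add]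
  congr 1
  simp only [← Finset.sum_neg_distrib]
  rw [Finset.sum_comm, Finset.sum_comm (s := Finset.univ (α := Fin u)), ← Finset.sum_add_distrib]
  refine Finset.sum_congr rfl fun i _ => ?_
  rw [powDiff]
  push_cast
  rw [Finset.mul_sum, Finset.mul_sum, ← Finset.sum_add_distrib]
  exact Finset.sum_congr rfl fun a _ => by ring

end DiagonalSystem

namespace DiagonalSystem

open Decoupling

lemma card_le_prod_of_fibers : ∀ {M : ℕ} {X : Fin M → Type} (Z : Finset (∀ m, X m)) (A : Fin M → ℝ),
    (∀ m, 0 ≤ A m) →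
    (∀ m, ∀ w ∈ Z, (((Z.filter fun z => ∀ m' > m, z m' = w m').image fun z => z m).card : ℝ) ≤ A m) →
    (Z.card : ℝ) ≤ ∏ m, A m := by
  intro M
  induction M with
  | zero =>
    intro X Z A _ _
    have : Z.card ≤ 1 := Finset.card_le_one_of_subsingleton Z
    simpa using this
  | succ M ih =>
    intro X Z A hA h
    set Z' : Finset (∀ m : Fin M, X m.succ) := Z.image Fin.tail with hZ'
    have h1 : (Z'.card : ℝ) ≤ ∏ m : Fin M, A m.succ := by
      refine ih Z' _ (fun m => hA _) fun m w hw => ?_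
      obtain ⟨w, hwZ, rfl⟩ := Finset.mem_image.1 hw
      refine le_trans ?_ (h m.succ w hwZ)
      norm_cast
      refine Finset.card_le_card fun x hx => ?_
      obtain ⟨z, hz, rfl⟩ := Finset.mem_image.1 hx
      obtain ⟨hz, hzw⟩ := Finset.mem_filter.1 hz
      obtain ⟨z, hzZ, rfl⟩ := Finset.mem_image.1 hz
      refine Finset.mem_image.2 ⟨z, Finset.mem_filter.2 ⟨hzZ, fun m' hm' => ?_⟩, rfl⟩
      obtain ⟨m', rfl⟩ := Fin.exists_succ_eq.2 (Fin.ne_zero_of_lt hm')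
      exact hzw m' (Fin.succ_lt_succ_iff.1 hm')
    have h2 : (Z.card : ℝ) ≤ ∑ w ∈ Z', A 0 := by
      rw [Finset.card_eq_sum_card_image Fin.tail Z]
      push_cast
      refine Finset.sum_le_sum fun w hw => ?_
      obtain ⟨w, hwZ, rfl⟩ := Finset.mem_image.1 hw
      refine le_trans ?_ (h 0 w hwZ)
      norm_cast
      rw [← Finset.card_image_of_injOn (s := Z.filter fun x => Fin.tail x = Fin.tail w)
        (f := fun z => z 0)]
      · refine Finset.card_le_card (Finset.image_subset_image fun z hz => ?_)
        obtain ⟨hz, hzw⟩ := Finset.mem_filter.1 hz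
        refine Finset.mem_filter.2 ⟨hz, fun m' hm' => ?_⟩
        obtain ⟨m', rfl⟩ := Fin.exists_succ_eq.2 (Fin.ne_zero_of_lt hm')
        exact congrFun hzw m'
      · intro x hx y hy hxy
        have hx := (Finset.mem_filter.1 hx).2
        have hy := (Finset.mem_filter.1 hy).2
        rw [← Fin.cons_self_tail x, ← Fin.cons_self_tail y, hx, hy]
        exact congrArg (fun a => Fin.cons a (Fin.tail w)) hxy
    rw [Fin.prod_univ_succ]
    refine h2.trans ?_
    rw [Finset.sum_const, nsmul_eq_mul, mul_comm]
    exact mul_le_mul_of_nonneg_left h1 (hA 0)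

lemma abs_powDiff_le {u P : ℕ} (e : ℕ) {z : (Fin u → ℕ) × (Fin u → ℕ)} (hz : z ∈ pairBox u P) :
    |powDiff e z| ≤ u * (P : ℤ) ^ e := by
  obtain ⟨h1, h2⟩ := Finset.mem_product.1 hz
  rw [Fintype.mem_piFinset] at h1 h2
  refine (Finset.abs_sum_le_sum_abs _ _).trans ?_
  refine (Finset.sum_le_card_nsmul _ _ ((P : ℤ) ^ e) fun a _ => ?_).trans (by simp)
  have b1 : (z.1 a : ℤ) ^ e ≤ (P : ℤ) ^ e := by
    exact_mod_cast Nat.pow_le_pow_left (Finset.mem_Icc.1 (h1 a)).2 e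
  have b2 : (z.2 a : ℤ) ^ e ≤ (P : ℤ) ^ e := by
    exact_mod_cast Nat.pow_le_pow_left (Finset.mem_Icc.1 (h2 a)).2 e
  have b3 : (0 : ℤ) ≤ (z.1 a : ℤ) ^ e := by positivity
  have b4 : (0 : ℤ) ≤ (z.2 a : ℤ) ^ e := by positivity
  rw [abs_le]; constructor <;> linarith

lemma sum_missing {κ : ℕ} {E : Finset ℕ} (hE : E ⊆ Finset.Icc 1 κ) :
    (∑ i : Fin κ, ((if (i : ℕ) + 1 ∈ E then 0 else (i : ℕ) + 1 : ℕ) : ℝ)) + ∑ e ∈ E, (e : ℝ)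
      = κ * (κ + 1) / 2 := by
  have h1 : ∀ f : ℕ → ℝ, ∑ i : Fin κ, f ((i : ℕ) + 1) = ∑ e ∈ Finset.Icc 1 κ, f e := by
    intro f
    rw [Fin.sum_univ_eq_sum_range (fun i => f (i + 1)) κ, Finset.range_eq_Ico,
      Finset.sum_Ico_add' f 0 κ 1]
    rfl
  have h2 : ∑ e ∈ E, (e : ℝ) = ∑ e ∈ Finset.Icc 1 κ, ((if e ∈ E then e else 0 : ℕ) : ℝ) := by
    push_cast
    rw [← Finset.sum_filter, Finset.filter_mem_eq_inter, Finset.inter_eq_right.2 hE]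
  rw [h1 (fun e => ((if e ∈ E then 0 else e : ℕ) : ℝ)), h2, ← Finset.sum_add_distrib,
    Finset.sum_congr rfl (g := fun e : ℕ => (e : ℝ)), ← h1 (fun e => (e : ℝ))]
  · rw [Fin.sum_univ_eq_sum_range (fun i => ((i + 1 : ℕ) : ℝ)) κ]
    clear hE h1 h2
    induction κ with
    | zero => simp
    | succ n ih => rw [Finset.sum_range_succ, ih]; push_cast; ring
  · intro e _
    split_ifs <;> simp

/-- The mean value theorem for systems with missing degrees. -/
lemma card_powDiff_le {κ : ℕ} (hκ : 1 ≤ κ) {E : Finset ℕ} (hE : E ⊆ Finset.Icc 1 κ) {u : ℕ}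
    (hu : κ * (κ + 1) ≤ 2 * u) {ε : ℝ} (hε : 0 < ε) : ∃ C : ℝ, 0 < C ∧ ∀ P : ℕ, 1 ≤ P → ∀ h : ℕ → ℤ,
      (((pairBox u P).filter fun z => ∀ e ∈ E, powDiff e z = h e).card : ℝ)
        ≤ C * (P : ℝ) ^ ((2 * u : ℝ) - ∑ e ∈ E, (e : ℝ) + ε) := by
  obtain ⟨C, hC, hV⟩ := vinogradov_mean_value hκ hu hε
  refine ⟨(2 * u + 1) ^ κ * C, by positivity, fun P hP h => ?_⟩
  have hP0 : (0 : ℝ) < P := by exact_mod_cast hP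
  set W : Fin κ → Finset ℤ := fun i => if (i : ℕ) + 1 ∈ E then {h (i + 1)} else
    Finset.Icc (-(u * (P : ℤ) ^ ((i : ℕ) + 1))) (u * (P : ℤ) ^ ((i : ℕ) + 1)) with hW
  have hWc : ∀ i, ((W i).card : ℝ)
      ≤ (2 * u + 1) * (P : ℝ) ^ (if (i : ℕ) + 1 ∈ E then 0 else (i : ℕ) + 1) := by
    intro i
    simp only [hW]
    split_ifs
    · simp
    · have h0 : (0 : ℤ) ≤ u * (P : ℤ) ^ ((i : ℕ) + 1) := by positivity
      have h1 : ((Finset.Icc (-(u * (P : ℤ) ^ ((i : ℕ) + 1))) (u * (P : ℤ) ^ ((i : ℕ) + 1))).card : ℤ)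
          = 2 * (u * (P : ℤ) ^ ((i : ℕ) + 1)) + 1 := by
        rw [Int.card_Icc, Int.toNat_of_nonneg] <;> linarith
      have h2 : ((Finset.Icc (-(u * (P : ℤ) ^ ((i : ℕ) + 1))) (u * (P : ℤ) ^ ((i : ℕ) + 1))).card : ℝ)
          = 2 * (u * (P : ℝ) ^ ((i : ℕ) + 1)) + 1 := by exact_mod_cast h1
      rw [h2]
      have : (1 : ℝ) ≤ (P : ℝ) ^ ((i : ℕ) + 1) := one_le_pow₀ (by exact_mod_cast hP)
      linarith
  have hsub : (pairBox u P).filter (fun z => ∀ e ∈ E, powDiff e z = h e)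
      ⊆ (Fintype.piFinset W).biUnion fun h' =>
        (pairBox u P).filter fun z => ∀ i : Fin κ, powDiff ((i : ℕ) + 1) z = h' i := by
    intro z hz
    obtain ⟨hz, hze⟩ := Finset.mem_filter.1 hz
    refine Finset.mem_biUnion.2 ⟨fun i => powDiff ((i : ℕ) + 1) z, Fintype.mem_piFinset.2 fun i => ?_,
      Finset.mem_filter.2 ⟨hz, fun i => rfl⟩⟩
    simp only [hW]
    split_ifs with hi
    · simp [hze _ hi]
    · exact Finset.mem_Icc.2 (abs_le.1 (abs_powDiff_le _ hz))
  have hcard : (((pairBox u P).filter fun z => ∀ e ∈ E, powDiff e z = h e).card : ℝ)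
      ≤ (Fintype.piFinset W).card * (C * (P : ℝ) ^ ((2 * u : ℝ) - κ * (κ + 1) / 2 + ε)) := by
    refine (Nat.cast_le.2 ((Finset.card_le_card hsub).trans Finset.card_biUnion_le)).trans ?_
    push_cast
    exact (Finset.sum_le_card_nsmul _ _ _ fun h' _ => hV P hP h').trans_eq (nsmul_eq_mul _ _)
  refine hcard.trans ?_
  have hWcard : ((Fintype.piFinset W).card : ℝ) ≤ (2 * u + 1) ^ κ
      * (P : ℝ) ^ (∑ i : Fin κ, ((if (i : ℕ) + 1 ∈ E then 0 else (i : ℕ) + 1 : ℕ) : ℝ)) := by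
    rw [Fintype.card_piFinset]
    push_cast
    refine (Finset.prod_le_prod (fun _ _ => by positivity) fun i _ => hWc i).trans (le_of_eq ?_)
    rw [Finset.prod_mul_distrib, Finset.prod_const, Finset.card_univ, Fintype.card_fin,
      Finset.prod_pow_eq_pow_sum, ← Real.rpow_natCast (P : ℝ) (∑ i, _)]
    push_cast
    rfl
  calc _ ≤ ((2 * u + 1) ^ κ
      * (P : ℝ) ^ (∑ i : Fin κ, ((if (i : ℕ) + 1 ∈ E then 0 else (i : ℕ) + 1 : ℕ) : ℝ)))
        * (C * (P : ℝ) ^ ((2 * u : ℝ) - κ * (κ + 1) / 2 + ε)) := by gcongr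
    _ = (2 * u + 1) ^ κ * C *
      ((P : ℝ) ^ (∑ i : Fin κ, ((if (i : ℕ) + 1 ∈ E then 0 else (i : ℕ) + 1 : ℕ) : ℝ))
        * (P : ℝ) ^ ((2 * u : ℝ) - κ * (κ + 1) / 2 + ε)) := by ring
    _ = _ := by
      rw [← Real.rpow_add hP0]
      congr 2
      linarith [sum_missing hE]

end DiagonalSystem

namespace DiagonalSystem

open Decoupling

variable {t : ℕ} {ν μ : Fin t → ℕ} (k : (l : Fin t) → Fin (ν l) → ℕ)

/-- The exponents of multiplicity greater than `m`. -/
def layerExps (μ : Fin t → ℕ) (m : ℕ) : Finset ℕ :=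
  (Finset.univ.filter fun p : KIdx t ν => m < μ p.1).image fun p => k p.1 p.2

variable {k}

lemma sum_layerExps (hinj : Function.Injective fun p : KIdx t ν => k p.1 p.2) {M : ℕ}
    (hM : ∀ l, μ l ≤ M) :
    ∑ m : Fin M, ∑ e ∈ layerExps k μ m, (e : ℝ) = Ktot t ν μ k := by
  have h1 : ∀ m : Fin M, ∑ e ∈ layerExps k μ m, (e : ℝ)
      = ∑ p : KIdx t ν, if (m : ℕ) < μ p.1 then (k p.1 p.2 : ℝ) else 0 := by
    intro m
    rw [layerExps, Finset.sum_image fun x _ y _ hxy => hinj hxy, Finset.sum_filter]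
  simp_rw [h1]
  rw [Finset.sum_comm, Ktot]
  push_cast
  rw [Fintype.sum_sigma, Fintype.sum_sigma]
  refine Finset.sum_congr rfl fun l _ => ?_
  rw [Fintype.sum_prod_type]
  refine Finset.sum_congr rfl fun n _ => ?_
  simp only [deg]
  rw [← Finset.sum_filter, Finset.sum_const, Finset.sum_const, Fin.card_filter_val_lt]
  simp [hM l]

lemma powDiff_eq_of_tail {s : ℕ} {c : EqIdx t ν μ → Fin s → ℤ} (hns : HighlyNonSingular t ν μ s c)
    {M : ℕ} (hM : ∀ l, μ l ≤ M) {u : Fin M → ℕ} {j : Fin M → Fin s} (hj : Function.Injective j)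
    {z w : ∀ m, (Fin (u m) → ℕ) × (Fin (u m) → ℕ)}
    (hz : ∀ i, ∑ m, c i (j m) * powDiff (deg t ν μ k i) (z m) = 0)
    (hw : ∀ i, ∑ m, c i (j m) * powDiff (deg t ν μ k i) (w m) = 0)
    {m : Fin M} (h : ∀ m' > m, z m' = w m') {e : ℕ} (he : e ∈ layerExps k μ m) :
    powDiff e (z m) = powDiff e (w m) := by
  obtain ⟨⟨l, n⟩, hp, rfl⟩ := Finset.mem_image.1 he
  have hm : (m : ℕ) < μ l := (Finset.mem_filter.1 hp).2
  set T : Fin (μ l) → Fin M := Fin.castLE (hM l)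
  have hT : Function.Injective T := Fin.castLE_injective _
  have hdet := hns.2 l n (j ∘ T) (hj.comp hT)
  have h0 := Matrix.eq_zero_of_mulVec_eq_zero hdet
    (v := fun b => powDiff (k l n) (z (T b)) - powDiff (k l n) (w (T b))) (by
      ext a
      have h1 := hz ⟨l, (n, a)⟩
      have h2 := hw ⟨l, (n, a)⟩
      simp only [Matrix.mulVec, dotProduct, Matrix.of_apply, Function.comp, Pi.zero_apply]
      rw [← sub_eq_zero.2 (h1.trans h2.symm), ← Finset.sum_sub_distrib]
      refine Fintype.sum_of_injective T hT _ _ (fun m' hm' => ?_) fun b => by simp only [deg]; ring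
      have : m < m' := by
        by_contra! hlt
        exact hm' ⟨⟨m', lt_of_le_of_lt hlt hm⟩, rfl⟩
      rw [h m' this, sub_self])
  exact sub_eq_zero.1 (congrFun h0 ⟨m, hm⟩)

lemma integral_prod_fsum_pow {ι : Type*} [Fintype ι] (d : ι → ℕ) {s : ℕ} (c : ι → Fin s → ℤ) (P : ℕ)
    {M : ℕ} (j : Fin M → Fin s) (u : Fin M → ℕ) (a : ι → ℝ) :
    ∫ α in box a, ∏ m, ‖fsum d c P (j m) α‖ ^ (2 * u m)
      = ((Fintype.piFinset fun m => pairBox (u m) P).filter fun z =>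
        ∀ i, ∑ m, c i (j m) * powDiff (d i) (z m) = 0).card := by
  have h : ∀ α, ((∏ m, ‖fsum d c P (j m) α‖ ^ (2 * u m) : ℝ) : ℂ)
      = ∑ z ∈ Fintype.piFinset fun m => pairBox (u m) P,
        eC (∑ i, α i * ((fun i => ∑ m, c i (j m) * powDiff (d i) (z m) : ι → ℤ) i)) := by
    intro α
    rw [Complex.ofReal_prod]
    simp_rw [norm_fsum_pow]
    rw [Finset.prod_univ_sum]
    refine Finset.sum_congr rfl fun z _ => ?_
    rw [← eC_sum, Finset.sum_comm]
    congr 1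
    refine Finset.sum_congr rfl fun i _ => ?_
    push_cast
    rw [Finset.mul_sum]
  apply Complex.ofReal_injective
  rw [← integral_complex_ofReal]
  simp_rw [h]
  rw [integral_box_sum]
  push_cast
  congr 3
  ext z
  exact funext_iff

/-- The mean value estimate for a highly non-singular system. -/
theorem system_mean_value (hgrp : GroupedDegrees t ν μ k) {s : ℕ} {c : EqIdx t ν μ → Fin s → ℤ}
    (hns : HighlyNonSingular t ν μ s c) {M : ℕ} (hM : ∀ l, μ l ≤ M) {u κ : Fin M → ℕ}
    (hκ1 : ∀ m, 1 ≤ κ m) (hκ : ∀ m : Fin M, layerExps k μ m ⊆ Finset.Icc 1 (κ m))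
    (hu : ∀ m, κ m * (κ m + 1) ≤ 2 * u m) {ε : ℝ} (hε : 0 < ε) :
    ∃ C : ℝ, 0 < C ∧ ∀ P : ℕ, 1 ≤ P → ∀ a : EqIdx t ν μ → ℝ, ∀ j : Fin M → Fin s,
      Function.Injective j →
      ∫ α in box a, ∏ m, ‖fsum (deg t ν μ k) c P (j m) α‖ ^ (2 * u m)
        ≤ C * (P : ℝ) ^ ((∑ m, 2 * (u m : ℝ)) - Ktot t ν μ k + ε) := by
  choose C hC hV using fun m => card_powDiff_le (hκ1 m) (hκ m) (hu m)
    (show 0 < ε / (M + 1) by positivity)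
  refine ⟨∏ m, C m, Finset.prod_pos fun m _ => hC m, fun P hP a j hj => ?_⟩
  have hP0 : (0 : ℝ) < P := by exact_mod_cast hP
  rw [integral_prod_fsum_pow]
  refine (card_le_prod_of_fibers _ (fun m => C m * (P : ℝ) ^ ((2 * u m : ℝ)
    - ∑ e ∈ layerExps k μ m, (e : ℝ) + ε / (M + 1))) (fun m => by have := hC m; positivity) ?_).trans ?_
  · intro m w hw
    obtain ⟨hwP, hw⟩ := Finset.mem_filter.1 hw
    refine le_trans ?_ (hV m P hP fun e => powDiff e (w m))
    norm_cast
    refine Finset.card_le_card fun x hx => ?_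
    simp only [Finset.mem_image, Finset.mem_filter] at hx
    obtain ⟨z, ⟨⟨hzP, hz⟩, hzw⟩, rfl⟩ := hx
    exact Finset.mem_filter.2 ⟨Fintype.mem_piFinset.1 hzP m, fun e he =>
      powDiff_eq_of_tail hns hM hj hz hw hzw he⟩
  · rw [Finset.prod_mul_distrib, ← Real.rpow_sum_of_pos hP0]
    refine mul_le_mul_of_nonneg_left ?_ (Finset.prod_pos fun m _ => hC m).le
    refine Real.rpow_le_rpow_of_exponent_le (by exact_mod_cast hP) ?_
    rw [Finset.sum_add_distrib, Finset.sum_sub_distrib, sum_layerExps hgrp.2.2.2.2.2 hM]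
    have : ∑ _m : Fin M, ε / ((M : ℝ) + 1) ≤ ε := by
      rw [Finset.sum_const, Finset.card_univ, Fintype.card_fin, nsmul_eq_mul, mul_div_assoc',
        div_le_iff₀ (by positivity)]
      nlinarith
    linarith

end DiagonalSystem

namespace DiagonalSystem

open Decoupling

variable {t : ℕ} {ν μ : Fin t → ℕ} {k : (l : Fin t) → Fin (ν l) → ℕ}

lemma sum_layers {a : ℕ → ℕ} {n : ℕ} (ha : ∀ h ∈ Finset.Icc 1 n, a (h + 1) ≤ a h) (f g : ℕ → ℝ)
    (hfg : ∀ h ∈ Finset.Icc 1 n, ∀ m ∈ Finset.Ico (a (h + 1)) (a h), f m = g h) :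
    ∑ m ∈ Finset.Ico (a (n + 1)) (a 1), f m = ∑ h ∈ Finset.Icc 1 n, ((a h : ℝ) - a (h + 1)) * g h := by
  suffices H : a (n + 1) ≤ a 1 ∧ ∑ m ∈ Finset.Ico (a (n + 1)) (a 1), f m
      = ∑ h ∈ Finset.Icc 1 n, ((a h : ℝ) - a (h + 1)) * g h from H.2
  induction n with
  | zero => simp
  | succ n ih =>
    have hsub : Finset.Icc 1 n ⊆ Finset.Icc 1 (n + 1) := Finset.Icc_subset_Icc le_rfl (by omega)
    obtain ⟨h1, h2⟩ := ih (fun h hh => ha h (hsub hh)) (fun h hh => hfg h (hsub hh))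
    have hmem : n + 1 ∈ Finset.Icc 1 (n + 1) := by simp
    have h3 := ha (n + 1) hmem
    refine ⟨h3.trans h1, ?_⟩
    rw [← Finset.sum_Ico_consecutive f h3 h1, h2, Finset.sum_Icc_succ_top (by omega),
      Finset.sum_congr rfl (hfg (n + 1) hmem), Finset.sum_const, Nat.card_Ico, nsmul_eq_mul,
      Nat.cast_sub h3, add_comm]

lemma layerExps_eq_of_mem (hμ : StrictAnti μ) {h m : ℕ} (h1 : 1 ≤ h) (ht : h ≤ t)
    (hm : m ∈ Finset.Ico (mu1 t μ (h + 1)) (mu1 t μ h)) :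
    layerExps k μ m = (Finset.univ.filter fun p : KIdx t ν => (p.1 : ℕ) < h).image
      fun p => k p.1 p.2 := by
  rw [layerExps]
  congr 1
  refine Finset.filter_congr fun p _ => ?_
  obtain ⟨hm1, hm2⟩ := Finset.mem_Ico.1 hm
  rw [mu1, dif_pos ⟨h1, ht⟩] at hm2
  constructor
  · intro hp
    by_contra! hlt
    have hlt' : h + 1 ≤ t := by have := p.1.2; omega
    rw [mu1, dif_pos ⟨by omega, hlt'⟩] at hm1
    have : μ p.1 ≤ μ ⟨h + 1 - 1, by omega⟩ := hμ.antitone (Fin.le_def.2 (by simpa using hlt))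
    omega
  · intro hp
    have : μ ⟨h - 1, by omega⟩ ≤ μ p.1 := hμ.antitone (Fin.le_def.2 (by simp; omega))
    omega

/-- The number of variables suffices for the mean value exponents of all layers. -/
lemma exists_layer_exponents (hgrp : GroupedDegrees t ν μ k) (hdeg3 : ∀ l n, 3 ≤ k l n) {s : ℕ}
    (hs : 2 * (mu1 t μ t : ℝ) * (kmax t ν k : ℝ) * ((kmax t ν k : ℝ) - 1)
      + 2 * (∑ h ∈ Finset.Icc 1 (t - 1),
        ((mu1 t μ h : ℝ) - (mu1 t μ (h + 1) : ℝ)) *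
          max ((ktil t ν k h : ℝ) * ((ktil t ν k h : ℝ) - 1))
            ((kmax t ν k : ℝ) * (1 + (varpi t ν h : ℝ)) / 2))
      + 1 ≤ (s : ℝ)) :
    ∃ (M : ℕ) (κ : Fin M → ℕ), 0 < M ∧ (∀ l, μ l ≤ M) ∧ (∀ m, 3 ≤ κ m) ∧
      (∀ m : Fin M, layerExps k μ m ⊆ Finset.Icc 1 (κ m)) ∧
      (∑ m, 2 * (κ m * (κ m - 1))) + 1 ≤ s := by
  obtain ⟨ht, hν, hμ0, hμ, hk0, hinj⟩ := hgrp
  set κ : ℕ → ℕ := fun m => (layerExps k μ m).sup id with hκ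
  have hle : ∀ m, layerExps k μ m ⊆ Finset.Icc 1 (κ m) := by
    intro m e he
    refine Finset.mem_Icc.2 ⟨?_, Finset.le_sup (f := id) he⟩
    obtain ⟨p, _, rfl⟩ := Finset.mem_image.1 he
    exact hk0 _ _
  have hM1 : mu1 t μ 1 = μ ⟨0, ht⟩ := by rw [mu1, dif_pos ⟨le_rfl, ht⟩]
  have h3 : ∀ m < mu1 t μ 1, 3 ≤ κ m := by
    intro m hm
    rw [hM1] at hm
    refine (hdeg3 ⟨0, ht⟩ ⟨0, hν _⟩).trans (Finset.le_sup (f := id) ?_)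
    exact Finset.mem_image.2 ⟨⟨⟨0, ht⟩, ⟨0, hν _⟩⟩, Finset.mem_filter.2 ⟨Finset.mem_univ _, hm⟩, rfl⟩
  refine ⟨mu1 t μ 1, fun m => κ m, hM1 ▸ hμ0 _, fun l => ?_, fun m => h3 m m.2, fun m => hle m, ?_⟩
  · rw [hM1]
    exact hμ.antitone (Fin.le_def.2 (Nat.zero_le _))
  · have hanti : ∀ h ∈ Finset.Icc 1 t, mu1 t μ (h + 1) ≤ mu1 t μ h := by
      intro h hh
      have hh := Finset.mem_Icc.1 hh
      rw [mu1, mu1, dif_pos (c := 1 ≤ h ∧ h ≤ t) hh]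
      split_ifs
      · exact hμ.antitone (Fin.le_def.2 (by simp))
      · exact Nat.zero_le _
    set g : ℕ → ℝ := fun h => 2 * ((ktil t ν k h : ℝ) * ((ktil t ν k h : ℝ) - 1)) with hg
    have hfg : ∀ h ∈ Finset.Icc 1 t, ∀ m ∈ Finset.Ico (mu1 t μ (h + 1)) (mu1 t μ h),
        ((2 * (κ m * (κ m - 1)) : ℕ) : ℝ) = g h := by
      intro h hh m hm
      have hh := Finset.mem_Icc.1 hh
      have hκm : κ m = ktil t ν k h := by
        simp only [hκ]
        rw [layerExps_eq_of_mem hμ hh.1 hh.2 hm, Finset.sup_image]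
        rfl
      have hm1 : m < mu1 t μ 1 := by
        have hm := (Finset.mem_Ico.1 hm).2
        rw [mu1, dif_pos hh] at hm
        rw [hM1]
        exact hm.trans_le (hμ.antitone (Fin.le_def.2 (Nat.zero_le _)))
      have := h3 m hm1
      simp only [hg]
      rw [← hκm]
      push_cast [Nat.cast_sub (show 1 ≤ κ m by omega)]
      ring
    have hsum := sum_layers hanti (fun m => ((2 * (κ m * (κ m - 1)) : ℕ) : ℝ)) g hfg
    have hz : mu1 t μ (t + 1) = 0 := by rw [mu1, dif_neg (by omega)]
    rw [hz, ← Finset.range_eq_Ico] at hsum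
    have hkt : ktil t ν k t = kmax t ν k := by
      rw [ktil, kmax]
      congr 1
      ext p
      simp
    obtain ⟨t', rfl⟩ : ∃ t', t = t' + 1 := ⟨t - 1, by omega⟩
    rw [Finset.sum_Icc_succ_top (by omega), hz] at hsum
    have hle2 : ∑ h ∈ Finset.Icc 1 t', ((mu1 (t' + 1) μ h : ℝ) - mu1 (t' + 1) μ (h + 1)) * g h
        ≤ 2 * ∑ h ∈ Finset.Icc 1 t', ((mu1 (t' + 1) μ h : ℝ) - (mu1 (t' + 1) μ (h + 1) : ℝ)) *
          max ((ktil (t' + 1) ν k h : ℝ) * ((ktil (t' + 1) ν k h : ℝ) - 1))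
            ((kmax (t' + 1) ν k : ℝ) * (1 + (varpi (t' + 1) ν h : ℝ)) / 2) := by
      rw [Finset.mul_sum]
      refine Finset.sum_le_sum fun h hh => ?_
      have h1 : (mu1 (t' + 1) μ (h + 1) : ℝ) ≤ mu1 (t' + 1) μ h := by
        exact_mod_cast hanti h (Finset.Icc_subset_Icc le_rfl (by omega) hh)
      have h2 := le_max_left ((ktil (t' + 1) ν k h : ℝ) * ((ktil (t' + 1) ν k h : ℝ) - 1))
            ((kmax (t' + 1) ν k : ℝ) * (1 + (varpi (t' + 1) ν h : ℝ)) / 2)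
      have := mul_le_mul_of_nonneg_left h2 (sub_nonneg.2 h1)
      rw [hg]
      linarith
    have hgt : g (t' + 1) = 2 * ((kmax (t' + 1) ν k : ℝ) * ((kmax (t' + 1) ν k : ℝ) - 1)) := by
      rw [hg, ← hkt]
    rw [hgt] at hsum
    rw [Nat.add_sub_cancel] at hs
    have hfinal : ((∑ m ∈ Finset.range (mu1 (t' + 1) μ 1), 2 * (κ m * (κ m - 1)) : ℕ) : ℝ) + 1 ≤ s := by
      push_cast at hsum ⊢
      linarith
    rw [Fin.sum_univ_eq_sum_range (fun m => 2 * (κ m * (κ m - 1)))]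
    exact_mod_cast hfinal

end DiagonalSystem

namespace DiagonalSystem

lemma exists_fiber_card_ge {α : Type*} {T : Finset α} {n : ℕ} (hn : 0 < n) (f : α → ℕ)
    (hf : ∀ x ∈ T, f x < n) : ∃ y < n, (T.card : ℝ) / n ≤ ((T.filter fun x => f x = y).card : ℝ) := by
  obtain ⟨y, hy, h⟩ := Finset.exists_le_card_fiber_of_nsmul_le_card_of_maps_to (s := T)
    (t := Finset.range n) (f := f) (b := (T.card : ℝ) / n) (fun x hx => Finset.mem_range.2 (hf x hx))
    ⟨0, Finset.mem_range.2 hn⟩ (by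
      rw [Finset.card_range, nsmul_eq_mul, mul_div_cancel₀]
      exact_mod_cast hn.ne')
  exact ⟨y, Finset.mem_range.1 hy, h⟩

set_option maxHeartbeats 1000000 in
/-- If `β h` is very close to an integer for a positive proportion of the `h ≤ P`, then `β` has a
good rational approximation of small denominator. -/
lemma exists_approx_of_many {H : ℝ} (hH : 2 ≤ H) {P : ℕ} (hP : 1 ≤ P) {S : Finset ℕ} (hS : S ⊆ Finset.Icc 1 P)
    (hSc : (P : ℝ) / H ≤ S.card) {e : ℕ} (he : 1 ≤ e) {β : ℝ}
    (hβ : ∀ h ∈ S, ∃ a : ℤ, |β * h - a| ≤ H / (P : ℝ) ^ e) :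
    ∃ q : ℕ, 1 ≤ q ∧ (q : ℝ) ≤ H ^ (40 * (e + 1)) ∧
      ∃ a : ℤ, |q * β - a| ≤ H ^ (40 * (e + 1)) / (P : ℝ) ^ (e + 1) := by
  have hH0 : 0 < H := by linarith
  have hH1 : 1 ≤ H := by linarith
  have hP0 : (0 : ℝ) < P := by exact_mod_cast hP
  by_cases hPH : (P : ℝ) ≤ H ^ 40
  · refine ⟨1, le_rfl, by simpa using one_le_pow₀ hH1, round β, ?_⟩
    rw [Nat.cast_one, one_mul]
    refine (abs_sub_round β).trans ?_
    rw [le_div_iff₀ (by positivity)]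
    have : (P : ℝ) ^ (e + 1) ≤ H ^ (40 * (e + 1)) := by
      rw [pow_mul]
      gcongr
    have h0 : 0 ≤ (P : ℝ) ^ (e + 1) := by positivity
    linarith
  push Not at hPH
  have hpow : ∀ {m n : ℕ}, m ≤ n → H ^ m ≤ H ^ n := fun h => pow_le_pow_right₀ hH1 h
  have h2H : ∀ x : ℝ, 0 ≤ x → 2 * x ≤ H * x := fun x hx => by nlinarith
  set L : ℕ := ⌊(P : ℝ) / H ^ 5⌋₊ with hL
  have hL1 : (L : ℝ) ≤ P / H ^ 5 := Nat.floor_le (by positivity)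
  have hL2 : (P : ℝ) / H ^ 6 ≤ L := by
    have h1 := Nat.lt_floor_add_one ((P : ℝ) / H ^ 5)
    have h2 : (P : ℝ) / H ^ 5 = H * (P / H ^ 6) := by field_simp
    have h3 : 1 ≤ (P : ℝ) / H ^ 6 := by
      rw [le_div_iff₀ (by positivity), one_mul]
      exact (hpow (by norm_num)).trans hPH.le
    have := h2H (P / H ^ 6) (by positivity)
    linarith
  have hL3 : H ^ 34 ≤ L := by
    refine le_trans ?_ hL2
    rw [le_div_iff₀ (by positivity), ← pow_add]
    exact hPH.le
  have hL0 : (0 : ℝ) < L := lt_of_lt_of_le (by positivity) hL3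
  have hLn : 0 < L := by exact_mod_cast hL0
  -- localise to a short block
  obtain ⟨j, -, hj⟩ := exists_fiber_card_ge (T := S) (n := P / L + 1) (Nat.succ_pos _) (fun x => x / L)
    fun x hx => Nat.lt_succ_of_le (Nat.div_le_div_right (Finset.mem_Icc.1 (hS hx)).2)
  set T := S.filter fun x => x / L = j with hT
  have hTc : (L : ℝ) / H ^ 2 ≤ T.card := by
    refine le_trans ?_ hj
    have h1 : ((P / L + 1 : ℕ) : ℝ) ≤ H * (P / L) := by
      push_cast
      have h2 : ((P / L : ℕ) : ℝ) ≤ P / L := Nat.cast_div_le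
      have h3 : 1 ≤ (P : ℝ) / L := by
        rw [le_div_iff₀ hL0, one_mul]
        exact hL1.trans (div_le_self hP0.le (one_le_pow₀ hH1))
      have := h2H (P / L) (by positivity)
      linarith
    calc (L : ℝ) / H ^ 2 = (P / H) / (H * (P / L)) := by field_simp
      _ ≤ (P / H) / ((P / L + 1 : ℕ) : ℝ) := by gcongr
      _ ≤ _ := by gcongr
  -- two close elements
  set g : ℕ := ⌈H ^ 4⌉₊ with hg
  have hg1 : H ^ 4 ≤ g := Nat.le_ceil _
  have hg2 : (g : ℝ) ≤ H ^ 5 := by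
    have h1 := Nat.ceil_lt_add_one (show 0 ≤ H ^ 4 by positivity)
    have h2 := h2H (H ^ 4) (by positivity)
    have h3 : 1 ≤ H ^ 4 := one_le_pow₀ hH1
    have : H ^ 5 = H * H ^ 4 := by ring
    linarith
  have hg0 : 0 < g := by
    have : (0 : ℝ) < g := lt_of_lt_of_le (by positivity) hg1
    exact_mod_cast this
  have hcell : ∃ x ∈ T, ∃ y ∈ T, x ≠ y ∧ x % L / g = y % L / g := by
    refine Finset.exists_ne_map_eq_of_card_lt_of_maps_to (t := Finset.range (L / g + 1)) ?_ ?_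
    · have h1 : ((L / g + 1 : ℕ) : ℝ) < T.card := by
        refine lt_of_lt_of_le ?_ hTc
        push_cast
        have h2 : ((L / g : ℕ) : ℝ) ≤ L / H ^ 4 := by
          refine Nat.cast_div_le.trans ?_
          gcongr
        have h3 : (L : ℝ) / H ^ 2 = H ^ 2 * (L / H ^ 4) := by field_simp
        have h4 : 1 ≤ (L : ℝ) / H ^ 4 := by
          rw [le_div_iff₀ (by positivity), one_mul]
          exact (hpow (by norm_num)).trans hL3
        have h5 : 4 ≤ H ^ 2 := by nlinarith
        nlinarith
      rw [Finset.card_range]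
      exact_mod_cast h1
    · intro x _
      exact Finset.mem_coe.2 (Finset.mem_range.2 (Nat.lt_succ_of_le
        (Nat.div_le_div_right (Nat.mod_lt _ hLn).le)))
  have hcell' : ∃ x ∈ T, ∃ y ∈ T, x < y ∧ y - x < g := by
    have key : ∀ x ∈ T, ∀ y ∈ T, x < y → x % L / g = y % L / g → y - x < g := by
      intro x hx y hy _ hxy
      have e1 := (Finset.mem_filter.1 hx).2
      have e2 := (Finset.mem_filter.1 hy).2
      have e3 := Nat.div_add_mod x L
      have e4 := Nat.div_add_mod y L
      rw [e1] at e3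
      rw [e2] at e4
      have e5 := Nat.div_add_mod (x % L) g
      have e6 := Nat.div_add_mod (y % L) g
      have e7 := Nat.mod_lt (y % L) hg0
      rw [hxy] at e5
      omega
    obtain ⟨x, hx, y, hy, hne, hxy⟩ := hcell
    rcases lt_or_gt_of_ne hne with h | h
    · exact ⟨x, hx, y, hy, h, key x hx y hy h hxy⟩
    · exact ⟨y, hy, x, hx, h, key y hy x hx h hxy.symm⟩
  have hdiff : ∀ x ∈ T, ∀ y ∈ T, x ≤ y → ∃ a : ℤ, |β * ((y - x : ℕ) : ℝ) - a| ≤ 2 * H / (P : ℝ) ^ e := by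
    intro x hx y hy hxy
    obtain ⟨a, ha⟩ := hβ x (Finset.mem_filter.1 hx).1
    obtain ⟨b, hb⟩ := hβ y (Finset.mem_filter.1 hy).1
    refine ⟨b - a, ?_⟩
    rw [Nat.cast_sub hxy]
    push_cast
    calc |β * (y - x) - (b - a)| = |(β * y - b) - (β * x - a)| := by congr 1; ring
      _ ≤ |β * y - b| + |β * x - a| := abs_sub _ _
      _ ≤ H / (P : ℝ) ^ e + H / (P : ℝ) ^ e := add_le_add hb ha
      _ = _ := by ring
  obtain ⟨x, hx, y, hy, hxy, hyx⟩ := hcell'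
  set q := y - x with hq
  have hq0 : 0 < q := Nat.sub_pos_of_lt hxy
  have hq5 : (q : ℝ) ≤ H ^ 5 := le_trans (by exact_mod_cast hyx.le) hg2
  obtain ⟨b, hb⟩ := hdiff x hx y hy hxy.le
  refine ⟨q, hq0, hq5.trans (hpow (by omega)), b, ?_⟩
  have hPe : (P : ℝ) ≤ (P : ℝ) ^ e := le_self_pow₀ (by exact_mod_cast hP) (by omega)
  -- two distant elements in the same class modulo `q`
  obtain ⟨w, -, hw⟩ := exists_fiber_card_ge (T := T) hq0 (fun x => x % q) fun x _ => Nat.mod_lt _ hq0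
  set U := T.filter fun x => x % q = w with hU
  have hUc : (L : ℝ) / H ^ 7 ≤ U.card := by
    refine le_trans ?_ hw
    calc (L : ℝ) / H ^ 7 = (L / H ^ 2) / H ^ 5 := by field_simp
      _ ≤ (T.card : ℝ) / q := by
        have : (0 : ℝ) < q := by exact_mod_cast hq0
        gcongr
  have hUne : U.Nonempty := by
    rw [← Finset.card_pos]
    have : (0 : ℝ) < U.card := lt_of_lt_of_le (by positivity) hUc
    exact_mod_cast this
  set x0 := U.min' hUne
  set x1 := U.max' hUne
  have hx0 : x0 ∈ U := U.min'_mem hUne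
  have hx1 : x1 ∈ U := U.max'_mem hUne
  have hx01 : x0 ≤ x1 := U.min'_le _ hx1
  obtain ⟨hx0T, hx0q⟩ := Finset.mem_filter.1 hx0
  obtain ⟨hx1T, hx1q⟩ := Finset.mem_filter.1 hx1
  have hqdvd : ∀ z ∈ U, q ∣ z - x0 := fun z hz =>
    (Nat.modEq_iff_dvd' (U.min'_le _ hz)).1 (hx0q.trans (Finset.mem_filter.1 hz).2.symm)
  obtain ⟨n, hn⟩ := hqdvd x1 hx1
  have hUn : U.card ≤ n + 1 := by
    have : U ⊆ (Finset.range (n + 1)).image fun i => x0 + q * i := by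
      intro z hz
      obtain ⟨i, hi⟩ := hqdvd z hz
      have h1 : x0 ≤ z := U.min'_le _ hz
      have h2 : z ≤ x1 := U.le_max' _ hz
      refine Finset.mem_image.2 ⟨i, Finset.mem_range.2 (Nat.lt_succ_of_le ?_), by omega⟩
      exact Nat.le_of_mul_le_mul_left (show q * i ≤ q * n by omega) hq0
    exact (Finset.card_le_card this).trans (Finset.card_image_le.trans (Finset.card_range _).le)
  have hn1 : (L : ℝ) / H ^ 8 ≤ n := by
    have h1 : (U.card : ℝ) ≤ n + 1 := by exact_mod_cast hUn
    have h2 : (L : ℝ) / H ^ 7 = H * (L / H ^ 8) := by field_simp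
    have h3 : 1 ≤ (L : ℝ) / H ^ 8 := by
      rw [le_div_iff₀ (by positivity), one_mul]
      exact (hpow (by norm_num)).trans hL3
    have := h2H (L / H ^ 8) (by positivity)
    linarith
  have hn0 : (0 : ℝ) < n := lt_of_lt_of_le (by positivity) hn1
  have hn2 : (P : ℝ) / H ^ 14 ≤ n := by
    refine le_trans ?_ hn1
    calc (P : ℝ) / H ^ 14 = (P / H ^ 6) / H ^ 8 := by field_simp
      _ ≤ _ := by gcongr
  have hnL : (n : ℝ) ≤ L := by
    have e1 := (Finset.mem_filter.1 hx0T).2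
    have e2 := (Finset.mem_filter.1 hx1T).2
    have e3 := Nat.div_add_mod x0 L
    have e4 := Nat.div_add_mod x1 L
    have e5 := Nat.mod_lt x1 hLn
    rw [e1] at e3
    rw [e2] at e4
    have : n ≤ q * n := Nat.le_mul_of_pos_left _ hq0
    have : n ≤ L := by omega
    exact_mod_cast this
  obtain ⟨m, hm⟩ := hdiff x0 hx0T x1 hx1T hx01
  rw [hn] at hm
  push_cast at hm
  have hbn : |β * (q * n) - b * n| ≤ 2 * H * n / P := by
    calc |β * (q * n) - b * n| = |β * q - b| * n := by
          rw [← abs_of_pos hn0, ← abs_mul, abs_of_pos hn0]; congr 1; ring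
      _ ≤ 2 * H / (P : ℝ) ^ e * n := by gcongr
      _ ≤ 2 * H / P * n := by gcongr
      _ = _ := by ring
  have hsmall1 : 2 * H * n / P ≤ 1 / 4 := by
    rw [div_le_iff₀ hP0]
    have h1 : (n : ℝ) * H ^ 5 ≤ P := by
      have := hnL.trans hL1
      rwa [le_div_iff₀ (by positivity)] at this
    have h2 : 8 * H ≤ H ^ 5 := by
      have : H ^ 5 = H ^ 4 * H := by ring
      have h16 : (16 : ℝ) ≤ H ^ 4 := by
        calc (16 : ℝ) = 2 ^ 4 := by norm_num
          _ ≤ _ := by gcongr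
      nlinarith
    nlinarith
  have hsmall2 : 2 * H / P ≤ 1 / 4 := by
    refine le_trans ?_ hsmall1
    have h1n : (1 : ℝ) ≤ n := by
      have : 0 < n := by exact_mod_cast hn0
      exact_mod_cast this
    have : 2 * H ≤ 2 * H * n := by nlinarith
    gcongr
  have hmb : m = b * n := by
    have h1 : |((m - b * n : ℤ) : ℝ)| < 1 := by
      push_cast
      calc |(m : ℝ) - b * n| = |(β * (q * n) - b * n) - (β * (q * n) - m)| := by congr 1; ring
        _ ≤ |β * (q * n) - b * n| + |β * (q * n) - m| := abs_sub _ _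
        _ < 1 := by
          have : 2 * H / (P : ℝ) ^ e ≤ 2 * H / P := by gcongr
          linarith
    have h2 : |m - b * n| < 1 := by exact_mod_cast h1
    have := Int.abs_lt_one_iff.1 h2
    omega
  have hfin : |q * β - b| * n ≤ 2 * H / (P : ℝ) ^ e := by
    refine le_trans (le_of_eq ?_) hm
    rw [hmb, ← abs_of_pos hn0, ← abs_mul, abs_of_pos hn0]
    push_cast
    congr 1
    ring
  rw [le_div_iff₀ (by positivity)]
  have h1 : |q * β - b| * (P / H ^ 14) ≤ 2 * H / (P : ℝ) ^ e :=
    (mul_le_mul_of_nonneg_left hn2 (abs_nonneg _)).trans hfin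
  rw [mul_div_assoc', div_le_div_iff₀ (by positivity) (by positivity)] at h1
  calc |q * β - b| * (P : ℝ) ^ (e + 1) = |q * β - b| * P * (P : ℝ) ^ e := by ring
    _ ≤ 2 * H * H ^ 14 := h1
    _ ≤ H * H * H ^ 14 := by gcongr
    _ = H ^ 16 := by ring
    _ ≤ _ := hpow (by omega)

end DiagonalSystem

namespace DiagonalSystem

open ComplexConjugate in
/-- Weyl differencing. -/
lemma norm_sum_sq_le {w : ℕ → ℂ} (hw : ∀ x, ‖w x‖ = 1) {u v P : ℕ} (hv : v ≤ P) :
    ‖∑ x ∈ Finset.Ioc u v, w x‖ ^ 2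
      ≤ P + 2 * ∑ h ∈ Finset.Icc 1 P, ‖∑ x ∈ Finset.Ioc u (v - h), w (x + h) * conj (w x)‖ := by
  set S := Finset.Ioc u v with hS
  set D := ∑ h ∈ Finset.Icc 1 P, ∑ x ∈ Finset.Ioc u (v - h), w (x + h) * conj (w x) with hD
  have hlt : ∑ z ∈ (S ×ˢ S).filter (fun z => z.1 < z.2), w z.2 * conj (w z.1) = D := by
    rw [hD, Finset.sum_sigma']
    symm
    refine Finset.sum_bij' (fun a _ => (a.2, a.2 + a.1)) (fun z _ => ⟨z.2 - z.1, z.1⟩) ?_ ?_ ?_ ?_ ?_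
    · rintro ⟨h, x⟩ ha
      simp only [hS, Finset.mem_sigma, Finset.mem_Icc, Finset.mem_Ioc, Finset.mem_filter,
        Finset.mem_product] at ha ⊢
      omega
    · rintro ⟨x, y⟩ ha
      simp only [hS, Finset.mem_sigma, Finset.mem_Icc, Finset.mem_Ioc, Finset.mem_filter,
        Finset.mem_product] at ha ⊢
      omega
    · rintro ⟨h, x⟩ ha
      simp
    · rintro ⟨x, y⟩ ha
      simp only [Finset.mem_filter] at ha
      simp only [Prod.mk.injEq, true_and]
      omega
    · rintro ⟨h, x⟩ ha
      rfl
  have hgt : ∑ z ∈ (S ×ˢ S).filter (fun z => z.2 < z.1), w z.2 * conj (w z.1) = conj D := by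
    rw [← hlt, map_sum]
    refine Finset.sum_bij' (fun z _ => (z.2, z.1)) (fun z _ => (z.2, z.1)) ?_ ?_ ?_ ?_ ?_
    · rintro ⟨x, y⟩ ha
      simp only [Finset.mem_filter, Finset.mem_product] at ha ⊢
      tauto
    · rintro ⟨x, y⟩ ha
      simp only [Finset.mem_filter, Finset.mem_product] at ha ⊢
      tauto
    · intros; rfl
    · intros; rfl
    · rintro ⟨x, y⟩ ha
      simp [mul_comm]
  have heq : ∑ z ∈ (S ×ˢ S).filter (fun z => z.1 = z.2), w z.2 * conj (w z.1) = S.card := by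
    have : ∀ z ∈ (S ×ˢ S).filter (fun z => z.1 = z.2), w z.2 * conj (w z.1) = 1 := by
      rintro ⟨x, y⟩ ha
      obtain rfl : x = y := (Finset.mem_filter.1 ha).2
      simp only
      rw [Complex.mul_conj, Complex.normSq_eq_norm_sq, hw]
      norm_num
    rw [Finset.sum_congr rfl this, Finset.sum_const, nsmul_eq_mul, mul_one]
    congr 1
    refine Finset.card_bij' (fun z _ => z.1) (fun x _ => (x, x)) ?_ ?_ ?_ ?_
    · rintro ⟨x, y⟩ ha
      exact (Finset.mem_product.1 (Finset.mem_filter.1 ha).1).1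
    · intro x hx
      simp [hx]
    · rintro ⟨x, y⟩ ha
      obtain rfl : x = y := (Finset.mem_filter.1 ha).2
      rfl
    · intros; rfl
  have hsq : ((‖∑ x ∈ S, w x‖ ^ 2 : ℝ) : ℂ) = S.card + D + conj D := by
    rw [← hgt, ← hlt, ← heq]
    rw [← Complex.normSq_eq_norm_sq, ← Complex.mul_conj, map_sum, Finset.sum_mul_sum, Finset.sum_comm,
      ← Finset.sum_product',
      ← Finset.sum_filter_add_sum_filter_not (S ×ˢ S) (fun z => z.1 = z.2), add_assoc]
    congr 1
    rw [← Finset.sum_filter_add_sum_filter_not ((S ×ˢ S).filter fun z => ¬ z.1 = z.2)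
      (fun z => z.1 < z.2), Finset.filter_filter, Finset.filter_filter]
    congr 1
    · refine Finset.sum_congr (Finset.filter_congr fun z _ => ?_) fun _ _ => rfl
      omega
    · refine Finset.sum_congr (Finset.filter_congr fun z _ => ?_) fun _ _ => rfl
      omega
  have hS' : (S.card : ℝ) ≤ P := by
    rw [hS, Nat.card_Ioc]
    exact_mod_cast (Nat.sub_le v u).trans hv
  have hn : ‖((‖∑ x ∈ S, w x‖ ^ 2 : ℝ) : ℂ)‖ = ‖∑ x ∈ S, w x‖ ^ 2 := by
    rw [Complex.norm_real, Real.norm_of_nonneg (by positivity)]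
  rw [← hn, hsq]
  have hDn : ‖D‖ ≤ ∑ h ∈ Finset.Icc 1 P, ‖∑ x ∈ Finset.Ioc u (v - h), w (x + h) * conj (w x)‖ :=
    norm_sum_le _ _
  calc ‖(S.card : ℂ) + D + conj D‖ ≤ ‖(S.card : ℂ)‖ + ‖D‖ + ‖conj D‖ := norm_add₃_le
    _ = S.card + 2 * ‖D‖ := by rw [Complex.norm_natCast, RCLike.norm_conj]; ring
    _ ≤ _ := by gcongr

open ComplexConjugate in
lemma many_large_differences {w : ℕ → ℂ} (hw : ∀ x, ‖w x‖ = 1) {u v P : ℕ} (hv : v ≤ P) {H : ℝ}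
    (hH : 2 ≤ H) (hP : H ^ 6 ≤ P) (h : (P : ℝ) / H ≤ ‖∑ x ∈ Finset.Ioc u v, w x‖) :
    (P : ℝ) / H ^ 6 ≤ (((Finset.Icc 1 P).filter fun h => (P : ℝ) / H ^ 6
      ≤ ‖∑ x ∈ Finset.Ioc u (v - h), w (x + h) * conj (w x)‖).card : ℝ) := by
  have hH0 : 0 < H := by linarith
  have hP0 : (0 : ℝ) < P := lt_of_lt_of_le (by positivity) hP
  set T : ℕ → ℝ := fun h => ‖∑ x ∈ Finset.Ioc u (v - h), w (x + h) * conj (w x)‖ with hT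
  set G := (Finset.Icc 1 P).filter fun h => (P : ℝ) / H ^ 6 ≤ T h with hG
  have h1 := norm_sum_sq_le hw (u := u) hv
  have hTP : ∀ h, T h ≤ P := by
    intro h
    refine (norm_sum_le _ _).trans ?_
    simp only [norm_mul, RCLike.norm_conj, hw, Finset.sum_const, Nat.card_Ioc, mul_one, nsmul_eq_mul]
    exact_mod_cast (Nat.sub_le _ _).trans ((Nat.sub_le _ _).trans hv)
  have h2 : ∑ h ∈ Finset.Icc 1 P, T h ≤ G.card * P + P * (P / H ^ 6) := by
    rw [← Finset.sum_filter_add_sum_filter_not (Finset.Icc 1 P) (fun h => (P : ℝ) / H ^ 6 ≤ T h)]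
    refine add_le_add ?_ ?_
    · exact (Finset.sum_le_card_nsmul _ _ _ fun h _ => hTP h).trans_eq (nsmul_eq_mul _ _)
    · refine (Finset.sum_le_card_nsmul _ _ ((P : ℝ) / H ^ 6) fun h hh => ?_).trans ?_
      · exact (not_le.1 (Finset.mem_filter.1 hh).2).le
      · rw [nsmul_eq_mul]
        have : (((Finset.Icc 1 P).filter fun h => ¬ (P : ℝ) / H ^ 6 ≤ T h).card : ℝ) ≤ P := by
          have := Finset.card_filter_le (Finset.Icc 1 P) fun h => ¬ (P : ℝ) / H ^ 6 ≤ T h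
          rw [Nat.card_Icc, Nat.add_sub_cancel] at this
          exact_mod_cast this
        gcongr
  have h3 : (P : ℝ) ^ 2 / H ^ 2 ≤ P + 2 * (G.card * P + P * (P / H ^ 6)) := by
    calc (P : ℝ) ^ 2 / H ^ 2 = (P / H) ^ 2 := by rw [div_pow]
      _ ≤ ‖∑ x ∈ Finset.Ioc u v, w x‖ ^ 2 := by gcongr
      _ ≤ _ := h1.trans (by gcongr)
  have h4 : (P : ℝ) / H ^ 2 ≤ 1 + 2 * (G.card + P / H ^ 6) := by
    refine le_of_mul_le_mul_right ?_ hP0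
    calc (P : ℝ) / H ^ 2 * P = (P : ℝ) ^ 2 / H ^ 2 := by ring
      _ ≤ _ := h3
      _ = _ := by ring
  have h5 : (P : ℝ) / H ^ 2 = H ^ 4 * (P / H ^ 6) := by field_simp
  have h6 : 1 ≤ (P : ℝ) / H ^ 6 := by rwa [le_div_iff₀ (by positivity), one_mul]
  have h7 : (16 : ℝ) ≤ H ^ 4 := by
    calc (16 : ℝ) = 2 ^ 4 := by norm_num
      _ ≤ _ := by gcongr
  rw [h5] at h4
  nlinarith

end DiagonalSystem

namespace DiagonalSystem

/-- `β` is within `X` of an integer. -/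
def NearInt (β X : ℝ) : Prop := ∃ a : ℤ, |β - a| ≤ X

lemma NearInt.mono {β X Y : ℝ} (h : NearInt β X) (hXY : X ≤ Y) : NearInt β Y :=
  let ⟨a, ha⟩ := h; ⟨a, ha.trans hXY⟩

lemma NearInt.add {β γ X Y : ℝ} (h : NearInt β X) (h' : NearInt γ Y) : NearInt (β + γ) (X + Y) := by
  obtain ⟨a, ha⟩ := h
  obtain ⟨b, hb⟩ := h'
  refine ⟨a + b, ?_⟩
  push_cast
  calc |β + γ - (a + b)| = |(β - a) + (γ - b)| := by ring_nf
    _ ≤ _ := (abs_add_le _ _).trans (add_le_add ha hb)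

lemma NearInt.neg {β X : ℝ} (h : NearInt β X) : NearInt (-β) X := by
  obtain ⟨a, ha⟩ := h
  refine ⟨-a, ?_⟩
  push_cast
  rwa [show -β - -(a : ℝ) = -(β - a) by ring, abs_neg]

lemma NearInt.sub {β γ X Y : ℝ} (h : NearInt β X) (h' : NearInt γ Y) : NearInt (β - γ) (X + Y) := by
  rw [sub_eq_add_neg]
  exact h.add h'.neg

lemma NearInt.natCast_mul {β X : ℝ} (h : NearInt β X) (n : ℕ) : NearInt (n * β) (n * X) := by
  obtain ⟨a, ha⟩ := h
  refine ⟨n * a, ?_⟩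
  push_cast
  rw [← mul_sub, abs_mul, abs_of_nonneg (Nat.cast_nonneg n)]
  gcongr

lemma NearInt.sum {ι : Type*} {s : Finset ι} {β X : ι → ℝ} (h : ∀ i ∈ s, NearInt (β i) (X i)) :
    NearInt (∑ i ∈ s, β i) (∑ i ∈ s, X i) := by
  induction s using Finset.induction_on with
  | empty => exact ⟨0, by simp⟩
  | insert a s ha ih =>
    rw [Finset.sum_insert ha, Finset.sum_insert ha]
    exact (h a (Finset.mem_insert_self _ _)).add (ih fun i hi => h i (Finset.mem_insert_of_mem hi))

/-- Coefficients of the differenced polynomial. -/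
def diffCoeff (γ : ℕ → ℝ) (k h e : ℕ) : ℝ :=
  ∑ j ∈ Finset.Ioc e k, γ j * (j.choose e) * (h : ℝ) ^ (j - e)

lemma sum_diffCoeff (γ : ℕ → ℝ) (k h : ℕ) (x : ℝ) :
    ∑ e ∈ Finset.range k, diffCoeff γ k h e * x ^ e
      = ∑ j ∈ Finset.range (k + 1), γ j * (x + h) ^ j - ∑ j ∈ Finset.range (k + 1), γ j * x ^ j := by
  have : ∀ j, γ j * (x + h) ^ j - γ j * x ^ j
      = ∑ e ∈ Finset.range j, γ j * (j.choose e) * (h : ℝ) ^ (j - e) * x ^ e := by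
    intro j
    rw [add_pow, Finset.sum_range_succ, mul_add, Finset.mul_sum]
    simp only [Nat.sub_self, pow_zero, Nat.choose_self, Nat.cast_one, mul_one, add_sub_cancel_right]
    exact Finset.sum_congr rfl fun e _ => by ring
  rw [← Finset.sum_sub_distrib, Finset.sum_congr rfl fun j _ => this j]
  simp only [diffCoeff, Finset.sum_mul]
  refine Finset.sum_comm' fun e j => ?_
  simp only [Finset.mem_range, Finset.mem_Ioc]
  omega

lemma exists_denominator_of_diffCoeff (k n : ℕ) (hn : n ≤ k) : ∃ A : ℕ, ∀ H : ℝ, 2 ≤ H → ∀ P : ℕ, 1 ≤ P →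
    ∀ S ⊆ Finset.Icc 1 P, (P : ℝ) / H ≤ S.card → ∀ (γ : ℕ → ℝ) (q : ℕ), 1 ≤ q → (q : ℝ) ≤ H →
    (∀ h ∈ S, ∀ e, 1 ≤ e → e ≤ k → NearInt (q * diffCoeff γ (k + 1) h e) (H / (P : ℝ) ^ e)) →
    ∃ Q : ℕ, 1 ≤ Q ∧ (Q : ℝ) ≤ H ^ A ∧ ∀ j, k + 1 - n < j → j ≤ k + 1 →
      NearInt (Q * γ j) (H ^ A / (P : ℝ) ^ j) := by
  induction n with
  | zero =>
    refine ⟨0, fun H hH P hP S hS hSc γ q hq hqH h => ⟨1, le_rfl, by simp, fun j h1 h2 => ?_⟩⟩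
    omega
  | succ n ih =>
    obtain ⟨A, ih⟩ := ih (by omega)
    set j := k + 1 - n with hj
    set e := k - n with he
    have hje : j = e + 1 := by omega
    set B := A + 2 * k + 4 with hB
    refine ⟨B * (40 * (e + 1)) + A + 1 + (k + 1), fun H hH P hP S hS hSc γ q hq hqH h => ?_⟩
    obtain ⟨Q, hQ1, hQA, hQ⟩ := ih H hH P hP S hS hSc γ q hq hqH h
    have hH1 : 1 ≤ H := by linarith
    have hP0 : (0 : ℝ) < P := by exact_mod_cast hP
    have h2 : ∀ m : ℕ, (2 : ℝ) ^ m ≤ H ^ m := fun m => by gcongr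
    have hn2 : ∀ m : ℕ, (m : ℝ) ≤ H ^ m := fun m =>
      le_trans (by exact_mod_cast Nat.lt_two_pow_self.le) (h2 m)
    have key : ∀ h' ∈ S, NearInt ((Q * q * j : ℕ) * γ j * h') (H ^ B / (P : ℝ) ^ e) := by
      intro x hx
      have hxP : (x : ℝ) ≤ P := by exact_mod_cast (Finset.mem_Icc.1 (hS hx)).2
      have h1 := (h x hx e (by omega) (by omega)).natCast_mul Q
      have h3 : NearInt (∑ i ∈ Finset.Ioc j (k + 1), ((q * i.choose e * x ^ (i - e) : ℕ) : ℝ) * (Q * γ i))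
          (∑ i ∈ Finset.Ioc j (k + 1), H ^ (A + k + 2) / (P : ℝ) ^ e) := by
        refine NearInt.sum fun i hi => ?_
        rw [Finset.mem_Ioc] at hi
        refine ((hQ i (by omega) hi.2).natCast_mul _).mono ?_
        have hc : ((i.choose e : ℕ) : ℝ) ≤ H ^ (k + 1) := by
          refine le_trans ?_ (h2 (k + 1))
          have : i.choose e ≤ 2 ^ (k + 1) := (Nat.choose_le_two_pow i e).trans
            (Nat.pow_le_pow_right (by norm_num) hi.2)
          exact_mod_cast this
        push_cast
        calc (q : ℝ) * (i.choose e) * (x : ℝ) ^ (i - e) * (H ^ A / (P : ℝ) ^ i)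
            ≤ H * H ^ (k + 1) * (P : ℝ) ^ (i - e) * (H ^ A / (P : ℝ) ^ i) := by gcongr
          _ = _ := by
              have : (P : ℝ) ^ i = (P : ℝ) ^ (i - e) * (P : ℝ) ^ e := by
                rw [← pow_add]; congr 1; omega
              rw [this]
              field_simp
              ring
      have h4 := (h1.sub h3).mono (Y := H ^ B / (P : ℝ) ^ e) ?_
      · convert h4 using 1
        have hsplit : Finset.Ioc e (k + 1) = insert j (Finset.Ioc j (k + 1)) := by
          ext i
          simp only [Finset.mem_insert, Finset.mem_Ioc]
          omega
        have hcj : j.choose e = j := by rw [hje, Nat.choose_succ_self_right]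
        have hj1 : j - e = 1 := by omega
        rw [diffCoeff, hsplit, Finset.sum_insert (by simp), hcj, hj1, mul_add, mul_add, Finset.mul_sum,
          Finset.mul_sum, add_sub_assoc, ← Finset.sum_sub_distrib, Finset.sum_eq_zero fun i _ => ?_]
        · push_cast; ring
        · push_cast; ring
      · rw [Finset.sum_const, Nat.card_Ioc, nsmul_eq_mul]
        calc (Q : ℝ) * (H / (P : ℝ) ^ e) + ((k + 1 - j : ℕ) : ℝ) * (H ^ (A + k + 2) / (P : ℝ) ^ e)
            ≤ H ^ A * (H ^ (k + 2) / (P : ℝ) ^ e) + ((k : ℕ) : ℝ) * (H ^ (A + k + 2) / (P : ℝ) ^ e) := by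
              gcongr
              · exact le_self_pow₀ hH1 (by omega)
              · omega
          _ = ((k + 1 : ℕ) : ℝ) * (H ^ (A + k + 2) / (P : ℝ) ^ e) := by push_cast; ring
          _ ≤ H ^ (k + 1) * (H ^ (A + k + 2) / (P : ℝ) ^ e) := by
              gcongr
              exact hn2 _
          _ = H ^ (A + 2 * k + 3) / (P : ℝ) ^ e := by ring
          _ ≤ H ^ B / (P : ℝ) ^ e := by
              gcongr
              omega
    obtain ⟨q', hq'1, hq'H, a, ha⟩ := exists_approx_of_many (H := H ^ B)
      (le_trans (by linarith) (le_self_pow₀ hH1 (by omega : B ≠ 0))) hP hS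
      (le_trans (by gcongr; exact le_self_pow₀ hH1 (by omega : B ≠ 0)) hSc) (e := e) (by omega) key
    have hjH : (j : ℝ) ≤ H ^ (k + 1) := (hn2 j).trans (pow_le_pow_right₀ hH1 (by omega))
    rw [← pow_mul] at hq'H ha
    refine ⟨q' * (Q * q * j), ?_, ?_, ?_⟩
    · have : 0 < q' * (Q * q * j) := by
        have : 0 < j := by omega
        positivity
      omega
    · push_cast
      calc (q' : ℝ) * (Q * q * j) ≤ H ^ (B * (40 * (e + 1))) * (H ^ A * H * H ^ (k + 1)) := by gcongr
        _ = _ := by ring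
    · intro i hi1 hi2
      rcases eq_or_ne i j with hij | hij
      · refine ⟨a, ?_⟩
        rw [hij, show (P : ℝ) ^ j = (P : ℝ) ^ (e + 1) by rw [hje]]
        calc |((q' * (Q * q * j) : ℕ) : ℝ) * γ j - a|
            = |(q' : ℝ) * (((Q * q * j : ℕ) : ℝ) * γ j) - a| := by push_cast; ring_nf
          _ ≤ _ := ha
          _ ≤ _ := by
            gcongr
            omega
      · have := (hQ i (by omega) hi2).natCast_mul (q' * q * j)
        convert this.mono ?_ using 1
        · push_cast; ring
        · push_cast
          calc (q' : ℝ) * q * j * (H ^ A / (P : ℝ) ^ i)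
              ≤ H ^ (B * (40 * (e + 1))) * H * H ^ (k + 1) * (H ^ A / (P : ℝ) ^ i) := by gcongr
            _ = _ := by ring

end DiagonalSystem

namespace DiagonalSystem

lemma nearInt_of_norm_eC_sub_one_le {β X : ℝ} (h : ‖eC β - 1‖ ≤ X) : NearInt β X := by
  refine ⟨round β, ?_⟩
  set θ := β - round β with hθ
  have h1 : eC β = eC θ := by
    have := eC_add_int β (-round β)
    rw [← this, hθ]
    congr 1
    push_cast
    ring
  have h2 : |θ| ≤ 1 / 2 := abs_sub_round β
  rw [h1, show eC θ = Complex.exp (Complex.I * ((2 * Real.pi * θ : ℝ) : ℂ)) by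
    rw [eC]; congr 1; push_cast; ring, Complex.norm_exp_I_mul_ofReal_sub_one] at h
  have h3 := Real.mul_abs_le_abs_sin (x := 2 * Real.pi * θ / 2) (by
    rw [show 2 * Real.pi * θ / 2 = Real.pi * θ by ring, abs_mul, abs_of_pos Real.pi_pos]
    nlinarith [Real.pi_pos])
  rw [show 2 * Real.pi * θ / 2 = Real.pi * θ by ring, abs_mul, abs_of_pos Real.pi_pos,
    ← mul_assoc, div_mul_cancel₀ _ Real.pi_ne_zero] at h3
  rw [show 2 * Real.pi * θ / 2 = Real.pi * θ by ring, Real.norm_eq_abs, abs_mul, abs_two] at h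
  have := abs_nonneg θ
  linarith

lemma NearInt.norm_eC_sub_one_le {β X : ℝ} (h : NearInt β X) : ‖eC β - 1‖ ≤ 2 * Real.pi * X := by
  obtain ⟨a, ha⟩ := h
  have : eC β = eC (β - a) := by
    have := eC_add_int β (-a)
    rw [← this]
    congr 1
    push_cast
    ring
  rw [this]
  refine (DiagonalSystem.norm_eC_sub_one_le _).trans ?_
  have := Real.pi_pos
  gcongr

lemma nearInt_of_one_le (β : ℝ) {X : ℝ} (hX : 1 ≤ X) : NearInt β X :=
  ⟨round β, (abs_sub_round β).trans (by linarith)⟩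

lemma norm_sum_Ioc_shift_sub_le {w : ℕ → ℂ} (hw : ∀ x, ‖w x‖ = 1) (u v Q : ℕ) :
    ‖∑ x ∈ Finset.Ioc u v, w (x + Q) - ∑ x ∈ Finset.Ioc u v, w x‖ ≤ 2 * Q := by
  induction Q with
  | zero => simp
  | succ Q ih =>
    have h1 : ‖∑ x ∈ Finset.Ioc u v, w (x + (Q + 1)) - ∑ x ∈ Finset.Ioc u v, w (x + Q)‖ ≤ 2 := by
      rcases le_or_gt v u with hvu | hvu
      · simp [Finset.Ioc_eq_empty_of_le hvu]
      · have h3 : ∑ x ∈ Finset.Ioc u v, w (x + (Q + 1)) = ∑ x ∈ Finset.Ioc (u + 1) (v + 1), w (x + Q) := by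
          refine Finset.sum_bij' (fun x _ => x + 1) (fun x _ => x - 1) ?_ ?_ ?_ ?_ ?_
          · intro x hx; simp only [Finset.mem_Ioc] at hx ⊢; omega
          · intro x hx; simp only [Finset.mem_Ioc] at hx ⊢; omega
          · intro x hx; omega
          · intro x hx; simp only [Finset.mem_Ioc] at hx; omega
          · intro x hx; congr 1; omega
        have h4 : Finset.Ioc (u + 1) (v + 1) = insert (v + 1) (Finset.Ioc (u + 1) v) := by
          ext x; simp only [Finset.mem_insert, Finset.mem_Ioc]; omega
        have h5 : Finset.Ioc u v = insert (u + 1) (Finset.Ioc (u + 1) v) := by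
          ext x; simp only [Finset.mem_insert, Finset.mem_Ioc]; omega
        rw [h3, h4, h5, Finset.sum_insert (by simp), Finset.sum_insert (by simp), add_sub_add_right_eq_sub]
        refine (norm_sub_le _ _).trans ?_
        rw [hw, hw]
        norm_num
    calc ‖∑ x ∈ Finset.Ioc u v, w (x + (Q + 1)) - ∑ x ∈ Finset.Ioc u v, w x‖
        = ‖(∑ x ∈ Finset.Ioc u v, w (x + (Q + 1)) - ∑ x ∈ Finset.Ioc u v, w (x + Q))
          + (∑ x ∈ Finset.Ioc u v, w (x + Q) - ∑ x ∈ Finset.Ioc u v, w x)‖ := by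
            rw [sub_add_sub_cancel]
      _ ≤ 2 + 2 * Q := (norm_add_le _ _).trans (add_le_add h1 ih)
      _ = _ := by push_cast; ring

lemma nearInt_linear_coeff (k A : ℕ) : ∃ B : ℕ, ∀ H : ℝ, 2 ≤ H → ∀ P : ℕ, 1 ≤ P →
    ∀ (γ : ℕ → ℝ) (u v : ℕ), v ≤ P →
    (P : ℝ) / H ≤ ‖∑ x ∈ Finset.Ioc u v, eC (∑ e ∈ Finset.range (k + 2), γ e * (x : ℝ) ^ e)‖ →
    ∀ Q : ℕ, 1 ≤ Q → (Q : ℝ) ≤ H ^ A →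
    (∀ j, 1 < j → j ≤ k + 1 → NearInt (Q * γ j) (H ^ A / (P : ℝ) ^ j)) →
    NearInt (Q * γ 1) (H ^ B / P) := by
  refine ⟨A + 3 * k + 10, fun H hH P hP γ u v hv hsum Q hQ1 hQA hQ => ?_⟩
  have hH1 : 1 ≤ H := by linarith
  have hP0 : (0 : ℝ) < P := by exact_mod_cast hP
  rcases lt_or_ge P Q with hPQ | hQP
  · refine nearInt_of_one_le _ ?_
    rw [le_div_iff₀ hP0, one_mul]
    calc (P : ℝ) ≤ Q := by exact_mod_cast hPQ.le
      _ ≤ H ^ A := hQA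
      _ ≤ _ := pow_le_pow_right₀ hH1 (by omega)
  have h2 : ∀ m : ℕ, (2 : ℝ) ^ m ≤ H ^ m := fun m => by gcongr
  have hn2 : ∀ m : ℕ, (m : ℝ) ≤ H ^ m := fun m =>
    le_trans (by exact_mod_cast Nat.lt_two_pow_self.le) (h2 m)
  set θ : ℕ → ℝ := fun x => ∑ e ∈ Finset.range (k + 2), γ e * (x : ℝ) ^ e with hθ
  set w : ℕ → ℂ := fun x => eC (θ x) with hw
  have hw1 : ∀ x, ‖w x‖ = 1 := fun x => norm_eC _
  set A1 := A + 3 * k + 2 with hA1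
  have hnear : ∀ x ∈ Finset.Ioc u v, NearInt (θ (x + Q) - θ x - Q * γ 1) (H ^ A1 / P) := by
    intro x hx
    have hxP : x ≤ P := (Finset.mem_Ioc.1 hx).2.trans hv
    set g : ℕ → ℕ := fun j => ∑ i ∈ Finset.range j, (x + Q) ^ i * x ^ (j - 1 - i) with hg
    have hgd : ∀ j, ((x + Q : ℕ) : ℝ) ^ j - (x : ℝ) ^ j = g j * Q := by
      intro j
      rw [← geom_sum₂_mul, hg]
      push_cast
      ring
    have hgb : ∀ j, (g j : ℝ) ≤ j * (2 * P) ^ (j - 1) := by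
      intro j
      have : g j ≤ j * (2 * P) ^ (j - 1) := by
        refine (Finset.sum_le_card_nsmul _ _ ((2 * P) ^ (j - 1)) fun i hi => ?_).trans_eq ?_
        · rw [Finset.mem_range] at hi
          calc (x + Q) ^ i * x ^ (j - 1 - i) ≤ (2 * P) ^ i * (2 * P) ^ (j - 1 - i) := by
                gcongr <;> omega
            _ = _ := by rw [← pow_add]; congr 1; omega
        · rw [Finset.card_range, smul_eq_mul]
      exact_mod_cast this
    have heq : θ (x + Q) - θ x - Q * γ 1 = ∑ j ∈ Finset.Icc 2 (k + 1), (g j : ℝ) * (Q * γ j) := by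
      have hr : Finset.range (k + 2) = insert 0 (insert 1 (Finset.Icc 2 (k + 1))) := by
        ext i; simp only [Finset.mem_insert, Finset.mem_Icc, Finset.mem_range]; omega
      rw [hθ]
      simp only
      rw [← Finset.sum_sub_distrib, hr, Finset.sum_insert (by simp), Finset.sum_insert (by simp)]
      have : ∀ j ∈ Finset.Icc 2 (k + 1), γ j * ((x + Q : ℕ) : ℝ) ^ j - γ j * (x : ℝ) ^ j
          = (g j : ℝ) * (Q * γ j) := fun j _ => by rw [← mul_sub, hgd]; ring
      rw [Finset.sum_congr rfl this]
      push_cast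
      ring
    rw [heq]
    refine (NearInt.sum (X := fun _ => H ^ (A + 2 * k + 2) / P) fun j hj => ?_).mono ?_
    · rw [Finset.mem_Icc] at hj
      refine ((hQ j (by omega) hj.2).natCast_mul (g j)).mono ?_
      calc (g j : ℝ) * (H ^ A / (P : ℝ) ^ j) ≤ (j * (2 * P) ^ (j - 1)) * (H ^ A / (P : ℝ) ^ j) := by
            gcongr; exact hgb j
        _ = j * 2 ^ (j - 1) * (H ^ A / P) := by
            have : (P : ℝ) ^ j = (P : ℝ) ^ (j - 1) * P := by
              rw [← pow_succ]; congr 1; omega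
            rw [this, mul_pow]
            field_simp
        _ ≤ H ^ (k + 1) * H ^ (k + 1) * (H ^ A / P) := by
            gcongr
            · exact (hn2 j).trans (pow_le_pow_right₀ hH1 hj.2)
            · exact (h2 _).trans (pow_le_pow_right₀ hH1 (by omega))
        _ = _ := by ring
    · rw [Finset.sum_const, Nat.card_Icc, nsmul_eq_mul, show k + 1 + 1 - 2 = k by omega]
      calc (k : ℝ) * (H ^ (A + 2 * k + 2) / P) ≤ H ^ k * (H ^ (A + 2 * k + 2) / P) := by
            gcongr; exact hn2 k
        _ = _ := by ring
  have hshift := norm_sum_Ioc_shift_sub_le hw1 u v Q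
  have hpi : 2 * Real.pi ≤ H ^ 3 := by
    have := Real.pi_lt_four
    calc 2 * Real.pi ≤ 2 ^ 3 := by linarith
      _ ≤ _ := h2 3
  have happ : ‖∑ x ∈ Finset.Ioc u v, w (x + Q) - eC (Q * γ 1) * ∑ x ∈ Finset.Ioc u v, w x‖
      ≤ H ^ (A1 + 3) := by
    rw [Finset.mul_sum, ← Finset.sum_sub_distrib]
    refine (norm_sum_le_of_le (f := fun x => w (x + Q) - eC (Q * γ 1) * w x) (n := fun _ => H ^ (A1 + 3) / P) _ fun x hx => ?_).trans ?_
    · have : w (x + Q) - eC (Q * γ 1) * w x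
          = eC (Q * γ 1) * w x * (eC (θ (x + Q) - θ x - Q * γ 1) - 1) := by
        rw [mul_sub, mul_one, hw]
        simp only
        rw [← eC_add, ← eC_add]
        congr 2
        ring
      rw [this, norm_mul, norm_mul, norm_eC, hw1, one_mul, one_mul]
      refine (hnear x hx).norm_eC_sub_one_le.trans ?_
      calc 2 * Real.pi * (H ^ A1 / P) ≤ H ^ 3 * (H ^ A1 / P) := by gcongr
        _ = _ := by ring
    · rw [Finset.sum_const, Nat.card_Ioc, nsmul_eq_mul]
      calc ((v - u : ℕ) : ℝ) * (H ^ (A1 + 3) / P) ≤ P * (H ^ (A1 + 3) / P) := by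
            gcongr; omega
        _ = _ := by field_simp
  have hfin : ‖eC (Q * γ 1) - 1‖ * (P / H) ≤ H ^ (A1 + 4) + 2 * Q := by
    calc ‖eC (Q * γ 1) - 1‖ * (P / H)
        ≤ ‖eC (Q * γ 1) - 1‖ * ‖∑ x ∈ Finset.Ioc u v, w x‖ := by gcongr
      _ = ‖(∑ x ∈ Finset.Ioc u v, w (x + Q) - ∑ x ∈ Finset.Ioc u v, w x)
          - (∑ x ∈ Finset.Ioc u v, w (x + Q) - eC (Q * γ 1) * ∑ x ∈ Finset.Ioc u v, w x)‖ := by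
          rw [← norm_mul]; congr 1; ring
      _ ≤ 2 * Q + H ^ (A1 + 3) := (norm_sub_le _ _).trans (add_le_add hshift happ)
      _ ≤ _ := by
          rw [add_comm]
          gcongr
          · norm_num
  refine nearInt_of_norm_eC_sub_one_le ?_
  rw [le_div_iff₀ hP0]
  have hQ2 : 2 * (Q : ℝ) ≤ H ^ (A1 + 4) := by
    calc 2 * (Q : ℝ) ≤ H * H ^ A := by gcongr
      _ = H ^ (A + 1) := by ring
      _ ≤ _ := pow_le_pow_right₀ hH1 (by omega)
  calc ‖eC (Q * γ 1) - 1‖ * P = H * (‖eC (Q * γ 1) - 1‖ * (P / H)) := by field_simp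
    _ ≤ H * (H ^ (A1 + 4) + H ^ (A1 + 4)) := by gcongr; linarith
    _ = 2 * H ^ (A1 + 5) := by ring
    _ ≤ H * H ^ (A1 + 5) := by gcongr
    _ = H ^ (A1 + 6) := by ring
    _ ≤ _ := pow_le_pow_right₀ hH1 (by omega)

open ComplexConjugate in
/-- Weyl's inequality. -/
theorem weyl (k : ℕ) : ∃ A : ℕ, ∀ H : ℝ, 2 ≤ H → ∀ P : ℕ, 1 ≤ P →
    ∀ (γ : ℕ → ℝ) (u v : ℕ), v ≤ P →
    (P : ℝ) / H ≤ ‖∑ x ∈ Finset.Ioc u v, eC (∑ e ∈ Finset.range (k + 1), γ e * (x : ℝ) ^ e)‖ →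
    ∃ Q : ℕ, 1 ≤ Q ∧ (Q : ℝ) ≤ H ^ A ∧ ∀ e, 1 ≤ e → e ≤ k →
      NearInt (Q * γ e) (H ^ A / (P : ℝ) ^ e) := by
  induction k with
  | zero => exact ⟨0, fun H _ P _ γ u v _ _ => ⟨1, le_rfl, by simp, fun e h1 h2 => by omega⟩⟩
  | succ k ih =>
    obtain ⟨A, ih⟩ := ih
    obtain ⟨A', hA'⟩ := exists_denominator_of_diffCoeff k k le_rfl
    set D := 6 * A + 7 with hD
    obtain ⟨B, hB⟩ := nearInt_linear_coeff k (D * A')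
    refine ⟨D * A' + B + 6 * (k + 1), fun H hH P hP γ u v hv hsum => ?_⟩
    have hH1 : 1 ≤ H := by linarith
    have hP0 : (0 : ℝ) < P := by exact_mod_cast hP
    have hP1 : (1 : ℝ) ≤ P := by exact_mod_cast hP
    rcases lt_or_ge (P : ℝ) (H ^ 6) with hPH | hPH
    · refine ⟨1, le_rfl, by simpa using one_le_pow₀ hH1, fun e h1 h2 => nearInt_of_one_le _ ?_⟩
      rw [le_div_iff₀ (by positivity), one_mul]
      calc (P : ℝ) ^ e ≤ (H ^ 6) ^ e := by gcongr
        _ = H ^ (6 * e) := by rw [pow_mul]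
        _ ≤ _ := pow_le_pow_right₀ hH1 (by omega)
    set w : ℕ → ℂ := fun x => eC (∑ e ∈ Finset.range (k + 1 + 1), γ e * (x : ℝ) ^ e) with hw
    have hw1 : ∀ x, ‖w x‖ = 1 := fun x => norm_eC _
    have hmany := many_large_differences hw1 hv hH hPH hsum
    set G := (Finset.Icc 1 P).filter fun h => (P : ℝ) / H ^ 6
      ≤ ‖∑ x ∈ Finset.Ioc u (v - h), w (x + h) * conj (w x)‖ with hG
    have hdiff : ∀ h x, w (x + h) * conj (w x)
        = eC (∑ e ∈ Finset.range (k + 1), diffCoeff γ (k + 1) h e * (x : ℝ) ^ e) := by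
      intro h x
      rw [sum_diffCoeff, hw]
      simp only
      rw [conj_eC, ← eC_add, sub_eq_add_neg]
      push_cast
      rfl
    have hqe : ∀ h, ∃ q : ℕ, h ∈ G → 1 ≤ q ∧ (q : ℝ) ≤ (H ^ 6) ^ A ∧ ∀ e, 1 ≤ e → e ≤ k →
        NearInt (q * diffCoeff γ (k + 1) h e) ((H ^ 6) ^ A / (P : ℝ) ^ e) := by
      intro h
      by_cases hh : h ∈ G
      · obtain ⟨q, hq⟩ := ih (H ^ 6) (hH.trans (le_self_pow₀ hH1 (by norm_num))) P hP
          (diffCoeff γ (k + 1) h) u (v - h) ((Nat.sub_le _ _).trans hv) (by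
            have := (Finset.mem_filter.1 hh).2
            simpa only [hdiff] using this)
        exact ⟨q, fun _ => hq⟩
      · exact ⟨0, fun h' => absurd h' hh⟩
    choose q hq using hqe
    set n := ⌊(H ^ 6) ^ A⌋₊ + 1 with hn
    obtain ⟨q0, -, hq0⟩ := exists_fiber_card_ge (T := G) (n := n) (Nat.succ_pos _) q fun h hh =>
      Nat.lt_succ_of_le (Nat.le_floor (hq h hh).2.1)
    set S := G.filter fun h => q h = q0 with hS
    have hH6A : (1 : ℝ) ≤ (H ^ 6) ^ A := one_le_pow₀ (one_le_pow₀ hH1)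
    have hnH : (n : ℝ) ≤ H * (H ^ 6) ^ A := by
      rw [hn]
      push_cast
      have := Nat.floor_le (zero_le_one.trans hH6A)
      nlinarith
    have hHD : H ^ D = H ^ 6 * (H * (H ^ 6) ^ A) := by
      rw [hD, ← pow_mul]; ring
    have hn0 : (0 : ℝ) < n := by positivity
    have hSc : (P : ℝ) / H ^ D ≤ S.card := by
      refine le_trans ?_ hq0
      rw [hHD, ← div_div]
      gcongr
    have hSpos : 0 < S.card := by
      have : (0 : ℝ) < S.card := lt_of_lt_of_le (by positivity) hSc
      exact_mod_cast this
    obtain ⟨h0, hh0⟩ := Finset.card_pos.1 hSpos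
    have hSm : ∀ h ∈ S, h ∈ G ∧ q h = q0 := fun h hh => Finset.mem_filter.1 hh
    have h6D : (H ^ 6) ^ A ≤ H ^ D := by
      rw [← pow_mul]
      exact pow_le_pow_right₀ hH1 (by omega)
    obtain ⟨Q, hQ1, hQA, hQ⟩ := hA' (H ^ D) (hH.trans (le_self_pow₀ hH1 (by omega))) P hP S
      ((Finset.filter_subset _ _).trans (Finset.filter_subset _ _)) hSc γ q0
      (by have := (hq h0 (hSm h0 hh0).1).1; rwa [(hSm h0 hh0).2] at this)
      (by have := (hq h0 (hSm h0 hh0).1).2.1; rw [(hSm h0 hh0).2] at this; exact this.trans h6D)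
      (fun h hh e h1 h2 => by
        have := (hq h (hSm h hh).1).2.2 e h1 h2
        rw [(hSm h hh).2] at this
        exact this.mono (by gcongr))
    rw [← pow_mul] at hQA
    have hQ' : ∀ j, 1 < j → j ≤ k + 1 → NearInt (Q * γ j) (H ^ (D * A') / (P : ℝ) ^ j) := by
      intro j h1 h2
      rw [pow_mul]
      exact hQ j (by omega) h2
    refine ⟨Q, hQ1, hQA.trans (pow_le_pow_right₀ hH1 (by omega)), fun e h1 h2 => ?_⟩
    rcases Nat.lt_or_ge 1 e with he | he
    · refine (hQ' e he h2).mono ?_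
      gcongr
      omega
    · obtain rfl : e = 1 := by omega
      rw [pow_one]
      refine (hB H hH P hP γ u v hv hsum Q hQ1 hQA hQ').mono ?_
      gcongr
      omega

end DiagonalSystem

namespace DiagonalSystem

lemma NearInt.intCast_mul {β X : ℝ} (h : NearInt β X) (n : ℤ) : NearInt (n * β) (n.natAbs * X) := by
  obtain ⟨a, ha⟩ := h
  refine ⟨n * a, ?_⟩
  push_cast
  rw [← mul_sub, abs_mul, Nat.cast_natAbs, Int.cast_abs]
  gcongr

/-- The coefficient of `x ^ e` in the phase of `fsum d c P j`. -/
def phaseCoeff {ι : Type*} [Fintype ι] (d : ι → ℕ) {s : ℕ} (c : ι → Fin s → ℤ) (α : ι → ℝ) (j : Fin s)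
    (e : ℕ) : ℝ :=
  ∑ i ∈ Finset.univ.filter fun i => d i = e, α i * c i j

lemma fsum_eq_sum_Ioc {ι : Type*} [Fintype ι] (d : ι → ℕ) {s : ℕ} (c : ι → Fin s → ℤ) {K : ℕ}
    (hK : ∀ i, d i ≤ K) (P : ℕ) (j : Fin s) (α : ι → ℝ) :
    fsum d c P j α
      = ∑ x ∈ Finset.Ioc 0 P, eC (∑ e ∈ Finset.range (K + 1), phaseCoeff d c α j e * (x : ℝ) ^ e) := by
  rw [fsum]
  refine Finset.sum_congr rfl fun x _ => ?_
  congr 1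
  rw [← Finset.sum_fiberwise_of_maps_to (s := Finset.univ) (t := Finset.range (K + 1)) (g := d)
    fun i _ => Finset.mem_range.2 (Nat.lt_succ_of_le (hK i))]
  refine Finset.sum_congr rfl fun e _ => ?_
  rw [phaseCoeff, Finset.sum_mul]
  refine Finset.sum_congr rfl fun i hi => ?_
  rw [(Finset.mem_filter.1 hi).2, mul_assoc]

/-- The major arcs. -/
def major {ι : Type*} (d : ι → ℕ) (H : ℝ) (P : ℕ) : Set (ι → ℝ) :=
  {α | ∃ q : ℕ, 1 ≤ q ∧ (q : ℝ) ≤ H ∧ ∃ a : ι → ℤ, ∀ i, |α i - a i / q| ≤ H / (P : ℝ) ^ d i}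

lemma mem_major_of_nearInt {ι : Type*} {d : ι → ℕ} {H : ℝ} {P : ℕ} {α : ι → ℝ} {q : ℕ} (hq : 1 ≤ q)
    (hqH : (q : ℝ) ≤ H) (h : ∀ i, NearInt (q * α i) (H / (P : ℝ) ^ d i)) : α ∈ major d H P := by
  choose a ha using h
  refine ⟨q, hq, hqH, a, fun i => le_trans ?_ (ha i)⟩
  have hq0 : (1 : ℝ) ≤ q := by exact_mod_cast hq
  have : |(q : ℝ) * α i - a i| = q * |α i - a i / q| := by
    rw [← abs_of_pos (show (0 : ℝ) < q by linarith), ← abs_mul, abs_of_pos (show (0 : ℝ) < q by linarith),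
      mul_sub, mul_div_cancel₀ _ (by linarith)]
  rw [this]
  exact le_mul_of_one_le_left (abs_nonneg _) hq0

variable {t : ℕ} {ν μ : Fin t → ℕ} {k : (l : Fin t) → Fin (ν l) → ℕ}

lemma phaseCoeff_deg (hinj : Function.Injective fun p : KIdx t ν => k p.1 p.2) {s : ℕ}
    (c : EqIdx t ν μ → Fin s → ℤ) (α : EqIdx t ν μ → ℝ) (j : Fin s) (l : Fin t) (n : Fin (ν l)) :
    phaseCoeff (deg t ν μ k) c α j (k l n) = ∑ a : Fin (μ l), α ⟨l, (n, a)⟩ * c ⟨l, (n, a)⟩ j := by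
  have : (Finset.univ.filter fun i : EqIdx t ν μ => deg t ν μ k i = k l n)
      = Finset.univ.image fun a : Fin (μ l) => (⟨l, (n, a)⟩ : EqIdx t ν μ) := by
    ext ⟨l', n', a'⟩
    rw [Finset.mem_filter, Finset.mem_image]
    simp only [Finset.mem_univ, true_and, deg]
    constructor
    · intro h
      have := @hinj ⟨l', n'⟩ ⟨l, n⟩ h
      obtain ⟨rfl, h2⟩ := Sigma.mk.inj_iff.1 this
      obtain rfl := eq_of_heq h2
      exact ⟨a', rfl⟩
    · rintro ⟨a, ha⟩
      obtain ⟨rfl, h2⟩ := Sigma.mk.inj_iff.1 ha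
      have := eq_of_heq h2
      simp only [Prod.mk.injEq] at this
      rw [this.1]
  rw [phaseCoeff, this, Finset.sum_image]
  intro a _ b _ hab
  have := eq_of_heq (Sigma.mk.inj_iff.1 hab).2
  simpa using this

lemma exists_nearInt_coord (hinj : Function.Injective fun p : KIdx t ν => k p.1 p.2) {s : ℕ}
    {c : EqIdx t ν μ → Fin s → ℤ} (hns : HighlyNonSingular t ν μ s c) {M : ℕ} (hM : ∀ l, μ l ≤ M)
    {j : Fin M → Fin s} (hj : Function.Injective j) (i : EqIdx t ν μ) :
    ∃ n C : ℕ, 1 ≤ n ∧ ∀ (α : EqIdx t ν μ → ℝ) (Q : ℕ) (X : ℝ),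
      (∀ m, NearInt (Q * phaseCoeff (deg t ν μ k) c α (j m) (deg t ν μ k i)) X) →
      NearInt (n * (Q * α i)) (C * X) := by
  obtain ⟨l, n, a⟩ := i
  set T : Fin (μ l) → Fin M := Fin.castLE (hM l)
  have hT : Function.Injective T := Fin.castLE_injective _
  set D : Matrix (Fin (μ l)) (Fin (μ l)) ℤ :=
    Matrix.of fun m m' : Fin (μ l) => c ⟨l, (n, m)⟩ ((j ∘ T) m') with hD
  have hdet : D.det ≠ 0 := hns.2 l n (j ∘ T) (hj.comp hT)
  refine ⟨D.det.natAbs, ∑ b, (D.adjugate b a).natAbs, Int.natAbs_pos.2 hdet, fun α Q X h => ?_⟩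
  have h1 : NearInt (∑ b, (D.adjugate b a : ℝ)
      * (Q * phaseCoeff (deg t ν μ k) c α (j (T b)) (k l n))) (∑ b, (D.adjugate b a).natAbs * X) :=
    NearInt.sum fun b _ => (h (T b)).intCast_mul _
  have h2 : ∑ b, (D.adjugate b a : ℝ) * (Q * phaseCoeff (deg t ν μ k) c α (j (T b)) (k l n))
      = D.det * (Q * α ⟨l, (n, a)⟩) := by
    have h3 : ∀ a', ∑ b, (D a' b : ℝ) * (D.adjugate b a : ℝ) = if a' = a then (D.det : ℝ) else 0 := by
      intro a'
      have := congrFun (congrFun (Matrix.mul_adjugate D) a') a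
      rw [Matrix.mul_apply, Matrix.smul_apply, Matrix.one_apply] at this
      have h4 : ((∑ b, D a' b * D.adjugate b a : ℤ) : ℝ) = ((D.det • if a' = a then (1 : ℤ) else 0 : ℤ) : ℝ) := by
        rw [this]
      push_cast at h4
      rw [h4]
      split_ifs <;> simp
    simp_rw [phaseCoeff_deg hinj]
    calc ∑ b, (D.adjugate b a : ℝ) * (Q * ∑ a', α ⟨l, (n, a')⟩ * c ⟨l, (n, a')⟩ (j (T b)))
        = ∑ a', (Q * α ⟨l, (n, a')⟩) * ∑ b, (D a' b : ℝ) * (D.adjugate b a : ℝ) := by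
          simp_rw [Finset.mul_sum]
          rw [Finset.sum_comm]
          refine Finset.sum_congr rfl fun a' _ => Finset.sum_congr rfl fun b _ => ?_
          simp only [hD, Matrix.of_apply, Function.comp]
          ring
      _ = _ := by
          simp_rw [h3]
          simp [mul_comm]
  rw [h2] at h1
  push_cast
  rw [Finset.sum_mul]
  obtain ⟨N, hN⟩ : ∃ N, N = D.det.natAbs := ⟨_, rfl⟩
  have h5 := Int.natAbs_eq D.det
  rw [← hN] at h5 ⊢
  rcases h5 with h5 | h5
  · rwa [h5, Int.cast_natCast] at h1
  · have := h1.neg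
    rwa [h5, Int.cast_neg, Int.cast_natCast, neg_mul, neg_neg] at this

/-- Weyl's inequality for the system: if `M` different exponential sums are simultaneously large,
the point lies on the major arcs. -/
theorem mem_major_of_large (hinj : Function.Injective fun p : KIdx t ν => k p.1 p.2)
    (hpos : ∀ l n, 0 < k l n) {s : ℕ}
    {c : EqIdx t ν μ → Fin s → ℤ} (hns : HighlyNonSingular t ν μ s c) {M : ℕ} (hM : ∀ l, μ l ≤ M) :
    ∃ A : ℕ, 1 ≤ A ∧ ∀ H : ℝ, 2 ≤ H → ∀ P : ℕ, 1 ≤ P → ∀ j : Fin M → Fin s, Function.Injective j →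
      ∀ α, (∀ m, (P : ℝ) / H ≤ ‖fsum (deg t ν μ k) c P (j m) α‖) → α ∈ major (deg t ν μ k) (H ^ A) P := by
  set K := ∑ i, deg t ν μ k i with hKdef
  have hK : ∀ i, deg t ν μ k i ≤ K := fun i =>
    Finset.single_le_sum (f := deg t ν μ k) (fun _ _ => Nat.zero_le _) (Finset.mem_univ i)
  obtain ⟨A, hA⟩ := weyl K
  have hfix : ∀ j : Fin M → Fin s, ∃ B : ℕ, Function.Injective j → ∀ H : ℝ, 2 ≤ H → ∀ P : ℕ, 1 ≤ P →
      ∀ α, (∀ m, (P : ℝ) / H ≤ ‖fsum (deg t ν μ k) c P (j m) α‖) →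
        α ∈ major (deg t ν μ k) (H ^ (A * M + B)) P := by
    intro j
    by_cases hj : Function.Injective j
    swap
    · exact ⟨0, fun h => absurd h hj⟩
    choose n C hn hC using exists_nearInt_coord hinj hns hM hj
    set D0 := ∏ i, n i with hD0
    have hD01 : 1 ≤ D0 := Finset.one_le_prod' fun i _ => hn i
    set B := D0 * (1 + ∑ i, C i) with hB
    refine ⟨B, fun _ H hH P hP α hα => ?_⟩
    have hH1 : 1 ≤ H := by linarith
    have hBH : (B : ℝ) ≤ H ^ B := le_trans (by exact_mod_cast Nat.lt_two_pow_self.le)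
      (show (2 : ℝ) ^ B ≤ H ^ B by gcongr)
    have hw : ∀ m, ∃ Q : ℕ, 1 ≤ Q ∧ (Q : ℝ) ≤ H ^ A ∧ ∀ e, 1 ≤ e → e ≤ K →
        NearInt (Q * phaseCoeff (deg t ν μ k) c α (j m) e) (H ^ A / (P : ℝ) ^ e) := fun m =>
      hA H hH P hP _ 0 P le_rfl (by rw [← fsum_eq_sum_Ioc _ _ hK]; exact hα m)
    choose Q hQ1 hQA hQ using hw
    set Q0 := ∏ m, Q m with hQ0
    have hQ01 : 1 ≤ Q0 := Finset.one_le_prod' fun i _ => hQ1 i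
    have hQ0A : (Q0 : ℝ) ≤ H ^ (A * M) := by
      rw [hQ0]
      push_cast
      refine (Finset.prod_le_prod (fun m _ => Nat.cast_nonneg _) fun m _ => hQA m).trans_eq ?_
      rw [Finset.prod_const, Finset.card_univ, Fintype.card_fin, ← pow_mul]
    have hQ0n : ∀ m e, 1 ≤ e → e ≤ K →
        NearInt (Q0 * phaseCoeff (deg t ν μ k) c α (j m) e) (H ^ (A * M) / (P : ℝ) ^ e) := by
      intro m e h1 h2
      have h3 := (hQ m e h1 h2).natCast_mul (∏ m' ∈ Finset.univ.erase m, Q m')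
      have h4 : Q0 = (∏ m' ∈ Finset.univ.erase m, Q m') * Q m :=
        (Finset.prod_erase_mul _ _ (Finset.mem_univ m)).symm
      rw [← mul_assoc, ← Nat.cast_mul, ← h4] at h3
      refine h3.mono ?_
      rw [← mul_div_assoc]
      gcongr
      push_cast
      have h5 : (∏ m' ∈ Finset.univ.erase m, (Q m' : ℝ)) ≤ ∏ m' ∈ Finset.univ.erase m, H ^ A :=
        Finset.prod_le_prod (fun m _ => Nat.cast_nonneg _) fun m _ => hQA m
      have h6 : H ^ (A * M) = (∏ m' ∈ Finset.univ.erase m, H ^ A) * H ^ A := by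
        rw [Finset.prod_erase_mul _ _ (Finset.mem_univ m), Finset.prod_const, Finset.card_univ,
          Fintype.card_fin, ← pow_mul]
      rw [h6]
      gcongr
    refine mem_major_of_nearInt (q := D0 * Q0) (Nat.mul_pos hD01 hQ01) ?_ fun i => ?_
    · push_cast
      rw [pow_add, mul_comm]
      gcongr
      refine le_trans ?_ hBH
      exact_mod_cast Nat.le_mul_of_pos_right _ (by omega)
    · have h1 := hC i α Q0 _ fun m => hQ0n m _ (hpos i.1 i.2.1) (hK i)
      have h2 := h1.natCast_mul (∏ i' ∈ Finset.univ.erase i, n i')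
      have h4 : D0 = (∏ i' ∈ Finset.univ.erase i, n i') * n i :=
        (Finset.prod_erase_mul _ _ (Finset.mem_univ i)).symm
      rw [← mul_assoc, ← Nat.cast_mul, ← h4, ← mul_assoc, ← Nat.cast_mul] at h2
      refine h2.mono ?_
      rw [← mul_assoc, ← mul_div_assoc, pow_add, mul_comm (H ^ (A * M))]
      gcongr
      refine le_trans ?_ hBH
      have h5 : ∏ i' ∈ Finset.univ.erase i, n i' ≤ D0 := by
        rw [h4]; exact Nat.le_mul_of_pos_right _ (hn i)
      have h6 : C i ≤ 1 + ∑ i, C i := le_trans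
        (Finset.single_le_sum (f := C) (fun _ _ => Nat.zero_le _) (Finset.mem_univ i)) (Nat.le_add_left _ _)
      exact_mod_cast Nat.mul_le_mul h5 h6
  choose B hB using hfix
  refine ⟨A * M + ∑ j, B j + 1, by omega, fun H hH P hP j hj α hα => ?_⟩
  obtain ⟨q, hq1, hqH, a, ha⟩ := hB j hj H hH P hP α hα
  have hle : H ^ (A * M + B j) ≤ H ^ (A * M + ∑ j, B j + 1) := by
    refine pow_le_pow_right₀ (by linarith) ?_
    have := Finset.single_le_sum (f := B) (fun _ _ => Nat.zero_le _) (Finset.mem_univ j)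
    omega
  exact ⟨q, hq1, hqH.trans hle, a, fun i => (ha i).trans (by gcongr)⟩

end DiagonalSystem

namespace DiagonalSystem

lemma exists_largest {s M : ℕ} (hMs : M ≤ s) (x : Fin s → ℝ) :
    ∃ j : Fin M → Fin s, Function.Injective j ∧ ∀ i, i ∉ Set.range j → ∀ m, x i ≤ x (j m) := by
  have hmono : Monotone (x ∘ Tuple.sort x) := Tuple.monotone_sort x
  refine ⟨fun m => Tuple.sort x ⟨s - M + m, by omega⟩, fun a b hab => ?_, fun i hi m => ?_⟩
  · have := (Tuple.sort x).injective hab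
    simp only [Fin.mk.injEq] at this
    exact Fin.ext (by omega)
  · obtain ⟨i', rfl⟩ := (Tuple.sort x).surjective i
    refine hmono (a := i') (b := ⟨s - M + m, by omega⟩) ?_
    rw [Fin.le_def]
    simp only
    by_contra! hlt
    refine hi ⟨⟨i' - (s - M), by omega⟩, ?_⟩
    simp only
    congr 1
    exact Fin.ext (by simp only; omega)

lemma exists_prod_le {s M : ℕ} (x : Fin s → ℝ) (hx0 : ∀ i, 0 ≤ x i) (hx1 : ∀ i, x i ≤ 1)
    {p : Fin M → ℕ} (hp : ∀ m, 1 ≤ p m) (hps : ∑ m, p m + 1 ≤ s) :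
    ∃ j : Fin M → Fin s, Function.Injective j ∧ ∀ m, ∏ i, x i ≤ x (j m) * ∏ m, x (j m) ^ p m := by
  have hsum : ∑ m, p m = ∑ m, (p m - 1) + M := by
    rw [Finset.sum_congr rfl fun m _ => (Nat.sub_add_cancel (hp m)).symm, Finset.sum_add_distrib]
    simp
  obtain ⟨j, hj, hjm⟩ := exists_largest (M := M) (by omega) x
  refine ⟨j, hj, fun m => ?_⟩
  obtain ⟨m1, -, hm1⟩ := Finset.exists_min_image Finset.univ (fun m => x (j m)) ⟨m, Finset.mem_univ m⟩
  have h1 : ∏ i, x i = (∏ m, x (j m)) * ∏ i ∈ (Finset.univ.image j)ᶜ, x i := by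
    rw [← Finset.prod_mul_prod_compl (Finset.univ.image j), Finset.prod_image fun a _ b _ h => hj h]
  have h2 : ∏ i ∈ (Finset.univ.image j)ᶜ, x i ≤ x (j m1) ^ (s - M) := by
    refine (Finset.prod_le_prod (fun i _ => hx0 i) fun i hi => hjm i ?_ m1).trans_eq ?_
    · simpa using hi
    · rw [Finset.prod_const, Finset.card_compl, Finset.card_image_of_injective _ hj]
      simp
  have h3 : x (j m1) ^ (s - M) ≤ x (j m) * ∏ m, x (j m) ^ (p m - 1) := by
    calc x (j m1) ^ (s - M) ≤ x (j m1) ^ (1 + ∑ m, (p m - 1)) :=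
          pow_le_pow_of_le_one (hx0 _) (hx1 _) (by omega)
      _ = x (j m1) * ∏ m, x (j m1) ^ (p m - 1) := by rw [pow_add, pow_one, Finset.prod_pow_eq_pow_sum]
      _ ≤ _ := by
          gcongr with m' _
          · exact Finset.prod_nonneg fun m _ => pow_nonneg (hx0 _) _
          · exact hx0 _
          · exact hm1 m (Finset.mem_univ _)
          · intro i _; exact pow_nonneg (hx0 _) _
          · exact hx0 _
          · exact hm1 m' (Finset.mem_univ _)
  rw [h1]
  calc (∏ m, x (j m)) * ∏ i ∈ (Finset.univ.image j)ᶜ, x i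
      ≤ (∏ m, x (j m)) * (x (j m) * ∏ m, x (j m) ^ (p m - 1)) :=
        mul_le_mul_of_nonneg_left (h2.trans h3) (Finset.prod_nonneg fun m _ => hx0 _)
    _ = x (j m) * ∏ m, x (j m) ^ p m := by
        rw [mul_left_comm, ← Finset.prod_mul_distrib]
        congr 1
        refine Finset.prod_congr rfl fun m' _ => ?_
        rw [← pow_succ', Nat.sub_add_cancel (hp m')]

lemma measurableSet_major {ι : Type*} [Finite ι] (d : ι → ℕ) (H : ℝ) (P : ℕ) :
    MeasurableSet (major d H P) := by
  have : major d H P = ⋃ q : ℕ, ⋃ _ : 1 ≤ q ∧ (q : ℝ) ≤ H, ⋃ a : ι → ℤ,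
      ⋂ i, {α : ι → ℝ | |α i - a i / q| ≤ H / (P : ℝ) ^ d i} := by
    ext α
    simp [major, and_assoc]
  rw [this]
  refine MeasurableSet.iUnion fun q => MeasurableSet.iUnion fun _ => MeasurableSet.iUnion fun a =>
    MeasurableSet.iInter fun i => ?_
  exact (isClosed_le (by fun_prop) continuous_const).measurableSet

variable {t : ℕ} {ν μ : Fin t → ℕ} {k : (l : Fin t) → Fin (ν l) → ℕ}

set_option maxHeartbeats 1000000 in
/-- The minor arc contribution. -/
theorem minor_arc_bound (hgrp : GroupedDegrees t ν μ k) {s : ℕ}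
    {c : EqIdx t ν μ → Fin s → ℤ} (hns : HighlyNonSingular t ν μ s c) {M : ℕ} (hM : ∀ l, μ l ≤ M) {κ : Fin M → ℕ} (hκ3 : ∀ m, 3 ≤ κ m)
    (hκ : ∀ m : Fin M, layerExps k μ m ⊆ Finset.Icc 1 (κ m))
    (hs : ∑ m, 2 * (κ m * (κ m - 1)) + 1 ≤ s) :
    ∃ A : ℕ, 1 ≤ A ∧ ∀ ε : ℝ, 0 < ε → ∃ C : ℝ, 0 < C ∧ ∀ H : ℝ, 2 ≤ H → ∀ P : ℕ, 1 ≤ P →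
      ∀ a : EqIdx t ν μ → ℝ,
      ∫ α in box a \ major (deg t ν μ k) (H ^ A) P, ∏ j, ‖fsum (deg t ν μ k) c P j α‖
        ≤ C * (P : ℝ) ^ ((s : ℝ) - Ktot t ν μ k + ε) / H := by
  obtain ⟨A, hA1, hA⟩ := mem_major_of_large hgrp.2.2.2.2.2 hgrp.2.2.2.2.1 hns hM
  refine ⟨A, hA1, fun ε hε => ?_⟩
  have hu : ∀ m, κ m * (κ m + 1) ≤ 2 * (κ m * (κ m - 1)) := fun m => by
    obtain ⟨n, hn⟩ := Nat.exists_eq_add_of_le (hκ3 m)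
    rw [hn, show 3 + n - 1 = 2 + n by omega]
    nlinarith
  obtain ⟨C, hC, hmv⟩ := system_mean_value hgrp hns hM (fun m => (by norm_num : 1 ≤ 3).trans (hκ3 m)) hκ
    (u := fun m => κ m * (κ m - 1)) hu hε
  set p : Fin M → ℕ := fun m => 2 * (κ m * (κ m - 1)) with hp
  have hp1 : ∀ m, 1 ≤ p m := fun m => by
    have := hκ3 m
    have : 0 < κ m * (κ m - 1) := Nat.mul_pos (by omega) (by omega)
    simp only [hp]
    omega
  set N : ℕ := Fintype.card (Fin M → Fin s)
  refine ⟨C * (N + 1), by positivity, fun H hH P hP a => ?_⟩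
  have hP0 : (0 : ℝ) < P := by exact_mod_cast hP
  have hH0 : 0 < H := by linarith
  set f := fsum (deg t ν μ k) c P with hf
  set J := (Finset.univ : Finset (Fin M → Fin s)).filter fun j => Function.Injective j
  have hpt : ∀ α ∉ major (deg t ν μ k) (H ^ A) P, ∏ j, ‖f j α‖
      ≤ (P : ℝ) ^ ((s : ℝ) - ∑ m, (p m : ℝ)) / H * ∑ j ∈ J, ∏ m, ‖f (j m) α‖ ^ p m := by
    intro α hα
    obtain ⟨j, hj, hjm⟩ := exists_prod_le (fun i => ‖f i α‖ / P) (fun i => by positivity)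
      (fun i => by rw [div_le_one hP0]; exact norm_fsum_le _ _ _ _ _) hp1 hs
    have hm : ∃ m, ‖f (j m) α‖ < P / H := by
      by_contra! hcon
      exact hα (hA H hH P hP j hj α hcon)
    obtain ⟨m, hm⟩ := hm
    have h1 := hjm m
    simp only [div_pow, Finset.prod_div_distrib, Finset.prod_const, Finset.card_univ,
      Fintype.card_fin, Finset.prod_pow_eq_pow_sum] at h1
    rw [div_le_iff₀ (by positivity)] at h1
    have h2 : (P : ℝ) ^ ((s : ℝ) - ∑ m, (p m : ℝ)) = (P : ℝ) ^ s / (P : ℝ) ^ (∑ m, p m) := by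
      rw [Real.rpow_sub hP0, Real.rpow_natCast, ← Nat.cast_sum, Real.rpow_natCast]
    rw [h2]
    calc ∏ j, ‖f j α‖ ≤ ‖f (j m) α‖ / P * ((∏ m, ‖f (j m) α‖ ^ p m) / (P : ℝ) ^ ∑ m, p m) * (P : ℝ) ^ s := h1
      _ ≤ 1 / H * ((∏ m, ‖f (j m) α‖ ^ p m) / (P : ℝ) ^ ∑ m, p m) * (P : ℝ) ^ s := by
          have h3 : ‖f (j m) α‖ / P ≤ 1 / H := by
            rw [div_le_iff₀ hP0]
            exact hm.le.trans_eq (by ring)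
          exact mul_le_mul_of_nonneg_right (mul_le_mul_of_nonneg_right h3 (by positivity)) (by positivity)
      _ = (P : ℝ) ^ s / (P : ℝ) ^ (∑ m, p m) / H * ∏ m, ‖f (j m) α‖ ^ p m := by
          generalize ∏ m, ‖f (j m) α‖ ^ p m = Z
          ring
      _ ≤ _ := by
          refine mul_le_mul_of_nonneg_left ?_ (by positivity)
          have hjJ : j ∈ J := Finset.mem_filter.2 ⟨Finset.mem_univ _, hj⟩
          have h4 : ∀ j ∈ J, 0 ≤ ∏ m, ‖f (j m) α‖ ^ p m := fun j _ => by positivity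
          exact Finset.single_le_sum h4 hjJ
  have hcont : Continuous fun α => ∏ j, ‖f j α‖ := by fun_prop
  have hcont2 : ∀ j : Fin M → Fin s, Continuous fun α => ∏ m, ‖f (j m) α‖ ^ p m := fun j => by fun_prop
  have hcont3 : Continuous fun α => (P : ℝ) ^ ((s : ℝ) - ∑ m, (p m : ℝ)) / H * ∑ j ∈ J, ∏ m, ‖f (j m) α‖ ^ p m := by
    fun_prop
  have hbb : Bornology.IsBounded (box a \ major (deg t ν μ k) (H ^ A) P) :=
    (isBounded_box a).subset Set.sdiff_subset
  calc ∫ α in box a \ major (deg t ν μ k) (H ^ A) P, ∏ j, ‖f j α‖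
      ≤ ∫ α in box a \ major (deg t ν μ k) (H ^ A) P,
          (P : ℝ) ^ ((s : ℝ) - ∑ m, (p m : ℝ)) / H * ∑ j ∈ J, ∏ m, ‖f (j m) α‖ ^ p m :=
        setIntegral_mono_on (integrableOn_of_continuous_pi hcont hbb)
          (integrableOn_of_continuous_pi hcont3 hbb)
          ((measurableSet_box a).diff (measurableSet_major _ _ _)) fun α hα => hpt α hα.2
    _ ≤ ∫ α in box a,
          (P : ℝ) ^ ((s : ℝ) - ∑ m, (p m : ℝ)) / H * ∑ j ∈ J, ∏ m, ‖f (j m) α‖ ^ p m :=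
        setIntegral_mono_set (integrableOn_of_continuous_pi hcont3 (isBounded_box a))
          (Eventually.of_forall fun α => by
            simp only [Pi.zero_apply]
            positivity) (Eventually.of_forall fun α hα => hα.1)
    _ = (P : ℝ) ^ ((s : ℝ) - ∑ m, (p m : ℝ)) / H * ∑ j ∈ J, ∫ α in box a, ∏ m, ‖f (j m) α‖ ^ p m := by
        rw [integral_const_mul, integral_finsetSum]
        exact fun j _ => integrableOn_of_continuous_pi (hcont2 j) (isBounded_box a)
    _ ≤ (P : ℝ) ^ ((s : ℝ) - ∑ m, (p m : ℝ)) / H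
          * ∑ j ∈ J, C * (P : ℝ) ^ ((∑ m, (p m : ℝ)) - Ktot t ν μ k + ε) := by
        gcongr with j hj
        refine (hmv P hP a j (Finset.mem_filter.1 hj).2).trans_eq ?_
        simp only [hp]
        push_cast
        rfl
    _ = (J.card : ℝ) * C * (P : ℝ) ^ ((s : ℝ) - Ktot t ν μ k + ε) / H := by
        rw [Finset.sum_const, nsmul_eq_mul]
        have : (P : ℝ) ^ ((s : ℝ) - Ktot t ν μ k + ε) = (P : ℝ) ^ ((s : ℝ) - ∑ m, (p m : ℝ))
            * (P : ℝ) ^ ((∑ m, (p m : ℝ)) - Ktot t ν μ k + ε) := by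
          rw [← Real.rpow_add hP0]
          congr 1
          ring
        rw [this]
        ring
    _ ≤ _ := by
        have h5 : (J.card : ℝ) ≤ N + 1 := by
          have : J.card ≤ N := Finset.card_le_univ _
          have : (J.card : ℝ) ≤ N := by exact_mod_cast this
          linarith
        rw [mul_comm C]
        gcongr

end DiagonalSystem

namespace DiagonalSystem

lemma sum_range_shift_of_periodic {w : ℕ → ℂ} {q : ℕ} (hw : ∀ x, w (x + q) = w x) (x : ℕ) :
    ∑ h ∈ Finset.range q, w (x + h) = ∑ h ∈ Finset.range q, w h := by
  induction x with
  | zero => simp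
  | succ x ih =>
    rw [← ih]
    have h1 := Finset.sum_range_succ (fun h => w (x + h)) q
    have h2 := Finset.sum_range_succ' (fun h => w (x + h)) q
    simp only [add_zero, hw] at h1 h2
    rw [h1] at h2
    rw [add_right_cancel h2]
    exact Finset.sum_congr rfl fun h _ => by congr 1; ring

lemma sum_range_mul_of_periodic {w : ℕ → ℂ} {q : ℕ} (hw : ∀ x, w (x + q) = w x) (n : ℕ) :
    ∑ h ∈ Finset.range (q * n), w h = n * ∑ h ∈ Finset.range q, w h := by
  induction n with
  | zero => simp
  | succ n ih =>
    rw [mul_add, mul_one, Finset.sum_range_add, ih, sum_range_shift_of_periodic hw]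
    push_cast; ring

lemma norm_sum_sub_integral_le {G : ℝ → ℂ} {L : ℝ} (hL : 0 ≤ L) (hG : Continuous G)
    (hGL : ∀ x ∈ Set.Icc (0 : ℝ) 2, ∀ y ∈ Set.Icc (0 : ℝ) 2, ‖G x - G y‖ ≤ L * |x - y|)
    {P : ℕ} (hP : 1 ≤ P) :
    ‖∑ x ∈ Finset.Ioc 0 P, G (x / P) - P * ∫ t in (0 : ℝ)..1, G t‖ ≤ L := by
  have hP0 : (0 : ℝ) < P := by exact_mod_cast hP
  have e1 : (P : ℂ) * ∫ t in (0 : ℝ)..1, G t = ∫ t in (0 : ℝ)..P, G (t / P) := by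
    rw [intervalIntegral.integral_comp_div _ hP0.ne', zero_div, div_self hP0.ne', Complex.real_smul]
    simp
  have e2 : ∫ t in (0 : ℝ)..P, G (t / P)
      = ∑ x ∈ Finset.range P, ∫ t in (x : ℝ)..(x + 1 : ℕ), G (t / P) := by
    have := intervalIntegral.sum_integral_adjacent_intervals (μ := volume)
      (f := fun t : ℝ => G (t / P)) (a := fun x : ℕ => (x : ℝ)) (n := P)
      fun x _ => (by fun_prop : Continuous fun t : ℝ => G (t / P)).intervalIntegrable _ _
    rw [this]; simp
  have e3 : ∑ x ∈ Finset.Ioc 0 P, G (x / P) = ∑ x ∈ Finset.range P, G ((x + 1 : ℕ) / P) := by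
    rw [Finset.range_eq_Ico, Finset.sum_Ico_add' (fun x : ℕ => G (x / P)) 0 P 1]
    congr 1
  rw [e1, e2, e3, ← Finset.sum_sub_distrib]
  calc _ ≤ ∑ x ∈ Finset.range P, L / P := by
        refine (norm_sum_le _ _).trans (Finset.sum_le_sum fun x hx => ?_)
        have hxP : (x : ℝ) + 1 ≤ P := by exact_mod_cast Finset.mem_range.1 hx
        have e4 : G ((x + 1 : ℕ) / P) = ∫ t in (x : ℝ)..(x + 1 : ℕ), G ((x + 1 : ℕ) / P) := by simp
        rw [e4, ← intervalIntegral.integral_sub intervalIntegrable_const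
          ((by fun_prop : Continuous fun t : ℝ => G (t / P)).intervalIntegrable _ _)]
        refine (intervalIntegral.norm_integral_le_of_norm_le_const (C := L / P) fun t ht => ?_).trans ?_
        · rw [Set.uIoc_of_le (by push_cast; linarith)] at ht
          push_cast at ht ⊢
          have hx0 : (0 : ℝ) ≤ x := by positivity
          have hm : ∀ y : ℝ, 0 ≤ y → y ≤ P → y / P ∈ Set.Icc (0 : ℝ) 2 := fun y h0 h1 =>
            ⟨by positivity, ((div_le_one hP0).2 h1).trans (by norm_num)⟩
          refine (hGL _ (hm _ (by linarith) hxP) _ (hm t (by linarith [ht.1]) (by linarith [ht.2]))).trans ?_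
          rw [← sub_div, abs_div, abs_of_pos hP0, abs_of_nonneg (by linarith [ht.2]),
            mul_div_assoc']
          gcongr
          nlinarith [ht.1]
        · push_cast
          simp
    _ = L := by simp; field_simp

lemma norm_sum_mul_periodic_sub_le {w : ℕ → ℂ} (hw1 : ∀ x, ‖w x‖ = 1) {q : ℕ} (hq : 1 ≤ q)
    (hw : ∀ x, w (x + q) = w x) {G : ℝ → ℂ} {L : ℝ} (hL : 0 ≤ L) (hG : Continuous G)
    (hG1 : ∀ x, ‖G x‖ = 1)
    (hGL : ∀ x ∈ Set.Icc (0 : ℝ) 2, ∀ y ∈ Set.Icc (0 : ℝ) 2, ‖G x - G y‖ ≤ L * |x - y|)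
    {P : ℕ} (hP : 1 ≤ P) :
    ‖∑ x ∈ Finset.Ioc 0 P, w x * G (x / P)
      - P * ((∑ h ∈ Finset.range q, w h) / q * ∫ t in (0 : ℝ)..1, G t)‖ ≤ q * (2 + 2 * L) := by
  have hP0 : (0 : ℝ) < P := by exact_mod_cast hP
  have hq0 : (0 : ℝ) < q := by exact_mod_cast hq
  have hqc : (q : ℂ) ≠ 0 := by exact_mod_cast hq0.ne'
  set σ := ∑ h ∈ Finset.range q, w h with hσ
  have hσ1 : ‖σ‖ ≤ q := by
    refine (norm_sum_le _ _).trans ?_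
    simp [hw1]
  have hσq : ‖σ / q‖ ≤ 1 := by
    rw [norm_div, Complex.norm_natCast, div_le_one hq0]
    exact hσ1
  have hI : ‖∫ t in (0 : ℝ)..1, G t‖ ≤ 1 := by
    refine (intervalIntegral.norm_integral_le_of_norm_le_const (C := 1) fun t _ => (hG1 t).le).trans ?_
    simp
  rcases lt_or_ge P q with hPq | hqP
  · have h1 : ‖∑ x ∈ Finset.Ioc 0 P, w x * G (x / P)‖ ≤ P := by
      refine (norm_sum_le _ _).trans ?_
      simp [hw1, hG1]
    have h2 : ‖(P : ℂ) * (σ / q * ∫ t in (0 : ℝ)..1, G t)‖ ≤ P := by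
      rw [norm_mul, norm_mul, Complex.norm_natCast]
      calc (P : ℝ) * (‖σ / q‖ * ‖∫ t in (0 : ℝ)..1, G t‖) ≤ P * (1 * 1) := by gcongr
        _ = P := by ring
    have hPq' : (P : ℝ) ≤ q := by exact_mod_cast hPq.le
    refine (norm_sub_le _ _).trans ?_
    nlinarith [mul_nonneg hq0.le hL]
  have hqP' : (q : ℝ) ≤ P := by exact_mod_cast hqP
  set S := ∑ x ∈ Finset.Ioc 0 P, w x * G (x / P) with hS
  set Γ := ∑ x ∈ Finset.Ioc 0 P, G (x / P) with hΓ
  have hh : ∀ h ∈ Finset.range q, ‖∑ x ∈ Finset.Ioc 0 P, w (x + h) * G (x / P) - S‖ ≤ q * (2 + L) := by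
    intro h hhq
    have hhq' : (h : ℝ) ≤ q := by exact_mod_cast (Finset.mem_range.1 hhq).le
    have h1 := norm_sum_Ioc_shift_sub_le (w := fun x : ℕ => w x * G (x / P))
      (fun x => by rw [norm_mul, hw1, hG1, one_mul]) 0 P h
    have h2 : ‖∑ x ∈ Finset.Ioc 0 P, w (x + h) * G (x / P)
        - ∑ x ∈ Finset.Ioc 0 P, w (x + h) * G ((x + h : ℕ) / P)‖ ≤ L * q := by
      rw [← Finset.sum_sub_distrib]
      calc _ ≤ ∑ x ∈ Finset.Ioc 0 P, L * (q / P) := by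
            refine (norm_sum_le _ _).trans (Finset.sum_le_sum fun x hx => ?_)
            have hxP : (x : ℝ) ≤ P := by exact_mod_cast (Finset.mem_Ioc.1 hx).2
            rw [← mul_sub, norm_mul, hw1, one_mul]
            refine (hGL _ ⟨by positivity, ?_⟩ _ ⟨by positivity, ?_⟩).trans ?_
            · rw [div_le_iff₀ hP0]; linarith
            · rw [div_le_iff₀ hP0]; push_cast; linarith
            · gcongr
              rw [← sub_div, abs_div, abs_of_pos hP0]
              gcongr
              push_cast
              rw [sub_add_cancel_left, abs_neg, abs_of_nonneg (by positivity)]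
              exact hhq'
        _ = L * q := by simp; field_simp
    calc _ ≤ ‖∑ x ∈ Finset.Ioc 0 P, w (x + h) * G (x / P)
        - ∑ x ∈ Finset.Ioc 0 P, w (x + h) * G ((x + h : ℕ) / P)‖
        + ‖∑ x ∈ Finset.Ioc 0 P, w (x + h) * G ((x + h : ℕ) / P) - S‖ := norm_sub_le_norm_sub_add_norm_sub _ _ _
      _ ≤ L * q + 2 * h := add_le_add h2 h1
      _ ≤ q * (2 + L) := by linarith
  have hav : ‖σ * Γ - q * S‖ ≤ q * (q * (2 + L)) := by
    have e1 : σ * Γ = ∑ h ∈ Finset.range q, ∑ x ∈ Finset.Ioc 0 P, w (x + h) * G (x / P) := by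
      rw [Finset.sum_comm, hΓ, Finset.mul_sum]
      refine Finset.sum_congr rfl fun x _ => ?_
      rw [← Finset.sum_mul, sum_range_shift_of_periodic hw]
    have e2 : (q : ℂ) * S = ∑ h ∈ Finset.range q, S := by simp
    rw [e1, e2, ← Finset.sum_sub_distrib]
    refine (norm_sum_le _ _).trans ((Finset.sum_le_sum hh).trans_eq ?_)
    simp
  have hav' : ‖S - σ / q * Γ‖ ≤ q * (2 + L) := by
    have e : S - σ / q * Γ = -(σ * Γ - q * S) / q := by field_simp; ring
    rw [e, norm_div, norm_neg, Complex.norm_natCast, div_le_iff₀ hq0]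
    linarith
  have hInt := norm_sum_sub_integral_le hL hG hGL hP
  calc _ = ‖(S - σ / q * Γ) + σ / q * (Γ - P * ∫ t in (0 : ℝ)..1, G t)‖ := by congr 1; ring
    _ ≤ q * (2 + L) + 1 * L := by
        refine (norm_add_le _ _).trans (add_le_add hav' ?_)
        rw [norm_mul]
        gcongr
    _ ≤ q * (2 + 2 * L) := by
        have : (1 : ℝ) ≤ q := by exact_mod_cast hq
        nlinarith

variable {ι : Type*} [Fintype ι] (d : ι → ℕ) {s : ℕ} (c : ι → Fin s → ℤ)

/-- The product of the denominators of a rational vector. -/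
def denProd (ρ : ι → ℚ) : ℕ := ∏ i, (ρ i).den

/-- The normalised complete exponential sum at a rational point. -/
def gaussMean (ρ : ι → ℚ) (j : Fin s) : ℂ :=
  (∑ h ∈ Finset.range (denProd ρ), eC (∑ i, (ρ i : ℝ) * (c i j * (h : ℝ) ^ d i))) / denProd ρ

/-- The oscillatory integral attached to the `j`-th variable. -/
def oscInt (b : ι → ℝ) (j : Fin s) : ℂ :=
  ∫ t in (0 : ℝ)..1, eC (∑ i, b i * (c i j * t ^ d i))

lemma exists_phase_period {ρ : ι → ℚ} {m : ℕ} (hm : ∀ i, ∃ a : ℤ, (m : ℚ) * ρ i = a) (j : Fin s) (x : ℕ) :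
    eC (∑ i, (ρ i : ℝ) * (c i j * ((x + m : ℕ) : ℝ) ^ d i))
      = eC (∑ i, (ρ i : ℝ) * (c i j * (x : ℝ) ^ d i)) := by
  choose a ha using hm
  have hdvd : ∀ i, ∃ z : ℤ, ((x + m : ℕ) : ℤ) ^ d i = (x : ℤ) ^ d i + m * z := fun i => by
    obtain ⟨z, hz⟩ := sub_dvd_pow_sub_pow ((x + m : ℕ) : ℤ) (x : ℤ) (d i)
    refine ⟨z, ?_⟩
    push_cast at hz ⊢
    linear_combination hz
  choose z hz using hdvd
  rw [← eC_add_int (∑ i, (ρ i : ℝ) * (c i j * (x : ℝ) ^ d i)) (∑ i, a i * (c i j * z i))]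
  congr 1
  push_cast
  rw [← Finset.sum_add_distrib]
  refine Finset.sum_congr rfl fun i _ => ?_
  have h1 : ((x + m : ℕ) : ℝ) ^ d i = (x : ℝ) ^ d i + m * z i := by exact_mod_cast hz i
  have h2 : (m : ℝ) * ρ i = a i := by exact_mod_cast congrArg (fun y : ℚ => (y : ℝ)) (ha i)
  push_cast at h1
  rw [h1, ← h2]
  ring

lemma denProd_pos (ρ : ι → ℚ) : 1 ≤ denProd ρ :=
  Nat.one_le_iff_ne_zero.2 (Finset.prod_ne_zero_iff.2 fun i _ => (ρ i).den_nz)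

lemma denProd_mul (ρ : ι → ℚ) (i : ι) : ∃ a : ℤ, (denProd ρ : ℚ) * ρ i = a := by
  refine ⟨(∏ i' ∈ Finset.univ.erase i, ((ρ i').den : ℤ)) * (ρ i).num, ?_⟩
  rw [denProd, ← Finset.mul_prod_erase _ _ (Finset.mem_univ i)]
  push_cast
  have := Rat.mul_den_eq_num (ρ i)
  linear_combination (∏ i' ∈ Finset.univ.erase i, ((ρ i').den : ℚ)) * this

lemma gaussMean_eq {ρ : ι → ℚ} {m : ℕ} (hm1 : 1 ≤ m) (hm : ∀ i, ∃ a : ℤ, (m : ℚ) * ρ i = a)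
    (j : Fin s) : gaussMean d c ρ j
      = (∑ h ∈ Finset.range m, eC (∑ i, (ρ i : ℝ) * (c i j * (h : ℝ) ^ d i))) / m := by
  have h1 := sum_range_mul_of_periodic
    (w := fun h : ℕ => eC (∑ i, (ρ i : ℝ) * (c i j * (h : ℝ) ^ d i)))
    (exists_phase_period d c hm j) (denProd ρ)
  have h2 := sum_range_mul_of_periodic
    (w := fun h : ℕ => eC (∑ i, (ρ i : ℝ) * (c i j * (h : ℝ) ^ d i)))
    (exists_phase_period d c (denProd_mul ρ) j) m
  rw [mul_comm m, h2] at h1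
  have hq : (denProd ρ : ℂ) ≠ 0 := by exact_mod_cast (Nat.one_le_iff_ne_zero.1 (denProd_pos ρ))
  have hmc : (m : ℂ) ≠ 0 := by exact_mod_cast (Nat.one_le_iff_ne_zero.1 hm1)
  rw [gaussMean, div_eq_div_iff hq hmc]
  linear_combination h1

lemma norm_gaussMean_le (ρ : ι → ℚ) (j : Fin s) : ‖gaussMean d c ρ j‖ ≤ 1 := by
  have hq : (0 : ℝ) < denProd ρ := by exact_mod_cast denProd_pos ρ
  rw [gaussMean, norm_div, Complex.norm_natCast, div_le_one hq]
  refine (norm_sum_le _ _).trans ?_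
  simp [norm_eC]

lemma norm_oscInt_le (b : ι → ℝ) (j : Fin s) : ‖oscInt d c b j‖ ≤ 1 := by
  refine (intervalIntegral.norm_integral_le_of_norm_le_const (C := 1) fun t _ => (norm_eC _).le).trans ?_
  simp

@[fun_prop]
lemma continuous_oscInt (j : Fin s) : Continuous fun b => oscInt d c b j := by
  unfold oscInt
  apply intervalIntegral.continuous_parametric_intervalIntegral_of_continuous'
  have := continuous_eC
  fun_prop

lemma gaussMean_zero (j : Fin s) : gaussMean d c (0 : ι → ℚ) j = 1 := by
  rw [gaussMean_eq d c le_rfl (fun i => ⟨0, by simp⟩)]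
  simp [eC_zero]

lemma oscInt_zero (j : Fin s) : oscInt d c (0 : ι → ℝ) j = 1 := by
  simp [oscInt, eC_zero]

/-- A Lipschitz constant for the phases of the `j`-th variable. -/
def phaseLip (j : Fin s) : ℝ := 2 * Real.pi * ∑ i, |(c i j : ℝ)| * (d i * 2 ^ (d i - 1))

lemma phaseLip_nonneg (j : Fin s) : 0 ≤ phaseLip d c j := by
  unfold phaseLip; have := Real.pi_pos; positivity

lemma norm_eC_phase_sub_le {b : ι → ℝ} {H : ℝ} (hb : ∀ i, |b i| ≤ H) (j : Fin s) {x y : ℝ}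
    (hx : x ∈ Set.Icc (0 : ℝ) 2) (hy : y ∈ Set.Icc (0 : ℝ) 2) :
    ‖eC (∑ i, b i * (c i j * x ^ d i)) - eC (∑ i, b i * (c i j * y ^ d i))‖
      ≤ phaseLip d c j * H * |x - y| := by
  refine (norm_eC_sub_le _ _).trans ?_
  have hpi := Real.pi_pos
  calc _ ≤ 2 * Real.pi * ∑ i, H * (|(c i j : ℝ)| * (|x - y| * d i * 2 ^ (d i - 1))) := by
        gcongr
        rw [← Finset.sum_sub_distrib]
        refine (Finset.abs_sum_le_sum_abs _ _).trans (Finset.sum_le_sum fun i _ => ?_)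
        rw [← mul_sub, ← mul_sub, abs_mul, abs_mul]
        have h1 : max |x| |y| ≤ 2 := by
          rw [abs_of_nonneg hx.1, abs_of_nonneg hy.1]; exact max_le hx.2 hy.2
        have h0 : 0 ≤ H := (abs_nonneg _).trans (hb i)
        have := abs_pow_sub_pow_le (a := x) (b := y) (d i)
        have h2 : max |x| |y| ^ (d i - 1) ≤ 2 ^ (d i - 1) := by gcongr
        refine mul_le_mul (hb i) ?_ (by positivity) h0
        refine mul_le_mul_of_nonneg_left (this.trans ?_) (abs_nonneg _)
        exact mul_le_mul_of_nonneg_left h2 (by positivity)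
    _ = _ := by
        unfold phaseLip
        simp only [Finset.mul_sum, Finset.sum_mul]
        exact Finset.sum_congr rfl fun i _ => by ring

/-- The major arc approximation for a single exponential sum. -/
lemma norm_fsum_sub_le {ρ : ι → ℚ} {m : ℕ} (hm1 : 1 ≤ m) (hm : ∀ i, ∃ a : ℤ, (m : ℚ) * ρ i = a)
    {b : ι → ℝ} {H : ℝ} (hH : 0 ≤ H) (hb : ∀ i, |b i| ≤ H) (j : Fin s) {P : ℕ} (hP : 1 ≤ P) :
    ‖fsum d c P j (fun i => ρ i + b i / (P : ℝ) ^ d i)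
      - P * (gaussMean d c ρ j * oscInt d c b j)‖ ≤ m * (2 + 2 * (phaseLip d c j * H)) := by
  have hP0 : (P : ℝ) ≠ 0 := by exact_mod_cast Nat.one_le_iff_ne_zero.1 hP
  have hce := continuous_eC
  have := norm_sum_mul_periodic_sub_le
    (w := fun h : ℕ => eC (∑ i, (ρ i : ℝ) * (c i j * (h : ℝ) ^ d i))) (fun x => norm_eC _) hm1
    (exists_phase_period d c hm j) (G := fun t => eC (∑ i, b i * (c i j * t ^ d i)))
    (mul_nonneg (phaseLip_nonneg d c j) hH) (by fun_prop) (fun x => norm_eC _)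
    (fun x hx y hy => norm_eC_phase_sub_le d c hb j hx hy) hP
  rw [gaussMean_eq d c hm1 hm, oscInt]
  refine le_of_eq_of_le ?_ this
  congr 2
  rw [fsum]
  refine Finset.sum_congr rfl fun x _ => ?_
  rw [← eC_add, ← Finset.sum_add_distrib]
  congr 1
  refine Finset.sum_congr rfl fun i _ => ?_
  rw [div_pow]
  field_simp

end DiagonalSystem

namespace DiagonalSystem

lemma norm_prod_sub_prod_le {α : Type*} (S : Finset α) {a b : α → ℂ} (ha : ∀ j, ‖a j‖ ≤ 1)
    (hb : ∀ j, ‖b j‖ ≤ 1) : ‖∏ j ∈ S, a j - ∏ j ∈ S, b j‖ ≤ ∑ j ∈ S, ‖a j - b j‖ := by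
  induction S using Finset.induction_on with
  | empty => simp
  | insert j S hj ih =>
    rw [Finset.prod_insert hj, Finset.prod_insert hj, Finset.sum_insert hj]
    have hP : ‖∏ j ∈ S, a j‖ ≤ 1 := by
      rw [norm_prod]; exact Finset.prod_le_one (fun _ _ => norm_nonneg _) fun _ _ => ha _
    calc _ = ‖(a j - b j) * ∏ j ∈ S, a j + b j * (∏ j ∈ S, a j - ∏ j ∈ S, b j)‖ := by
          congr 1; ring
      _ ≤ ‖a j - b j‖ * 1 + 1 * ∑ j ∈ S, ‖a j - b j‖ := by
          refine (norm_add_le _ _).trans ?_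
          rw [norm_mul, norm_mul]
          gcongr
          exact hb j
      _ = _ := by ring

variable {ι : Type*} [Fintype ι] (d : ι → ℕ) {s : ℕ} (c : ι → Fin s → ℤ)

/-- The terms of the singular series. -/
def singCoeff (ρ : ι → ℚ) : ℂ := ∏ j, gaussMean d c ρ j

/-- The integrand of the singular integral. -/
def singKernel (b : ι → ℝ) : ℂ := ∏ j, oscInt d c b j

@[fun_prop]
lemma continuous_singKernel : Continuous (singKernel d c) := by
  unfold singKernel
  exact continuous_finsetProd _ fun j _ => continuous_oscInt d c j

lemma singCoeff_zero : singCoeff d c (0 : ι → ℚ) = 1 := by simp [singCoeff, gaussMean_zero]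

lemma singKernel_zero : singKernel d c (0 : ι → ℝ) = 1 := by simp [singKernel, oscInt_zero]

/-- The product of the exponential sums. -/
def genFun (P : ℕ) (α : ι → ℝ) : ℂ := ∏ j, fsum d c P j α

@[fun_prop]
lemma continuous_genFun (P : ℕ) : Continuous (genFun d c P) := by
  unfold genFun
  exact continuous_finsetProd _ fun j _ => continuous_fsum d c P j

/-- The major arc approximation for the generating function. -/
lemma exists_norm_genFun_sub_le : ∃ C : ℝ, 0 ≤ C ∧ ∀ (H : ℝ), 1 ≤ H → ∀ (m : ℕ), 1 ≤ m →
    (m : ℝ) ≤ H → ∀ ρ : ι → ℚ, (∀ i, ∃ a : ℤ, (m : ℚ) * ρ i = a) → ∀ b : ι → ℝ,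
    (∀ i, |b i| ≤ H) → ∀ P : ℕ, 1 ≤ P →
    ‖genFun d c P (fun i => ρ i + b i / (P : ℝ) ^ d i)
      - (P : ℂ) ^ s * (singCoeff d c ρ * singKernel d c b)‖ ≤ C * H ^ 2 * ((P : ℝ) ^ s / P) := by
  refine ⟨∑ j, (2 + 2 * phaseLip d c j),
    Finset.sum_nonneg fun j _ => by have := phaseLip_nonneg d c j; positivity, ?_⟩
  intro H hH m hm1 hmH ρ hm b hb P hP
  have hP0 : (0 : ℝ) < P := by exact_mod_cast hP
  have hPc : (P : ℂ) ≠ 0 := by exact_mod_cast hP0.ne'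
  set α : ι → ℝ := fun i => ρ i + b i / (P : ℝ) ^ d i
  have key := norm_prod_sub_prod_le Finset.univ (a := fun j => fsum d c P j α / P)
    (b := fun j => gaussMean d c ρ j * oscInt d c b j)
    (fun j => by
      rw [norm_div, Complex.norm_natCast, div_le_one hP0]
      exact norm_fsum_le d c P j α)
    (fun j => by
      rw [norm_mul]
      exact mul_le_one₀ (norm_gaussMean_le d c _ _) (norm_nonneg _) (norm_oscInt_le d c _ _))
  have hj : ∀ j, ‖fsum d c P j α / P - gaussMean d c ρ j * oscInt d c b j‖
      ≤ (2 + 2 * phaseLip d c j) * H ^ 2 / P := fun j => by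
    have h1 := norm_fsum_sub_le d c hm1 hm (by linarith : 0 ≤ H) hb j hP
    have e : fsum d c P j α / P - gaussMean d c ρ j * oscInt d c b j
        = (fsum d c P j α - P * (gaussMean d c ρ j * oscInt d c b j)) / P := by field_simp
    rw [e, norm_div, Complex.norm_natCast]
    have hL := phaseLip_nonneg d c j
    gcongr
    refine h1.trans ?_
    calc (m : ℝ) * (2 + 2 * (phaseLip d c j * H)) ≤ H * (2 * H + 2 * (phaseLip d c j * H)) := by
          gcongr; linarith
      _ = _ := by ring
  have e : genFun d c P α - (P : ℂ) ^ s * (singCoeff d c ρ * singKernel d c b)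
      = (P : ℂ) ^ s * (∏ j, fsum d c P j α / P - ∏ j, gaussMean d c ρ j * oscInt d c b j) := by
    rw [Finset.prod_div_distrib, Finset.prod_mul_distrib, genFun, singCoeff, singKernel]
    simp only [Finset.prod_const, Finset.card_univ, Fintype.card_fin]
    field_simp
  rw [e, norm_mul, norm_pow, Complex.norm_natCast]
  calc (P : ℝ) ^ s * _ ≤ (P : ℝ) ^ s * ∑ j, (2 + 2 * phaseLip d c j) * H ^ 2 / P := by
        gcongr
        exact key.trans (Finset.sum_le_sum fun j _ => hj j)
    _ = _ := by
        rw [← Finset.sum_div, ← Finset.sum_mul]; ring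

/-- The `m`-torsion points of the unit cube. -/
def torPts (ι : Type*) [Fintype ι] (m : ℕ) : Finset (ι → ℚ) :=
  (Fintype.piFinset fun _ : ι => Finset.range m).image fun a i => (a i : ℚ) / m

lemma mem_torPts {m : ℕ} (hm : 1 ≤ m) {ρ : ι → ℚ} :
    ρ ∈ torPts ι m ↔ (∀ i, 0 ≤ ρ i ∧ ρ i < 1) ∧ ∀ i, ∃ a : ℤ, (m : ℚ) * ρ i = a := by
  have hm0 : (0 : ℚ) < m := by exact_mod_cast hm
  simp only [torPts, Finset.mem_image, Fintype.mem_piFinset, Finset.mem_range]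
  constructor
  · rintro ⟨a, ha, rfl⟩
    refine ⟨fun i => ⟨by positivity, ?_⟩, fun i => ⟨a i, ?_⟩⟩
    · rw [div_lt_one hm0]; exact_mod_cast ha i
    · push_cast; field_simp
  · rintro ⟨h1, h2⟩
    choose a ha using h2
    have ha0 : ∀ i, 0 ≤ a i := fun i => by
      have : (0 : ℚ) ≤ a i := by rw [← ha]; exact mul_nonneg hm0.le (h1 i).1
      exact_mod_cast this
    refine ⟨fun i => (a i).toNat, fun i => ?_, ?_⟩
    · have : (a i : ℚ) < m := by rw [← ha]; nlinarith [(h1 i).2]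
      have : a i < m := by exact_mod_cast this
      have := ha0 i
      show (a i).toNat < m
      omega
    · ext i
      have : (((a i).toNat : ℤ) : ℚ) = a i := by rw [Int.toNat_of_nonneg (ha0 i)]
      rw [Int.cast_natCast] at this
      rw [this, ← ha]
      field_simp

lemma card_torPts_le (m : ℕ) : (torPts ι m).card ≤ m ^ Fintype.card ι :=
  Finset.card_image_le.trans (by simp)

/-- The rational points of height at most `H` in the unit cube. -/
def ratPts (ι : Type*) [Fintype ι] (H : ℝ) : Finset (ι → ℚ) :=
  (Finset.Icc 1 ⌊H⌋₊).biUnion (torPts ι)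

lemma mem_ratPts {H : ℝ} (hH : 0 ≤ H) {ρ : ι → ℚ} :
    ρ ∈ ratPts ι H ↔ ∃ m : ℕ, 1 ≤ m ∧ (m : ℝ) ≤ H ∧ (∀ i, 0 ≤ ρ i ∧ ρ i < 1) ∧
      ∀ i, ∃ a : ℤ, (m : ℚ) * ρ i = a := by
  simp only [ratPts, Finset.mem_biUnion, Finset.mem_Icc]
  constructor
  · rintro ⟨m, ⟨h1, h2⟩, h3⟩
    exact ⟨m, h1, (Nat.le_floor_iff hH).1 h2, (mem_torPts h1).1 h3⟩
  · rintro ⟨m, h1, h2, h3⟩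
    exact ⟨m, ⟨h1, (Nat.le_floor_iff hH).2 h2⟩, (mem_torPts h1).2 h3⟩

lemma ratPts_mono {H H' : ℝ} (h : H ≤ H') : ratPts ι H ⊆ ratPts ι H' :=
  Finset.biUnion_subset_biUnion_of_subset_left _
    (Finset.Icc_subset_Icc_right (Nat.floor_le_floor h))

lemma card_ratPts_le {H : ℝ} (hH : 0 ≤ H) :
    ((ratPts ι H).card : ℝ) ≤ H ^ (Fintype.card ι + 1) := by
  have h1 : (ratPts ι H).card ≤ ⌊H⌋₊ * ⌊H⌋₊ ^ Fintype.card ι := by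
    refine Finset.card_biUnion_le.trans ?_
    calc _ ≤ ∑ m ∈ Finset.Icc 1 ⌊H⌋₊, ⌊H⌋₊ ^ Fintype.card ι :=
          Finset.sum_le_sum fun m hm => (card_torPts_le m).trans
            (Nat.pow_le_pow_left (Finset.mem_Icc.1 hm).2 _)
      _ = _ := by simp
  calc ((ratPts ι H).card : ℝ) ≤ (⌊H⌋₊ : ℝ) * (⌊H⌋₊ : ℝ) ^ Fintype.card ι := by exact_mod_cast h1
    _ ≤ H * H ^ Fintype.card ι := by gcongr <;> exact Nat.floor_le hH
    _ = _ := by ring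

/-- A single major arc. -/
def arc (H : ℝ) (P : ℕ) (ρ : ι → ℚ) : Set (ι → ℝ) :=
  {α | ∀ i, |α i - ρ i| ≤ H / (P : ℝ) ^ d i}

lemma measurableSet_arc (H : ℝ) (P : ℕ) (ρ : ι → ℚ) : MeasurableSet (arc d H P ρ) := by
  simp only [arc, Set.ofPred_forall]
  exact MeasurableSet.iInter fun i => measurableSet_le (by fun_prop) (by fun_prop)

lemma isBounded_arc (H : ℝ) (P : ℕ) (ρ : ι → ℚ) : Bornology.IsBounded (arc d H P ρ) :=
  (Metric.isBounded_Icc (fun i => (ρ i : ℝ) - H / (P : ℝ) ^ d i)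
    fun i => (ρ i : ℝ) + H / (P : ℝ) ^ d i).subset fun _ hx =>
    ⟨fun i => by have := (abs_le.1 (hx i)).1; linarith, fun i => by have := (abs_le.1 (hx i)).2; linarith⟩

lemma abs_sub_le_of_mem_arc {d : ι → ℕ} {H : ℝ} {P : ℕ} {ρ : ι → ℚ} (hd : ∀ i, 1 ≤ d i) (hH : 0 ≤ H) (hP : 1 ≤ P) {α : ι → ℝ}
    (hα : α ∈ arc d H P ρ) (i : ι) : |α i - ρ i| ≤ H / P := by
  have hP1 : (1 : ℝ) ≤ P := by exact_mod_cast hP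
  refine (hα i).trans ?_
  gcongr
  exact le_self_pow₀ hP1 (Nat.one_le_iff_ne_zero.1 (hd i))

/-- Up to translation, the major arcs are the arcs around rational points. -/
lemma box_inter_major {H H' : ℝ} (hd : ∀ i, 1 ≤ d i) (hH : 1 ≤ H) (hHH' : H ≤ H') {P : ℕ}
    (hP : 2 * H' ^ 3 < P) :
    box (fun _ : ι => -(H' / P)) ∩ major d H P = ⋃ ρ ∈ ratPts ι H, arc d H P ρ := by
  have hH0 : 0 < H := by linarith
  have hH'0 : 0 < H' := by linarith
  have hP0 : (0 : ℝ) < P := lt_trans (by positivity) hP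
  have hP1 : 1 ≤ P := by exact_mod_cast hP0
  have hsmall : H' / P + H / P < 1 / H := by
    rw [← add_div, div_lt_div_iff₀ hP0 hH0]
    calc (H' + H) * H ≤ (H' + H') * H' := by gcongr
      _ = 2 * (H' ^ 2 * 1) := by ring
      _ ≤ 2 * (H' ^ 2 * H') := by gcongr; linarith
      _ < 1 * P := by linarith [hP]
  have hHP : H / P ≤ H' / P := by gcongr
  ext α
  simp only [Set.mem_inter_iff, Set.mem_iUnion, exists_prop]
  constructor
  · rintro ⟨hb, q, hq1, hqH, a, ha⟩
    have hq0 : (0 : ℝ) < q := by exact_mod_cast hq1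
    have hmem : α ∈ arc d H P (fun i => (a i : ℚ) / q) := fun i => by
      push_cast; exact ha i
    refine ⟨_, (mem_ratPts hH0.le).2 ⟨q, hq1, hqH, fun i => ?_, fun i => ⟨a i, ?_⟩⟩, hmem⟩
    · have h1 := abs_le.1 (abs_sub_le_of_mem_arc hd hH0.le hP1 hmem i)
      have h2 := hb i trivial
      simp only [Set.mem_Ico] at h2
      push_cast at h1
      have h3 : (a i : ℝ) / q < 1 := by linarith
      have h4 : -(1 / q : ℝ) < a i / q := by
        have : 1 / H ≤ 1 / (q : ℝ) := by gcongr
        linarith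
      rw [div_lt_one hq0] at h3
      rw [← neg_div, div_lt_div_iff_of_pos_right hq0] at h4
      have h5 : a i < q := by exact_mod_cast h3
      have h6 : -1 < a i := by exact_mod_cast h4
      have hq0' : (0 : ℚ) < q := by exact_mod_cast hq1
      refine ⟨div_nonneg ?_ hq0'.le, (div_lt_one hq0').2 (by exact_mod_cast h5)⟩
      exact_mod_cast (by omega : 0 ≤ a i)
    · field_simp
  · rintro ⟨ρ, hρ, hα⟩
    obtain ⟨m, hm1, hmH, h01, hInt⟩ := (mem_ratPts hH0.le).1 hρ
    have hm0 : (0 : ℝ) < m := by exact_mod_cast hm1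
    choose a ha using hInt
    have ha' : ∀ i, (m : ℝ) * ρ i = a i := fun i => by exact_mod_cast congrArg (fun y : ℚ => (y : ℝ)) (ha i)
    have hρa : ∀ i, (ρ i : ℝ) = a i / m := fun i => by rw [← ha']; field_simp
    refine ⟨fun i _ => ?_, m, hm1, hmH, a, fun i => by rw [← hρa]; exact hα i⟩
    have h1 := abs_le.1 (abs_sub_le_of_mem_arc hd hH0.le hP1 hα i)
    have h0 : (0 : ℝ) ≤ ρ i := by exact_mod_cast (h01 i).1
    have h2 : (ρ i : ℝ) ≤ 1 - 1 / H := by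
      have h3 : (a i : ℝ) < m := by
        rw [← ha']
        have : (ρ i : ℝ) < 1 := by exact_mod_cast (h01 i).2
        nlinarith
      have h4 : (a i : ℝ) ≤ m - 1 := by
        have : a i < m := by exact_mod_cast h3
        have : a i ≤ (m : ℤ) - 1 := by omega
        exact_mod_cast this
      have h5 : 1 / H ≤ 1 / (m : ℝ) := by gcongr
      rw [hρa]
      calc (a i : ℝ) / m ≤ (m - 1) / m := by gcongr
        _ = 1 - 1 / m := by field_simp
        _ ≤ _ := by linarith
    constructor <;> simp only <;> linarith

lemma pairwiseDisjoint_arc {H : ℝ} (hd : ∀ i, 1 ≤ d i) (hH : 1 ≤ H) {P : ℕ} (hP : 2 * H ^ 3 < P) :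
    (ratPts ι H : Set (ι → ℚ)).PairwiseDisjoint (arc d H P) := by
  have hH0 : 0 < H := by linarith
  have hP0 : (0 : ℝ) < P := lt_trans (by positivity) hP
  have hP1 : 1 ≤ P := by exact_mod_cast hP0
  intro ρ hρ ρ' hρ' hne
  obtain ⟨m, hm1, hmH, -, hInt⟩ := (mem_ratPts hH0.le).1 hρ
  obtain ⟨m', hm1', hmH', -, hInt'⟩ := (mem_ratPts hH0.le).1 hρ'
  obtain ⟨i, hi⟩ := Function.ne_iff.1 hne
  obtain ⟨a, ha⟩ := hInt i
  obtain ⟨a', ha'⟩ := hInt' i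
  have hr : (m : ℝ) * ρ i = a := by exact_mod_cast congrArg (fun y : ℚ => (y : ℝ)) ha
  have hr' : (m' : ℝ) * ρ' i = a' := by exact_mod_cast congrArg (fun y : ℚ => (y : ℝ)) ha'
  refine Set.disjoint_left.2 fun α hα hα' => ?_
  have h1 := abs_sub_le_of_mem_arc hd hH0.le hP1 hα i
  have h2 := abs_sub_le_of_mem_arc hd hH0.le hP1 hα' i
  have h3 : |(ρ i : ℝ) - ρ' i| ≤ 2 * H / P := by
    rw [abs_sub_comm] at h1
    have := abs_sub_le (ρ i : ℝ) (α i) (ρ' i)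
    rw [mul_div_assoc]; linarith
  have h4 : (1 : ℝ) ≤ m * m' * |(ρ i : ℝ) - ρ' i| := by
    have e : (m : ℝ) * m' * |(ρ i : ℝ) - ρ' i| = ((|m' * a - m * a'| : ℤ) : ℝ) := by
      rw [← abs_of_nonneg (by positivity : (0 : ℝ) ≤ m * m'), ← abs_mul]
      push_cast
      rw [← hr, ← hr']
      congr 1; ring
    rw [e]
    have hz : m' * a - m * a' ≠ 0 := fun hz => by
      refine hi ?_
      have hz' : (m' : ℚ) * a - m * a' = 0 := by exact_mod_cast hz
      rw [← ha, ← ha'] at hz'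
      have hm : (m : ℚ) * m' ≠ 0 := by positivity
      have := mul_left_cancel₀ hm (show (m : ℚ) * m' * ρ i = m * m' * ρ' i by linarith)
      exact this
    exact_mod_cast Int.one_le_abs hz
  have h5 : (m : ℝ) * m' * |(ρ i : ℝ) - ρ' i| ≤ H * H * (2 * H / P) := by gcongr
  have h6 : H * H * (2 * H / P) < 1 := by
    rw [mul_div_assoc', div_lt_one hP0]
    linarith [hP]
  linarith

/-- The change of variables `α = ρ + P^{-d} b`. -/
lemma integral_rescale {E : Type*} [NormedAddCommGroup E] [NormedSpace ℝ E]
    {f : (ι → ℝ) → E} (hf : StronglyMeasurable f) {P : ℕ} (hP : 1 ≤ P) (ρ : ι → ℚ) :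
    ∫ α, f α = ((P : ℝ) ^ ∑ i, d i)⁻¹ • ∫ b : ι → ℝ, f fun i => ρ i + b i / (P : ℝ) ^ d i := by
  have hP0 : (0 : ℝ) < P := by exact_mod_cast hP
  have hdet : (Matrix.diagonal fun i => ((P : ℝ) ^ d i)⁻¹).det = ((P : ℝ) ^ ∑ i, d i)⁻¹ := by
    rw [Matrix.det_diagonal, Finset.prod_inv_distrib, Finset.prod_pow_eq_pow_sum]
  have hv := Real.smul_map_diagonal_volume_pi (D := fun i => ((P : ℝ) ^ d i)⁻¹)
    (by rw [hdet]; positivity)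
  rw [hdet, abs_of_pos (by positivity)] at hv
  have htr : ∫ α, f α = ∫ α : ι → ℝ, f ((fun i => (ρ i : ℝ)) + α) :=
    (integral_add_left_eq_self f _).symm
  have hg : StronglyMeasurable fun α : ι → ℝ => f ((fun i => (ρ i : ℝ)) + α) :=
    hf.comp_measurable (by fun_prop)
  rw [htr]
  conv_lhs => rw [← hv]
  rw [integral_smul_measure, ENNReal.toReal_ofReal (by positivity), integral_map]
  · congr 1
    refine integral_congr_ae (Eventually.of_forall fun b => ?_)
    simp only [Matrix.toLin'_apply]
    congr 1
    ext i
    simp [Matrix.mulVec_diagonal, div_eq_inv_mul]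
  · exact (LinearMap.continuous_on_pi _).aemeasurable
  · exact hg.aestronglyMeasurable

lemma setIntegral_arc {E : Type*} [NormedAddCommGroup E] [NormedSpace ℝ E]
    {f : (ι → ℝ) → E} (hf : StronglyMeasurable f) {P : ℕ} (hP : 1 ≤ P) {H : ℝ} (hH : 0 ≤ H)
    (ρ : ι → ℚ) :
    ∫ α in arc d H P ρ, f α = ((P : ℝ) ^ ∑ i, d i)⁻¹ •
      ∫ b in Metric.closedBall (0 : ι → ℝ) H, f fun i => ρ i + b i / (P : ℝ) ^ d i := by
  have hP0 : (0 : ℝ) < P := by exact_mod_cast hP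
  rw [← integral_indicator (measurableSet_arc d H P ρ),
    integral_rescale d (hf.indicator (measurableSet_arc d H P ρ)) hP ρ,
    ← integral_indicator Metric.isClosed_closedBall.measurableSet]
  congr 1
  refine integral_congr_ae (Eventually.of_forall fun b => ?_)
  simp only [Set.indicator]
  congr 1
  simp only [arc, Set.mem_ofPred_eq, mem_closedBall_zero_iff, pi_norm_le_iff_of_nonneg hH,
    add_sub_cancel_left, abs_div, Real.norm_eq_abs, eq_iff_iff]
  refine forall_congr' fun i => ?_
  rw [abs_of_pos (by positivity : (0 : ℝ) < (P : ℝ) ^ d i), div_le_div_iff_of_pos_right (by positivity)]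

lemma setIntegral_major {E : Type*} [NormedAddCommGroup E] [NormedSpace ℝ E] [CompleteSpace E]
    {f : (ι → ℝ) → E} (hf : Continuous f) {H H' : ℝ} (hd : ∀ i, 1 ≤ d i) (hH : 1 ≤ H)
    (hHH' : H ≤ H') {P : ℕ} (hP : 2 * H' ^ 3 < P) :
    ∫ α in box (fun _ : ι => -(H' / P)) ∩ major d H P, f α = ((P : ℝ) ^ ∑ i, d i)⁻¹ •
      ∑ ρ ∈ ratPts ι H, ∫ b in Metric.closedBall (0 : ι → ℝ) H,
        f fun i => ρ i + b i / (P : ℝ) ^ d i := by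
  have hH0 : 0 < H := by linarith
  have hP0 : (0 : ℝ) < P := lt_trans (by have : 0 < H' := by linarith
                                         positivity) hP
  have hP1 : 1 ≤ P := by exact_mod_cast hP0
  rw [box_inter_major d hd hH hHH' hP, integral_biUnion_finset]
  · rw [Finset.smul_sum]
    exact Finset.sum_congr rfl fun ρ _ => setIntegral_arc d hf.stronglyMeasurable hP1 hH0.le ρ
  · exact fun ρ _ => measurableSet_arc d H P ρ
  · exact pairwiseDisjoint_arc d hd hH (lt_of_le_of_lt (by gcongr) hP)
  · exact fun ρ _ => integrableOn_of_continuous_pi hf (isBounded_arc d H P ρ)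

end DiagonalSystem

namespace DiagonalSystem

variable {ι : Type*} [Fintype ι] (d : ι → ℕ) {s : ℕ} (c : ι → Fin s → ℤ)

lemma exists_major_approx (hd : ∀ i, 1 ≤ d i) : ∃ C : ℝ, 0 ≤ C ∧
    ∀ {E : Type} [NormedAddCommGroup E] [NormedSpace ℝ E] [CompleteSpace E] (φ : ℂ → E),
    (∀ x y, ‖φ x - φ y‖ ≤ ‖x - y‖) → ∀ H H' : ℝ, 1 ≤ H → H ≤ H' → ∀ P : ℕ, 2 * H' ^ 3 < P →
    ‖(∫ α in box (fun _ : ι => -(H' / P)) ∩ major d H P, φ (genFun d c P α))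
      - ((P : ℝ) ^ ∑ i, d i)⁻¹ • ∑ ρ ∈ ratPts ι H, ∫ b in Metric.closedBall (0 : ι → ℝ) H,
        φ ((P : ℂ) ^ s * (singCoeff d c ρ * singKernel d c b))‖
      ≤ C * ((P : ℝ) ^ ∑ i, d i)⁻¹ * (P : ℝ) ^ s * (H ^ (2 * Fintype.card ι + 3) / P) := by
  obtain ⟨C, hC0, hC⟩ := exists_norm_genFun_sub_le d c
  refine ⟨C * 2 ^ Fintype.card ι, by positivity, ?_⟩
  intro E _ _ _ φ hφ H H' hH hHH' P hP
  have hH0 : 0 < H := by linarith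
  have hP0 : (0 : ℝ) < P := lt_trans (by have : 0 < H' := by linarith
                                         positivity) hP
  have hP1 : 1 ≤ P := by exact_mod_cast hP0
  have hφc : Continuous φ := (LipschitzWith.of_dist_le_mul (K := 1) fun x y => by
    rw [dist_eq_norm, dist_eq_norm]; simpa using hφ x y).continuous
  rw [setIntegral_major d (f := fun α => φ (genFun d c P α)) (hφc.comp (continuous_genFun d c P)) hd hH hHH' hP, ← smul_sub,
    norm_smul, norm_inv, norm_pow, Real.norm_natCast, ← Finset.sum_sub_distrib]
  have hvol : volume.real (Metric.closedBall (0 : ι → ℝ) H) = (2 * H) ^ Fintype.card ι := by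
    rw [Measure.real, Real.volume_pi_closedBall _ hH0.le, ENNReal.toReal_ofReal (by positivity)]
  have hterm : ∀ ρ ∈ ratPts ι H, ‖(∫ b in Metric.closedBall (0 : ι → ℝ) H,
        φ (genFun d c P fun i => ρ i + b i / (P : ℝ) ^ d i))
      - ∫ b in Metric.closedBall (0 : ι → ℝ) H,
        φ ((P : ℂ) ^ s * (singCoeff d c ρ * singKernel d c b))‖
      ≤ C * H ^ 2 * ((P : ℝ) ^ s / P) * (2 * H) ^ Fintype.card ι := fun ρ hρ => by
    obtain ⟨m, hm1, hmH, -, hInt⟩ := (mem_ratPts hH0.le).1 hρ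
    rw [← integral_sub, ← hvol]
    · refine norm_setIntegral_le_of_norm_le_const measure_closedBall_lt_top fun b hb => ?_
      refine (hφ _ _).trans (hC H hH m hm1 hmH ρ hInt b ?_ P hP1)
      rw [mem_closedBall_zero_iff, pi_norm_le_iff_of_nonneg hH0.le] at hb
      exact hb
    · exact integrableOn_of_continuous_pi (by fun_prop) Metric.isBounded_closedBall
    · exact integrableOn_of_continuous_pi (by fun_prop) Metric.isBounded_closedBall
  calc ((P : ℝ) ^ ∑ i, d i)⁻¹ * _
      ≤ ((P : ℝ) ^ ∑ i, d i)⁻¹ * ((ratPts ι H).card *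
        (C * H ^ 2 * ((P : ℝ) ^ s / P) * (2 * H) ^ Fintype.card ι)) := by
        gcongr
        refine (norm_sum_le _ _).trans ((Finset.sum_le_sum hterm).trans_eq ?_)
        simp
    _ ≤ ((P : ℝ) ^ ∑ i, d i)⁻¹ * (H ^ (Fintype.card ι + 1) *
        (C * H ^ 2 * ((P : ℝ) ^ s / P) * (2 * H) ^ Fintype.card ι)) := by
        gcongr
        exact card_ratPts_le hH0.le
    _ = _ := by rw [mul_pow]; ring

/-- A partial sum of the absolute singular series. -/
def absSer (H : ℝ) : ℝ := ∑ ρ ∈ ratPts ι H, ‖singCoeff d c ρ‖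

/-- A truncation of the absolute singular integral. -/
def absInt (H : ℝ) : ℝ := ∫ b in Metric.closedBall (0 : ι → ℝ) H, ‖singKernel d c b‖

/-- The minor arc bound needed for the asymptotic formula. -/
def MinorBound (A : ℕ) : Prop :=
  1 ≤ A ∧ ∀ ε : ℝ, 0 < ε → ∃ C : ℝ, 0 < C ∧ ∀ H : ℝ, 2 ≤ H → ∀ P : ℕ, 1 ≤ P → ∀ a : ι → ℝ,
    ∫ α in box a \ major d (H ^ A) P, ‖genFun d c P α‖
      ≤ C * (P : ℝ) ^ ε * (((P : ℝ) ^ ∑ i, d i)⁻¹ * (P : ℝ) ^ s) / H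

variable {d c}

lemma abs_truncation_diff_le (hd : ∀ i, 1 ≤ d i) {A : ℕ} (hMB : MinorBound d c A) {ε : ℝ} (hε : 0 < ε) :
    ∃ C : ℝ, 0 ≤ C ∧ ∀ h : ℝ, 2 ≤ h → ∀ H' : ℝ, h ^ A ≤ H' → ∀ P : ℕ, 2 * H' ^ 3 < P →
      absSer d c H' * absInt d c H' - absSer d c (h ^ A) * absInt d c (h ^ A)
        ≤ C * ((P : ℝ) ^ ε / h + H' ^ (2 * Fintype.card ι + 3) / P) := by
  obtain ⟨C1, hC1, hmaj⟩ := exists_major_approx d c hd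
  obtain ⟨C2, hC2, hmin⟩ := hMB.2 ε hε
  refine ⟨C2 + 2 * C1, by positivity, fun h hh H' hH' P hP => ?_⟩
  set B := 2 * Fintype.card ι + 3
  have hH : 1 ≤ h ^ A := one_le_pow₀ (by linarith)
  have hH'1 : 1 ≤ H' := hH.trans hH'
  have hP0 : (0 : ℝ) < P := lt_trans (by positivity) hP
  have hP1 : 1 ≤ P := by exact_mod_cast hP0
  set Q : ℝ := ((P : ℝ) ^ ∑ i, d i)⁻¹ * (P : ℝ) ^ s with hQ
  have hQ0 : 0 < Q := by positivity
  have hT : ∀ X : ℝ, ((P : ℝ) ^ ∑ i, d i)⁻¹ • ∑ ρ ∈ ratPts ι X,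
      ∫ b in Metric.closedBall (0 : ι → ℝ) X, ‖(P : ℂ) ^ s * (singCoeff d c ρ * singKernel d c b)‖
      = Q * (absSer d c X * absInt d c X) := fun X => by
    simp only [norm_mul, norm_pow, Complex.norm_natCast, integral_const_mul, smul_eq_mul]
    rw [← Finset.mul_sum, ← Finset.sum_mul, absSer, absInt, hQ]
    ring
  have m1 := hmaj (fun z => ‖z‖) (fun x y => abs_norm_sub_norm_le x y) (h ^ A) H' hH hH' P hP
  have m2 := hmaj (fun z => ‖z‖) (fun x y => abs_norm_sub_norm_le x y) H' H' hH'1 le_rfl P hP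
  simp only [hT] at m1 m2
  have hmin' := hmin h hh P hP1 (fun _ => -(H' / P))
  have hI : ∀ X : Set (ι → ℝ), X ⊆ box (fun _ : ι => -(H' / P)) →
      IntegrableOn (fun α => ‖genFun d c P α‖) X := fun X hX =>
    integrableOn_of_continuous_pi (by fun_prop) ((isBounded_box _).subset hX)
  have hsplit : ∫ α in box (fun _ : ι => -(H' / P)) ∩ major d H' P, ‖genFun d c P α‖
      ≤ (∫ α in box (fun _ : ι => -(H' / P)) ∩ major d (h ^ A) P, ‖genFun d c P α‖)
        + ∫ α in box (fun _ : ι => -(H' / P)) \ major d (h ^ A) P, ‖genFun d c P α‖ := by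
    rw [← setIntegral_union (Set.disjoint_left.2 fun x hx hx' => hx'.2 hx.2)
      ((measurableSet_box _).diff (measurableSet_major _ _ _))
      (hI _ Set.inter_subset_left) (hI _ Set.sdiff_subset)]
    refine setIntegral_mono_set ?_ (Eventually.of_forall fun _ => norm_nonneg _) ?_
    · exact hI _ (Set.union_subset Set.inter_subset_left Set.sdiff_subset)
    · rw [Set.inter_union_sdiff]
      exact LE.le.eventuallyLE Set.inter_subset_left
  rw [Real.norm_eq_abs, abs_le] at m1 m2
  have hBm : (h ^ A) ^ B / P ≤ H' ^ B / P := by gcongr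
  have e1 : C1 * ((P : ℝ) ^ ∑ i, d i)⁻¹ * (P : ℝ) ^ s * ((h ^ A) ^ B / P) ≤ C1 * (H' ^ B / P) * Q := by
    rw [hQ]
    calc _ = C1 * (((P : ℝ) ^ ∑ i, d i)⁻¹ * (P : ℝ) ^ s) * ((h ^ A) ^ B / P) := by ring
      _ ≤ C1 * (((P : ℝ) ^ ∑ i, d i)⁻¹ * (P : ℝ) ^ s) * (H' ^ B / P) := by gcongr
      _ = _ := by ring
  have e2 : C1 * ((P : ℝ) ^ ∑ i, d i)⁻¹ * (P : ℝ) ^ s * (H' ^ B / P) = C1 * (H' ^ B / P) * Q := by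
    rw [hQ]; ring
  have e3 : C2 * (P : ℝ) ^ ε * Q / h = C2 * ((P : ℝ) ^ ε / h) * Q := by ring
  rw [e3] at hmin'
  have n1 : 0 ≤ (P : ℝ) ^ ε / h := by positivity
  have n2 : 0 ≤ H' ^ B / P := by positivity
  have : Q * (absSer d c H' * absInt d c H' - absSer d c (h ^ A) * absInt d c (h ^ A))
      ≤ Q * ((C2 * ((P : ℝ) ^ ε / h)) + 2 * C1 * (H' ^ B / P)) := by
    rw [e2] at m2
    linarith [m1.1, m1.2, m2.1, m2.2]
  refine (le_of_mul_le_mul_left this hQ0).trans ?_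
  nlinarith [mul_nonneg hC1 n1, mul_nonneg hC2.le n2]

lemma absSer_nonneg (H : ℝ) : 0 ≤ absSer d c H := Finset.sum_nonneg fun _ _ => norm_nonneg _

lemma one_le_absSer {H : ℝ} (hH : 1 ≤ H) : 1 ≤ absSer d c H := by
  have h0 : (0 : ι → ℚ) ∈ ratPts ι H := (mem_ratPts (by linarith)).2
    ⟨1, le_rfl, by simpa using hH, by simp, fun i => ⟨0, by simp⟩⟩
  have := Finset.single_le_sum (f := fun ρ : ι → ℚ => ‖singCoeff d c ρ‖) (fun _ _ => norm_nonneg _) h0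
  simpa [singCoeff_zero, absSer] using this

lemma absInt_mono {H H' : ℝ} (h : H ≤ H') : absInt d c H ≤ absInt d c H' := by
  refine setIntegral_mono_set ?_ (Eventually.of_forall fun _ => norm_nonneg _)
    (LE.le.eventuallyLE (Metric.closedBall_subset_closedBall h))
  exact integrableOn_of_continuous_pi (by fun_prop) Metric.isBounded_closedBall

lemma absInt_nonneg (H : ℝ) : 0 ≤ absInt d c H := integral_nonneg fun _ => norm_nonneg _

lemma absInt_pos {H : ℝ} (hH : 0 < H) : 0 < absInt d c H := by
  rw [absInt, setIntegral_pos_iff_support_of_nonneg_ae (Eventually.of_forall fun _ => norm_nonneg _)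
    (integrableOn_of_continuous_pi (by fun_prop) Metric.isBounded_closedBall)]
  have hopen : IsOpen (Function.support (fun b : ι → ℝ => ‖singKernel d c b‖) ∩ Metric.ball 0 H) :=
    (Continuous.isOpen_support (by fun_prop)).inter Metric.isOpen_ball
  refine (hopen.measure_pos volume ⟨0, ?_, Metric.mem_ball_self hH⟩).trans_le
    (measure_mono (Set.inter_subset_inter_right _ Metric.ball_subset_closedBall))
  simp [singKernel_zero]

/-- The truncated absolute singular series and integral are jointly bounded. -/
lemma exists_abs_truncation_bound (hd : ∀ i, 1 ≤ d i) {A : ℕ} (hMB : MinorBound d c A) :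
    ∃ C : ℝ, ∀ n : ℕ, 1 ≤ n → absSer d c (2 ^ (A * n)) * absInt d c (2 ^ (A * n)) ≤ C := by
  set B := 2 * Fintype.card ι + 3 with hB
  set E := A * B + 3 * A + 3 with hE
  have hE0 : 0 < E := by omega
  obtain ⟨C, hC0, hC⟩ := abs_truncation_diff_le hd hMB (ε := ((2 * E : ℕ) : ℝ)⁻¹) (by positivity)
  set T : ℕ → ℝ := fun n => absSer d c (2 ^ (A * n)) * absInt d c (2 ^ (A * n)) with hT
  set r : ℝ := (Real.sqrt 2)⁻¹ with hr
  have hs0 : 0 < Real.sqrt 2 := by positivity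
  have hs2 : Real.sqrt 2 ^ 2 = 2 := Real.sq_sqrt (by norm_num)
  have hs1 : 1 < Real.sqrt 2 := by nlinarith
  have hr0 : 0 < r := by positivity
  have hr1 : r < 1 := inv_lt_one_of_one_lt₀ hs1
  have hstep : ∀ n : ℕ, 1 ≤ n → T (n + 1) - T n ≤ 3 * C * r ^ n := fun n hn => by
    have h1 : (2 : ℝ) ≤ 2 ^ n := le_self_pow₀ (by norm_num) (by omega)
    have := hC (2 ^ n) h1 (2 ^ (A * (n + 1)))
      (by rw [← pow_mul]; exact pow_le_pow_right₀ (by norm_num) (by rw [mul_comm]; gcongr; omega))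
      (2 ^ (E * (n + 1))) (by
        push_cast
        rw [← pow_mul, ← pow_succ']
        refine pow_lt_pow_right₀ (by norm_num) ?_
        rw [hE]
        nlinarith [Nat.zero_le (A * B * (n + 1))])
    rw [← pow_mul, mul_comm n A] at this
    refine this.trans ?_
    rw [mul_comm (3 : ℝ) C, mul_assoc]
    gcongr
    have p1 : ((2 ^ (E * (n + 1)) : ℕ) : ℝ) ^ (((2 * E : ℕ) : ℝ)⁻¹) = Real.sqrt 2 ^ (n + 1) := by
      have : ((2 ^ (E * (n + 1)) : ℕ) : ℝ) = (Real.sqrt 2 ^ (n + 1)) ^ (2 * E) := by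
        rw [← pow_mul, show (n + 1) * (2 * E) = 2 * (E * (n + 1)) by ring, pow_mul (Real.sqrt 2) 2, hs2]
        push_cast; rfl
      rw [this, Real.pow_rpow_inv_natCast (by positivity) (by omega)]
    have p2 : Real.sqrt 2 ^ (n + 1) / (2 : ℝ) ^ n ≤ 2 * r ^ n := by
      have e : (2 : ℝ) ^ n = Real.sqrt 2 ^ n * Real.sqrt 2 ^ n := by
        rw [← mul_pow, ← sq, hs2]
      rw [e, hr, inv_pow, pow_succ, mul_comm (Real.sqrt 2 ^ n) (Real.sqrt 2),
        mul_div_mul_right _ _ (by positivity), div_eq_mul_inv]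
      gcongr
      nlinarith
    have p3 : ((2 : ℝ) ^ (A * (n + 1))) ^ B / ((2 ^ (E * (n + 1)) : ℕ) : ℝ) ≤ r ^ n := by
      rw [hr, inv_pow, div_le_iff₀ (by positivity), ← div_eq_inv_mul, le_div_iff₀ (by positivity)]
      push_cast
      have : Real.sqrt 2 ^ n ≤ 2 ^ n := by
        gcongr
        nlinarith
      calc _ ≤ ((2 : ℝ) ^ (A * (n + 1))) ^ B * 2 ^ n := by gcongr
        _ = 2 ^ (A * (n + 1) * B + n) := by rw [← pow_mul, ← pow_add]
        _ ≤ _ := by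
          refine pow_le_pow_right₀ (by norm_num) ?_
          rw [hE]
          nlinarith [Nat.zero_le (A * (n + 1))]
    rw [p1]
    linarith
  have hsum : ∀ n : ℕ, T (n + 1) ≤ T 1 + ∑ m ∈ Finset.range n, 3 * C * r ^ (m + 1) := fun n => by
    induction n with
    | zero => simp
    | succ n ih =>
      rw [Finset.sum_range_succ]
      linarith [hstep (n + 1) (by omega)]
  refine ⟨T 1 + 3 * C * (1 - r)⁻¹, fun n hn => ?_⟩
  obtain ⟨n, rfl⟩ := Nat.exists_eq_add_of_le' hn
  refine (hsum n).trans ?_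
  rw [← Finset.mul_sum]
  gcongr
  calc _ ≤ ∑ m ∈ Finset.range n, r ^ m :=
        Finset.sum_le_sum fun m _ => pow_le_pow_of_le_one hr0.le hr1.le (by omega)
    _ ≤ _ := by
      rw [← tsum_geometric_of_lt_one hr0.le hr1]
      exact (summable_geometric_of_lt_one hr0.le hr1).sum_le_tsum _ fun _ _ => by positivity

end DiagonalSystem

namespace DiagonalSystem

variable {ι : Type*} [Fintype ι] {d : ι → ℕ} {s : ℕ} {c : ι → Fin s → ℤ}

lemma tendsto_two_pow_mul {A : ℕ} (hA : 1 ≤ A) :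
    Tendsto (fun n : ℕ => (2 : ℝ) ^ (A * n)) atTop atTop :=
  (tendsto_pow_atTop_atTop_of_one_lt (by norm_num)).comp
    (tendsto_atTop_mono (fun n => Nat.le_mul_of_pos_left n hA) tendsto_id)

lemma integrable_singKernel (hd : ∀ i, 1 ≤ d i) {A : ℕ} (hMB : MinorBound d c A) :
    Integrable (singKernel d c) := by
  obtain ⟨C, hC⟩ := exists_abs_truncation_bound hd hMB
  refine (aecover_closedBall (μ := (volume : Measure (ι → ℝ))) (x := 0)
    (tendsto_two_pow_mul hMB.1)).integrable_of_integral_norm_bounded C (fun n =>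
      integrableOn_of_continuous_pi (by fun_prop) Metric.isBounded_closedBall) ?_
  filter_upwards [eventually_ge_atTop 1] with n hn
  refine le_trans ?_ (hC n hn)
  exact le_mul_of_one_le_left (absInt_nonneg _) (one_le_absSer (one_le_pow₀ (by norm_num)))

/-- The rational points of the unit cube. -/
abbrev UnitRat (ι : Type*) := {ρ : ι → ℚ // ∀ i, 0 ≤ ρ i ∧ ρ i < 1}

/-- Rational points of bounded height, as a finite set of points of the unit cube. -/
def unitRatPts (ι : Type*) [Fintype ι] (H : ℝ) : Finset (UnitRat ι) :=
  (ratPts ι H).subtype fun ρ => ∀ i, 0 ≤ ρ i ∧ ρ i < 1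

lemma sum_unitRatPts {E : Type*} [AddCommMonoid E] {H : ℝ} (hH : 0 ≤ H) (f : (ι → ℚ) → E) :
    ∑ ρ ∈ unitRatPts ι H, f ρ = ∑ ρ ∈ ratPts ι H, f ρ := by
  refine Finset.sum_subtype_of_mem f fun ρ hρ => ?_
  obtain ⟨m, -, -, h, -⟩ := (mem_ratPts hH).1 hρ
  exact h

lemma tendsto_unitRatPts : Tendsto (unitRatPts ι) atTop atTop := by
  refine tendsto_atTop_finset_of_monotone (fun H H' h => Finset.subtype_mono (ratPts_mono h)) fun ρ => ?_
  refine ⟨denProd ρ.1, Finset.mem_subtype.2 ((mem_ratPts (by positivity)).2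
    ⟨denProd ρ.1, denProd_pos _, le_rfl, ρ.2, denProd_mul _⟩)⟩

lemma summable_norm_singCoeff (hd : ∀ i, 1 ≤ d i) {A : ℕ} (hMB : MinorBound d c A) :
    Summable fun ρ : UnitRat ι => ‖singCoeff d c ρ.1‖ := by
  obtain ⟨C, hC⟩ := exists_abs_truncation_bound hd hMB
  have hI := absInt_pos (d := d) (c := c) one_pos
  refine summable_of_sum_le (c := C / absInt d c 1) (fun _ => norm_nonneg _) fun u => ?_
  have hev : ∀ᶠ n : ℕ in atTop, u ≤ unitRatPts ι ((2 : ℝ) ^ (A * n)) :=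
    (tendsto_unitRatPts.comp (tendsto_two_pow_mul hMB.1)).eventually (eventually_ge_atTop u)
  obtain ⟨n, hn, hn1⟩ := (hev.and (eventually_ge_atTop 1)).exists
  have h2 : (1 : ℝ) ≤ 2 ^ (A * n) := one_le_pow₀ (by norm_num)
  rw [le_div_iff₀ hI]
  calc _ ≤ absSer d c (2 ^ (A * n)) * absInt d c (2 ^ (A * n)) := by
        refine mul_le_mul ?_ (absInt_mono h2) hI.le (absSer_nonneg _)
        rw [absSer, ← sum_unitRatPts (by positivity) fun ρ => ‖singCoeff d c ρ‖]
        exact Finset.sum_le_sum_of_subset_of_nonneg hn fun _ _ _ => norm_nonneg _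
    _ ≤ C := hC n hn1

/-- The circle method: the asymptotic formula follows from the minor arc bound. -/
theorem tendsto_count (hd : ∀ i, 1 ≤ d i) {A : ℕ} (hMB : MinorBound d c A) {N : ℕ → ℂ}
    (hN : ∀ P a, N P = ∫ α in box a, genFun d c P α) :
    Tendsto (fun P : ℕ => N P * (((P : ℝ) ^ s * ((P : ℝ) ^ ∑ i, d i)⁻¹ : ℝ) : ℂ)⁻¹) atTop
      (nhds ((∑' ρ : UnitRat ι, singCoeff d c ρ.1) * ∫ b, singKernel d c b)) := by
  obtain ⟨C1, hC1, hmaj⟩ := exists_major_approx d c hd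
  set B := 2 * Fintype.card ι + 3 with hB
  set δ : ℝ := (2 * ((A : ℝ) * B + 3 * A + 3))⁻¹ with hδ
  have hδ0 : 0 < δ := by positivity
  obtain ⟨C2, hC2, hmin⟩ := hMB.2 (δ / 2) (by positivity)
  set h : ℕ → ℝ := fun P => (P : ℝ) ^ δ with hh
  have hhT : Tendsto h atTop atTop := (tendsto_rpow_atTop hδ0).comp tendsto_natCast_atTop_atTop
  have hHT : Tendsto (fun P => h P ^ A) atTop atTop :=
    (tendsto_pow_atTop (by have := hMB.1; omega)).comp hhT
  have hZ : Tendsto (fun P => ∑ ρ ∈ ratPts ι (h P ^ A), singCoeff d c ρ) atTop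
      (nhds (∑' ρ : UnitRat ι, singCoeff d c ρ.1)) := by
    have h1 := (summable_norm_singCoeff hd hMB).of_norm.hasSum.comp (tendsto_unitRatPts.comp hHT)
    refine h1.congr fun P => ?_
    exact sum_unitRatPts (by positivity) fun ρ => singCoeff d c ρ
  have hW : Tendsto (fun P => ∫ b in Metric.closedBall (0 : ι → ℝ) (h P ^ A), singKernel d c b) atTop
      (nhds (∫ b, singKernel d c b)) :=
    (aecover_closedBall (μ := (volume : Measure (ι → ℝ))) (x := 0) hHT).integral_tendsto_of_countably_generated
      (integrable_singKernel hd hMB)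
  have hdiff : Tendsto (fun P : ℕ => N P * (((P : ℝ) ^ s * ((P : ℝ) ^ ∑ i, d i)⁻¹ : ℝ) : ℂ)⁻¹
      - (∑ ρ ∈ ratPts ι (h P ^ A), singCoeff d c ρ) *
        ∫ b in Metric.closedBall (0 : ι → ℝ) (h P ^ A), singKernel d c b) atTop (nhds 0) := by
    have hlim : Tendsto (fun P : ℕ => C1 * (P : ℝ) ^ (-(1 / 2 : ℝ)) + C2 * (P : ℝ) ^ (-(δ / 2))) atTop (nhds 0) := by
      have h1 := ((tendsto_rpow_neg_atTop (by norm_num : (0 : ℝ) < 1 / 2)).comp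
        tendsto_natCast_atTop_atTop).const_mul C1
      have h2 := ((tendsto_rpow_neg_atTop (by positivity : (0 : ℝ) < δ / 2)).comp
        tendsto_natCast_atTop_atTop).const_mul C2
      simpa using h1.add h2
    refine squeeze_zero_norm' ?_ hlim
    filter_upwards [hhT.eventually_ge_atTop 2, eventually_ge_atTop 17] with P hhP hP17
    have hP17' : (17 : ℝ) ≤ P := by exact_mod_cast hP17
    have hP0 : (0 : ℝ) < P := by linarith
    have hP1 : 1 ≤ P := by omega
    have hpow : ∀ n : ℕ, (h P ^ A) ^ n = (P : ℝ) ^ (δ * (A * n)) := fun n => by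
      rw [← pow_mul, hh]
      simp only
      rw [← Real.rpow_natCast, ← Real.rpow_mul hP0.le]
      push_cast; rfl
    have hδAB : δ * (A * B) ≤ 1 / 2 := by
      rw [hδ, inv_mul_le_iff₀ (by positivity)]
      have : (0 : ℝ) ≤ A := by positivity
      linarith
    have hH3 : 2 * (h P ^ A) ^ 3 < (P : ℝ) := by
      have h3 : (h P ^ A) ^ 3 ≤ (P : ℝ) ^ (1 / 2 : ℝ) := by
        rw [hpow]
        refine Real.rpow_le_rpow_of_exponent_le (by linarith) ?_
        rw [hδ, inv_mul_le_iff₀ (by positivity)]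
        have : (0 : ℝ) ≤ (A : ℝ) * B := by positivity
        push_cast
        linarith
      rw [← Real.sqrt_eq_rpow] at h3
      have h4 := Real.sq_sqrt hP0.le
      have h5 : 4 < Real.sqrt P := Real.lt_sqrt_of_sq_lt (by linarith)
      nlinarith
    have hH1 : 1 ≤ h P ^ A := one_le_pow₀ (by linarith)
    have m1 := hmaj (fun z => z) (fun x y => le_rfl) (h P ^ A) (h P ^ A) hH1 le_rfl P hH3
    have m2 := hmin (h P) hhP P hP1 (fun _ => -((h P ^ A) / P))
    set Q : ℝ := (P : ℝ) ^ s * ((P : ℝ) ^ ∑ i, d i)⁻¹ with hQ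
    have hQ0 : 0 < Q := by positivity
    have hsplit := integral_inter_add_sdiff (f := genFun d c P) (s := box fun _ : ι => -((h P ^ A) / P))
      (measurableSet_major d (h P ^ A) P)
      (integrableOn_of_continuous_pi (by fun_prop) (isBounded_box _))
    rw [← hN] at hsplit
    have hmin2 := (norm_integral_le_integral_norm (μ := volume.restrict
      (box (fun _ : ι => -((h P ^ A) / P)) \ major d (h P ^ A) P)) (genFun d c P)).trans m2
    have e1 : ((P : ℝ) ^ ∑ i, d i)⁻¹ • ∑ ρ ∈ ratPts ι (h P ^ A),
        ∫ b in Metric.closedBall (0 : ι → ℝ) (h P ^ A), (P : ℂ) ^ s * (singCoeff d c ρ * singKernel d c b)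
        = (Q : ℂ) * ((∑ ρ ∈ ratPts ι (h P ^ A), singCoeff d c ρ) *
        ∫ b in Metric.closedBall (0 : ι → ℝ) (h P ^ A), singKernel d c b) := by
      simp only [integral_const_mul, Complex.real_smul]
      rw [← Finset.mul_sum, ← Finset.sum_mul, hQ]
      push_cast
      ring
    rw [e1] at m1
    set Z := (∑ ρ ∈ ratPts ι (h P ^ A), singCoeff d c ρ) *
        ∫ b in Metric.closedBall (0 : ι → ℝ) (h P ^ A), singKernel d c b
    have hQc : (Q : ℂ) ≠ 0 := by exact_mod_cast hQ0.ne'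
    have hNQ : ‖N P - Q * Z‖ ≤ Q * (C1 * (P : ℝ) ^ (-(1 / 2 : ℝ)) + C2 * (P : ℝ) ^ (-(δ / 2))) := by
      rw [← hsplit, add_sub_right_comm]
      refine (norm_add_le _ _).trans ((add_le_add m1 hmin2).trans ?_)
      have b1 : (h P ^ A) ^ B / (P : ℝ) ≤ (P : ℝ) ^ (-(1 / 2 : ℝ)) := by
        rw [hpow, div_eq_mul_inv, ← Real.rpow_neg_one, ← Real.rpow_add hP0]
        exact Real.rpow_le_rpow_of_exponent_le (by linarith) (by linarith)
      have b2 : (P : ℝ) ^ (δ / 2) / h P = (P : ℝ) ^ (-(δ / 2)) := by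
        rw [hh, div_eq_mul_inv, ← Real.rpow_neg hP0.le, ← Real.rpow_add hP0]
        congr 1; ring
      rw [← b2]
      calc _ = Q * (C1 * ((h P ^ A) ^ B / (P : ℝ)) + C2 * ((P : ℝ) ^ (δ / 2) / h P)) := by
            rw [hQ]; ring
        _ ≤ _ := by gcongr
    have e2 : N P * (Q : ℂ)⁻¹ - Z = (N P - Q * Z) / Q := by field_simp
    rw [e2, norm_div, Complex.norm_real, Real.norm_of_nonneg hQ0.le, div_le_iff₀ hQ0]
    linarith
  simpa using hdiff.add (hZ.mul hW)

end DiagonalSystem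

namespace DiagonalSystem

section

variable {𝕜 : Type*} {ι : Type*} [Fintype ι] (d : ι → ℕ) {s : ℕ} (c : ι → Fin s → ℤ)

/-- The values of the diagonal forms at a point. -/
def forms [CommRing 𝕜] (x : Fin s → 𝕜) (i : ι) : 𝕜 := ∑ j, (c i j : 𝕜) * x j ^ d i

/-- The Jacobian matrix of the diagonal forms. -/
def jac [CommRing 𝕜] (x : Fin s → 𝕜) : Matrix ι (Fin s) 𝕜 :=
  Matrix.of fun i j => (d i : 𝕜) * (c i j : 𝕜) * x j ^ (d i - 1)

lemma forms_smul [CommRing 𝕜] (a : 𝕜) (x : Fin s → 𝕜) (i : ι) :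
    forms d c (a • x) i = a ^ d i * forms d c x i := by
  simp only [forms, Pi.smul_apply, smul_eq_mul, mul_pow, Finset.mul_sum]
  exact Finset.sum_congr rfl fun j _ => by ring

lemma rank_jac_smul [Field 𝕜] {a : 𝕜} (ha : a ≠ 0) (x : Fin s → 𝕜) :
    (jac d c (a • x)).rank = (jac d c x).rank := by
  have h : jac d c (a • x) = Matrix.diagonal (fun i => a ^ (d i - 1)) * jac d c x := by
    ext i j
    simp only [jac, Matrix.of_apply, Pi.smul_apply, smul_eq_mul, mul_pow, Matrix.diagonal_mul]
    ring
  rw [h]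
  refine Matrix.rank_mul_eq_right_of_isUnit_det _ _ ?_
  rw [Matrix.det_diagonal]
  exact (Finset.prod_ne_zero_iff.2 fun i _ => pow_ne_zero _ ha).isUnit

/-- Some `|ι|` columns of a full-rank matrix form a surjective submatrix. -/
lemma exists_columns_surjective [Field 𝕜] (A : Matrix ι (Fin s) 𝕜) (h : A.rank = Fintype.card ι) :
    ∃ J : Finset (Fin s), J.card = Fintype.card ι ∧
      ∀ v : ι → 𝕜, ∃ w : Fin s → 𝕜, (∀ j ∉ J, w j = 0) ∧ A.mulVec w = v := by
  obtain ⟨κ, a, ha, hspan, hli⟩ := exists_linearIndependent' 𝕜 A.col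
  have : Fintype κ := Fintype.ofInjective a ha
  have hrk : Module.finrank 𝕜 (Submodule.span 𝕜 (Set.range A.col)) = Fintype.card ι := by
    rw [← Matrix.rank_eq_finrank_span_cols, h]
  have htop : Submodule.span 𝕜 (Set.range A.col) = ⊤ :=
    Submodule.eq_top_of_finrank_eq (by rw [hrk, Module.finrank_fintype_fun_eq_card])
  refine ⟨Finset.univ.map ⟨a, ha⟩, ?_, fun v => ?_⟩
  · rw [Finset.card_map, Finset.card_univ, ← hrk, ← hspan, finrank_span_eq_card hli]
  · have hv : v ∈ Submodule.span 𝕜 (Set.range (A.col ∘ a)) := by rw [hspan, htop]; trivial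
    obtain ⟨u, hu⟩ := (Submodule.mem_span_range_iff_exists_fun 𝕜).1 hv
    refine ⟨fun j => ∑ x, if a x = j then u x else 0, fun j hj => ?_, ?_⟩
    · refine Finset.sum_eq_zero fun x _ => if_neg fun hx => hj ?_
      exact Finset.mem_map.2 ⟨x, Finset.mem_univ _, hx⟩
    · rw [← hu]
      ext i
      simp only [Matrix.mulVec, dotProduct, Finset.mul_sum, mul_ite, mul_zero]
      rw [Finset.sum_comm]
      simp only [Finset.sum_ite_eq, Finset.mem_univ, if_true, Finset.sum_apply, Pi.smul_apply,
        smul_eq_mul, Function.comp_apply, Matrix.col_apply]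
      exact Finset.sum_congr rfl fun x _ => mul_comm _ _

variable [NontriviallyNormedField 𝕜]

/-- The derivative of the diagonal forms. -/
def formsDeriv (x : Fin s → 𝕜) : (Fin s → 𝕜) →L[𝕜] (ι → 𝕜) :=
  ContinuousLinearMap.pi fun i => ∑ j, jac d c x i j • ContinuousLinearMap.proj (R := 𝕜) j

lemma formsDeriv_apply (x w : Fin s → 𝕜) : formsDeriv d c x w = (jac d c x).mulVec w := by
  ext i
  simp [formsDeriv, Matrix.mulVec, dotProduct]

lemma hasStrictFDerivAt_forms (x : Fin s → 𝕜) :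
    HasStrictFDerivAt (forms d c) (formsDeriv d c x) x := by
  rw [formsDeriv, hasStrictFDerivAt_pi']
  intro i
  have : (fun y : Fin s → 𝕜 => forms d c y i) = fun y => ∑ j, (c i j : 𝕜) * y j ^ d i := rfl
  rw [this]
  have h := HasStrictFDerivAt.fun_sum (u := Finset.univ) fun (j : Fin s) _ =>
    ((hasStrictFDerivAt_apply (𝕜 := 𝕜) j x).pow (d i)).const_mul (c i j : 𝕜)
  refine h.congr_fderiv ?_
  ext w
  simp [jac]
  exact Finset.sum_congr rfl fun j _ => by ring

/-- Near a non-singular zero of a diagonal system, the coordinates outside a set of `|ι|`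
coordinates can be prescribed. -/
theorem exists_forms_eq_zero_near [CompleteSpace 𝕜] {x₀ : Fin s → 𝕜} (h0 : forms d c x₀ = 0)
    (hr : (jac d c x₀).rank = Fintype.card ι) :
    ∃ J : Finset (Fin s), J.card = Fintype.card ι ∧ ∀ W ∈ nhds x₀, ∀ᶠ y in nhds x₀,
      ∃ x ∈ W, (∀ j ∉ J, x j = y j) ∧ forms d c x = 0 := by
  obtain ⟨J, hJ, hsurj⟩ := exists_columns_surjective _ hr
  refine ⟨J, hJ, fun W hW => ?_⟩
  let R : (Fin s → 𝕜) →L[𝕜] ({j // j ∉ J} → 𝕜) :=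
    ContinuousLinearMap.pi fun j => ContinuousLinearMap.proj (R := 𝕜) j.1
  have hd : HasStrictFDerivAt (fun x => (forms d c x, R x)) ((formsDeriv d c x₀).prod R) x₀ :=
    (hasStrictFDerivAt_forms d c x₀).prodMk R.hasStrictFDerivAt
  have hrange : ((formsDeriv d c x₀).prod R).range = ⊤ := by
    rw [LinearMap.range_eq_top]
    rintro ⟨v, u⟩
    let u' : Fin s → 𝕜 := fun j => if hj : j ∉ J then u ⟨j, hj⟩ else 0
    obtain ⟨w, hw0, hw⟩ := hsurj (v - (jac d c x₀).mulVec u')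
    refine ⟨w + u', ?_⟩
    refine Prod.ext ?_ ?_
    · change formsDeriv d c x₀ (w + u') = v
      rw [formsDeriv_apply, Matrix.mulVec_add, hw]; abel
    · change R (w + u') = u
      ext j
      simp [R, u', hw0 j.1 j.2, j.2]
  have hmap := hd.map_nhds_eq_of_surj hrange
  have h1 : (fun x => (forms d c x, R x)) '' W ∈ nhds ((0 : ι → 𝕜), R x₀) := by
    rw [← h0, ← hmap]; exact image_mem_map hW
  have h2 : Tendsto (fun y : Fin s → 𝕜 => ((0 : ι → 𝕜), R y)) (nhds x₀) (nhds (0, R x₀)) :=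
    (by fun_prop : Continuous fun y : Fin s → 𝕜 => ((0 : ι → 𝕜), R y)).tendsto _
  filter_upwards [h2 h1] with y hy
  obtain ⟨x, hxW, hx⟩ := hy
  refine ⟨x, hxW, fun j hj => ?_, congrArg Prod.fst hx⟩
  exact congrFun (congrArg Prod.snd hx) ⟨j, hj⟩

end

end DiagonalSystem

namespace DiagonalSystem

section

variable {ι : Type*} [Fintype ι] (d : ι → ℕ) {s : ℕ} (c : ι → Fin s → ℤ)

lemma continuous_forms {𝕜 : Type*} [NormedField 𝕜] (i : ι) :
    Continuous fun x : Fin s → 𝕜 => forms d c x i := by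
  unfold forms; fun_prop

/-- The points of the open unit cube at which all forms are at most `δ` in absolute value. -/
def nearZeros (δ : ℝ) : Set (Fin s → ℝ) :=
  {x | (∀ j, x j ∈ Set.Ioo (0 : ℝ) 1) ∧ ∀ i, |forms d c x i| ≤ δ}

lemma measurableSet_nearZeros (δ : ℝ) : MeasurableSet (nearZeros d c δ) := by
  have : nearZeros d c δ = (⋂ j, (fun x : Fin s → ℝ => x j) ⁻¹' Set.Ioo 0 1) ∩
      ⋂ i, (fun x => |forms d c x i|) ⁻¹' Set.Iic δ := by
    ext x; simp [nearZeros]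
  rw [this]
  refine MeasurableSet.inter (MeasurableSet.iInter fun j => ?_) (MeasurableSet.iInter fun i => ?_)
  · exact measurableSet_Ioo.preimage (measurable_pi_apply j)
  · exact measurableSet_Iic.preimage (continuous_forms d c i).abs.measurable

/-- A non-singular solution with positive coordinates can be moved into the open unit cube. -/
lemma exists_solution_unit_cube {x₀ : Fin s → ℝ} (hpos : ∀ j, 0 < x₀ j) (h0 : forms d c x₀ = 0)
    (hr : (jac d c x₀).rank = Fintype.card ι) :
    ∃ x : Fin s → ℝ, (∀ j, x j ∈ Set.Ioo (0 : ℝ) 1) ∧ forms d c x = 0 ∧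
      (jac d c x).rank = Fintype.card ι := by
  set S := 1 + ∑ j, x₀ j with hS
  have hS0 : 0 < S := by
    have := Finset.sum_nonneg fun j (_ : j ∈ Finset.univ) => (hpos j).le
    linarith
  refine ⟨S⁻¹ • x₀, fun j => ⟨mul_pos (inv_pos.2 hS0) (hpos j), ?_⟩, ?_, ?_⟩
  · have := Finset.single_le_sum (fun j (_ : j ∈ Finset.univ) => (hpos j).le) (Finset.mem_univ j)
    simp only [Pi.smul_apply, smul_eq_mul]
    rw [inv_mul_lt_one₀ hS0]; linarith
  · ext i
    rw [forms_smul, h0]; simp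
  · rw [rank_jac_smul d c (inv_pos.2 hS0).ne', hr]

lemma volume_nearZeros_ge {x₀ : Fin s → ℝ} (hcube : ∀ j, x₀ j ∈ Set.Ioo (0 : ℝ) 1)
    (h0 : forms d c x₀ = 0) (hr : (jac d c x₀).rank = Fintype.card ι) :
    ∃ C > 0, ∃ δ₀ > 0, ∀ δ > 0, δ ≤ δ₀ →
      ENNReal.ofReal (C * δ ^ Fintype.card ι) ≤ volume (nearZeros d c δ) := by
  obtain ⟨p, hp, hnear⟩ : ∃ p : Fin s → Prop, Fintype.card {j // p j} = Fintype.card ι ∧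
      ∀ W ∈ nhds x₀, ∀ᶠ y in nhds x₀, ∃ x ∈ W, (∀ j, ¬ p j → x j = y j) ∧ forms d c x = 0 := by
    obtain ⟨J, hJ, hnear⟩ := exists_forms_eq_zero_near d c h0 hr
    refine ⟨fun j => j ∈ J, ?_, hnear⟩
    rw [← hJ, Fintype.card_subtype]
    simp
  obtain ⟨L, U, hU, hL⟩ := (hasStrictFDerivAt_forms d c x₀).exists_lipschitzOnWith
  have hcubeN : {x : Fin s → ℝ | ∀ j, x j ∈ Set.Ioo (0 : ℝ) 1} ∈ nhds x₀ := by
    have : {x : Fin s → ℝ | ∀ j, x j ∈ Set.Ioo (0 : ℝ) 1}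
        = Set.univ.pi fun _ => Set.Ioo (0 : ℝ) 1 := by ext x; simp
    rw [this]
    exact (isOpen_set_pi Set.finite_univ fun _ _ => isOpen_Ioo).mem_nhds fun j _ => hcube j
  obtain ⟨η, hη, hball⟩ := Metric.mem_nhds_iff.1 (Filter.inter_mem hU hcubeN)
  obtain ⟨ε, hε, hsol⟩ := Metric.eventually_nhds_iff_ball.1
    (hnear (Metric.ball x₀ (η / 2)) (Metric.ball_mem_nhds _ (half_pos hη)))
  set L' : ℝ := L + 1 with hL'
  have hL'0 : 0 < L' := by positivity
  refine ⟨(2 / L') ^ Fintype.card ι * (2 * ε) ^ Fintype.card {j // ¬ p j}, by positivity,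
    L' * (η / 2), by positivity, fun δ hδ hδ₀ => ?_⟩
  set τ := δ / L' with hτ
  have hτ0 : 0 < τ := by positivity
  have hτη : τ ≤ η / 2 := by rw [hτ, div_le_iff₀ hL'0]; linarith
  let e := MeasurableEquiv.piEquivPiSubtypeProd (fun _ : Fin s => ℝ) p
  have he : MeasurePreserving e.symm volume volume :=
    (volume_preserving_piEquivPiSubtypeProd (fun _ : Fin s => ℝ) p).symm
  have hm := measurableSet_nearZeros d c δ
  rw [← he.measure_preimage hm.nullMeasurableSet, Measure.volume_eq_prod,
    Measure.prod_apply_symm (he.measurable hm)]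
  let y₀ : {j // ¬ p j} → ℝ := fun j => x₀ j
  have hslice : ∀ y ∈ Metric.ball y₀ ε, ENNReal.ofReal ((2 * τ) ^ Fintype.card {j // p j})
      ≤ volume ((fun x => (x, y)) ⁻¹' (e.symm ⁻¹' nearZeros d c δ)) := by
    intro y hy
    let y' : Fin s → ℝ := fun j => if hj : p j then x₀ j else y ⟨j, hj⟩
    have hy' : y' ∈ Metric.ball x₀ ε := by
      rw [Metric.mem_ball, dist_pi_lt_iff hε] at hy ⊢
      intro j
      by_cases hj : p j
      · simpa [y', hj] using hε
      · simpa [y', hj] using hy ⟨j, hj⟩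
    obtain ⟨x, hxW, hxy, hx0⟩ := hsol y' hy'
    rw [← Real.volume_pi_ball (fun j : {j // p j} => x j) hτ0]
    refine measure_mono fun w hw => ?_
    set z : Fin s → ℝ := e.symm (w, y) with hz
    have hzx : dist z x ≤ τ := by
      rw [dist_pi_le_iff hτ0.le]
      intro j
      by_cases hj : p j
      · have h1 : z j = w ⟨j, hj⟩ := by
          simp [hz, e, MeasurableEquiv.piEquivPiSubtypeProd, Equiv.piEquivPiSubtypeProd, hj]
        rw [h1]
        exact ((dist_le_pi_dist w (fun j : {j // p j} => x j) ⟨j, hj⟩).trans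
          (Metric.mem_ball.1 hw).le)
      · have h1 : z j = y ⟨j, hj⟩ := by
          simp [hz, e, MeasurableEquiv.piEquivPiSubtypeProd, Equiv.piEquivPiSubtypeProd, hj]
        have h2 : x j = y ⟨j, hj⟩ := by rw [hxy j hj]; simp [y', hj]
        rw [h1, h2, dist_self]; exact hτ0.le
    have hxη : dist x x₀ < η / 2 := hxW
    have hzb : z ∈ Metric.ball x₀ η := by
      rw [Metric.mem_ball]
      linarith [dist_triangle z x x₀]
    have hxb : x ∈ Metric.ball x₀ η := by
      rw [Metric.mem_ball]; linarith
    change z ∈ nearZeros d c δ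
    refine ⟨(hball hzb).2, fun i => ?_⟩
    have h3 := hL.dist_le_mul z (hball hzb).1 x (hball hxb).1
    rw [hx0] at h3
    have h4 := dist_le_pi_dist (forms d c z) 0 i
    rw [Real.dist_eq] at h4
    simp only [Pi.zero_apply, sub_zero] at h4
    calc |forms d c z i| ≤ L * dist z x := h4.trans h3
      _ ≤ L' * τ := by gcongr; simp [hL']
      _ = δ := by rw [hτ]; field_simp
  calc ENNReal.ofReal ((2 / L') ^ Fintype.card ι * (2 * ε) ^ Fintype.card {j // ¬ p j}
        * δ ^ Fintype.card ι)
      = ENNReal.ofReal ((2 * τ) ^ Fintype.card {j // p j}) * volume (Metric.ball y₀ ε) := by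
        rw [Real.volume_pi_ball y₀ hε, ← ENNReal.ofReal_mul (by positivity)]
        congr 1
        rw [hp, hτ]
        ring
    _ = ∫⁻ _ in Metric.ball y₀ ε, ENNReal.ofReal ((2 * τ) ^ Fintype.card {j // p j}) := by
        rw [setLIntegral_const]
    _ ≤ ∫⁻ y in Metric.ball y₀ ε, volume ((fun x => (x, y)) ⁻¹' (e.symm ⁻¹' nearZeros d c δ)) :=
        setLIntegral_mono' measurableSet_ball hslice
    _ ≤ _ := setLIntegral_le_lintegral _ _

end

end DiagonalSystem

namespace DiagonalSystem

lemma integral_eC_mul_gaussian {T : ℝ} (hT : 0 < T) (u : ℝ) :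
    ∫ b : ℝ, eC (b * u) * (Real.exp (-(Real.pi / T ^ 2) * b ^ 2) : ℂ)
      = ((T * Real.exp (-Real.pi * (T * u) ^ 2) : ℝ) : ℂ) := by
  have hb : 0 < Real.pi / T ^ 2 := by positivity
  have h := fourierIntegral_gaussian (b := ((Real.pi / T ^ 2 : ℝ) : ℂ)) (by rw [Complex.ofReal_re]; exact hb)
    ((2 * Real.pi * u : ℝ) : ℂ)
  have e1 : ∀ b : ℝ, eC (b * u) * (Real.exp (-(Real.pi / T ^ 2) * b ^ 2) : ℂ)
      = Complex.exp (Complex.I * ((2 * Real.pi * u : ℝ) : ℂ) * b)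
        * Complex.exp (-((Real.pi / T ^ 2 : ℝ) : ℂ) * b ^ 2) := by
    intro b
    rw [eC]
    push_cast
    congr 2
    ring
  simp_rw [e1, h]
  have e2 : ((Real.pi : ℂ) / ((Real.pi / T ^ 2 : ℝ) : ℂ)) ^ (1 / 2 : ℂ) = (T : ℂ) := by
    have : (Real.pi : ℂ) / ((Real.pi / T ^ 2 : ℝ) : ℂ) = ((T ^ 2 : ℝ) : ℂ) := by
      rw [← Complex.ofReal_div]; congr 1; field_simp
    rw [this]
    have h2 : (1 / 2 : ℂ) = ((1 / 2 : ℝ) : ℂ) := by push_cast; ring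
    rw [h2, ← Complex.ofReal_cpow (by positivity), ← Real.sqrt_eq_rpow, Real.sqrt_sq hT.le]
  rw [e2, Complex.ofReal_mul (r := T), Complex.ofReal_exp]
  congr 2
  push_cast
  have : (Real.pi : ℂ) ≠ 0 := by exact_mod_cast Real.pi_ne_zero
  have : (T : ℂ) ≠ 0 := by exact_mod_cast hT.ne'
  field_simp
  ring

section

variable {ι : Type*} [Fintype ι] (d : ι → ℕ) {s : ℕ} (c : ι → Fin s → ℤ)

/-- Lebesgue measure on the unit cube. -/
def cubeMeasure (s : ℕ) : Measure (Fin s → ℝ) :=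
  Measure.pi fun _ => volume.restrict (Set.Ioc (0 : ℝ) 1)

instance (s : ℕ) : IsProbabilityMeasure (cubeMeasure s) := by
  have : IsProbabilityMeasure (volume.restrict (Set.Ioc (0 : ℝ) 1)) := ⟨by simp⟩
  unfold cubeMeasure; infer_instance

lemma cubeMeasure_nearZeros (δ : ℝ) :
    cubeMeasure s (nearZeros d c δ) = volume (nearZeros d c δ) := by
  rw [cubeMeasure, ← Measure.restrict_pi_pi, Measure.restrict_apply (measurableSet_nearZeros d c δ),
    Set.inter_eq_left.2]
  · rfl
  · exact fun x hx j _ => Set.Ioo_subset_Ioc_self (hx.1 j)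

lemma singKernel_eq_integral (b : ι → ℝ) :
    singKernel d c b = ∫ t, eC (∑ i, b i * forms d c t i) ∂cubeMeasure s := by
  have h : ∀ t : Fin s → ℝ, eC (∑ i, b i * forms d c t i)
      = ∏ j, eC (∑ i, b i * (c i j * t j ^ d i)) := by
    intro t
    rw [← eC_sum]
    congr 1
    rw [Finset.sum_comm]
    simp only [forms, Finset.mul_sum]
  simp_rw [h]
  rw [cubeMeasure, integral_fintype_prod_eq_prod
    (fun (j : Fin s) (t : ℝ) => eC (∑ i, b i * (c i j * t ^ d i)))]
  simp only [singKernel, oscInt]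
  exact Finset.prod_congr rfl fun j _ => intervalIntegral.integral_of_le zero_le_one

/-- The Gaussian weight of scale `T`. -/
def gaussWeight (T : ℝ) (b : ι → ℝ) : ℝ := ∏ i, Real.exp (-(Real.pi / T ^ 2) * b i ^ 2)

lemma gaussWeight_nonneg (T : ℝ) (b : ι → ℝ) : 0 ≤ gaussWeight T b :=
  Finset.prod_nonneg fun _ _ => (Real.exp_pos _).le

lemma gaussWeight_le_one (T : ℝ) (b : ι → ℝ) : gaussWeight T b ≤ 1 := by
  refine Finset.prod_le_one (fun _ _ => (Real.exp_pos _).le) fun i _ => ?_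
  rw [Real.exp_le_one_iff, neg_mul]
  have : 0 ≤ Real.pi / T ^ 2 * b i ^ 2 := by positivity
  linarith

lemma continuous_gaussWeight (T : ℝ) : Continuous (gaussWeight (ι := ι) T) := by
  unfold gaussWeight; fun_prop

lemma integrable_gaussWeight {T : ℝ} (hT : 0 < T) : Integrable (gaussWeight (ι := ι) T) :=
  Integrable.fintype_prod fun _ => integrable_exp_neg_mul_sq (by positivity)

lemma integral_singKernel_mul_gaussWeight {T : ℝ} (hT : 0 < T) :
    ∫ b, singKernel d c b * (gaussWeight T b : ℂ)
      = ((∫ t, ∏ i, T * Real.exp (-Real.pi * (T * forms d c t i) ^ 2) ∂cubeMeasure s : ℝ) : ℂ) := by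
  have hF : ∀ i, Continuous fun t : Fin s → ℝ => forms d c t i := continuous_forms d c
  simp_rw [singKernel_eq_integral, ← integral_mul_const]
  rw [integral_integral_swap, ← integral_complex_ofReal]
  · refine integral_congr_ae (Eventually.of_forall fun t => ?_)
    have h : ∀ b : ι → ℝ, eC (∑ i, b i * forms d c t i) * (gaussWeight T b : ℂ)
        = ∏ i, eC (b i * forms d c t i) * (Real.exp (-(Real.pi / T ^ 2) * b i ^ 2) : ℂ) := by
      intro b
      rw [eC_sum, gaussWeight, Finset.prod_mul_distrib]
      push_cast; rfl
    simp only [h]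
    rw [integral_fintype_prod_volume_eq_prod
      (fun (i : ι) (b : ℝ) => eC (b * forms d c t i) * (Real.exp (-(Real.pi / T ^ 2) * b ^ 2) : ℂ))]
    simp_rw [integral_eC_mul_gaussian hT]
    push_cast; rfl
  · refine ((integrable_gaussWeight hT).comp_fst (cubeMeasure s)).mono' ?_ ?_
    · refine Continuous.aestronglyMeasurable ?_
      refine Continuous.mul (continuous_eC.comp ?_) (Complex.continuous_ofReal.comp
        ((continuous_gaussWeight T).comp continuous_fst))
      exact continuous_finsetSum _ fun i _ =>
        ((continuous_apply i).comp continuous_fst).mul ((hF i).comp continuous_snd)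
    · refine Eventually.of_forall fun x => ?_
      simp only [Function.uncurry, norm_mul, norm_eC, one_mul, Complex.norm_real]
      rw [Real.norm_of_nonneg (gaussWeight_nonneg _ _)]

/-- Positivity of the singular integral. -/
theorem integral_singKernel_pos {x₀ : Fin s → ℝ} (hpos : ∀ j, 0 < x₀ j) (h0 : forms d c x₀ = 0)
    (hr : (jac d c x₀).rank = Fintype.card ι) (hInt : Integrable (singKernel d c)) :
    ∃ y : ℝ, 0 < y ∧ ∫ b, singKernel d c b = (y : ℂ) := by
  obtain ⟨x₁, hx₁, h1, hr1⟩ := exists_solution_unit_cube d c hpos h0 hr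
  obtain ⟨C, hC, δ₀, hδ₀, hvol⟩ := volume_nearZeros_ge d c hx₁ h1 hr1
  set r := Fintype.card ι with hrdef
  let Y : ℕ → ℝ := fun n =>
    ∫ t, ∏ i, ((n : ℝ) * Real.exp (-Real.pi * (n * forms d c t i) ^ 2)) ∂cubeMeasure s
  have hlim : Tendsto (fun n : ℕ => ((Y n : ℝ) : ℂ)) atTop (nhds (∫ b, singKernel d c b)) := by
    have h2 : Tendsto (fun n : ℕ => ∫ b, singKernel d c b * (gaussWeight (n : ℝ) b : ℂ)) atTop
        (nhds (∫ b, singKernel d c b)) := by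
      refine tendsto_integral_of_dominated_convergence (fun b => ‖singKernel d c b‖) ?_ hInt.norm
        ?_ ?_
      · intro n
        exact ((continuous_singKernel d c).mul
          (Complex.continuous_ofReal.comp (continuous_gaussWeight _))).aestronglyMeasurable
      · intro n
        refine Eventually.of_forall fun b => ?_
        rw [norm_mul, Complex.norm_real, Real.norm_of_nonneg (gaussWeight_nonneg _ _)]
        exact mul_le_of_le_one_right (norm_nonneg _) (gaussWeight_le_one _ _)
      · refine Eventually.of_forall fun b => ?_
        have h3 : Tendsto (fun n : ℕ => gaussWeight (n : ℝ) b) atTop (nhds 1) := by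
          have h4 : ∀ i : ι, Tendsto (fun n : ℕ => Real.exp (-(Real.pi / (n : ℝ) ^ 2) * b i ^ 2))
              atTop (nhds 1) := by
            intro i
            have h5 : Tendsto (fun n : ℕ => Real.pi / (n : ℝ) ^ 2) atTop (nhds 0) :=
              Tendsto.div_atTop tendsto_const_nhds
                ((tendsto_pow_atTop two_ne_zero).comp tendsto_natCast_atTop_atTop)
            have h6 := (h5.neg.mul_const (b i ^ 2)).rexp
            simpa using h6
          have h9 := tendsto_finsetProd Finset.univ fun i _ => h4 i
          rwa [Finset.prod_const_one] at h9
        have h7 := ((Complex.continuous_ofReal.tendsto _).comp h3).const_mul (singKernel d c b)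
        simpa using h7
    refine h2.congr' ?_
    filter_upwards [eventually_gt_atTop 0] with n hn
    exact integral_singKernel_mul_gaussWeight d c (by exact_mod_cast hn)
  have hlow : ∀ᶠ n : ℕ in atTop, C * Real.exp (-Real.pi * r) ≤ Y n := by
    filter_upwards [eventually_gt_atTop 0, tendsto_natCast_atTop_atTop.eventually_ge_atTop δ₀⁻¹]
      with n hn hnδ
    have hn0 : (0 : ℝ) < n := by exact_mod_cast hn
    have hF : ∀ i, Continuous fun t : Fin s → ℝ => forms d c t i := continuous_forms d c
    set g : (Fin s → ℝ) → ℝ := fun t =>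
      ∏ i, ((n : ℝ) * Real.exp (-Real.pi * (n * forms d c t i) ^ 2)) with hg
    have hg0 : ∀ t, 0 ≤ g t := fun t => Finset.prod_nonneg fun i _ => by positivity
    have hgi : Integrable g (cubeMeasure s) := by
      refine (integrable_const ((n : ℝ) ^ r)).mono' ?_ (Eventually.of_forall fun t => ?_)
      · exact Continuous.aestronglyMeasurable (by rw [hg]; fun_prop)
      · rw [Real.norm_of_nonneg (hg0 t), hrdef, ← Finset.card_univ]
        rw [← Finset.prod_const]
        refine Finset.prod_le_prod (fun i _ => by positivity) fun i _ => ?_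
        refine mul_le_of_le_one_right hn0.le ?_
        rw [Real.exp_le_one_iff]
        have : 0 ≤ Real.pi * (n * forms d c t i) ^ 2 := by positivity
        linarith
    have hδ : (0 : ℝ) < (n : ℝ)⁻¹ := by positivity
    have hv := hvol (n : ℝ)⁻¹ hδ (inv_le_of_inv_le₀ hδ₀ hnδ)
    rw [← cubeMeasure_nearZeros] at hv
    have hv' : C * (n : ℝ)⁻¹ ^ r ≤ (cubeMeasure s).real (nearZeros d c (n : ℝ)⁻¹) := by
      rw [Measure.real, ← ENNReal.ofReal_le_iff_le_toReal (measure_ne_top _ _)]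
      exact hv
    calc C * Real.exp (-Real.pi * r)
        = (C * (n : ℝ)⁻¹ ^ r) * ((n : ℝ) * Real.exp (-Real.pi)) ^ r := by
          rw [mul_pow, ← Real.exp_nat_mul, inv_pow, mul_comm (r : ℝ)]
          field_simp
      _ ≤ (cubeMeasure s).real (nearZeros d c (n : ℝ)⁻¹) * ((n : ℝ) * Real.exp (-Real.pi)) ^ r := by
          gcongr
      _ = ∫ t in nearZeros d c (n : ℝ)⁻¹, ((n : ℝ) * Real.exp (-Real.pi)) ^ r ∂cubeMeasure s := by
          rw [setIntegral_const, smul_eq_mul]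
      _ ≤ ∫ t in nearZeros d c (n : ℝ)⁻¹, g t ∂cubeMeasure s := by
          refine setIntegral_mono_on (integrable_const _).integrableOn hgi.integrableOn
            (measurableSet_nearZeros d c _) fun t ht => ?_
          rw [hrdef, ← Finset.card_univ, ← Finset.prod_const]
          refine Finset.prod_le_prod (fun i _ => by positivity) fun i _ => ?_
          refine mul_le_mul_of_nonneg_left (Real.exp_le_exp.2 ?_) hn0.le
          have h8 : (n * forms d c t i) ^ 2 ≤ 1 := by
            rw [sq_le_one_iff_abs_le_one, abs_mul, abs_of_pos hn0]
            calc (n : ℝ) * |forms d c t i| ≤ n * (n : ℝ)⁻¹ := by gcongr; exact ht.2 i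
              _ = 1 := mul_inv_cancel₀ hn0.ne'
          nlinarith [Real.pi_pos]
      _ ≤ ∫ t, g t ∂cubeMeasure s :=
          setIntegral_le_integral hgi (Eventually.of_forall hg0)
  have hre : Tendsto Y atTop (nhds (∫ b, singKernel d c b).re) := by
    exact (Complex.continuous_re.tendsto _).comp hlim
  refine ⟨(∫ b, singKernel d c b).re, ?_, ?_⟩
  · exact lt_of_lt_of_le (by positivity) (ge_of_tendsto hre hlow)
  · exact tendsto_nhds_unique hlim ((Complex.continuous_ofReal.tendsto _).comp hre)

end

end DiagonalSystem

namespace DiagonalSystem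

lemma eC_eq_one_iff {x : ℝ} : eC x = 1 ↔ ∃ n : ℤ, x = n := by
  refine ⟨fun h => ?_, fun ⟨n, hn⟩ => by rw [hn, eC_int]⟩
  rw [eC, Complex.exp_eq_one_iff] at h
  obtain ⟨n, hn⟩ := h
  refine ⟨n, ?_⟩
  have h2 : (2 * Real.pi * Complex.I : ℂ) ≠ 0 := Complex.two_pi_I_ne_zero
  rw [mul_comm (n : ℂ)] at hn
  have h3 := mul_left_cancel₀ h2 hn
  exact_mod_cast h3

lemma eC_nat_mul (n : ℕ) (x : ℝ) : eC (n * x) = eC x ^ n := by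
  rw [eC, eC, ← Complex.exp_nat_mul]
  push_cast; ring_nf

lemma sum_range_eC_div {m : ℕ} (hm : 1 ≤ m) (N : ℤ) :
    ∑ a ∈ Finset.range m, eC ((a : ℝ) * ((N : ℝ) / m)) = if (m : ℤ) ∣ N then (m : ℂ) else 0 := by
  have hm0 : (m : ℝ) ≠ 0 := by positivity
  simp_rw [eC_nat_mul]
  split_ifs with h
  · obtain ⟨z, rfl⟩ := h
    have : eC (((m * z : ℤ) : ℝ) / m) = 1 := by
      rw [eC_eq_one_iff]; exact ⟨z, by push_cast; field_simp⟩
    rw [this]; simp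
  · have h1 : eC ((N : ℝ) / m) ≠ 1 := by
      rw [Ne, eC_eq_one_iff]
      rintro ⟨z, hz⟩
      rw [div_eq_iff hm0] at hz
      exact h ⟨z, by rw [mul_comm]; exact_mod_cast hz⟩
    have h2 : eC ((N : ℝ) / m) ^ m = 1 := by
      rw [← eC_nat_mul, mul_div_cancel₀ _ hm0, eC_int]
    have h3 := geom_sum_mul (eC ((N : ℝ) / m)) m
    rw [h2, sub_self] at h3
    exact (mul_eq_zero.1 h3).resolve_right (sub_ne_zero.2 h1)

section

variable {ι : Type*} [Fintype ι] (d : ι → ℕ) {s : ℕ} (c : ι → Fin s → ℤ)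

lemma forms_map {R S : Type*} [CommRing R] [CommRing S] (f : R →+* S) (x : Fin s → R) (i : ι) :
    forms d c (fun j => f (x j)) i = f (forms d c x i) := by
  simp [forms, map_sum, map_mul, map_pow]

/-- The number of solutions of the system modulo `m`. -/
def modSol (m : ℕ) : ℕ := Nat.card {x : Fin s → ZMod m // forms d c x = 0}

lemma modSol_mul {m n : ℕ} (h : m.Coprime n) :
    modSol d c (m * n) = modSol d c m * modSol d c n := by
  rw [modSol, modSol, modSol, ← Nat.card_prod]
  let e := ZMod.chineseRemainder h
  have hfst : ∀ x : Fin s → ZMod (m * n), ∀ i,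
      forms d c (fun j => (e (x j)).1) i = (e (forms d c x i)).1 := fun x i =>
    forms_map d c ((RingHom.fst _ _).comp e.toRingHom) x i
  have hsnd : ∀ x : Fin s → ZMod (m * n), ∀ i,
      forms d c (fun j => (e (x j)).2) i = (e (forms d c x i)).2 := fun x i =>
    forms_map d c ((RingHom.snd _ _).comp e.toRingHom) x i
  refine Nat.card_congr
    { toFun := fun x => (⟨fun j => (e (x.1 j)).1, ?_⟩, ⟨fun j => (e (x.1 j)).2, ?_⟩)
      invFun := fun y => ⟨fun j => e.symm (y.1.1 j, y.2.1 j), ?_⟩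
      left_inv := fun x => ?_
      right_inv := fun y => ?_ }
  · ext i
    rw [hfst, congrFun x.2 i]; simp
  · ext i
    rw [hsnd, congrFun x.2 i]; simp
  · ext i
    refine e.injective (Prod.ext ?_ ?_)
    · rw [← hfst]; simpa using congrFun y.1.2 i
    · rw [← hsnd]; simpa using congrFun y.2.2 i
  · ext j; simp
  · refine Prod.ext (Subtype.ext ?_) (Subtype.ext ?_) <;> ext j <;> simp

lemma modSol_eq_card {m : ℕ} (hm : 1 ≤ m) : modSol d c m
    = ((Fintype.piFinset fun _ : Fin s => Finset.range m).filter
        fun x => ∀ i, (m : ℤ) ∣ forms d c (fun j => (x j : ℤ)) i).card := by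
  have : NeZero m := ⟨by omega⟩
  rw [modSol, Nat.card_eq_fintype_card, Fintype.card_subtype]
  have hcast : ∀ x : Fin s → ℕ, (forms d c (fun j => (x j : ZMod m)) = 0) ↔
      ∀ i, (m : ℤ) ∣ forms d c (fun j => (x j : ℤ)) i := by
    intro x
    rw [funext_iff]
    refine forall_congr' fun i => ?_
    have h := forms_map d c (Int.castRingHom (ZMod m)) (fun j => (x j : ℤ)) i
    simp only [eq_intCast, Int.cast_natCast] at h
    rw [← ZMod.intCast_zmod_eq_zero_iff_dvd, h, Pi.zero_apply]
  refine Finset.card_nbij' (fun x j => (x j).val) (fun x j => (x j : ZMod m)) ?_ ?_ ?_ ?_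
  · intro x hx
    simp only [Finset.coe_filter, Set.mem_ofPred_eq, Finset.mem_univ, true_and,
      Fintype.mem_piFinset, Finset.mem_range] at hx ⊢
    refine ⟨fun j => ZMod.val_lt _, (hcast _).1 ?_⟩
    simpa using hx
  · intro x hx
    simp only [Finset.coe_filter, Set.mem_ofPred_eq, Finset.mem_univ, true_and,
      Fintype.mem_piFinset, Finset.mem_range] at hx ⊢
    exact (hcast _).2 hx.2
  · intro x _
    ext j; simp
  · intro x hx
    simp only [Finset.coe_filter, Set.mem_ofPred_eq, Fintype.mem_piFinset, Finset.mem_range] at hx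
    ext j
    exact ZMod.val_cast_of_lt (hx.1 j)

/-- The normalised number of solutions modulo `m` is the sum of the singular series terms at the
`m`-torsion points. -/
lemma sum_torPts_singCoeff {m : ℕ} (hm : 1 ≤ m) :
    ∑ ρ ∈ torPts ι m, singCoeff d c ρ
      = (m : ℂ) ^ Fintype.card ι * modSol d c m / (m : ℂ) ^ s := by
  have hm0 : (m : ℚ) ≠ 0 := by positivity
  have hmR : (m : ℝ) ≠ 0 := by positivity
  have hterm : ∀ a : ι → ℕ, singCoeff d c (fun i => (a i : ℚ) / m)
      = (∑ x ∈ Fintype.piFinset fun _ : Fin s => Finset.range m, ∏ i,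
        eC ((a i : ℝ) * ((forms d c (fun j => (x j : ℤ)) i : ℤ) / (m : ℝ)))) / (m : ℂ) ^ s := by
    intro a
    have hρ : ∀ i, ∃ z : ℤ, (m : ℚ) * ((a i : ℚ) / m) = z := fun i =>
      ⟨a i, by push_cast; field_simp⟩
    simp_rw [singCoeff, gaussMean_eq d c hm hρ]
    rw [Finset.prod_div_distrib, Finset.prod_const, Finset.card_univ, Fintype.card_fin,
      Finset.prod_univ_sum]
    congr 1
    refine Finset.sum_congr rfl fun x _ => ?_
    rw [← eC_sum, ← eC_sum, Finset.sum_comm]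
    congr 1
    refine Finset.sum_congr rfl fun i _ => ?_
    simp only [forms]
    push_cast
    rw [Finset.sum_div, Finset.mul_sum]
    exact Finset.sum_congr rfl fun j _ => by ring
  rw [torPts, Finset.sum_image]
  · simp_rw [hterm]
    rw [← Finset.sum_div, Finset.sum_comm]
    congr 1
    have hin : ∀ x : Fin s → ℕ, ∑ a ∈ Fintype.piFinset fun _ : ι => Finset.range m, ∏ i,
        eC ((a i : ℝ) * ((forms d c (fun j => (x j : ℤ)) i : ℤ) / (m : ℝ)))
        = if ∀ i, (m : ℤ) ∣ forms d c (fun j => (x j : ℤ)) i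
          then (m : ℂ) ^ Fintype.card ι else 0 := by
      intro x
      have h := Finset.prod_univ_sum (fun _ : ι => Finset.range m)
        fun i (a : ℕ) => eC ((a : ℝ) * ((forms d c (fun j => (x j : ℤ)) i : ℤ) / (m : ℝ)))
      rw [← h]
      simp_rw [sum_range_eC_div hm]
      split_ifs with hx
      · simp [hx]
      · push Not at hx
        obtain ⟨i, hi⟩ := hx
        exact Finset.prod_eq_zero (Finset.mem_univ i) (if_neg hi)
    simp_rw [hin]
    rw [← Finset.sum_filter, Finset.sum_const, nsmul_eq_mul, modSol_eq_card d c hm, mul_comm]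
  · intro a _ b _ hab
    ext i
    have := congrFun hab i
    simp only at this
    rw [div_left_inj' hm0] at this
    exact_mod_cast this

end

end DiagonalSystem

namespace DiagonalSystem

variable {ι : Type*} [Fintype ι] (d : ι → ℕ) {s : ℕ} (c : ι → Fin s → ℤ)

/-- The normalised number of solutions modulo `m`. -/
def modDensity (m : ℕ) : ℝ := (m : ℝ) ^ Fintype.card ι * modSol d c m / (m : ℝ) ^ s

/-- A non-singular `p`-adic solution forces many solutions modulo powers of `p`. -/
theorem exists_le_modDensity (p : ℕ) [Fact p.Prime] {x₀ : Fin s → ℚ_[p]} (h0 : forms d c x₀ = 0)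
    (hr : (jac d c x₀).rank = Fintype.card ι) :
    ∃ C : ℝ, 0 < C ∧ ∃ e : ℕ, ∀ h, e ≤ h → C ≤ modDensity d c (p ^ h) := by
  obtain ⟨a, ha0, ha⟩ := NormedField.exists_norm_lt ℚ_[p] (r := 1 / (1 + ‖x₀‖)) (by positivity)
  have hx1 : a • x₀ ∈ Metric.ball (0 : Fin s → ℚ_[p]) 1 := by
    rw [mem_ball_zero_iff, norm_smul]
    rw [lt_div_iff₀ (by positivity)] at ha
    nlinarith [norm_nonneg x₀]
  set x₁ := a • x₀ with hx₁
  have h1 : forms d c x₁ = 0 := by ext i; rw [hx₁, forms_smul, h0]; simp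
  have hr1 : (jac d c x₁).rank = Fintype.card ι := by
    rw [hx₁, rank_jac_smul d c (norm_pos_iff.1 ha0), hr]
  obtain ⟨J, hJ, hnear⟩ := exists_forms_eq_zero_near d c h1 hr1
  obtain ⟨ε, hε, hsol⟩ := Metric.eventually_nhds_iff_ball.1
    (hnear _ (Metric.isOpen_ball.mem_nhds hx1))
  have hp : p.Prime := Fact.out
  have hp0 : (0 : ℝ) < p := by exact_mod_cast hp.pos
  obtain ⟨e, he⟩ := exists_pow_lt_of_lt_one hε (inv_lt_one_of_one_lt₀ (by exact_mod_cast hp.one_lt :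
    (1 : ℝ) < p))
  have hcard : Fintype.card {j // j ∉ J} + Fintype.card ι = s := by
    have h2 := Finset.card_compl_add_card J
    rw [Fintype.card_fin, hJ] at h2
    refine Eq.trans ?_ h2
    rw [Fintype.card_subtype]
    congr 2
    ext j; simp
  refine ⟨(((p : ℝ) ^ e) ^ Fintype.card {j // j ∉ J})⁻¹, by positivity, e, fun h hh => ?_⟩
  have key : ∀ w : {j // j ∉ J} → Fin (p ^ (h - e)), ∃ z : Fin s → ℤ_[p], forms d c z = 0 ∧
      ∀ j : {j // j ∉ J}, (z j : ℚ_[p]) = x₁ j + (p : ℚ_[p]) ^ e * ((w j : ℕ) : ℚ_[p]) := by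
    intro w
    let y : Fin s → ℚ_[p] := fun j =>
      if hj : j ∉ J then x₁ j + (p : ℚ_[p]) ^ e * ((w ⟨j, hj⟩ : ℕ) : ℚ_[p]) else x₁ j
    have hy : y ∈ Metric.ball x₁ ε := by
      rw [Metric.mem_ball, dist_pi_lt_iff hε]
      intro j
      by_cases hj : j ∉ J
      · simp only [y, dif_pos hj, dist_eq_norm, add_sub_cancel_left, norm_mul, norm_pow,
          Padic.norm_p]
        refine lt_of_le_of_lt (mul_le_of_le_one_right (by positivity) ?_) he
        exact_mod_cast Padic.norm_int_le_one ((w ⟨j, hj⟩ : ℕ) : ℤ)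
      · simp only [y, dif_neg hj, dist_self]; exact hε
    obtain ⟨x, hxW, hxy, hx0⟩ := hsol y hy
    have hxn : ∀ j, ‖x j‖ ≤ 1 := fun j => (norm_le_pi_norm x j).trans (mem_ball_zero_iff.1 hxW).le
    refine ⟨fun j => ⟨x j, hxn j⟩, ?_, fun j => ?_⟩
    · ext i
      have h3 := forms_map d c (PadicInt.Coe.ringHom (p := p)) (fun j => (⟨x j, hxn j⟩ : ℤ_[p])) i
      have h4 : forms d c (fun j => PadicInt.Coe.ringHom (p := p) (⟨x j, hxn j⟩ : ℤ_[p])) i = 0 :=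
        congrFun hx0 i
      rw [h4] at h3
      exact Subtype.coe_injective h3.symm
    · change x j = _
      rw [hxy j j.2]
      simp only [y, dif_pos j.2]
  choose z hz hzw using key
  let g : ({j // j ∉ J} → Fin (p ^ (h - e))) →
      {x : Fin s → ZMod (p ^ h) // forms d c x = 0} := fun w =>
    ⟨fun j => PadicInt.toZModPow h (z w j), by
      ext i; rw [forms_map, hz]; simp⟩
  have : NeZero (p ^ h) := ⟨pow_ne_zero _ hp.ne_zero⟩
  have hg : Function.Injective g := by
    intro w w' hww
    ext j
    have h5 : PadicInt.toZModPow h (z w j) = PadicInt.toZModPow h (z w' j) :=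
      congrFun (congrArg Subtype.val hww) j
    have h6 : z w j + ((p ^ e * (w' j : ℕ) : ℕ) : ℤ_[p]) = z w' j + ((p ^ e * (w j : ℕ) : ℕ) : ℤ_[p]) := by
      apply Subtype.coe_injective
      push_cast
      rw [hzw w j, hzw w' j]
      ring
    have h7 := congrArg (PadicInt.toZModPow h) h6
    rw [map_add, map_add, h5, add_right_inj, map_natCast, map_natCast,
      ZMod.natCast_eq_natCast_iff'] at h7
    have hlt : ∀ v : Fin (p ^ (h - e)), p ^ e * (v : ℕ) < p ^ h := fun v => by
      calc p ^ e * (v : ℕ) < p ^ e * p ^ (h - e) :=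
            Nat.mul_lt_mul_of_pos_left v.2 (pow_pos hp.pos _)
        _ = p ^ h := by rw [← pow_add, Nat.add_sub_cancel' hh]
    rw [Nat.mod_eq_of_lt (hlt _), Nat.mod_eq_of_lt (hlt _)] at h7
    exact (Nat.eq_of_mul_eq_mul_left (pow_pos hp.pos _) h7).symm
  have hle := Nat.card_le_card_of_injective g hg
  rw [Nat.card_eq_fintype_card, Fintype.card_fun, Fintype.card_fin] at hle
  have hle' : ((p : ℝ) ^ (h - e)) ^ Fintype.card {j // j ∉ J} ≤ modSol d c (p ^ h) := by
    exact_mod_cast hle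
  set n := Fintype.card {j // j ∉ J}
  rw [modDensity]
  push_cast
  rw [le_div_iff₀ (by positivity)]
  calc (((p : ℝ) ^ e) ^ n)⁻¹ * ((p : ℝ) ^ h) ^ s
      = ((p : ℝ) ^ h) ^ Fintype.card ι * ((p : ℝ) ^ (h - e)) ^ n := by
        rw [← hcard, pow_add, ← Nat.add_sub_cancel' hh, pow_add (p : ℝ) e, mul_pow _ _ n,
          Nat.add_sub_cancel_left]
        field_simp
    _ ≤ _ := by gcongr

end DiagonalSystem

namespace DiagonalSystem

lemma one_sub_sum_le_prod {α : Type*} (S : Finset α) {x ε : α → ℝ} (hε : ∀ i, 0 ≤ ε i)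
    (hx : ∀ i, 0 ≤ x i) (h : ∀ i ∈ S, 1 - ε i ≤ x i) (hS : ∑ i ∈ S, ε i ≤ 1) :
    1 - ∑ i ∈ S, ε i ≤ ∏ i ∈ S, x i := by
  induction S using Finset.induction_on with
  | empty => simp
  | insert a S ha ih =>
    rw [Finset.sum_insert ha] at hS ⊢
    rw [Finset.prod_insert ha]
    have h1 := Finset.sum_nonneg fun i (_ : i ∈ S) => hε i
    have h2 := ih (fun i hi => h i (Finset.mem_insert_of_mem hi)) (by linarith [hε a])
    have h3 := h a (Finset.mem_insert_self _ _)
    have h4 := hε a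
    calc 1 - (ε a + ∑ i ∈ S, ε i) ≤ (1 - ε a) * (1 - ∑ i ∈ S, ε i) := by nlinarith
      _ ≤ x a * ∏ i ∈ S, x i := mul_le_mul h3 h2 (by linarith) (hx a)

variable {ι : Type*} [Fintype ι] (d : ι → ℕ) {s : ℕ} (c : ι → Fin s → ℤ)

lemma modDensity_nonneg (m : ℕ) : 0 ≤ modDensity d c m := by unfold modDensity; positivity

lemma modDensity_one : modDensity d c 1 = 1 := by
  have : modSol d c 1 = 1 := by
    rw [modSol, Nat.card_eq_one_iff_unique]
    exact ⟨⟨fun a b => Subtype.ext (Subsingleton.elim _ _)⟩, ⟨⟨0, Subsingleton.elim _ _⟩⟩⟩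
  simp [modDensity, this]

lemma modDensity_mul {m n : ℕ} (h : m.Coprime n) :
    modDensity d c (m * n) = modDensity d c m * modDensity d c n := by
  simp only [modDensity, modSol_mul d c h]
  push_cast
  rw [mul_pow, mul_pow]
  ring

lemma modDensity_eq_prod {n : ℕ} (hn : n ≠ 0) :
    modDensity d c n = ∏ p ∈ n.primeFactors, modDensity d c (p ^ n.factorization p) :=
  Nat.multiplicative_factorization (modDensity d c) (fun _ _ h => modDensity_mul d c h)
    (modDensity_one d c) hn

/-- The `m`-torsion points, as points of the unit cube. -/
def unitTorPts (ι : Type*) [Fintype ι] (m : ℕ) : Finset (UnitRat ι) :=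
  (torPts ι m).subtype fun ρ => ∀ i, 0 ≤ ρ i ∧ ρ i < 1

lemma mem_unitTorPts {m : ℕ} (hm : 1 ≤ m) {ρ : UnitRat ι} :
    ρ ∈ unitTorPts ι m ↔ ∀ i, ∃ a : ℤ, (m : ℚ) * ρ.1 i = a := by
  rw [unitTorPts, Finset.mem_subtype, mem_torPts hm]
  exact and_iff_right ρ.2

lemma sum_unitTorPts {m : ℕ} (hm : 1 ≤ m) :
    ∑ ρ ∈ unitTorPts ι m, singCoeff d c ρ.1 = (modDensity d c m : ℂ) := by
  rw [unitTorPts, Finset.sum_subtype_of_mem (singCoeff d c) fun ρ hρ => ((mem_torPts hm).1 hρ).1,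
    sum_torPts_singCoeff d c hm, modDensity]
  push_cast; rfl

/-- The origin, as a point of the unit cube. -/
def unitRatZero (ι : Type*) : UnitRat ι := ⟨0, fun _ => by simp⟩

lemma unitRatZero_mem {m : ℕ} (hm : 1 ≤ m) : unitRatZero ι ∈ unitTorPts ι m :=
  (mem_unitTorPts hm).2 fun i => ⟨0, by simp [unitRatZero]⟩

lemma eq_unitRatZero_of_coprime {m n : ℕ} (h : m.Coprime n) {ρ : UnitRat ι}
    (hm : ∀ i, ∃ a : ℤ, (m : ℚ) * ρ.1 i = a) (hn : ∀ i, ∃ a : ℤ, (n : ℚ) * ρ.1 i = a) :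
    ρ = unitRatZero ι := by
  refine Subtype.ext (funext fun i => ?_)
  obtain ⟨a, ha⟩ := hm i
  obtain ⟨b, hb⟩ := hn i
  have hbez : (1 : ℤ) = m * m.gcdA n + n * m.gcdB n := by
    rw [← Nat.gcd_eq_gcd_ab, h.gcd_eq_one]; rfl
  have hbezQ : (1 : ℚ) = m * (m.gcdA n : ℤ) + n * (m.gcdB n : ℤ) := by exact_mod_cast hbez
  have hz : ρ.1 i = ((a * m.gcdA n + b * m.gcdB n : ℤ) : ℚ) := by
    push_cast
    rw [← ha, ← hb]
    linear_combination ρ.1 i * hbezQ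
  have h1 := ρ.2 i
  rw [hz] at h1
  have h2 : 0 ≤ a * m.gcdA n + b * m.gcdB n := by exact_mod_cast h1.1
  have h3 : a * m.gcdA n + b * m.gcdB n < 1 := by exact_mod_cast h1.2
  rw [hz, show a * m.gcdA n + b * m.gcdB n = 0 by omega]
  simp [unitRatZero]

lemma one_sub_le_modDensity {m : ℕ} (hm : 1 ≤ m) :
    1 - ∑ ρ ∈ (unitTorPts ι m).erase (unitRatZero ι), ‖singCoeff d c ρ.1‖ ≤ modDensity d c m := by
  have h := Finset.add_sum_erase _ (fun ρ : UnitRat ι => singCoeff d c ρ.1) (unitRatZero_mem hm)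
  rw [sum_unitTorPts d c hm] at h
  have h1 : singCoeff d c (unitRatZero ι).1 = 1 := singCoeff_zero d c
  simp only [h1] at h
  have h2 := norm_sum_le ((unitTorPts ι m).erase (unitRatZero ι)) fun ρ => singCoeff d c ρ.1
  have h3 := congrArg Complex.re h
  rw [Complex.add_re, Complex.one_re, Complex.ofReal_re] at h3
  have h4 := (abs_le.1 (Complex.abs_re_le_norm
    (∑ ρ ∈ (unitTorPts ι m).erase (unitRatZero ι), singCoeff d c ρ.1))).1
  linarith

lemma tendsto_unitTorPts_factorial :
    Tendsto (fun n : ℕ => unitTorPts ι n.factorial) atTop atTop := by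
  refine tendsto_atTop_finset_of_monotone (fun m n hmn ρ hρ => ?_) fun ρ => ?_
  · rw [mem_unitTorPts (Nat.factorial_pos _)] at hρ ⊢
    obtain ⟨z, hz⟩ := Nat.factorial_dvd_factorial hmn
    intro i
    obtain ⟨a, ha⟩ := hρ i
    refine ⟨z * a, ?_⟩
    rw [hz]; push_cast; rw [← ha]; ring
  · refine ⟨denProd ρ.1, (mem_unitTorPts (Nat.factorial_pos _)).2 fun i => ?_⟩
    obtain ⟨a, ha⟩ := denProd_mul ρ.1 i
    obtain ⟨z, hz⟩ := Nat.dvd_factorial (denProd_pos ρ.1) le_rfl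
    refine ⟨z * a, ?_⟩
    rw [hz]; push_cast; rw [← ha]; ring

/-- Positivity of the singular series. -/
theorem tsum_singCoeff_pos (hsum : Summable fun ρ : UnitRat ι => ‖singCoeff d c ρ.1‖)
    (hloc : ∀ p : ℕ, p.Prime → ∃ C : ℝ, 0 < C ∧ ∃ e : ℕ, ∀ h, e ≤ h →
      C ≤ modDensity d c (p ^ h)) :
    ∃ y : ℝ, 0 < y ∧ ∑' ρ : UnitRat ι, singCoeff d c ρ.1 = (y : ℂ) := by
  choose! C hC e he using hloc
  obtain ⟨S, hS⟩ := summable_iff_vanishing_norm.1 hsum (1 / 2) (by norm_num)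
  set p₀ := ∑ ρ ∈ S, denProd ρ.1 with hp₀
  have htail : ∀ n : ℕ, 1 / 2 ≤ ∏ p ∈ n.primeFactors with p₀ < p,
      modDensity d c (p ^ n.factorization p) := by
    intro n
    let T : ℕ → Finset (UnitRat ι) := fun p =>
      (unitTorPts ι (p ^ n.factorization p)).erase (unitRatZero ι)
    set Q := n.primeFactors.filter fun p => p₀ < p with hQ
    have hpr : ∀ p ∈ Q, p.Prime ∧ p₀ < p := fun p hp =>
      ⟨Nat.prime_of_mem_primeFactors (Finset.mem_filter.1 hp).1, (Finset.mem_filter.1 hp).2⟩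
    have hpow : ∀ p ∈ Q, 1 ≤ p ^ n.factorization p := fun p hp => Nat.pow_pos (hpr p hp).1.pos
    have hdisj : (Q : Set ℕ).PairwiseDisjoint T := by
      intro p hp q hq hpq
      refine Finset.disjoint_left.2 fun ρ hρ hρ' => ?_
      rw [Finset.mem_erase, mem_unitTorPts (hpow _ hp)] at hρ
      rw [Finset.mem_erase, mem_unitTorPts (hpow _ hq)] at hρ'
      refine hρ.1 (eq_unitRatZero_of_coprime ?_ hρ.2 hρ'.2)
      exact Nat.Coprime.pow _ _ ((Nat.coprime_primes (hpr p hp).1 (hpr q hq).1).2 hpq)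
    have hS' : Disjoint (Q.biUnion T) S := by
      refine Finset.disjoint_left.2 fun ρ hρ hρS => ?_
      obtain ⟨p, hp, hρp⟩ := Finset.mem_biUnion.1 hρ
      rw [Finset.mem_erase, mem_unitTorPts (hpow _ hp)] at hρp
      refine hρp.1 (eq_unitRatZero_of_coprime ?_ hρp.2 (denProd_mul ρ.1))
      refine Nat.Coprime.pow_left _ (((hpr p hp).1.coprime_iff_not_dvd).2 fun hdvd => ?_)
      have h1 := Nat.le_of_dvd (denProd_pos ρ.1) hdvd
      have h2 := Finset.single_le_sum (f := fun ρ : UnitRat ι => denProd ρ.1)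
        (fun _ _ => Nat.zero_le _) hρS
      have h3 := (hpr p hp).2
      omega
    have hle := hS _ hS'
    rw [Finset.sum_biUnion hdisj] at hle
    have hle' := (le_abs_self _).trans_lt hle
    have := one_sub_sum_le_prod Q (x := fun p => modDensity d c (p ^ n.factorization p))
      (ε := fun p => ∑ ρ ∈ T p, ‖singCoeff d c ρ.1‖)
      (fun p => Finset.sum_nonneg fun _ _ => norm_nonneg _) (fun p => modDensity_nonneg _ _ _)
      (fun p hp => one_sub_le_modDensity d c (hpow p hp)) (by linarith)
    linarith
  set R := (Finset.range (p₀ + 1)).filter Nat.Prime with hR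
  have hRp : ∀ p ∈ R, p.Prime := fun p hp => (Finset.mem_filter.1 hp).2
  have hhead : ∀ᶠ n : ℕ in atTop, ∏ p ∈ R, C p ≤
      ∏ p ∈ n.factorial.primeFactors with ¬ p₀ < p,
        modDensity d c (p ^ n.factorial.factorization p) := by
    have hev : ∀ᶠ n : ℕ in atTop, ∀ p ∈ R, p ^ e p ≤ n :=
      (Finset.eventually_all R).2 fun p _ => eventually_ge_atTop _
    filter_upwards [hev, eventually_ge_atTop p₀] with n hn hnp
    have hset : (n.factorial.primeFactors.filter fun p => ¬ p₀ < p) = R := by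
      ext p
      simp only [hR, Finset.mem_filter, Finset.mem_range, Nat.mem_primeFactors, not_lt]
      constructor
      · rintro ⟨⟨h1, -⟩, h2⟩
        exact ⟨by omega, h1⟩
      · rintro ⟨h1, h2⟩
        exact ⟨⟨h2, h2.dvd_factorial.2 (by omega), Nat.factorial_ne_zero _⟩, by omega⟩
    rw [hset]
    refine Finset.prod_le_prod (fun p hp => (hC p (hRp p hp)).le) fun p hp => ?_
    refine he p (hRp p hp) _ ?_
    rw [← (hRp p hp).pow_dvd_iff_le_factorization (Nat.factorial_ne_zero _)]
    exact Nat.dvd_factorial (pow_pos (hRp p hp).pos _) (hn p hp)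
  have hlow : ∀ᶠ n : ℕ in atTop, (∏ p ∈ R, C p) * (1 / 2) ≤ modDensity d c n.factorial := by
    filter_upwards [hhead] with n hn
    rw [modDensity_eq_prod d c (Nat.factorial_ne_zero n),
      ← Finset.prod_filter_mul_prod_filter_not n.factorial.primeFactors (fun p => p₀ < p), mul_comm]
    exact mul_le_mul (htail _) hn (Finset.prod_nonneg fun p hp => (hC p (hRp p hp)).le)
      (Finset.prod_nonneg fun p _ => modDensity_nonneg _ _ _)
  have hlim : Tendsto (fun n : ℕ => ((modDensity d c n.factorial : ℝ) : ℂ)) atTop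
      (nhds (∑' ρ : UnitRat ι, singCoeff d c ρ.1)) := by
    have h := (hsum.of_norm.hasSum.comp (tendsto_unitTorPts_factorial (ι := ι)))
    refine h.congr fun n => ?_
    exact sum_unitTorPts d c (Nat.factorial_pos n)
  have hre : Tendsto (fun n : ℕ => modDensity d c n.factorial) atTop
      (nhds (∑' ρ : UnitRat ι, singCoeff d c ρ.1).re) :=
    (Complex.continuous_re.tendsto _).comp hlim
  refine ⟨(∑' ρ : UnitRat ι, singCoeff d c ρ.1).re, ?_, ?_⟩
  · refine lt_of_lt_of_le ?_ (ge_of_tendsto hre hlow)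
    exact mul_pos (Finset.prod_pos fun p hp => hC p (hRp p hp)) (by norm_num)
  · exact tendsto_nhds_unique hlim ((Complex.continuous_ofReal.tendsto _).comp hre)

end DiagonalSystem

namespace DiagonalSystem

variable {t : ℕ} {ν μ : Fin t → ℕ} {k : (l : Fin t) → Fin (ν l) → ℕ}

lemma isSol_iff {s : ℕ} {c : EqIdx t ν μ → Fin s → ℤ} {A : Type*} [CommRing A] {x : Fin s → A} :
    IsSol t ν μ k s c x ↔ forms (deg t ν μ k) c x = 0 := by
  rw [funext_iff]; rfl

lemma rpow_count_exponent {P : ℕ} (hP : 1 ≤ P) (s K : ℕ) :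
    (P : ℝ) ^ ((s : ℝ) - K) = ((P : ℝ) ^ K)⁻¹ * (P : ℝ) ^ s := by
  have hP0 : (0 : ℝ) < P := by exact_mod_cast hP
  rw [Real.rpow_sub hP0, Real.rpow_natCast, Real.rpow_natCast]
  ring

lemma exists_minorBound (hgrp : GroupedDegrees t ν μ k) {s : ℕ}
    {c : EqIdx t ν μ → Fin s → ℤ} (hns : HighlyNonSingular t ν μ s c) {M : ℕ}
    (hM : ∀ l, μ l ≤ M) {κ : Fin M → ℕ} (hκ3 : ∀ m, 3 ≤ κ m)
    (hκ : ∀ m : Fin M, layerExps k μ m ⊆ Finset.Icc 1 (κ m))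
    (hs : ∑ m, 2 * (κ m * (κ m - 1)) + 1 ≤ s) :
    ∃ A : ℕ, MinorBound (deg t ν μ k) c A := by
  obtain ⟨A, hA1, hA⟩ := minor_arc_bound hgrp hns hM hκ3 hκ hs
  refine ⟨A, hA1, fun ε hε => ?_⟩
  obtain ⟨C, hC, h⟩ := hA ε hε
  refine ⟨C, hC, fun H hH P hP a => ?_⟩
  have hP0 : (0 : ℝ) < P := by exact_mod_cast hP
  have h1 := h H hH P hP a
  simp only [genFun, norm_prod]
  rw [Real.rpow_add hP0, rpow_count_exponent hP, Ktot] at h1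
  convert h1 using 2
  ring

lemma Ncount_eq_integral {s : ℕ} (c : EqIdx t ν μ → Fin s → ℤ) (P : ℕ) (a : EqIdx t ν μ → ℝ) :
    (Ncount t ν μ k s c P : ℂ) = ∫ α in box a, genFun (deg t ν μ k) c P α := by
  simp_rw [genFun, prod_fsum]
  rw [integral_box_sum a _ fun (x : Fin s → ℕ) i => ∑ j, c i j * (x j : ℤ) ^ deg t ν μ k i]
  congr 1
  exact_mod_cast Nat.subtype_card _ fun x => by
    simp only [Finset.mem_filter, Fintype.mem_piFinset, Finset.mem_Icc, funext_iff, IsSol]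
    rfl

end DiagonalSystem

/-- Corollary 1.2 of Brandes–Parsell: if all degrees are at
least `3` and `s ≥ 2μk(k-1) + 2 Σ_{h<t} (μ_h - μ_{h+1}) max{k̃_h(k̃_h-1), (k/2)(1+ϖ_h)} + 1`,
then the asymptotic formula `N(P) = (C + o(1)) P^{s-K}` holds with `C > 0`. -/
theorem statement2
    (t : ℕ) (ν μ : Fin t → ℕ) (k : (l : Fin t) → Fin (ν l) → ℕ)
    (hgrp : GroupedDegrees t ν μ k)
    (hdeg3 : ∀ (l : Fin t) (n : Fin (ν l)), 3 ≤ k l n)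
    (s : ℕ)
    (hs : 2 * (mu1 t μ t : ℝ) * (kmax t ν k : ℝ) * ((kmax t ν k : ℝ) - 1)
      + 2 * (∑ h ∈ Finset.Icc 1 (t - 1),
        ((mu1 t μ h : ℝ) - (mu1 t μ (h + 1) : ℝ)) *
          max ((ktil t ν k h : ℝ) * ((ktil t ν k h : ℝ) - 1))
            ((kmax t ν k : ℝ) * (1 + (varpi t ν h : ℝ)) / 2))
      + 1 ≤ (s : ℝ))
    (c : EqIdx t ν μ → Fin s → ℤ)
    (hns : HighlyNonSingular t ν μ s c)
    (hreal : ∃ x : Fin s → ℝ, (∀ j, 0 < x j) ∧ IsSol t ν μ k s c x ∧ JacFullRank t ν μ k s c x)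
    (hpadic : ∀ (p : ℕ) [Fact p.Prime], ∃ x : Fin s → ℚ_[p],
      IsSol t ν μ k s c x ∧ JacFullRank t ν μ k s c x) :
    ∃ C : ℝ, 0 < C ∧ Filter.Tendsto
      (fun P : ℕ => (Ncount t ν μ k s c P : ℝ) / (P : ℝ) ^ ((s : ℝ) - (Ktot t ν μ k : ℝ)))
      Filter.atTop (nhds C) := by
  obtain ⟨M, κ, -, hM, hκ3, hκ, hs'⟩ := DiagonalSystem.exists_layer_exponents hgrp hdeg3 hs
  obtain ⟨A, hMB⟩ := DiagonalSystem.exists_minorBound hgrp hns hM hκ3 hκ hs'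
  have hd : ∀ i, 1 ≤ deg t ν μ k i := fun i => (by norm_num : 1 ≤ 3).trans (hdeg3 _ _)
  obtain ⟨x₀, hpos, hsol, hrank⟩ := hreal
  obtain ⟨y₂, hy₂, hI⟩ := DiagonalSystem.integral_singKernel_pos (deg t ν μ k) c hpos (DiagonalSystem.isSol_iff.1 hsol) hrank
    (DiagonalSystem.integrable_singKernel hd hMB)
  obtain ⟨y₁, hy₁, hS⟩ := DiagonalSystem.tsum_singCoeff_pos (deg t ν μ k) c (DiagonalSystem.summable_norm_singCoeff hd hMB)
    fun p hp => by
      have : Fact p.Prime := ⟨hp⟩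
      obtain ⟨x, hx, hr⟩ := hpadic p
      exact DiagonalSystem.exists_le_modDensity (deg t ν μ k) c p (DiagonalSystem.isSol_iff.1 hx) hr
  refine ⟨y₁ * y₂, mul_pos hy₁ hy₂, ?_⟩
  have h := DiagonalSystem.tendsto_count hd hMB (N := fun P => Ncount t ν μ k s c P) (DiagonalSystem.Ncount_eq_integral c)
  rw [hS, hI, ← Complex.ofReal_mul] at h
  refine ((Complex.continuous_re.tendsto _).comp h).congr' ?_
  filter_upwards [eventually_ge_atTop 1] with P hP
  rw [DiagonalSystem.rpow_count_exponent hP, Ktot, Function.comp_apply, ← Complex.ofReal_inv,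
    ← Complex.ofReal_natCast, ← Complex.ofReal_mul, Complex.ofReal_re, div_eq_mul_inv,
    mul_comm ((P : ℝ) ^ s)]

end
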